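/- Let n ≥ 2 be an integer and let p ≥ 2(n+1)/(n-1). For every ε > 0 there is a constant C_ε (depending only on n, p, ε) such that for every 0 < δ < 1, every finite √δ-separated set Λ ⊂ P^{n-1}, every family of coefficients a : Λ → ℂ, every R ≥ δ^{-1} and every Euclidean ball B_R ⊂ ℝⁿ of radius R, one has ( (1/|B_R|) ∫_{B_R} |Σ_{ξ ∈ Λ} a_ξ e(ξ·x)|^p dx )^{1/p} ≤ C_ε · δ^{(n+1)/(2p) - (n-1)/4 - ε} · (Σ_{ξ ∈ Λ} |a_ξ|²)^{1/2}. -/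

import Mathlib

open MeasureTheory Real
open scoped RealInnerProductSpace

noncomputable section

abbrev Rsp (m : ℕ) : Type := EuclideanSpace ℝ (Fin m ⊕ Unit)

/-- `e(t) = e^{2πit}`. -/
def ee (t : ℝ) : ℂ := Complex.exp (2 * Real.pi * Complex.I * t)

/-- The truncated elliptic paraboloid `P^{n-1} ⊂ ℝⁿ`. -/
def parabSurf (n : ℕ) : Set (Rsp (n - 1)) :=
  {x | (∀ i, |x (Sum.inl i)| ≤ 1 / 2) ∧
    x (Sum.inr ()) = ∑ i, (x (Sum.inl i)) ^ 2}


namespace DR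
open Filter Topology
open scoped ENNReal NNReal

/-! ### Basic setup: space, pairing, exponentials, spectral classes -/

abbrev V (d : ℕ) : Type := (Fin d → ℝ) × ℝ

instance (d : ℕ) : (volume : Measure (V d)).IsAddHaarMeasure :=
  inferInstanceAs ((volume : Measure (Fin d → ℝ)).prod (volume : Measure ℝ)).IsAddHaarMeasure

lemma ee_add (s t : ℝ) : ee (s + t) = ee s * ee t := by
  unfold ee; rw [← Complex.exp_add]; congr 1; push_cast; ring

@[simp] lemma ee_zero : ee 0 = 1 := by simp [ee]

@[simp] lemma norm_ee (t : ℝ) : ‖ee t‖ = 1 := by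
  unfold ee
  rw [show (2 * Real.pi * Complex.I * t : ℂ) = ((2 * Real.pi * t : ℝ) : ℂ) * Complex.I by
    push_cast; ring]
  exact Complex.norm_exp_ofReal_mul_I _

lemma continuous_ee : Continuous ee := by unfold ee; fun_prop

@[fun_prop] lemma measurable_ee : Measurable ee := continuous_ee.measurable

lemma ee_conj (t : ℝ) : (starRingEnd ℂ) (ee t) = ee (-t) := by
  unfold ee
  rw [← Complex.exp_conj]
  congr 1
  simp [Complex.conj_ofNat]

lemma ee_ne_zero (t : ℝ) : ee t ≠ 0 := Complex.exp_ne_zero _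

variable {d e : ℕ}

def pr (ξ x : V d) : ℝ := ∑ i, ξ.1 i * x.1 i + ξ.2 * x.2

lemma continuous_pr (ξ : V d) : Continuous (fun x => pr ξ x) := by unfold pr; fun_prop

@[fun_prop] lemma measurable_pr (ξ : V d) : Measurable (fun x => pr ξ x) :=
  (continuous_pr ξ).measurable

lemma pr_add_left (ξ η x : V d) : pr (ξ + η) x = pr ξ x + pr η x := by
  simp only [pr, Prod.fst_add, Prod.snd_add, Pi.add_apply, add_mul, Finset.sum_add_distrib]; ring

lemma pr_add_right (ξ x y : V d) : pr ξ (x + y) = pr ξ x + pr ξ y := by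
  simp only [pr, Prod.fst_add, Prod.snd_add, Pi.add_apply, mul_add, Finset.sum_add_distrib]; ring

lemma pr_neg_left (ξ x : V d) : pr (-ξ) x = - pr ξ x := by
  simp only [pr, Prod.fst_neg, Prod.snd_neg, Pi.neg_apply, neg_mul, Finset.sum_neg_distrib]; ring

lemma pr_neg_right (ξ x : V d) : pr ξ (-x) = - pr ξ x := by
  simp only [pr, Prod.fst_neg, Prod.snd_neg, Pi.neg_apply, mul_neg, Finset.sum_neg_distrib]; ring

lemma pr_sub_right (ξ x y : V d) : pr ξ (x - y) = pr ξ x - pr ξ y := by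
  rw [sub_eq_add_neg, pr_add_right, pr_neg_right]; ring

lemma pr_sub_left (ξ η x : V d) : pr (ξ - η) x = pr ξ x - pr η x := by
  rw [sub_eq_add_neg, pr_add_left, pr_neg_left]; ring

@[simp] lemma pr_zero_left (x : V d) : pr 0 x = 0 := by simp [pr]

/-- Bounded functions with frequencies in `S`. -/
inductive FS (S : Set (V d)) : (V d → ℂ) → Prop
  | exp (ξ : V d) (h : ξ ∈ S) : FS S (fun x => ee (pr ξ x))
  | zero : FS S (fun _ => 0)
  | add (f g : V d → ℂ) (hf : FS S f) (hg : FS S g) : FS S (fun x => f x + g x)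
  | smul (c : ℂ) (f : V d → ℂ) (hf : FS S f) : FS S (fun x => c * f x)
  | lim (F : ℕ → V d → ℂ) (f : V d → ℂ) (B : ℝ) (hF : ∀ n, FS S (F n))
      (hB : ∀ n x, ‖F n x‖ ≤ B) (hl : ∀ x, Tendsto (fun n => F n x) atTop (𝓝 (f x))) : FS S f

namespace FS

lemma bdd {S : Set (V d)} {f : V d → ℂ} (h : FS S f) : ∃ B : ℝ, 0 ≤ B ∧ ∀ x, ‖f x‖ ≤ B := by
  induction h with
  | exp ξ h => exact ⟨1, by norm_num, fun x => by simp⟩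
  | zero => exact ⟨0, le_rfl, fun x => by simp⟩
  | add f g hf hg ih1 ih2 =>
    obtain ⟨B, hB0, hB⟩ := ih1
    obtain ⟨B', hB0', hB'⟩ := ih2
    exact ⟨B + B', by positivity, fun x => (norm_add_le _ _).trans (add_le_add (hB x) (hB' x))⟩
  | smul c f hf ih =>
    obtain ⟨B, hB0, hB⟩ := ih
    exact ⟨‖c‖ * B, by positivity, fun x => by rw [norm_mul]; gcongr; exact hB x⟩
  | lim F f B hF hB hl ih =>
    refine ⟨B, (norm_nonneg _).trans (hB 0 0), fun x => ?_⟩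
    exact le_of_tendsto (hl x).norm (Eventually.of_forall fun n => hB n x)

lemma meas {S : Set (V d)} {f : V d → ℂ} (h : FS S f) : Measurable f := by
  induction h with
  | exp ξ h => fun_prop
  | zero => fun_prop
  | add f g hf hg ih1 ih2 => exact ih1.add ih2
  | smul c f hf ih => exact ih.const_mul c
  | lim F f B hF hB hl ih => exact measurable_of_tendsto_metrizable ih (tendsto_pi_nhds.2 hl)

/-- Generic composition principle. -/
lemma comp {S : Set (V d)} {T : Set (V e)} {f : V d → ℂ} (h : FS S f) (g : V e → V d)
    (hg : ∀ ξ ∈ S, FS T (fun x => ee (pr ξ (g x)))) : FS T (fun x => f (g x)) := by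
  induction h with
  | exp ξ h => exact hg ξ h
  | zero => exact .zero
  | add f g hf hg ih1 ih2 => exact .add _ _ ih1 ih2
  | smul c f hf ih => exact .smul _ _ ih
  | lim F f B hF hB hl ih =>
    exact .lim (fun n x => F n (g x)) _ B ih (fun n x => hB n _) (fun x => hl _)

lemma mono {S T : Set (V d)} {f : V d → ℂ} (h : FS S f) (hST : S ⊆ T) : FS T f :=
  h.comp id (fun ξ hξ => .exp ξ (hST hξ))

lemma sum {ι : Type*} {S : Set (V d)} {s : Finset ι} {f : ι → V d → ℂ}
    (h : ∀ i ∈ s, FS S (f i)) : FS S (fun x => ∑ i ∈ s, f i x) := by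
  classical
  induction s using Finset.induction_on with
  | empty => simpa using FS.zero
  | insert a s ha ih =>
    simp only [Finset.sum_insert ha]
    exact .add _ _ (h a (by simp)) (ih fun i hi => h i (by simp [hi]))

lemma mul {S T U : Set (V d)} {f g : V d → ℂ} (hf : FS S f) (hg : FS T g)
    (hU : ∀ ξ ∈ S, ∀ η ∈ T, ξ + η ∈ U) : FS U (fun x => f x * g x) := by
  have key : ∀ ξ ∈ S, FS U (fun x => ee (pr ξ x) * g x) := by
    intro ξ hξ
    clear hf
    induction hg with
    | exp η h =>
      simp only [← ee_add, ← pr_add_left]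
      exact .exp _ (hU ξ hξ η h)
    | zero => simpa using FS.zero
    | add f g hf hg ih1 ih2 =>
      simp only [mul_add]; exact .add _ _ ih1 ih2
    | smul c f hf ih =>
      simp only [mul_left_comm _ c]; exact .smul _ _ ih
    | lim F f B hF hB hl ih =>
      exact .lim (fun n x => ee (pr ξ x) * F n x) _ B ih (fun n x => by simpa using hB n x)
        (fun x => (hl x).const_mul _)
  obtain ⟨B', hB0, hB'⟩ := hg.bdd
  induction hf with
  | exp ξ h => exact key ξ h
  | zero => simpa using FS.zero
  | add f g hf hg ih1 ih2 => simp only [add_mul]; exact .add _ _ ih1 ih2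
  | smul c f hf ih => simp only [mul_assoc]; exact .smul _ _ ih
  | lim F f B hF hB hl ih =>
    exact .lim (fun n x => F n x * g x) _ (B * B') ih
      (fun n x => by
        rw [norm_mul]
        exact mul_le_mul (hB n x) (hB' x) (norm_nonneg _) ((norm_nonneg _).trans (hB n x)))
      (fun x => (hl x).mul_const _)

lemma conj {S T : Set (V d)} {f : V d → ℂ} (hf : FS S f) (hT : ∀ ξ ∈ S, -ξ ∈ T) :
    FS T (fun x => (starRingEnd ℂ) (f x)) := by
  induction hf with
  | exp ξ h =>
    simp only [ee_conj, ← pr_neg_left]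
    exact .exp _ (hT ξ h)
  | zero => simpa using FS.zero
  | add f g hf hg ih1 ih2 => simp only [map_add]; exact .add _ _ ih1 ih2
  | smul c f hf ih => simp only [map_mul]; exact .smul _ _ ih
  | lim F f B hF hB hl ih =>
    exact .lim (fun n x => (starRingEnd ℂ) (F n x)) _ B ih (fun n x => by simpa using hB n x)
      (fun x => (Complex.continuous_conj.tendsto _).comp (hl x))

lemma exp_mul {S T : Set (V d)} {f : V d → ℂ} (hf : FS S f) (b : V d)
    (hT : ∀ ξ ∈ S, b + ξ ∈ T) : FS T (fun x => ee (pr b x) * f x) :=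
  FS.mul (S := {b}) (.exp b rfl) hf (by rintro _ rfl η hη; exact hT η hη)

/-- translation -/
lemma shift {S : Set (V d)} {f : V d → ℂ} (hf : FS S f) (y : V d) : FS S (fun x => f (x + y)) := by
  refine hf.comp (fun x => x + y) (fun ξ hξ => ?_)
  simp only [pr_add_right, ee_add]
  have := FS.smul (ee (pr ξ y)) _ (FS.exp ξ hξ)
  simpa only [mul_comm] using this

/-- Convolution against a kernel whose Fourier transform is constant on `S`. -/
lemma conv {S : Set (V d)} {f : V d → ℂ} (hf : FS S f) {K : V d → ℂ} (hK : Integrable K)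
    (c : ℂ) (hc : ∀ ξ ∈ S, ∫ y, ee (- pr ξ y) * K y = c) (x : V d) :
    ∫ y, f (x - y) * K y = c * f x := by
  have hinteg : ∀ {g : V d → ℂ}, FS S g → Integrable (fun y => g (x - y) * K y) := by
    intro g hg
    obtain ⟨B, hB0, hB⟩ := hg.bdd
    refine hK.bdd_mul (c := B) ?_ (ae_of_all _ fun y => hB _)
    exact (hg.meas.comp (measurable_const.sub measurable_id)).aestronglyMeasurable
  induction hf with
  | exp ξ h =>
    have := hc ξ h
    simp only [sub_eq_add_neg, pr_add_right, pr_neg_right, ee_add, mul_assoc]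
    rw [integral_const_mul, this, mul_comm]
  | zero => simp
  | add f g hf hg ih1 ih2 =>
    simp only [add_mul]
    rw [integral_add (hinteg hf) (hinteg hg), ih1, ih2, mul_add]
  | smul a f hf ih =>
    simp only [mul_assoc]
    rw [integral_const_mul, ih]; ring
  | lim F f B hF hB hl ih =>
    have h1 : Tendsto (fun n => ∫ y, F n (x - y) * K y) atTop (𝓝 (∫ y, f (x - y) * K y)) := by
      refine tendsto_integral_of_dominated_convergence (fun y => B * ‖K y‖) (fun n => ?_) ?_ ?_ ?_
      · exact (hinteg (hF n)).aestronglyMeasurable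
      · exact hK.norm.const_mul B
      · intro n; exact ae_of_all _ fun y => by rw [norm_mul]; gcongr; exact hB n _
      · exact ae_of_all _ fun y => (hl _).mul_const _
    simp only [ih] at h1
    exact tendsto_nhds_unique h1 ((hl x).const_mul c)

end FS
end DR

namespace DR
open Filter Topology
open scoped ENNReal NNReal

/-! ### `ℝ≥0∞`-valued norms and convolutions -/

section norms
variable {α : Type*} [MeasurableSpace α] {μ : Measure α}

def N (p : ℝ) (μ : Measure α) (F : α → ℝ≥0∞) : ℝ≥0∞ := (∫⁻ x, F x ^ p ∂μ) ^ (1 / p)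

/-- finite `ℓ²` sums -/
def l2 {ι : Type*} (T : Finset ι) (F : ι → ℝ≥0∞) : ℝ≥0∞ := (∑ z ∈ T, F z ^ (2 : ℝ)) ^ (1 / 2 : ℝ)

lemma rpow_rpow_inv' (a : ℝ≥0∞) {p : ℝ} (hp : p ≠ 0) : (a ^ p) ^ (1 / p) = a := by
  rw [← ENNReal.rpow_mul, mul_one_div_cancel hp, ENNReal.rpow_one]

lemma rpow_inv_rpow' (a : ℝ≥0∞) {p : ℝ} (hp : p ≠ 0) : (a ^ (1 / p)) ^ p = a := by
  rw [← ENNReal.rpow_mul, one_div_mul_cancel hp, ENNReal.rpow_one]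

lemma N_rpow_self {p : ℝ} (hp : 0 < p) (F : α → ℝ≥0∞) : N p μ F ^ p = ∫⁻ x, F x ^ p ∂μ :=
  rpow_inv_rpow' _ hp.ne'

lemma l2_sq {ι : Type*} (T : Finset ι) (F : ι → ℝ≥0∞) :
    l2 T F ^ (2 : ℝ) = ∑ z ∈ T, F z ^ (2 : ℝ) := by
  unfold l2; exact rpow_inv_rpow' _ two_ne_zero

lemma l2_mono {ι : Type*} {T : Finset ι} {F G : ι → ℝ≥0∞} (h : ∀ i ∈ T, F i ≤ G i) :
    l2 T F ≤ l2 T G := by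
  unfold l2
  gcongr with i hi
  exact h i hi

lemma l2_subset {ι : Type*} {T S : Finset ι} (h : T ⊆ S) {F : ι → ℝ≥0∞} :
    l2 T F ≤ l2 S F := by
  unfold l2
  gcongr

lemma le_l2 {ι : Type*} {T : Finset ι} {i : ι} (h : i ∈ T) {F : ι → ℝ≥0∞} :
    F i ≤ l2 T F := by
  unfold l2
  calc F i = (F i ^ (2 : ℝ)) ^ (1 / 2 : ℝ) := (rpow_rpow_inv' _ two_ne_zero).symm
    _ ≤ _ := by
      gcongr
      exact Finset.single_le_sum (f := fun z => F z ^ (2 : ℝ)) (fun _ _ => zero_le) h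

lemma l2_const_mul {ι : Type*} (T : Finset ι) (c : ℝ≥0∞) (F : ι → ℝ≥0∞) :
    l2 T (fun i => c * F i) = c * l2 T F := by
  unfold l2
  simp only [ENNReal.mul_rpow_of_nonneg _ _ (zero_le_two : (0 : ℝ) ≤ 2)]
  rw [← Finset.mul_sum, ENNReal.mul_rpow_of_nonneg _ _ (by norm_num), rpow_rpow_inv' _ two_ne_zero]

lemma N_mono {p : ℝ} (hp : 0 ≤ p) {F G : α → ℝ≥0∞} (h : ∀ x, F x ≤ G x) : N p μ F ≤ N p μ G := by
  unfold N
  gcongr with x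
  exact h x

lemma N_const_mul {p : ℝ} (hp : 0 < p) (c : ℝ≥0∞) {F : α → ℝ≥0∞} (hF : Measurable F) :
    N p μ (fun x => c * F x) = c * N p μ F := by
  unfold N
  simp only [ENNReal.mul_rpow_of_nonneg _ _ hp.le]
  rw [lintegral_const_mul _ (hF.pow_const p), ENNReal.mul_rpow_of_nonneg _ _ (by positivity),
    rpow_rpow_inv' _ hp.ne']

lemma N_zero {p : ℝ} (hp : 0 < p) : N p μ (fun _ => 0) = 0 := by
  unfold N
  simp [ENNReal.zero_rpow_of_pos hp, hp]

lemma N_add_le {p : ℝ} (hp : 1 ≤ p) {F G : α → ℝ≥0∞} (hF : Measurable F) (hG : Measurable G) :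
    N p μ (fun x => F x + G x) ≤ N p μ F + N p μ G :=
  ENNReal.lintegral_Lp_add_le hF.aemeasurable hG.aemeasurable hp

lemma N_sum_le {ι : Type*} {p : ℝ} (hp : 1 ≤ p) (T : Finset ι) {F : ι → α → ℝ≥0∞}
    (hF : ∀ i, Measurable (F i)) :
    N p μ (fun x => ∑ i ∈ T, F i x) ≤ ∑ i ∈ T, N p μ (F i) := by
  classical
  induction T using Finset.induction_on with
  | empty => simp [N_zero (lt_of_lt_of_le one_pos hp)]
  | insert a s ha ih =>
    simp only [Finset.sum_insert ha]
    refine (N_add_le hp (hF a) (Finset.measurable_sum _ fun i _ => hF i)).trans ?_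
    gcongr

lemma N_rpow {p a : ℝ} (ha : 0 < a) (F : α → ℝ≥0∞) :
    N p μ (fun x => F x ^ a) = N (p * a) μ F ^ a := by
  unfold N
  rw [← ENNReal.rpow_mul]
  simp only [← ENNReal.rpow_mul]
  rcases eq_or_ne p 0 with h | h
  · subst h; simp
  · congr 2
    · simp only [mul_comm p a]
    · field_simp

lemma N_l2_le {ι : Type*} {p : ℝ} (hp : 2 ≤ p) (T : Finset ι) {F : ι → α → ℝ≥0∞}
    (hF : ∀ i, Measurable (F i)) :
    N p μ (fun x => l2 T (fun i => F i x)) ≤ l2 T (fun i => N p μ (F i)) := by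
  unfold l2
  rw [N_rpow (by norm_num)]
  gcongr
  refine (N_sum_le (by linarith) T (fun i => (hF i).pow_const _)).trans ?_
  gcongr with i hi
  rw [N_rpow (by norm_num)]
  gcongr
  · apply le_of_eq; congr 1; ring

/-- Jensen / Hölder with a finite mass measure. -/
lemma lintegral_le_mass {r : ℝ} (hr : 1 ≤ r) {F : α → ℝ≥0∞} (hF : Measurable F) :
    ∫⁻ x, F x ∂μ ≤ (∫⁻ x, F x ^ r ∂μ) ^ (1 / r) * (μ Set.univ) ^ (1 - 1 / r) := by
  have h0 : (0 : ℝ) < r := by linarith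
  have := ENNReal.lintegral_mul_norm_pow_le (μ := μ) (f := fun x => F x ^ r) (g := fun _ => 1)
    (hF.pow_const r).aemeasurable aemeasurable_const (p := 1 / r) (q := 1 - 1 / r)
    (by positivity) (by rw [sub_nonneg, div_le_one h0]; exact hr) (by ring)
  simpa [rpow_rpow_inv' _ h0.ne', ← ENNReal.rpow_mul, h0.ne'] using this

lemma lintegral_rpow_le_mass {r : ℝ} (hr0 : 0 < r) (hr : r ≤ 1) {F : α → ℝ≥0∞}
    (hF : Measurable F) :
    ∫⁻ x, F x ^ r ∂μ ≤ (∫⁻ x, F x ∂μ) ^ r * (μ Set.univ) ^ (1 - r) := by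
  have := lintegral_le_mass (μ := μ) (r := 1 / r) (by rw [le_div_iff₀ hr0]; simpa)
    (hF.pow_const r)
  simpa [rpow_rpow_inv' _ hr0.ne', ← ENNReal.rpow_mul, hr0.ne'] using this

end norms

set_option linter.unusedSectionVars false

section conv
variable {G : Type*} [MeasureSpace G] [AddCommGroup G] [MeasurableAdd₂ G] [MeasurableNeg G]
  [SFinite (volume : Measure G)] [(volume : Measure G).IsAddLeftInvariant]
  [(volume : Measure G).IsNegInvariant]

def cv (g w : G → ℝ≥0∞) (x : G) : ℝ≥0∞ := ∫⁻ y, g (x - y) * w y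

lemma cv_mono {g g' w w' : G → ℝ≥0∞} (hg : ∀ x, g x ≤ g' x) (hw : ∀ x, w x ≤ w' x) (x : G) :
    cv g w x ≤ cv g' w' x := by
  unfold cv
  gcongr with y
  · exact hg _
  · exact hw _

lemma cv_comm (g w : G → ℝ≥0∞) (x : G) : cv g w x = cv w g x := by
  unfold cv
  rw [← lintegral_sub_left_eq_self _ x]
  simp [mul_comm]

@[fun_prop] lemma cv_meas {g w : G → ℝ≥0∞} (hg : Measurable g) (hw : Measurable w) :
    Measurable (cv g w) := by
  unfold cv
  apply Measurable.lintegral_prod_right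
  have : MeasurableSub₂ G := inferInstance
  fun_prop

lemma cv_assoc {g w v : G → ℝ≥0∞} (hg : Measurable g) (hw : Measurable w) (hv : Measurable v)
    (x : G) : cv (cv g w) v x = cv g (cv w v) x := by
  have hs : MeasurableSub₂ G := inferInstance
  unfold cv
  have h1 : ∀ y, (∫⁻ z, g (x - y - z) * w z) * v y = ∫⁻ z, g (x - z) * (w (z - y) * v y) := by
    intro y
    rw [← lintegral_mul_const _ (by fun_prop)]
    rw [← lintegral_sub_right_eq_self _ y]
    congr 1; ext z; rw [← mul_assoc]; congr 3; abel
  simp only [h1]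
  rw [lintegral_lintegral_swap]
  · congr 1; ext z
    rw [lintegral_const_mul _ (by fun_prop)]
  · apply Measurable.aemeasurable
    unfold Function.uncurry
    fun_prop

lemma cv_const_mul_right {g w : G → ℝ≥0∞} (hg : Measurable g) (hw : Measurable w) (c : ℝ≥0∞)
    (x : G) : cv g (fun y => c * w y) x = c * cv g w x := by
  have hs : MeasurableSub₂ G := inferInstance
  unfold cv
  simp only [mul_left_comm _ c]
  rw [lintegral_const_mul _ (by fun_prop)]

lemma cv_const_mul_left {g w : G → ℝ≥0∞} (hg : Measurable g) (hw : Measurable w) (c : ℝ≥0∞)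
    (x : G) : cv (fun y => c * g y) w x = c * cv g w x := by
  rw [cv_comm, cv_const_mul_right hw hg, cv_comm]

lemma cv_sum_left {ι : Type*} {T : Finset ι} {g : ι → G → ℝ≥0∞} {w : G → ℝ≥0∞}
    (hg : ∀ i, Measurable (g i)) (hw : Measurable w)
    (x : G) : cv (fun y => ∑ i ∈ T, g i y) w x = ∑ i ∈ T, cv (g i) w x := by
  have hs : MeasurableSub₂ G := inferInstance
  unfold cv
  simp only [Finset.sum_mul]
  rw [lintegral_finsetSum _ (fun i _ => by fun_prop)]

lemma lintegral_cv {g w : G → ℝ≥0∞} (hg : Measurable g) (hw : Measurable w) :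
    ∫⁻ x, cv g w x = (∫⁻ x, g x) * ∫⁻ x, w x := by
  have hs : MeasurableSub₂ G := inferInstance
  unfold cv
  rw [lintegral_lintegral_swap]
  · simp_rw [fun y => lintegral_mul_const (w y) (f := fun x => g (x - y)) (μ := volume)
      (by fun_prop), lintegral_sub_right_eq_self]
    rw [lintegral_const_mul _ hw]
  · apply Measurable.aemeasurable
    unfold Function.uncurry
    fun_prop

lemma cv_withDensity {g w : G → ℝ≥0∞} (hg : Measurable g) (hw : Measurable w) (x : G) :
    cv g w x = ∫⁻ y, g (x - y) ∂(volume.withDensity w) := by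
  have hs : MeasurableSub₂ G := inferInstance
  rw [lintegral_withDensity_eq_lintegral_mul _ hw (by fun_prop)]
  simp [cv, mul_comm]

lemma withDensity_univ {w : G → ℝ≥0∞} : (volume.withDensity w) Set.univ = ∫⁻ y, w y := by
  rw [withDensity_apply _ MeasurableSet.univ]; simp

lemma cv_jensen {r : ℝ} (hr : 1 ≤ r) {g w : G → ℝ≥0∞} (hg : Measurable g) (hw : Measurable w)
    (x : G) : cv g w x ≤ cv (fun y => g y ^ r) w x ^ (1 / r) * (∫⁻ y, w y) ^ (1 - 1 / r) := by
  have hs : MeasurableSub₂ G := inferInstance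
  rw [cv_withDensity hg hw, cv_withDensity (hg.pow_const r) hw, ← withDensity_univ]
  exact lintegral_le_mass hr (F := fun y => g (x - y)) (by fun_prop)

/-- Minkowski for convolutions. -/
lemma cv_minkowski {ι : Type*} {r : ℝ} (hr : 1 ≤ r) (T : Finset ι) {g : ι → G → ℝ≥0∞}
    {w : G → ℝ≥0∞} (hg : ∀ i, Measurable (g i)) (hw : Measurable w) (x : G) :
    cv (fun y => (∑ i ∈ T, g i y ^ (1 / r)) ^ r) w x ≤ (∑ i ∈ T, cv (g i) w x ^ (1 / r)) ^ r := by
  have hs : MeasurableSub₂ G := inferInstance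
  have h0 : 0 < r := by linarith
  have := N_sum_le (μ := volume.withDensity w) hr T (F := fun i y => g i (x - y) ^ (1 / r))
    (fun i => by fun_prop)
  rw [cv_withDensity (by fun_prop) hw]
  have h2 := ENNReal.rpow_le_rpow this h0.le
  rw [N_rpow_self h0] at h2
  refine h2.trans (le_of_eq ?_)
  congr 2; ext i
  rw [cv_withDensity (hg i) hw]
  unfold N
  simp only [rpow_inv_rpow' _ h0.ne']

end conv

end DR

namespace DR
open Filter Topology
open scoped ENNReal NNReal FourierTransform SchwartzMap ContDiff

/-! ### One-dimensional kernels -/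

def bump (c r : ℝ) (hr : 0 < r) : ContDiffBump c := ⟨r, 2 * r, hr, by linarith⟩

def bumpS (c r : ℝ) (hr : 0 < r) : 𝓢(ℝ, ℂ) :=
  HasCompactSupport.toSchwartzMap (f := fun x : ℝ => ((bump c r hr x : ℝ) : ℂ))
    ((bump c r hr).hasCompactSupport.comp_left (g := fun x : ℝ => (x : ℂ)) (by simp))
    (Complex.ofRealCLM.contDiff.comp (bump c r hr).contDiff)

lemma bumpS_apply (c r : ℝ) (hr : 0 < r) (x : ℝ) :
    bumpS c r hr x = ((bump c r hr x : ℝ) : ℂ) := rfl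

lemma fourier_eq_ee (f : ℝ → ℂ) (s : ℝ) : 𝓕 f s = ∫ x, ee (-(s * x)) * f x := by
  rw [Real.fourier_eq']
  congr 1; ext x
  simp only [smul_eq_mul, ee]
  congr 2
  simp
  ring

lemma schwartz_decay (f : 𝓢(ℝ, ℂ)) (F : ℕ) :
    ∃ C : ℝ, 0 < C ∧ ∀ s, ‖f s‖ ≤ C * ((1 + |s|) ^ F)⁻¹ := by
  obtain ⟨C, hC⟩ : ∃ C : ℝ, ∀ s, (1 + |s|) ^ F * ‖f s‖ ≤ C := by
    refine ⟨2 ^ (F, 0).1 * ((Finset.Iic (F, 0)).sup fun m => SchwartzMap.seminorm ℝ m.1 m.2) f,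
      fun s => ?_⟩
    have := SchwartzMap.one_add_le_sup_seminorm_apply (𝕜 := ℝ) (m := (F, 0)) le_rfl le_rfl f s
    simpa using this
  refine ⟨max C 1, by positivity, fun s => ?_⟩
  have h1 : 0 < (1 + |s|) ^ F := by positivity
  rw [← div_eq_mul_inv, le_div_iff₀ h1, mul_comm]
  exact (hC s).trans (le_max_left _ _)

lemma exists_psi (A : ℝ) (hA : 0 < A) : ∃ ψ : ℝ → ℂ, Continuous ψ ∧
    (∀ F : ℕ, ∃ C : ℝ, 0 < C ∧ ∀ s, ‖ψ s‖ ≤ C * ((1 + |s|) ^ F)⁻¹) ∧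
    ∀ θ : ℝ, |θ| ≤ A → ∫ s, ee (-(θ * s)) * ψ s = 1 := by
  refine ⟨⇑(𝓕⁻ (bumpS 0 A hA) : 𝓢(ℝ, ℂ)), (𝓕⁻ (bumpS 0 A hA)).continuous, schwartz_decay _, ?_⟩
  intro θ hθ
  rw [← fourier_eq_ee, ← SchwartzMap.fourier_coe, FourierTransform.fourier_fourierInv_eq,
    bumpS_apply, (bump 0 A hA).one_of_mem_closedBall]
  · simp
  · simpa [bump] using hθ

lemma bumpS_shift (r : ℝ) (hr : 0 < r) (θ x : ℝ) : bumpS θ r hr (x + θ) = bumpS 0 r hr x := by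
  rw [bumpS_apply, bumpS_apply]
  simp [bump, ContDiffBump.apply]

lemma exists_phi : ∃ (φ : ℝ → ℝ) (Γ c : ℝ), 0 < Γ ∧ 0 < c ∧ Continuous φ ∧ (∀ s, 0 ≤ φ s) ∧
    (∀ s, |s| ≤ 1 → c ≤ φ s) ∧
    (∀ F : ℕ, ∃ C : ℝ, 0 < C ∧ ∀ s, φ s ≤ C * ((1 + |s|) ^ F)⁻¹) ∧
    ∀ θ : ℝ, Γ ≤ |θ| → ∫ s, ee (-(θ * s)) * (φ s : ℂ) = 0 := by
  have h1 : (0 : ℝ) < 1 := one_pos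
  set b := bumpS 0 1 h1 with hb
  set ψ : ℝ → ℂ := ⇑(𝓕 b : 𝓢(ℝ, ℂ)) with hψ
  have hc : Continuous ψ := (𝓕 b).continuous
  have h0 : ψ 0 ≠ 0 := by
    rw [hψ, SchwartzMap.fourier_coe, fourier_eq_ee]
    simp only [zero_mul, neg_zero, ee_zero, one_mul]
    have : (∫ x, b x) = ((∫ x, bump 0 1 h1 x : ℝ) : ℂ) := by
      exact integral_ofReal (𝕜 := ℂ) (f := fun x => bump 0 1 h1 x)
    rw [this]
    have := (bump 0 1 h1).integral_pos (μ := volume)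
    exact_mod_cast this.ne'
  -- lower bound near zero
  obtain ⟨r, hr0, hr⟩ : ∃ r > 0, ∀ s, |s| ≤ r → ‖ψ 0‖ / 2 ≤ ‖ψ s‖ := by
    have hlt : ‖ψ 0‖ / 2 < ‖ψ 0‖ := by have := norm_pos_iff.2 h0; linarith
    have := (hc.norm.tendsto 0).eventually (lt_mem_nhds hlt)
    obtain ⟨r, hr0, hr⟩ := Metric.eventually_nhds_iff.1 this
    refine ⟨r / 2, by positivity, fun s hs => (hr ?_).le⟩
    rw [Real.dist_eq, sub_zero]; linarith
  -- rescale so that r = 1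
  refine ⟨fun s => ‖ψ (r * s)‖ ^ 2, r * 4, (‖ψ 0‖ / 2) ^ 2, by positivity,
    by have := norm_pos_iff.2 h0; positivity, by fun_prop, fun s => by positivity, ?_, ?_, ?_⟩
  · intro s hs
    have := hr (r * s) (by rw [abs_mul, abs_of_pos hr0]; nlinarith)
    exact pow_le_pow_left₀ (by positivity) this 2
  · intro F
    obtain ⟨C, hC0, hC⟩ := schwartz_decay (𝓕 b) F
    have hC' : ∀ s, ‖ψ (r * s)‖ ^ 2 ≤ C * C * ((1 + |r * s|) ^ F)⁻¹ := by
      intro s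
      have h2 := hC (r * s)
      have h3 : ((1 + |r * s|) ^ F)⁻¹ ≤ 1 := by
        apply inv_le_one_of_one_le₀
        apply one_le_pow₀; linarith [abs_nonneg (r * s)]
      have h4 : 0 ≤ ((1 + |r * s|) ^ F)⁻¹ := by positivity
      have h5 : ‖ψ (r * s)‖ ≤ C := h2.trans (by nlinarith)
      calc ‖ψ (r * s)‖ ^ 2 = ‖ψ (r * s)‖ * ‖ψ (r * s)‖ := sq _
        _ ≤ C * (C * ((1 + |r * s|) ^ F)⁻¹) := by gcongr
        _ = _ := by ring
    set m := min r 1 with hm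
    have hm0 : 0 < m := lt_min hr0 one_pos
    refine ⟨C * C * (m ^ F)⁻¹, by positivity, fun s => (hC' s).trans ?_⟩
    rw [mul_assoc (C * C)]
    refine mul_le_mul_of_nonneg_left ?_ (by positivity)
    rw [← mul_inv, ← mul_pow]
    gcongr
    rw [abs_mul, abs_of_pos hr0]
    have h6 : m ≤ r := min_le_left _ _
    have h7 : m ≤ 1 := min_le_right _ _
    nlinarith [abs_nonneg s]
  · intro θ hθ
    have key : ∀ θ' : ℝ, 4 ≤ |θ'| → ∫ s, ee (-(θ' * s)) * ((‖ψ s‖ ^ 2 : ℝ) : ℂ) = 0 := by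
      intro θ' hθ'
      have hP := SchwartzMap.integral_inner_fourier_fourier b (bumpS θ' 1 h1)
      have hz : ∫ x, inner ℂ (b x) (bumpS θ' 1 h1 x) = 0 := by
        have : ∀ x, inner ℂ (b x) (bumpS θ' 1 h1 x) = 0 := by
          intro x
          by_cases hx : 2 ≤ |x|
          · have : b x = 0 := by
              rw [hb, bumpS_apply, (bump 0 1 h1).zero_of_le_dist]
              · simp
              · simpa [bump] using hx
            rw [this, inner_zero_left]
          · have : bumpS θ' 1 h1 x = 0 := by
              rw [bumpS_apply, (bump θ' 1 h1).zero_of_le_dist]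
              · simp
              · have : (bump θ' 1 h1).rOut = 2 := by simp [bump]
                rw [this, dist_comm, Real.dist_eq]
                have := abs_sub_abs_le_abs_sub θ' x
                linarith
            rw [this, inner_zero_right]
        simp only [this, integral_zero]
      rw [hz] at hP
      rw [← hP]
      congr 1; ext s
      have hs : (𝓕 (bumpS θ' 1 h1)) s = ee (-(θ' * s)) * ψ s := by
        rw [hψ, SchwartzMap.fourier_coe, SchwartzMap.fourier_coe, fourier_eq_ee, fourier_eq_ee]
        rw [← integral_add_right_eq_self _ θ', ← integral_const_mul]
        congr 1; ext x
        rw [bumpS_shift, ← mul_assoc, ← ee_add]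
        congr 2; ring
      rw [hs]
      rw [RCLike.inner_apply']
      have : (starRingEnd ℂ) (ψ s) * ψ s = ((‖ψ s‖ ^ 2 : ℝ) : ℂ) := by
        rw [mul_comm, Complex.mul_conj, Complex.normSq_eq_norm_sq]
      rw [← this, ← hψ]; ring
    have h2 := key (θ / r) (by rw [abs_div, abs_of_pos hr0, le_div_iff₀ hr0]; linarith)
    have h3 := Measure.integral_comp_mul_left
      (fun s => ee (-(θ / r * s)) * ((‖ψ s‖ ^ 2 : ℝ) : ℂ)) r
    rw [h2, smul_zero] at h3
    rw [← h3]
    congr 1; ext s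
    congr 3; field_simp

end DR

namespace DR
open Filter Topology
open scoped ENNReal NNReal

/-! ### Weights -/

variable {d : ℕ}

def vr (F : ℕ) (ρ s : ℝ) : ℝ := ρ⁻¹ * ((1 + |s| / ρ) ^ F)⁻¹

def v (F : ℕ) (ρ s : ℝ) : ℝ≥0∞ := ENNReal.ofReal (vr F ρ s)

/-- tube weight -/
def W (F : ℕ) (g : Fin d → ℝ) (ρ L : ℝ) (x : V d) : ℝ≥0∞ :=
  (∏ i, v F ρ (x.1 i + g i * x.2)) * v F L x.2

/-- isotropic weight -/
def w (E : ℕ) (R : ℝ) (x : V d) : ℝ≥0∞ :=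
  ENNReal.ofReal ((R ^ (d + 1))⁻¹ * ((1 + ‖x‖ / R) ^ E)⁻¹)

@[fun_prop] lemma meas_v (F : ℕ) (ρ : ℝ) : Measurable (v F ρ) := by
  unfold v vr; fun_prop

@[fun_prop] lemma meas_W (F : ℕ) (g : Fin d → ℝ) (ρ L : ℝ) : Measurable (W F g ρ L) := by
  unfold W; fun_prop

@[fun_prop] lemma meas_w (E : ℕ) (R : ℝ) : Measurable (w (d := d) E R) := by
  unfold w; fun_prop

lemma lintegral_pi_prod : ∀ {d : ℕ} (f : Fin d → ℝ → ℝ≥0∞) (_ : ∀ i, Measurable (f i)),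
    ∫⁻ x : Fin d → ℝ, ∏ i, f i (x i) = ∏ i, ∫⁻ s, f i s := by
  intro d
  induction d with
  | zero => intro f hf; simp [volume_pi, Measure.pi_empty_univ]
  | succ d ih =>
    intro f hf
    have hm := (volume_preserving_piFinSuccAbove (fun _ : Fin (d + 1) => ℝ) 0)
    rw [← hm.symm.lintegral_comp_emb (MeasurableEquiv.measurableEmbedding _), Measure.volume_eq_prod]
    simp only [MeasurableEquiv.piFinSuccAbove_symm_apply, Fin.insertNthEquiv,
        Fin.prod_univ_succ, Fin.insertNth_zero', Equiv.coe_fn_mk, Fin.cons_zero, Fin.cons_succ,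
        Fin.zero_succAbove]
    rw [lintegral_prod_mul (f := f 0) (g := fun x : Fin d → ℝ => ∏ i, f i.succ (x i))
      (hf 0).aemeasurable
      (Finset.measurable_prod _ fun i _ => (hf i.succ).comp (measurable_pi_apply i)).aemeasurable, ih _ (fun i => hf _)]

lemma lintegral_comp_mul (f : ℝ → ℝ≥0∞) {ρ : ℝ} (hρ : 0 < ρ) :
    ∫⁻ s, f (s / ρ) = ENNReal.ofReal ρ * ∫⁻ s, f s := by
  have h := Real.map_volume_mul_left (a := ρ⁻¹) (by positivity)
  rw [inv_inv, abs_of_pos hρ] at h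
  have h2 : MeasurableEmbedding (fun x : ℝ => ρ⁻¹ * x) :=
    (Homeomorph.mulLeft₀ ρ⁻¹ (by positivity)).measurableEmbedding
  rw [← smul_eq_mul, ← lintegral_smul_measure, ← h, h2.lintegral_map]
  simp [div_eq_inv_mul]

lemma one_le_br (s : ℝ) {ρ : ℝ} (hρ : 0 < ρ) : 1 ≤ 1 + |s| / ρ := by
  have : 0 ≤ |s| / ρ := by positivity
  linarith

lemma one_le_brn (x : V d) {ρ : ℝ} (hρ : 0 < ρ) : 1 ≤ 1 + ‖x‖ / ρ := by
  have : 0 ≤ ‖x‖ / ρ := by positivity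
  linarith

lemma v_mono {F F' : ℕ} (h : F ≤ F') {ρ : ℝ} (hρ : 0 < ρ) (s : ℝ) : v F' ρ s ≤ v F ρ s := by
  unfold v vr
  have := one_le_br s hρ
  gcongr

lemma w_mono {F F' : ℕ} (h : F ≤ F') {ρ : ℝ} (hρ : 0 < ρ) (x : V d) : w F' ρ x ≤ w F ρ x := by
  unfold w
  have := one_le_brn x hρ
  gcongr

def Cv : ℝ≥0∞ := ∫⁻ s, v 2 1 s

lemma Cv_lt_top : Cv < ∞ := by
  have := finite_integral_one_add_norm (E := ℝ) (μ := volume) (r := 2) (by norm_num)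
  refine lt_of_le_of_lt (le_of_eq ?_) this
  unfold Cv v vr
  congr 1; ext s
  simp only [inv_one, one_mul, div_one, Real.norm_eq_abs]
  congr 1
  rw [Real.rpow_neg (by positivity)]
  norm_cast

lemma lintegral_v {F : ℕ} (hF : 2 ≤ F) {ρ : ℝ} (hρ : 0 < ρ) : ∫⁻ s, v F ρ s ≤ Cv := by
  calc ∫⁻ s, v F ρ s ≤ ∫⁻ s, v 2 ρ s := lintegral_mono fun s => v_mono hF hρ s
    _ = ∫⁻ s, ENNReal.ofReal ρ⁻¹ * v 2 1 (s / ρ) := by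
      congr 1; ext s
      unfold v vr
      rw [← ENNReal.ofReal_mul (by positivity)]
      simp [abs_div, abs_of_pos hρ]
    _ = Cv := by
      rw [lintegral_const_mul _ (by fun_prop), lintegral_comp_mul _ hρ, ← mul_assoc,
        ← ENNReal.ofReal_mul (by positivity), inv_mul_cancel₀ hρ.ne']
      simp [Cv]

/-- shear and product integration -/
lemma lintegral_shear {f : Fin d → ℝ → ℝ≥0∞} (hf : ∀ i, Measurable (f i)) {h : ℝ → ℝ≥0∞}
    (hh : Measurable h) (g : Fin d → ℝ) :
    ∫⁻ x : V d, (∏ i, f i (x.1 i + g i * x.2)) * h x.2 = (∏ i, ∫⁻ s, f i s) * ∫⁻ s, h s := by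
  rw [Measure.volume_eq_prod, lintegral_prod_symm _ (by fun_prop)]
  have : ∀ t : ℝ, ∫⁻ y : Fin d → ℝ, (∏ i, f i (y i + g i * t)) * h t
      = (∏ i, ∫⁻ s, f i s) * h t := by
    intro t
    rw [lintegral_mul_const _ (by fun_prop), ← lintegral_pi_prod f hf]
    congr 1
    exact lintegral_add_right_eq_self (fun y : Fin d → ℝ => ∏ i, f i (y i)) (fun i => g i * t)
  simp only [this]
  rw [lintegral_const_mul _ hh]

lemma lintegral_W {F : ℕ} (hF : 2 ≤ F) (g : Fin d → ℝ) {ρ L : ℝ} (hρ : 0 < ρ) (hL : 0 < L) :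
    ∫⁻ x, W F g ρ L x ≤ Cv ^ (d + 1) := by
  unfold W
  rw [lintegral_shear (fun i => meas_v F ρ) (meas_v F L)]
  rw [pow_succ]
  gcongr
  · simp only [Finset.prod_const, Finset.card_univ, Fintype.card_fin]
    gcongr
    exact lintegral_v hF hρ
  · exact lintegral_v hF hL

lemma lintegral_comp_lin {E : Type*} [NormedAddCommGroup E] [NormedSpace ℝ E]
    [MeasureSpace E] [BorelSpace E] [FiniteDimensional ℝ E]
    [(volume : Measure E).IsAddHaarMeasure] (A : E →ₗ[ℝ] E) (hA : LinearMap.det A ≠ 0)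
    {f : E → ℝ≥0∞} (hf : Measurable f) :
    ∫⁻ x, f (A x) = ENNReal.ofReal |(LinearMap.det A)⁻¹| * ∫⁻ x, f x := by
  rw [← smul_eq_mul, ← lintegral_smul_measure, ← Measure.map_linearMap_addHaar_eq_smul_addHaar _ hA,
    lintegral_map hf A.continuous_of_finiteDimensional.measurable]

lemma lintegral_dil {f : V d → ℝ≥0∞} (hf : Measurable f) {R : ℝ} (hR : 0 < R) :
    ∫⁻ x, f (R⁻¹ • x) = ENNReal.ofReal (R ^ (d + 1)) * ∫⁻ x, f x := by
  have h := Measure.map_addHaar_smul (volume : Measure (V d)) (r := R⁻¹) (by positivity)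
  rw [show Module.finrank ℝ (V d) = d + 1 by simp] at h
  rw [inv_pow, inv_inv, abs_of_pos (by positivity)] at h
  rw [← smul_eq_mul, ← lintegral_smul_measure, ← h, lintegral_map hf (by fun_prop)]

def Cw (d : ℕ) : ℝ≥0∞ := ∫⁻ x : V d, w (d + 2) 1 x

lemma Cw_lt_top : Cw d < ∞ := by
  have := finite_integral_one_add_norm (E := V d) (μ := volume) (r := d + 2) (by simp)
  refine lt_of_le_of_lt (le_of_eq ?_) this
  unfold Cw w
  congr 1; ext s
  simp only [one_pow, inv_one, one_mul, div_one]
  congr 1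
  rw [Real.rpow_neg (by positivity)]
  norm_cast

lemma lintegral_w {E : ℕ} (hE : d + 2 ≤ E) {R : ℝ} (hR : 0 < R) :
    ∫⁻ x : V d, w E R x ≤ Cw d := by
  calc ∫⁻ s, w E R s ≤ ∫⁻ s : V d, w (d + 2) R s := lintegral_mono fun s => w_mono hE hR s
    _ = ∫⁻ s : V d, ENNReal.ofReal (R ^ (d + 1))⁻¹ * w (d + 2) 1 (R⁻¹ • s) := by
      congr 1; ext s
      unfold w
      rw [← ENNReal.ofReal_mul (by positivity)]
      simp [norm_smul, abs_of_pos hR, div_eq_inv_mul]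
    _ = Cw d := by
      rw [lintegral_const_mul _ (by fun_prop), lintegral_dil (by fun_prop) hR, ← mul_assoc,
        ← ENNReal.ofReal_mul (by positivity), inv_mul_cancel₀ (by positivity)]
      simp [Cw]

/-! Peetre-type inequalities -/

lemma peetre {a b ρ : ℝ} (ha : 0 ≤ a) (hb : 0 ≤ b) (hρ : 0 < ρ) :
    1 + (a + b) / ρ ≤ (1 + a / ρ) * (1 + b / ρ) := by
  have : 0 ≤ a / ρ * (b / ρ) := by positivity
  rw [add_div]; linarith

lemma vr_shift (F : ℕ) {ρ : ℝ} (hρ : 0 < ρ) (s a : ℝ) :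
    vr F ρ (s + a) ≤ (1 + |a| / ρ) ^ F * vr F ρ s := by
  unfold vr
  have h1 : 1 + |s| / ρ ≤ (1 + |a| / ρ) * (1 + |s + a| / ρ) := by
    refine le_trans ?_ (peetre (abs_nonneg a) (abs_nonneg (s + a)) hρ)
    have : |s| ≤ |a| + |s + a| := by
      have := abs_add_le (-a) (s + a)
      simpa using this
    gcongr
  have h2 : ((1 + |s + a| / ρ) ^ F)⁻¹ ≤ (1 + |a| / ρ) ^ F * ((1 + |s| / ρ) ^ F)⁻¹ := by
    rw [← div_eq_mul_inv, le_div_iff₀ (by positivity), inv_mul_le_iff₀ (by positivity), ← mul_pow]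
    gcongr
    rw [mul_comm]; exact h1
  calc ρ⁻¹ * ((1 + |s + a| / ρ) ^ F)⁻¹ ≤ ρ⁻¹ * ((1 + |a| / ρ) ^ F * ((1 + |s| / ρ) ^ F)⁻¹) := by
        gcongr
    _ = _ := by ring

lemma v_shift (F : ℕ) {ρ : ℝ} (hρ : 0 < ρ) (s a : ℝ) :
    v F ρ (s + a) ≤ ENNReal.ofReal ((1 + |a| / ρ) ^ F) * v F ρ s := by
  unfold v
  rw [← ENNReal.ofReal_mul (by positivity)]
  exact ENNReal.ofReal_le_ofReal (vr_shift F hρ s a)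

lemma w_shift (E : ℕ) {R : ℝ} (hR : 0 < R) (x y : V d) :
    w E R (x + y) ≤ ENNReal.ofReal ((1 + ‖y‖ / R) ^ E) * w E R x := by
  unfold w
  rw [← ENNReal.ofReal_mul (by positivity)]
  apply ENNReal.ofReal_le_ofReal
  have h1 : 1 + ‖x‖ / R ≤ (1 + ‖y‖ / R) * (1 + ‖x + y‖ / R) := by
    refine le_trans ?_ (peetre (norm_nonneg y) (norm_nonneg (x + y)) hR)
    have : ‖x‖ ≤ ‖y‖ + ‖x + y‖ := by
      have := norm_add_le (-y) (x + y)
      simpa using this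
    gcongr
  have h2 : ((1 + ‖x + y‖ / R) ^ E)⁻¹ ≤ (1 + ‖y‖ / R) ^ E * ((1 + ‖x‖ / R) ^ E)⁻¹ := by
    rw [← div_eq_mul_inv, le_div_iff₀ (by positivity), inv_mul_le_iff₀ (by positivity), ← mul_pow]
    gcongr
    rw [mul_comm]; exact h1
  calc _ ≤ (R ^ (d + 1))⁻¹ * ((1 + ‖y‖ / R) ^ E * ((1 + ‖x‖ / R) ^ E)⁻¹) := by
        gcongr
    _ = _ := by ring

lemma W_shift (F : ℕ) (g : Fin d → ℝ) {ρ L : ℝ} (hρ : 0 < ρ) (hL : 0 < L) (x y : V d) :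
    W F g ρ L (x + y) ≤ ((∏ i, ENNReal.ofReal ((1 + |y.1 i + g i * y.2| / ρ) ^ F)) *
      ENNReal.ofReal ((1 + |y.2| / L) ^ F)) * W F g ρ L x := by
  unfold W
  rw [mul_mul_mul_comm, ← Finset.prod_mul_distrib]
  gcongr with i
  · have := v_shift F hρ (x.1 i + g i * x.2) (y.1 i + g i * y.2)
    refine le_trans (le_of_eq ?_) this
    congr 1
    simp; ring
  · exact v_shift F hL x.2 y.2

lemma abs_fst_le (y : V d) (i : Fin d) : |y.1 i| ≤ ‖y‖ :=
  (norm_le_pi_norm y.1 i).trans (norm_fst_le y)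

lemma abs_snd_le (y : V d) : |y.2| ≤ ‖y‖ := norm_snd_le y

lemma abs_shear_le {g : Fin d → ℝ} {G : ℝ} (hg : ∀ i, |g i| ≤ G) (y : V d) (i : Fin d) :
    |y.1 i + g i * y.2| ≤ (1 + G) * ‖y‖ := by
  have h1 := abs_fst_le y i
  have h2 := abs_snd_le y
  have h3 := hg i
  have hG : 0 ≤ G := (abs_nonneg _).trans h3
  calc |y.1 i + g i * y.2| ≤ |y.1 i| + |g i| * |y.2| := by
        rw [← abs_mul]; exact abs_add_le _ _
    _ ≤ ‖y‖ + G * ‖y‖ := by gcongr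
    _ = _ := by ring

/-- shift of a tube weight by a general vector, at scale `ρ ≤ L` -/
lemma W_shift_norm (F : ℕ) {g : Fin d → ℝ} {G : ℝ} (hG : 0 ≤ G) (hg : ∀ i, |g i| ≤ G) {ρ L : ℝ}
    (hρ : 0 < ρ) (hL : ρ ≤ L) (x y : V d) :
    W F g ρ L (x + y) ≤ ENNReal.ofReal ((1 + G) ^ (F * (d + 1))) *
      ENNReal.ofReal ((1 + ‖y‖ / ρ) ^ (F * (d + 1))) * W F g ρ L x := by
  refine (W_shift F g hρ (hρ.trans_le hL) x y).trans ?_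
  refine mul_le_mul_left ?_ _
  rw [← ENNReal.ofReal_mul (by positivity), ← ENNReal.ofReal_prod_of_nonneg (fun _ _ => by positivity),
    ← ENNReal.ofReal_mul (by positivity)]
  apply ENNReal.ofReal_le_ofReal
  have hn : 0 ≤ ‖y‖ / ρ := by positivity
  have key : ∀ i, (1 + |y.1 i + g i * y.2| / ρ) ^ F ≤ ((1 + G) * (1 + ‖y‖ / ρ)) ^ F := by
    intro i
    gcongr
    have := abs_shear_le hg y i
    calc 1 + |y.1 i + g i * y.2| / ρ ≤ 1 + (1 + G) * ‖y‖ / ρ := by gcongr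
      _ ≤ _ := by rw [mul_div_assoc]; nlinarith
  have key2 : (1 + |y.2| / L) ^ F ≤ ((1 + G) * (1 + ‖y‖ / ρ)) ^ F := by
    have hL' : 0 < L := hρ.trans_le hL
    gcongr
    have : |y.2| / L ≤ ‖y‖ / ρ := by
      gcongr; exact abs_snd_le y
    nlinarith
  calc (∏ i, (1 + |y.1 i + g i * y.2| / ρ) ^ F) * (1 + |y.2| / L) ^ F
      ≤ (∏ i : Fin d, ((1 + G) * (1 + ‖y‖ / ρ)) ^ F) * ((1 + G) * (1 + ‖y‖ / ρ)) ^ F := by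
        have hL' : 0 < L := hρ.trans_le hL
        refine mul_le_mul (Finset.prod_le_prod (fun _ _ => by positivity) fun i _ => key i) key2
          (by positivity) (by positivity)
    _ = _ := by
        simp only [Finset.prod_const, Finset.card_univ, Fintype.card_fin]
        rw [← pow_mul, ← pow_add, mul_pow]; congr 2

lemma w_mul_br {E A : ℕ} (hA : A ≤ E) {R : ℝ} (hR : 0 < R) (y : V d) :
    ENNReal.ofReal ((1 + ‖y‖ / R) ^ A) * w E R y = w (E - A) R y := by
  unfold w
  rw [← ENNReal.ofReal_mul (by positivity)]
  congr 1
  have : 0 < 1 + ‖y‖ / R := by positivity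
  rw [mul_left_comm]
  congr 1
  obtain ⟨B, rfl⟩ := Nat.exists_eq_add_of_le hA
  rw [pow_add, mul_inv, ← mul_assoc, mul_inv_cancel₀ (by positivity), one_mul]
  simp

/-- (I3) -/
lemma W_cv_w {F E : ℕ} (hE : F * (d + 1) + d + 2 ≤ E) {g : Fin d → ℝ} {G : ℝ} (hG : 0 ≤ G)
    (hg : ∀ i, |g i| ≤ G) {ρ L : ℝ} (hρ : 0 < ρ) (hL : ρ ≤ L) (x : V d) :
    cv (W F g ρ L) (w E ρ) x ≤ (ENNReal.ofReal ((1 + G) ^ (F * (d + 1))) * Cw d) * W F g ρ L x := by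
  unfold cv
  calc ∫⁻ y, W F g ρ L (x - y) * w E ρ y
      ≤ ∫⁻ y, ENNReal.ofReal ((1 + G) ^ (F * (d + 1))) * W F g ρ L x *
          w (E - F * (d + 1)) ρ y := by
        apply lintegral_mono; intro y
        have := W_shift_norm F hG hg hρ hL x (-y)
        rw [norm_neg, ← sub_eq_add_neg] at this
        calc _ ≤ _ := mul_le_mul_left this _
          _ = _ := by
            dsimp only
            rw [← w_mul_br (by omega : F * (d + 1) ≤ E) hρ]; ring
    _ ≤ _ := by
        rw [lintegral_const_mul _ (by fun_prop)]
        calc _ ≤ ENNReal.ofReal ((1 + G) ^ (F * (d + 1))) * W F g ρ L x * Cw d := by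
              gcongr; exact lintegral_w (by omega) hρ
          _ = _ := by ring

lemma w_cv_w {F E : ℕ} (hE : F + d + 2 ≤ E) {ρ : ℝ} (hρ : 0 < ρ) (x : V d) :
    cv (w F ρ) (w E ρ) x ≤ Cw d * w F ρ x := by
  unfold cv
  calc ∫⁻ y, w F ρ (x - y) * w E ρ y
      ≤ ∫⁻ y, w F ρ x * w (E - F) ρ y := by
        apply lintegral_mono; intro y
        have := w_shift F hρ x (-y)
        rw [norm_neg, ← sub_eq_add_neg] at this
        calc _ ≤ _ := mul_le_mul_left this _
          _ = _ := by
            dsimp only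
            rw [← w_mul_br (by omega : F ≤ E) hρ]; ring
    _ ≤ _ := by
        rw [lintegral_const_mul _ (by fun_prop), mul_comm]
        gcongr; exact lintegral_w (by omega) hρ

/-- (I5) -/
lemma W_le_w (F : ℕ) {g : Fin d → ℝ} {G : ℝ} (hG : 0 ≤ G) (hg : ∀ i, |g i| ≤ G) {R : ℝ}
    (hR : 0 < R) (x : V d) :
    W F g R R x ≤ ENNReal.ofReal ((1 + G) ^ F) * w F R x := by
  unfold W w v vr
  rw [← ENNReal.ofReal_prod_of_nonneg (fun _ _ => by positivity), ← ENNReal.ofReal_mul (by positivity),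
    ← ENNReal.ofReal_mul (by positivity)]
  apply ENNReal.ofReal_le_ofReal
  rw [Finset.prod_mul_distrib]
  simp only [Finset.prod_const, Finset.card_univ, Fintype.card_fin]
  rw [Finset.prod_inv_distrib, Finset.prod_pow]
  set P := ∏ i, (1 + |x.1 i + g i * x.2| / R) with hP
  have hP1 : 1 ≤ P := Finset.prod_induction _ (fun a => (1 : ℝ) ≤ a)
    (fun a b ha hb => by nlinarith) le_rfl (fun i _ => one_le_br _ hR)
  have hPi : ∀ i, 1 + |x.1 i + g i * x.2| / R ≤ P := by
    intro i
    rw [hP, ← Finset.mul_prod_erase _ _ (Finset.mem_univ i)]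
    have : (1 : ℝ) ≤ ∏ i ∈ Finset.univ.erase i, (1 + |x.1 i + g i * x.2| / R) :=
      Finset.prod_induction _ (fun a => (1 : ℝ) ≤ a)
        (fun a b ha hb => by nlinarith) le_rfl (fun i _ => one_le_br _ hR)
    have h0 := one_le_br (x.1 i + g i * x.2) hR
    nlinarith
  set t := 1 + |x.2| / R with ht
  have ht1 : 1 ≤ t := one_le_br _ hR
  have hmain : 1 + ‖x‖ / R ≤ (1 + G) * (P * t) := by
    have hx : ‖x‖ ≤ ((1 + G) * (P * t) - 1) * R := by
      have hPt : 1 ≤ P * t := by nlinarith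
      have h0 : 0 ≤ ((1 + G) * (P * t) - 1) * R := by
        apply mul_nonneg _ hR.le; nlinarith
      rw [norm_prod_le_iff]
      constructor
      · rw [pi_norm_le_iff_of_nonneg h0]
        intro i
        have h1 : |x.1 i| ≤ |x.1 i + g i * x.2| + G * |x.2| := by
          calc |x.1 i| = |(x.1 i + g i * x.2) + (-(g i * x.2))| := by ring_nf
            _ ≤ |x.1 i + g i * x.2| + |-(g i * x.2)| := abs_add_le _ _
            _ ≤ _ := by rw [abs_neg, abs_mul]; gcongr; exact hg i
        have h2 : |x.1 i + g i * x.2| ≤ (P - 1) * R := by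
          have := hPi i
          rw [← div_le_iff₀ hR]; linarith
        have h3 : |x.2| = (t - 1) * R := by rw [ht]; field_simp; ring
        rw [Real.norm_eq_abs]
        calc |x.1 i| ≤ (P - 1) * R + G * ((t - 1) * R) := by rw [← h3]; linarith
          _ = (P - 1 + G * (t - 1)) * R := by ring
          _ ≤ _ := by
            gcongr
            nlinarith [mul_nonneg (sub_nonneg.2 hP1) (sub_nonneg.2 ht1),
              mul_nonneg hG (mul_nonneg (sub_nonneg.2 hP1) (by linarith : (0:ℝ) ≤ t))]
      · rw [Real.norm_eq_abs]
        have h3 : |x.2| = (t - 1) * R := by rw [ht]; field_simp; ring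
        rw [h3]
        gcongr
        nlinarith [mul_nonneg (sub_nonneg.2 hP1) (sub_nonneg.2 ht1),
              mul_nonneg hG (by positivity : (0:ℝ) ≤ P * t)]
    rw [← div_le_iff₀ hR] at hx
    linarith
  have hpos : 0 < 1 + ‖x‖ / R := by positivity
  have h5 : (P ^ F)⁻¹ * (t ^ F)⁻¹ ≤ (1 + G) ^ F * ((1 + ‖x‖ / R) ^ F)⁻¹ := by
    rw [← mul_inv, ← div_eq_mul_inv, le_div_iff₀ (by positivity), inv_mul_le_iff₀ (by positivity),
      ← mul_pow, ← mul_pow]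
    gcongr
    linarith
  calc R⁻¹ ^ d * (P ^ F)⁻¹ * (R⁻¹ * (t ^ F)⁻¹)
      = (R ^ (d + 1))⁻¹ * ((P ^ F)⁻¹ * (t ^ F)⁻¹) := by
        rw [pow_succ, mul_inv, inv_pow]; ring
    _ ≤ (R ^ (d + 1))⁻¹ * ((1 + G) ^ F * ((1 + ‖x‖ / R) ^ F)⁻¹) := by gcongr
    _ = _ := by ring

end DR

namespace DR
open Filter Topology
open scoped ENNReal NNReal

/-! ### Reproducing kernels on `V d` -/

variable {d : ℕ}

lemma integrable_shear {k : Fin d → ℝ → ℂ} (hk : ∀ i, Integrable (k i)) (hkm : ∀ i, Measurable (k i))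
    {l : ℝ → ℂ} (hl : Integrable l) (hlm : Measurable l) (g : Fin d → ℝ) :
    Integrable (fun x : V d => (∏ i, k i (x.1 i + g i * x.2)) * l x.2) := by
  refine ⟨Measurable.aestronglyMeasurable (by fun_prop), ?_⟩
  unfold HasFiniteIntegral
  have : ∀ a : V d, ‖(∏ i, k i (a.1 i + g i * a.2)) * l a.2‖ₑ
      = (∏ i, ‖k i (a.1 i + g i * a.2)‖ₑ) * ‖l a.2‖ₑ := by
    intro a
    rw [enorm_mul, ← ofReal_norm (∏ i, _), norm_prod,
      ENNReal.ofReal_prod_of_nonneg (fun _ _ => norm_nonneg _)]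
    simp only [ofReal_norm]
  simp only [this]
  rw [lintegral_shear (f := fun i s => ‖k i s‖ₑ) (h := fun s => ‖l s‖ₑ) (fun i => (hkm i).enorm)
    hlm.enorm]
  refine ENNReal.mul_lt_top (ENNReal.prod_lt_top fun i _ => (hk i).2) hl.2

lemma integral_shear {k : Fin d → ℝ → ℂ} (hk : ∀ i, Integrable (k i)) (hkm : ∀ i, Measurable (k i))
    {l : ℝ → ℂ} (hl : Integrable l) (hlm : Measurable l) (g : Fin d → ℝ) :
    ∫ x : V d, (∏ i, k i (x.1 i + g i * x.2)) * l x.2 = (∏ i, ∫ s, k i s) * ∫ s, l s := by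
  have hI := integrable_shear hk hkm hl hlm g
  rw [Measure.volume_eq_prod] at hI ⊢
  rw [integral_prod_symm _ hI]
  have : ∀ t : ℝ, ∫ y : Fin d → ℝ, (∏ i, k i (y i + g i * t)) * l t
      = (∏ i, ∫ s, k i s) * l t := by
    intro t
    rw [integral_mul_const, ← integral_fintype_prod_volume_eq_prod]
    congr 1
    exact integral_add_right_eq_self (fun y : Fin d → ℝ => ∏ i, k i (y i)) (fun i => g i * t)
  simp only [this]
  rw [integral_const_mul]

/-- `L¹`-normalised dilation -/
def sc (ρ : ℝ) (ψ : ℝ → ℂ) (u : ℝ) : ℂ := (ρ⁻¹ : ℝ) * ψ (u / ρ)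

lemma sc_cont {ψ : ℝ → ℂ} (h : Continuous ψ) (ρ : ℝ) : Continuous (sc ρ ψ) := by
  unfold sc; fun_prop

lemma sc_fourier (ψ : ℝ → ℂ) {ρ : ℝ} (hρ : 0 < ρ) (θ : ℝ) :
    ∫ u, ee (-(θ * u)) * sc ρ ψ u = ∫ s, ee (-(θ * ρ * s)) * ψ s := by
  have := Measure.integral_comp_div (fun s => ee (-(θ * ρ * s)) * ψ s) ρ
  rw [abs_of_pos hρ] at this
  have h2 : ∫ s, ee (-(θ * ρ * s)) * ψ s = ρ⁻¹ • ∫ u, ee (-(θ * ρ * (u / ρ))) * ψ (u / ρ) := by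
    rw [this, smul_smul, inv_mul_cancel₀ hρ.ne', one_smul]
  rw [h2, ← integral_smul]
  congr 1; ext u
  have : θ * ρ * (u / ρ) = θ * u := by field_simp
  rw [this]
  simp only [sc, Complex.real_smul]; ring

lemma sc_le {ψ : ℝ → ℂ} {F : ℕ} {C : ℝ} (hC : 0 ≤ C) (h : ∀ s, ‖ψ s‖ ≤ C * ((1 + |s|) ^ F)⁻¹)
    {ρ : ℝ} (hρ : 0 < ρ) (u : ℝ) : ‖sc ρ ψ u‖ₑ ≤ ENNReal.ofReal C * v F ρ u := by
  rw [← ofReal_norm, v, ← ENNReal.ofReal_mul hC]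
  apply ENNReal.ofReal_le_ofReal
  unfold sc vr
  rw [norm_mul, Complex.norm_real, Real.norm_eq_abs, abs_of_pos (by positivity)]
  have := h (u / ρ)
  rw [abs_div, abs_of_pos hρ] at this
  calc ρ⁻¹ * ‖ψ (u / ρ)‖ ≤ ρ⁻¹ * (C * ((1 + |u| / ρ) ^ F)⁻¹) := by gcongr
    _ = _ := by ring

lemma sc_integrable {ψ : ℝ → ℂ} (hψ : Continuous ψ) {C : ℝ} (hC : 0 ≤ C)
    (h : ∀ s, ‖ψ s‖ ≤ C * ((1 + |s|) ^ 2)⁻¹)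
    {ρ : ℝ} (hρ : 0 < ρ) : Integrable (sc ρ ψ) := by
  refine ⟨(sc_cont hψ ρ).aestronglyMeasurable, ?_⟩
  refine lt_of_le_of_lt (lintegral_mono fun u => sc_le hC h hρ u) ?_
  rw [lintegral_const_mul _ (by fun_prop)]
  exact ENNReal.mul_lt_top ENNReal.ofReal_lt_top
    (lt_of_le_of_lt (lintegral_v le_rfl hρ) Cv_lt_top)

lemma ee_mul_integrable {f : ℝ → ℂ} (hf : Integrable f) (θ : ℝ) :
    Integrable (fun s => ee (-(θ * s)) * f s) :=
  hf.bdd_mul (c := 1) (Measurable.aestronglyMeasurable (by fun_prop)) (ae_of_all _ fun y => by simp)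

/-- The sheared product kernel. -/
def ker (ψ : ℝ → ℂ) (g : Fin d → ℝ) (ρ L : ℝ) (y : V d) : ℂ :=
  (∏ i, sc ρ ψ (y.1 i + g i * y.2)) * sc L ψ y.2

lemma ker_le {ψ : ℝ → ℂ} {F : ℕ} {C : ℝ} (hC : 0 ≤ C) (h : ∀ s, ‖ψ s‖ ≤ C * ((1 + |s|) ^ F)⁻¹)
    (g : Fin d → ℝ) {ρ L : ℝ} (hρ : 0 < ρ) (hL : 0 < L) (y : V d) :
    ‖ker ψ g ρ L y‖ₑ ≤ ENNReal.ofReal C ^ (d + 1) * W F g ρ L y := by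
  unfold ker W
  simp only [enorm_mul]
  rw [← ofReal_norm, norm_prod, ENNReal.ofReal_prod_of_nonneg (fun _ _ => norm_nonneg _)]
  simp only [ofReal_norm]
  calc _ ≤ (∏ i, (ENNReal.ofReal C * v F ρ (y.1 i + g i * y.2))) * (ENNReal.ofReal C * v F L y.2) := by
        gcongr
        · exact sc_le hC h hρ _
        · exact sc_le hC h hL _
    _ = _ := by
        rw [Finset.prod_mul_distrib]
        simp only [Finset.prod_const, Finset.card_univ, Fintype.card_fin]
        ring

lemma ker_cont {ψ : ℝ → ℂ} (hψ : Continuous ψ) (g : Fin d → ℝ) (ρ L : ℝ) :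
    Continuous (ker ψ g ρ L) := by
  have h1 := sc_cont hψ ρ
  have h2 := sc_cont hψ L
  unfold ker; fun_prop

lemma ker_integrable {ψ : ℝ → ℂ} (hψ : Continuous ψ) {C : ℝ} (hC : 0 ≤ C)
    (h : ∀ s, ‖ψ s‖ ≤ C * ((1 + |s|) ^ 2)⁻¹) (g : Fin d → ℝ) {ρ L : ℝ} (hρ : 0 < ρ) (hL : 0 < L) :
    Integrable (ker ψ g ρ L) :=
  integrable_shear (fun _ => sc_integrable hψ hC h hρ) (fun _ => (sc_cont hψ ρ).measurable)
    (sc_integrable hψ hC h hL) (sc_cont hψ L).measurable g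

lemma ker_fourier {ψ : ℝ → ℂ} (hψ : Continuous ψ) {C : ℝ} (hC : 0 ≤ C)
    (h : ∀ s, ‖ψ s‖ ≤ C * ((1 + |s|) ^ 2)⁻¹) (g : Fin d → ℝ) {ρ L : ℝ} (hρ : 0 < ρ) (hL : 0 < L)
    (ξ : V d) :
    ∫ y, ee (- pr ξ y) * ker ψ g ρ L y =
      (∏ i, ∫ s, ee (-(ξ.1 i * ρ * s)) * ψ s) *
        ∫ s, ee (-((ξ.2 - ∑ i, g i * ξ.1 i) * L * s)) * ψ s := by
  have := integral_shear (k := fun i s => ee (-(ξ.1 i * s)) * sc ρ ψ s)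
    (l := fun s => ee (-((ξ.2 - ∑ i, g i * ξ.1 i) * s)) * sc L ψ s)
    (fun i => ee_mul_integrable (sc_integrable hψ hC h hρ) _)
    (fun i => by have := (sc_cont hψ ρ).measurable; fun_prop)
    (ee_mul_integrable (sc_integrable hψ hC h hL) _)
    (by have := (sc_cont hψ L).measurable; fun_prop) g
  simp only [sc_fourier _ hρ, sc_fourier _ hL] at this
  rw [← this]
  congr 1; ext y
  unfold ker
  have hprod : ∏ i, ee (-(ξ.1 i * (y.1 i + g i * y.2)))
      = ee (∑ i, -(ξ.1 i * (y.1 i + g i * y.2))) := by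
    induction (Finset.univ : Finset (Fin d)) using Finset.induction_on with
    | empty => simp
    | insert a s ha ih => rw [Finset.prod_insert ha, Finset.sum_insert ha, ee_add, ih]
  rw [Finset.prod_mul_distrib, hprod]
  have : ee (-pr ξ y) = ee (∑ i, -(ξ.1 i * (y.1 i + g i * y.2))) *
      ee (-((ξ.2 - ∑ i, g i * ξ.1 i) * y.2)) := by
    rw [← ee_add]; congr 1
    unfold pr
    simp only [mul_add, neg_add, Finset.sum_add_distrib, sub_mul, Finset.sum_mul,
      Finset.sum_neg_distrib]
    have : ∑ i, ξ.1 i * (g i * y.2) = ∑ i, g i * ξ.1 i * y.2 := by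
      congr 1; ext i; ring
    rw [this]; ring
  rw [this]; ring

/-- Frequencies in a parallelepiped: local constancy. -/
lemma L1 (d F : ℕ) (hF : 2 ≤ F) (A : ℝ) (hA : 0 < A) (q : ℝ) (hq : 1 ≤ q) :
    ∃ C : ℝ≥0, ∀ (S : Set (V d)) (f : V d → ℂ), FS S f → ∀ (c : Fin d → ℝ) (h : ℝ) (g : Fin d → ℝ)
      (ρ L : ℝ), 0 < ρ → 0 < L →
      (∀ ξ ∈ S, (∀ i, |ξ.1 i - c i| ≤ A / ρ) ∧ |ξ.2 - h - ∑ i, g i * (ξ.1 i - c i)| ≤ A / L) →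
      ∀ x, ‖f x‖ₑ ^ q ≤ C * cv (fun y => ‖f y‖ₑ ^ q) (W F g ρ L) x := by
  obtain ⟨ψ, hψc, hψd, hψ1⟩ := exists_psi A hA
  obtain ⟨C2, hC2, h2⟩ := hψd 2
  obtain ⟨CF, hCF, hF'⟩ := hψd F
  have hq0 : 0 < q := by linarith
  set D : ℝ≥0∞ := (ENNReal.ofReal CF ^ (d + 1)) ^ q * ((Cv ^ (d + 1)) ^ (1 - 1 / q)) ^ q with hD
  have h1q : 0 ≤ 1 - 1 / q := by rw [sub_nonneg, div_le_one hq0]; exact hq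
  have hDtop : D ≠ ∞ := by
    apply ENNReal.mul_ne_top
    · exact ENNReal.rpow_ne_top_of_nonneg hq0.le (ENNReal.pow_ne_top ENNReal.ofReal_ne_top)
    · exact ENNReal.rpow_ne_top_of_nonneg hq0.le (ENNReal.rpow_ne_top_of_nonneg h1q
        (ENNReal.pow_ne_top Cv_lt_top.ne))
  refine ⟨D.toNNReal, ?_⟩
  intro S f hf c h g ρ L hρ hL hS x
  rw [ENNReal.coe_toNNReal hDtop]
  set b : V d := (c, h) with hb
  set K : V d → ℂ := fun y => ee (pr b y) * ker ψ g ρ L y with hK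
  have hKi : Integrable K :=
    (ker_integrable hψc hC2.le h2 g hρ hL).bdd_mul (c := 1)
      (Measurable.aestronglyMeasurable (by fun_prop)) (ae_of_all _ fun y => by simp)
  have hrep := hf.conv hKi 1 (by
    intro ξ hξ
    have := ker_fourier hψc hC2.le h2 g hρ hL (ξ - b)
    have e1 : ∫ y, ee (-pr ξ y) * K y = ∫ y, ee (-pr (ξ - b) y) * ker ψ g ρ L y := by
      congr 1; ext y
      rw [hK]
      simp only
      rw [← mul_assoc, ← ee_add, pr_sub_left]; congr 2; ring
    rw [e1, this]
    obtain ⟨ha, hb'⟩ := hS ξ hξ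
    rw [Finset.prod_eq_one, one_mul]
    · apply hψ1
      rw [abs_mul, abs_of_pos hL]
      rw [le_div_iff₀ hL] at hb'
      simpa [hb] using hb'
    · intro i _
      apply hψ1
      have := ha i
      rw [abs_mul, abs_of_pos hρ]
      rw [le_div_iff₀ hρ] at this
      simpa [hb] using this) x
  rw [one_mul] at hrep
  have hfm := hf.meas
  have hstep : ‖f x‖ₑ ≤ ENNReal.ofReal CF ^ (d + 1) * cv (fun y => ‖f y‖ₑ) (W F g ρ L) x := by
    calc ‖f x‖ₑ = ‖∫ y, f (x - y) * K y‖ₑ := by rw [hrep]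
      _ ≤ ∫⁻ y, ‖f (x - y) * K y‖ₑ := enorm_integral_le_lintegral_enorm _
      _ ≤ ∫⁻ y, ENNReal.ofReal CF ^ (d + 1) * (‖f (x - y)‖ₑ * W F g ρ L y) := by
          apply lintegral_mono; intro y
          simp only
          rw [enorm_mul, mul_left_comm]
          gcongr
          rw [hK]
          simp only [enorm_mul]
          have : ‖ee (pr b y)‖ₑ = 1 := by rw [← ofReal_norm]; simp
          rw [this, one_mul]
          exact ker_le hCF.le hF' g hρ hL y
      _ = _ := by rw [lintegral_const_mul _ (by fun_prop)]; rfl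
  have hj := cv_jensen hq hfm.enorm (meas_W F g ρ L) x
  calc ‖f x‖ₑ ^ q ≤ (ENNReal.ofReal CF ^ (d + 1) *
        (cv (fun y => ‖f y‖ₑ ^ q) (W F g ρ L) x ^ (1 / q) * (Cv ^ (d + 1)) ^ (1 - 1 / q))) ^ q := by
        gcongr
        refine hstep.trans ?_
        gcongr
        refine hj.trans ?_
        gcongr
        exact lintegral_W hF g hρ hL
    _ = _ := by
        rw [ENNReal.mul_rpow_of_nonneg _ _ hq0.le, ENNReal.mul_rpow_of_nonneg _ _ hq0.le,
          rpow_inv_rpow' _ hq0.ne', hD]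
        ring

end DR

namespace DR
open Filter Topology
open scoped ENNReal NNReal

/-! ### Local `L²` orthogonality -/

variable {d : ℕ}

/-- Sup-norm closeness of lattice points. -/
def near (A : ℕ) (J J' : Fin d → ℤ) : Prop := ∀ i, |J i - J' i| ≤ (A : ℤ)

instance (A : ℕ) (J J' : Fin d → ℤ) : Decidable (near A J J') := by unfold near; infer_instance

lemma near_symm {A : ℕ} {J J' : Fin d → ℤ} (h : near A J J') : near A J' J := fun i => by
  rw [abs_sub_comm]; exact h i

lemma card_near (A : ℕ) (T : Finset (Fin d → ℤ)) (J : Fin d → ℤ) :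
    (T.filter (fun J' => near A J J')).card ≤ (2 * A + 1) ^ d := by
  have : T.filter (fun J' => near A J J') ⊆
      Fintype.piFinset (fun i => Finset.Icc (J i - A) (J i + A)) := by
    intro J' h
    simp only [Finset.mem_filter] at h
    simp only [Fintype.mem_piFinset, Finset.mem_Icc]
    intro i
    have := abs_le.1 (h.2 i)
    constructor <;> linarith [this.1, this.2]
  refine (Finset.card_le_card this).trans ?_
  rw [Fintype.card_piFinset]
  have : ∀ i, (Finset.Icc (J i - (A : ℤ)) (J i + A)).card = 2 * A + 1 := by
    intro i; rw [Int.card_Icc]; omega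
  simp [this]

lemma sum_near {A : ℕ} {T : Finset (Fin d → ℤ)} {I : (Fin d → ℤ) → ℝ} (hI : ∀ J, 0 ≤ I J) :
    ∑ J ∈ T, ∑ J' ∈ T, (if near A J J' then (I J + I J') / 2 else 0)
      ≤ ((2 * A + 1) ^ d : ℕ) * ∑ J ∈ T, I J := by
  have h1 : ∀ J ∈ T, ∑ J' ∈ T, (if near A J J' then I J / 2 else 0)
      ≤ ((2 * A + 1) ^ d : ℕ) * (I J / 2) := by
    intro J _
    rw [← Finset.sum_filter, Finset.sum_const, nsmul_eq_mul]
    have := hI J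
    gcongr
    exact card_near A T J
  have h2 : ∑ J ∈ T, ∑ J' ∈ T, (if near A J J' then I J' / 2 else 0)
      = ∑ J ∈ T, ∑ J' ∈ T, (if near A J J' then I J / 2 else 0) := by
    rw [Finset.sum_comm]
    refine Finset.sum_congr rfl fun J _ => Finset.sum_congr rfl fun J' _ => ?_
    have : near A J' J ↔ near A J J' := ⟨near_symm, near_symm⟩
    simp [this]
  have h3 : ∑ J ∈ T, ∑ J' ∈ T, (if near A J J' then (I J + I J') / 2 else 0)
      = ∑ J ∈ T, ∑ J' ∈ T, (if near A J J' then I J / 2 else 0)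
        + ∑ J ∈ T, ∑ J' ∈ T, (if near A J J' then I J' / 2 else 0) := by
    simp only [← Finset.sum_add_distrib]
    refine Finset.sum_congr rfl fun J _ => Finset.sum_congr rfl fun J' _ => ?_
    split_ifs <;> ring
  rw [h3, h2]
  have := Finset.sum_le_sum h1
  rw [← Finset.mul_sum] at this
  have e : ∑ J ∈ T, I J / 2 = (∑ J ∈ T, I J) / 2 := by rw [Finset.sum_div]
  rw [e] at this
  linarith

lemma L2_core {φ : ℝ → ℝ} (hφc : Continuous φ) (hφ0 : ∀ s, 0 ≤ φ s) {Γ : ℝ} (hΓ : 0 < Γ)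
    {C : ℝ} (hC : 0 ≤ C) (hφ2 : ∀ s, φ s ≤ C * ((1 + |s|) ^ 2)⁻¹)
    (hφΓ : ∀ θ : ℝ, Γ ≤ |θ| → ∫ s, ee (-(θ * s)) * (φ s : ℂ) = 0)
    {A : ℕ} (hA : Γ + 4 ≤ A) {R r : ℝ} (hr : 0 < r) (hRr : 1 ≤ R * r)
    (T : Finset (Fin d → ℤ)) (f : (Fin d → ℤ) → V d → ℂ)
    (hf : ∀ J ∈ T, FS {ξ : V d | ∀ i, |ξ.1 i - J i * r| ≤ 2 * r} (f J)) (x : V d) :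
    cv (fun y => ‖∑ J ∈ T, f J y‖ₑ ^ (2 : ℝ)) (fun y => ‖ker (d := d) (fun s => (φ s : ℂ)) 0 R R y‖ₑ) x
      ≤ ((2 * A + 1) ^ d : ℕ) * ∑ J ∈ T, cv (fun y => ‖f J y‖ₑ ^ (2 : ℝ))
        (fun y => ‖ker (d := d) (fun s => (φ s : ℂ)) 0 R R y‖ₑ) x := by
  classical
  have hR : 0 < R := by
    by_contra h
    push Not at h
    have : R * r ≤ 0 := mul_nonpos_of_nonpos_of_nonneg h hr.le
    linarith
  have hφc' : Continuous (fun s => (φ s : ℂ)) := by fun_prop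
  have hφ2' : ∀ s, ‖(φ s : ℂ)‖ ≤ C * ((1 + |s|) ^ 2)⁻¹ := by
    intro s; rw [Complex.norm_real, Real.norm_eq_abs, abs_of_nonneg (hφ0 s)]; exact hφ2 s
  set K : V d → ℂ := ker (d := d) (fun s => (φ s : ℂ)) 0 R R with hK
  have hKi : Integrable K := ker_integrable hφc' hC hφ2' 0 hR hR
  set k : V d → ℝ := fun y => ‖K y‖ with hk
  have hKk : ∀ y, K y = (k y : ℂ) := by
    intro y
    have h0 : ∀ u, sc R (fun s => (φ s : ℂ)) u = ((R⁻¹ * φ (u / R) : ℝ) : ℂ) := by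
      intro u; unfold sc; push_cast; ring
    have : K y = (((∏ i, (R⁻¹ * φ ((y.1 i + (0 : Fin d → ℝ) i * y.2) / R))) *
        (R⁻¹ * φ (y.2 / R)) : ℝ) : ℂ) := by
      rw [hK]; unfold ker
      simp only [h0]; push_cast; rfl
    rw [hk]
    simp only
    rw [this, Complex.norm_real, Real.norm_eq_abs, abs_of_nonneg]
    have := hφ0
    refine mul_nonneg (Finset.prod_nonneg fun i _ => mul_nonneg (by positivity) (hφ0 _))
      (mul_nonneg (by positivity) (hφ0 _))
  have hkK : ∀ y, k y = ‖K y‖ := fun _ => rfl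
  have hk0 : ∀ y, 0 ≤ k y := fun _ => norm_nonneg _
  have hki : Integrable k := hKi.norm
  -- integrability
  have hinteg : ∀ J ∈ T, ∀ J' ∈ T, Integrable (fun y => ‖f J (x - y)‖ * ‖f J' (x - y)‖ * k y) := by
    intro J hJ J' hJ'
    obtain ⟨B, hB0, hB⟩ := (hf J hJ).bdd
    obtain ⟨B', hB0', hB'⟩ := (hf J' hJ').bdd
    have m1 := (hf J hJ).meas
    have m2 := (hf J' hJ').meas
    refine hki.bdd_mul (c := B * B') (Measurable.aestronglyMeasurable (by fun_prop))
      (ae_of_all _ fun y => ?_)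
    rw [norm_mul, norm_norm, norm_norm]
    exact mul_le_mul (hB _) (hB' _) (norm_nonneg _) hB0
  have hintc : ∀ J ∈ T, ∀ J' ∈ T,
      Integrable (fun y => f J (x - y) * (starRingEnd ℂ) (f J' (x - y)) * K y) := by
    intro J hJ J' hJ'
    have m1 := (hf J hJ).meas
    have m2 := (hf J' hJ').meas
    have m3 : Measurable K := (ker_cont hφc' 0 R R).measurable
    refine (hinteg J hJ J' hJ').mono' (Measurable.aestronglyMeasurable ?_) (ae_of_all _ fun y => ?_)
    · have : Measurable (fun y => (starRingEnd ℂ) (f J' (x - y))) :=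
        Complex.continuous_conj.measurable.comp (by fun_prop)
      fun_prop
    · simp [hkK]
  set I : (Fin d → ℤ) → ℝ := fun J => ∫ y, ‖f J (x - y)‖ * ‖f J (x - y)‖ * k y with hI
  have hI0 : ∀ J, 0 ≤ I J := fun J => integral_nonneg fun y => by
    have := hk0 y
    dsimp only
    positivity
  -- far pairs
  have hfar : ∀ J ∈ T, ∀ J' ∈ T, ¬ near A J J' →
      ∫ y, f J (x - y) * (starRingEnd ℂ) (f J' (x - y)) * K y = 0 := by
    intro J hJ J' hJ' hn
    unfold near at hn
    push Not at hn
    obtain ⟨i, hi⟩ := hn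
    have h1 := (hf J' hJ').conj (T := {ξ | -ξ ∈ {ξ : V d | ∀ i, |ξ.1 i - J' i * r| ≤ 2 * r}})
      (by intro ξ hξ; simpa using hξ)
    have h2 := (hf J hJ).mul h1 (U := {ξ : V d | Γ * r ≤ |ξ.1 i|}) (by
      intro ξ hξ η hη
      simp only [Set.mem_ofPred_eq] at hξ hη ⊢
      have a1 := hξ i
      have a2 := hη i
      simp only [Prod.fst_neg, Pi.neg_apply, Prod.fst_add, Pi.add_apply] at a2 ⊢
      have hi' : (A : ℝ) < |(J i : ℝ) - J' i| := by exact_mod_cast hi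
      have : |((J i : ℝ) - J' i) * r| = |(J i : ℝ) - J' i| * r := by
        rw [abs_mul, abs_of_pos hr]
      have h3 : (Γ + 4) * r ≤ |(J i : ℝ) - J' i| * r := by gcongr; linarith
      rw [← this] at h3
      have h4 : ((J i : ℝ) - J' i) * r = (ξ.1 i + η.1 i) - (ξ.1 i - J i * r) + (-η.1 i - J' i * r) := by
        ring
      have h5 : |((J i : ℝ) - J' i) * r| ≤ |ξ.1 i + η.1 i| + |ξ.1 i - J i * r| + |-η.1 i - J' i * r| := by
        rw [h4]
        exact (abs_add_le _ _).trans (add_le_add (abs_sub _ _) le_rfl)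
      linarith)
    have h3 := h2.conv hKi 0 (by
      intro ξ hξ
      simp only [Set.mem_ofPred_eq] at hξ
      rw [hK, ker_fourier hφc' hC hφ2' 0 hR hR, Finset.prod_eq_zero (Finset.mem_univ i), zero_mul]
      apply hφΓ
      rw [abs_mul, abs_of_pos hR]
      calc Γ = Γ * 1 := (mul_one _).symm
        _ ≤ Γ * (R * r) := by gcongr
        _ = Γ * r * R := by ring
        _ ≤ |ξ.1 i| * R := by gcongr) x
    rw [zero_mul] at h3
    exact h3
  have hpair : ∀ J ∈ T, ∀ J' ∈ T,
      ‖∫ y, f J (x - y) * (starRingEnd ℂ) (f J' (x - y)) * K y‖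
        ≤ if near A J J' then (I J + I J') / 2 else 0 := by
    intro J hJ J' hJ'
    split_ifs with hn
    · calc ‖∫ y, f J (x - y) * (starRingEnd ℂ) (f J' (x - y)) * K y‖
          ≤ ∫ y, ‖f J (x - y) * (starRingEnd ℂ) (f J' (x - y)) * K y‖ :=
            norm_integral_le_integral_norm _
        _ ≤ ∫ y, (‖f J (x - y)‖ * ‖f J (x - y)‖ * k y + ‖f J' (x - y)‖ * ‖f J' (x - y)‖ * k y) / 2 := by
            refine integral_mono (hintc J hJ J' hJ').norm
              (((hinteg J hJ J hJ).add (hinteg J' hJ' J' hJ')).div_const 2) fun y => ?_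
            simp only [norm_mul, RCLike.norm_conj]
            rw [← hkK]
            nlinarith [mul_nonneg (sq_nonneg (‖f J (x - y)‖ - ‖f J' (x - y)‖)) (hk0 y)]
        _ = (I J + I J') / 2 := by
            rw [integral_div, integral_add (hinteg J hJ J hJ) (hinteg J' hJ' J' hJ')]
    · rw [hfar J hJ J' hJ' hn]; simp
  have hexp : ((∫ y, ‖∑ J ∈ T, f J (x - y)‖ * ‖∑ J ∈ T, f J (x - y)‖ * k y : ℝ) : ℂ)
      = ∑ J ∈ T, ∑ J' ∈ T, ∫ y, f J (x - y) * (starRingEnd ℂ) (f J' (x - y)) * K y := by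
    have : ∀ J ∈ T, ∑ J' ∈ T, ∫ y, f J (x - y) * (starRingEnd ℂ) (f J' (x - y)) * K y
        = ∫ y, ∑ J' ∈ T, f J (x - y) * (starRingEnd ℂ) (f J' (x - y)) * K y := fun J hJ =>
      (integral_finsetSum _ fun J' hJ' => hintc J hJ J' hJ').symm
    rw [Finset.sum_congr rfl this, ← integral_finsetSum _
      (fun J hJ => integrable_finsetSum _ fun J' hJ' => hintc J hJ J' hJ'), ← integral_complex_ofReal]
    congr 1; ext y
    rw [hKk]
    push_cast
    rw [← Complex.ofReal_mul, ← sq, ← Complex.normSq_eq_norm_sq, ← Complex.mul_conj, map_sum,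
      Finset.sum_mul_sum]
    simp only [Finset.sum_mul]
  have hreal : ∫ y, ‖∑ J ∈ T, f J (x - y)‖ * ‖∑ J ∈ T, f J (x - y)‖ * k y
      ≤ ((2 * A + 1) ^ d : ℕ) * ∑ J ∈ T, I J := by
    refine le_trans ?_ (sum_near (A := A) hI0)
    refine le_trans (le_abs_self _) ?_
    rw [← Real.norm_eq_abs, ← Complex.norm_real, hexp]
    refine (norm_sum_le _ _).trans (Finset.sum_le_sum fun J hJ => ?_)
    exact (norm_sum_le _ _).trans (Finset.sum_le_sum fun J' hJ' => hpair J hJ J' hJ')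
  have hcv : ∀ g : V d → ℂ, Measurable g → (∃ B : ℝ, 0 ≤ B ∧ ∀ x, ‖g x‖ ≤ B) →
      cv (fun y => ‖g y‖ₑ ^ (2 : ℝ)) (fun y => ‖K y‖ₑ) x
        = ENNReal.ofReal (∫ y, ‖g (x - y)‖ * ‖g (x - y)‖ * k y) := by
    rintro g hg ⟨B, hB0, hB⟩
    rw [ofReal_integral_eq_lintegral_ofReal]
    · unfold cv
      congr 1; ext y
      rw [ENNReal.ofReal_mul (by positivity), ENNReal.ofReal_mul (by positivity), ofReal_norm,
        hkK, ofReal_norm]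
      dsimp only
      rw [ENNReal.rpow_two, sq]
    · refine hki.bdd_mul (c := B * B) (Measurable.aestronglyMeasurable (by fun_prop))
        (ae_of_all _ fun y => ?_)
      rw [norm_mul, norm_norm]
      exact mul_le_mul (hB _) (hB _) (norm_nonneg _) hB0
    · exact ae_of_all _ fun y => by
        have := hk0 y
        dsimp only [Pi.zero_apply]
        positivity
  have hsum : FS Set.univ (fun y => ∑ J ∈ T, f J y) :=
    FS.sum fun J hJ => (hf J hJ).mono (Set.subset_univ _)
  rw [hcv _ hsum.meas hsum.bdd, Finset.sum_congr rfl fun J hJ => hcv _ (hf J hJ).meas (hf J hJ).bdd,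
    ← ENNReal.ofReal_sum_of_nonneg (fun J _ => hI0 J), ← ENNReal.ofReal_natCast,
    ← ENNReal.ofReal_mul (by positivity)]
  exact ENNReal.ofReal_le_ofReal hreal

lemma ker_phi_lower {φ : ℝ → ℝ} (hφ0 : ∀ s, 0 ≤ φ s) {c : ℝ} (hc : 0 < c)
    (hφ : ∀ s, |s| ≤ 1 → c ≤ φ s) {R : ℝ} (hR : 0 < R) {y : V d} (hy : ‖y‖ ≤ R) :
    ENNReal.ofReal ((R ^ (d + 1))⁻¹ * c ^ (d + 1))
      ≤ ‖ker (d := d) (fun s => (φ s : ℂ)) 0 R R y‖ₑ := by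
  rw [← ofReal_norm]
  apply ENNReal.ofReal_le_ofReal
  unfold ker sc
  rw [norm_mul, norm_prod]
  have h : ∀ u : ℝ, |u| ≤ R → R⁻¹ * c ≤ ‖((R⁻¹ : ℝ) : ℂ) * (φ (u / R) : ℂ)‖ := by
    intro u hu
    rw [norm_mul, Complex.norm_real, Complex.norm_real, Real.norm_eq_abs, Real.norm_eq_abs,
      abs_of_pos (by positivity : 0 < R⁻¹), abs_of_nonneg (hφ0 _)]
    gcongr
    apply hφ
    rw [abs_div, abs_of_pos hR, div_le_one hR]; exact hu
  calc (R ^ (d + 1))⁻¹ * c ^ (d + 1) = (∏ _i : Fin d, R⁻¹ * c) * (R⁻¹ * c) := by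
        simp only [Finset.prod_const, Finset.card_univ, Fintype.card_fin]
        rw [← pow_succ, mul_pow, inv_pow]
    _ ≤ _ := by
        gcongr with i
        · apply h
          simpa using (abs_fst_le y i).trans hy
        · exact h _ ((abs_snd_le y).trans hy)

/-- Local `L²` orthogonality, weighted form. -/
lemma L2 (d E : ℕ) : ∃ C : ℝ≥0, ∀ (R r : ℝ), 0 < r → 1 ≤ R * r →
    ∀ (T : Finset (Fin d → ℤ)) (f : (Fin d → ℤ) → V d → ℂ),
    (∀ J ∈ T, FS {ξ : V d | ∀ i, |ξ.1 i - J i * r| ≤ 2 * r} (f J)) → ∀ x,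
    cv (fun y => ‖∑ J ∈ T, f J y‖ₑ ^ (2 : ℝ)) (w E R) x
      ≤ C * ∑ J ∈ T, cv (fun y => ‖f J y‖ₑ ^ (2 : ℝ)) (w E R) x := by
  obtain ⟨φ, Γ, c, hΓ, hc, hφc, hφ0, hφ1, hφd, hφΓ⟩ := exists_phi
  obtain ⟨C2, hC2, h2⟩ := hφd 2
  obtain ⟨CF, hCF, hF⟩ := hφd (E + d + 2)
  have hφc' : Continuous (fun s => (φ s : ℂ)) := by fun_prop
  obtain ⟨A, hA⟩ := exists_nat_ge (Γ + 4)
  set c1 : ℝ≥0∞ := ENNReal.ofReal (c ^ (d + 1)) * volume (Metric.ball (0 : V d) 1) with hc1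
  have hc1pos : c1 ≠ 0 := mul_ne_zero (by simp only [ne_eq, ENNReal.ofReal_eq_zero, not_le]; positivity)
    (Metric.measure_ball_pos volume _ one_pos).ne'
  have hc1top : c1 ≠ ∞ := ENNReal.mul_ne_top ENNReal.ofReal_ne_top measure_ball_lt_top.ne
  set C1 : ℝ≥0∞ := 2 ^ E * c1⁻¹ with hC1
  set C3 : ℝ≥0∞ := ENNReal.ofReal CF ^ (d + 1) * Cw d with hC3
  have hC1top : C1 ≠ ∞ := ENNReal.mul_ne_top (by simp) (ENNReal.inv_ne_top.2 hc1pos)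
  have hC3top : C3 ≠ ∞ := ENNReal.mul_ne_top (by simp) Cw_lt_top.ne
  set D : ℝ≥0∞ := C1 * (((2 * A + 1) ^ d : ℕ) * C3) with hD
  have hDtop : D ≠ ∞ := ENNReal.mul_ne_top hC1top (ENNReal.mul_ne_top (ENNReal.natCast_ne_top _) hC3top)
  refine ⟨D.toNNReal, ?_⟩
  intro R r hr hRr T f hf x
  rw [ENNReal.coe_toNNReal hDtop]
  have hR : 0 < R := by
    by_contra h
    push Not at h
    have : R * r ≤ 0 := mul_nonpos_of_nonpos_of_nonneg h hr.le
    linarith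
  set K : V d → ℝ≥0∞ := fun y => ‖ker (d := d) (fun s => (φ s : ℂ)) 0 R R y‖ₑ with hK
  have hKm : Measurable K := (ker_cont hφc' 0 R R).measurable.enorm
  have hwm : Measurable (w (d := d) E R) := by fun_prop
  have ha : ∀ z, cv K (w E R) z ≤ C3 * w E R z := by
    intro z
    rw [cv_comm]
    calc cv (w E R) K z ≤ cv (w E R) (fun y => ENNReal.ofReal CF ^ (d + 1) * w (E + d + 2) R y) z := by
          refine cv_mono (fun _ => le_rfl) (fun y => ?_) z
          have := ker_le (d := d) (ψ := fun s => (φ s : ℂ)) hCF.le (F := E + d + 2) (by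
            intro s; rw [Complex.norm_real, Real.norm_eq_abs, abs_of_nonneg (hφ0 s)]; exact hF s)
            0 hR hR y
          refine this.trans ?_
          gcongr
          have := W_le_w (d := d) (E + d + 2) (g := 0) (G := 0) le_rfl (by simp) hR y
          simpa using this
      _ = ENNReal.ofReal CF ^ (d + 1) * cv (w E R) (w (E + d + 2) R) z :=
          cv_const_mul_right (by fun_prop) (by fun_prop) _ _
      _ ≤ ENNReal.ofReal CF ^ (d + 1) * (Cw d * w E R z) := by
          gcongr; exact w_cv_w le_rfl hR z
      _ = _ := by rw [hC3]; ring
  have hb : ∀ z, w E R z ≤ C1 * cv K (w E R) z := by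
    intro z
    rw [cv_comm]
    have hvol : c1 = ENNReal.ofReal ((R ^ (d + 1))⁻¹ * c ^ (d + 1)) *
        volume (Metric.closedBall (0 : V d) R) := by
      rw [Measure.addHaar_closedBall _ _ hR.le, hc1, show Module.finrank ℝ (V d) = d + 1 by simp,
        ← mul_assoc, ← ENNReal.ofReal_mul (by positivity)]
      congr 2
      field_simp
    have : w E R z * c1 ≤ 2 ^ E * cv (w E R) K z := by
      calc w E R z * c1 = ∫⁻ _y in Metric.closedBall (0 : V d) R,
            w E R z * ENNReal.ofReal ((R ^ (d + 1))⁻¹ * c ^ (d + 1)) := by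
            rw [setLIntegral_const, hvol, mul_assoc]
        _ ≤ ∫⁻ y in Metric.closedBall (0 : V d) R, 2 ^ E * (w E R (z - y) * K y) := by
            refine setLIntegral_mono (by fun_prop) fun y hy => ?_
            rw [mem_closedBall_zero_iff] at hy
            rw [← mul_assoc]
            gcongr
            · have := w_shift E hR (z - y) y
              rw [sub_add_cancel] at this
              refine this.trans ?_
              gcongr
              rw [show (2 : ℝ≥0∞) ^ E = ENNReal.ofReal (2 ^ E) by
                rw [ENNReal.ofReal_pow (by norm_num)]; simp]
              apply ENNReal.ofReal_le_ofReal
              have : ‖y‖ / R ≤ 1 := (div_le_one hR).2 hy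
              gcongr
              linarith
            · exact ker_phi_lower hφ0 hc hφ1 hR hy
        _ ≤ ∫⁻ y, 2 ^ E * (w E R (z - y) * K y) := setLIntegral_le_lintegral _ _
        _ = _ := by rw [lintegral_const_mul _ (by fun_prop)]; rfl
    calc w E R z = (w E R z * c1) * c1⁻¹ := by
          rw [mul_assoc, ENNReal.mul_inv_cancel hc1pos hc1top, mul_one]
      _ ≤ (2 ^ E * cv (w E R) K z) * c1⁻¹ := by gcongr
      _ = _ := by rw [hC1]; ring
  classical
  have hfm : ∀ J ∈ T, Measurable (f J) := fun J hJ => (hf J hJ).meas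
  have hsm : Measurable (fun y => ‖∑ J ∈ T, f J y‖ₑ ^ (2 : ℝ)) := by
    have : Measurable (fun y => ∑ J ∈ T, f J y) := Finset.measurable_sum _ hfm
    fun_prop
  set f' : (Fin d → ℤ) → V d → ℂ := fun J => if J ∈ T then f J else 0 with hf'
  have hf'm : ∀ J, Measurable (f' J) := by
    intro J; rw [hf']; dsimp only; split_ifs with h
    · exact hfm J h
    · fun_prop
  have hff : ∀ J ∈ T, f J = f' J := fun J hJ => by rw [hf']; simp [hJ]
  have hgm : ∀ J, Measurable (fun y => ‖f' J y‖ₑ ^ (2 : ℝ)) := fun J => by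
    have := hf'm J; fun_prop
  calc cv (fun y => ‖∑ J ∈ T, f J y‖ₑ ^ (2 : ℝ)) (w E R) x
      ≤ cv (fun y => ‖∑ J ∈ T, f J y‖ₑ ^ (2 : ℝ)) (fun z => C1 * cv K (w E R) z) x :=
        cv_mono (fun _ => le_rfl) hb x
    _ = C1 * cv (cv (fun y => ‖∑ J ∈ T, f J y‖ₑ ^ (2 : ℝ)) K) (w E R) x := by
        rw [cv_const_mul_right hsm (by fun_prop), cv_assoc hsm hKm hwm]
    _ ≤ C1 * cv (fun z => ((2 * A + 1) ^ d : ℕ) * ∑ J ∈ T, cv (fun y => ‖f' J y‖ₑ ^ (2 : ℝ)) K z)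
          (w E R) x := by
        gcongr
        refine cv_mono (fun z => ?_) (fun _ => le_rfl) x
        have := L2_core hφc hφ0 hΓ hC2.le h2 hφΓ hA hr hRr T f hf z
        refine this.trans (le_of_eq ?_)
        congr 1
        refine Finset.sum_congr rfl fun J hJ => ?_
        rw [hff J hJ]
    _ = C1 * (((2 * A + 1) ^ d : ℕ) * ∑ J ∈ T, cv (fun y => ‖f' J y‖ₑ ^ (2 : ℝ)) (cv K (w E R)) x) := by
        rw [cv_const_mul_left (by fun_prop) hwm, cv_sum_left (by fun_prop) hwm]
        congr 2
        refine Finset.sum_congr rfl fun J hJ => ?_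
        exact cv_assoc (hgm J) hKm hwm x
    _ ≤ C1 * (((2 * A + 1) ^ d : ℕ) * ∑ J ∈ T, C3 * cv (fun y => ‖f' J y‖ₑ ^ (2 : ℝ)) (w E R) x) := by
        gcongr with J hJ
        rw [← cv_const_mul_right (hgm J) hwm]
        exact cv_mono (fun _ => le_rfl) ha x
    _ = D * ∑ J ∈ T, cv (fun y => ‖f' J y‖ₑ ^ (2 : ℝ)) (w E R) x := by
        rw [← Finset.mul_sum, hD]; ring
    _ = _ := by
        congr 1
        refine Finset.sum_congr rfl fun J hJ => ?_
        rw [hff J hJ]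

end DR

namespace DR
open Filter Topology
open scoped ENNReal NNReal

/-! ### A band-limited localizer -/

variable {d : ℕ}

lemma sinc_two_mul (x : ℝ) : sinc (2 * x) = cos x * sinc x := by
  rcases eq_or_ne x 0 with h | h
  · simp [h]
  · rw [sinc_of_ne_zero h, sinc_of_ne_zero (by simpa using h), sin_two_mul]
    field_simp

/-- Partial products in the formula of Viete. -/
def vp (n : ℕ) (u : ℝ) : ℝ := ∏ k ∈ Finset.range n, cos (u / 2 ^ (k + 1))

lemma vp_mul_sinc (n : ℕ) (u : ℝ) : vp n u * sinc (u / 2 ^ n) = sinc u := by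
  induction n with
  | zero => simp [vp]
  | succ n ih =>
    rw [← ih, vp, Finset.prod_range_succ, ← vp, mul_assoc, ← sinc_two_mul]
    congr 2
    rw [pow_succ]; field_simp

lemma abs_vp_le (n : ℕ) (u : ℝ) : |vp n u| ≤ 1 := by
  unfold vp
  rw [Finset.abs_prod]
  exact Finset.prod_le_one (fun _ _ => abs_nonneg _) fun _ _ => abs_cos_le_one _

lemma tendsto_vp (u : ℝ) : Tendsto (fun n => vp n u) atTop (𝓝 (sinc u)) := by
  have h1 : Tendsto (fun n : ℕ => u / 2 ^ n) atTop (𝓝 0) :=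
    tendsto_const_nhds.div_atTop (tendsto_pow_atTop_atTop_of_one_lt one_lt_two)
  have h2 : Tendsto (fun n : ℕ => sinc (u / 2 ^ n)) atTop (𝓝 1) := by
    have := (continuous_sinc.tendsto 0).comp h1
    rw [sinc_zero] at this
    exact this
  have h3 : Tendsto (fun n : ℕ => sinc u / sinc (u / 2 ^ n)) atTop (𝓝 (sinc u)) := by
    have := (tendsto_const_nhds (x := sinc u) (f := atTop)).div h2 one_ne_zero
    rw [div_one] at this
    exact this
  refine h3.congr' ?_
  filter_upwards [h2.eventually_ne one_ne_zero] with n hn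
  rw [← vp_mul_sinc n u]; field_simp

lemma cos_eq_ee (s : ℝ) : ((cos (π * s) : ℝ) : ℂ) = (1 / 2) * ee (s / 2) + (1 / 2) * ee (-(s / 2)) := by
  unfold ee
  rw [Complex.ofReal_cos, Complex.cos]
  have h1 : (2 * (π : ℂ) * Complex.I * ((s / 2 : ℝ) : ℂ)) = ((π * s : ℝ) : ℂ) * Complex.I := by
    push_cast; ring
  have h2 : (2 * (π : ℂ) * Complex.I * ((-(s / 2) : ℝ) : ℂ)) = -((π * s : ℝ) : ℂ) * Complex.I := by
    push_cast; ring
  rw [h1, h2]; ring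

/-- frequencies in a sup-norm ball -/
abbrev SB (d : ℕ) (r : ℝ) : Set (V d) := {ξ | ‖ξ‖ ≤ r}

lemma pr_smul_left (c : ℝ) (ξ x : V d) : pr (c • ξ) x = c * pr ξ x := by
  simp only [pr, Prod.smul_fst, Prod.smul_snd, Pi.smul_apply, smul_eq_mul, mul_add, Finset.mul_sum]
  congr 1
  · exact Finset.sum_congr rfl fun i _ => by ring
  · ring

lemma FS_vp (η : V d) (n : ℕ) :
    FS (SB d (‖η‖ * (1 - 1 / 2 ^ n) / 2)) (fun x => ((vp n (π * pr η x) : ℝ) : ℂ)) := by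
  induction n with
  | zero =>
    have := FS.exp (S := SB d (‖η‖ * (1 - 1 / 2 ^ 0) / 2)) 0 (by simp)
    simpa [vp] using this
  | succ n ih =>
    have h1 : FS (SB d (‖η‖ / 2 ^ (n + 1) / 2))
        (fun x => ((cos (π * pr η x / 2 ^ (n + 1)) : ℝ) : ℂ)) := by
      have e : ∀ x, π * pr η x / 2 ^ (n + 1) = π * (pr η x / 2 ^ (n + 1)) := fun x => by ring
      simp only [e, cos_eq_ee]
      refine .add _ _ (.smul _ _ ?_) (.smul _ _ ?_)
      · have : ∀ x, pr η x / 2 ^ (n + 1) / 2 = pr ((1 / 2 ^ (n + 1) / 2 : ℝ) • η) x := fun x => by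
          rw [pr_smul_left]; ring
        simp only [this]
        refine .exp _ ?_
        simp only [Set.mem_ofPred_eq, norm_smul, Real.norm_eq_abs]
        rw [abs_of_pos (by positivity)]
        exact le_of_eq (by ring)
      · have : ∀ x, -(pr η x / 2 ^ (n + 1) / 2) = pr ((-(1 / 2 ^ (n + 1) / 2) : ℝ) • η) x := fun x => by
          rw [pr_smul_left]; ring
        simp only [this]
        refine .exp _ ?_
        simp only [Set.mem_ofPred_eq, norm_smul, Real.norm_eq_abs, abs_neg]
        rw [abs_of_pos (by positivity)]
        exact le_of_eq (by ring)
    have h2 := ih.mul h1 (U := SB d (‖η‖ * (1 - 1 / 2 ^ (n + 1)) / 2)) (by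
      intro ξ hξ ζ hζ
      simp only [Set.mem_ofPred_eq] at *
      refine (norm_add_le _ _).trans ((add_le_add hξ hζ).trans (le_of_eq ?_))
      rw [pow_succ]; field_simp; ring)
    have e : ∀ x, ((vp (n + 1) (π * pr η x) : ℝ) : ℂ) = (vp n (π * pr η x) : ℝ) *
        ((cos (π * pr η x / 2 ^ (n + 1)) : ℝ) : ℂ) := fun x => by
      rw [vp, Finset.prod_range_succ, ← vp]; push_cast; rfl
    simp only [e]
    exact h2

lemma FS_sinc (η : V d) : FS (SB d ‖η‖) (fun x => ((sinc (π * pr η x) : ℝ) : ℂ)) := by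
  refine .lim (fun n x => ((vp n (π * pr η x) : ℝ) : ℂ)) _ 1 (fun n => (FS_vp η n).mono ?_)
    (fun n x => ?_) (fun x => ?_)
  · intro ξ hξ
    simp only [Set.mem_ofPred_eq] at *
    refine hξ.trans ?_
    have h1 : (0 : ℝ) < 1 / 2 ^ n := by positivity
    have := norm_nonneg η
    nlinarith
  · rw [Complex.norm_real, Real.norm_eq_abs]; exact abs_vp_le _ _
  · exact (Complex.continuous_ofReal.tendsto _).comp (tendsto_vp _)

lemma FS_prod {ι : Type*} (s : Finset ι) (f : ι → V d → ℂ) {r : ℝ}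
    (hf : ∀ i ∈ s, FS (SB d r) (f i)) : FS (SB d (s.card * r)) (fun x => ∏ i ∈ s, f i x) := by
  classical
  induction s using Finset.induction_on with
  | empty =>
    have := FS.exp (S := SB d (((∅ : Finset ι).card : ℝ) * r)) 0 (by simp)
    simpa using this
  | insert a s ha ih =>
    simp only [Finset.prod_insert ha]
    refine (hf a (by simp)).mul (ih fun i hi => hf i (by simp [hi])) ?_
    intro ξ hξ ζ hζ
    simp only [Set.mem_ofPred_eq] at *
    refine (norm_add_le _ _).trans ((add_le_add hξ hζ).trans (le_of_eq ?_))
    rw [Finset.card_insert_of_notMem ha]; push_cast; ring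

lemma abs_sinc_pi_le (s : ℝ) : |sinc (π * s)| ≤ 2 * (1 + |s|)⁻¹ := by
  have h1 := abs_sinc_le_one (π * s)
  have h2 : |s| * |sinc (π * s)| ≤ 1 := by
    rcases eq_or_ne s 0 with h | h
    · simp [h]
    · rw [sinc_of_ne_zero (by positivity), abs_div, abs_mul, abs_of_pos pi_pos]
      have : 0 < |s| := abs_pos.2 h
      rw [show |s| * (|sin (π * s)| / (π * |s|)) = |sin (π * s)| / π by field_simp]
      rw [div_le_one pi_pos]
      linarith [abs_sin_le_one (π * s), pi_gt_three]
  rw [← div_eq_mul_inv, le_div_iff₀ (by positivity)]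
  nlinarith

lemma sinc_pi_ge {s : ℝ} (hs : |s| ≤ 1 / 2) : 1 / 2 ≤ sinc (π * s) := by
  rcases eq_or_ne s 0 with h | h
  · simp [h]; norm_num
  have key : ∀ s : ℝ, 0 < s → s ≤ 1 / 2 → 1 / 2 ≤ sinc (π * s) := by
    intro s h0 h1
    rw [sinc_of_ne_zero (by positivity), le_div_iff₀ (by positivity)]
    have := mul_le_sin (x := π * s) (by positivity) (by nlinarith [pi_pos])
    have e : 2 / π * (π * s) = 2 * s := by field_simp
    rw [e] at this
    nlinarith [pi_le_four]
  rcases lt_or_gt_of_ne h with h | h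
  · rw [← sinc_neg, ← mul_neg]
    exact key _ (by linarith) (by rw [abs_of_neg h] at hs; exact hs)
  · exact key _ h (by rw [abs_of_pos h] at hs; exact hs)

lemma exists_chi (d m : ℕ) : ∃ Γ c C : ℝ, 0 < Γ ∧ 0 < c ∧ 0 < C ∧ ∀ R : ℝ, 0 < R →
    ∃ χ : V d → ℂ, FS (SB d (Γ / R)) χ ∧ (∀ x, ‖χ x‖ ≤ C * ((1 + ‖x‖ / R) ^ m)⁻¹) ∧
      (∀ x, ‖x‖ ≤ R / 2 → c ≤ ‖χ x‖) := by
  refine ⟨(d * m + m + 1 : ℕ), (1 / 2) ^ (m * (d + 1)), 2 ^ m, by positivity, by positivity,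
    by positivity, ?_⟩
  intro R hR
  set e : Fin d → V d := fun i => (Pi.single i R⁻¹, 0) with he
  set e0 : V d := (0, R⁻¹) with he0
  have hpe : ∀ i x, pr (e i) x = x.1 i / R := by
    intro i x
    simp only [pr, he, Pi.single_apply]
    rw [Finset.sum_eq_single i] <;> simp +contextual [div_eq_inv_mul]
  have hpe0 : ∀ x, pr e0 x = x.2 / R := by
    intro x; simp [pr, he0, div_eq_inv_mul]
  have hne : ∀ i, ‖e i‖ ≤ 1 / R := by
    intro i
    simp only [he, Prod.norm_def, norm_zero]
    refine max_le ?_ (by positivity)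
    rw [pi_norm_le_iff_of_nonneg (by positivity)]
    intro j
    rw [Pi.single_apply]
    split_ifs
    · simp [abs_of_pos hR]
    · simp; positivity
  have hne0 : ‖e0‖ ≤ 1 / R := by
    simp only [he0, Prod.norm_def, norm_zero]
    refine max_le (by positivity) ?_
    simp [abs_of_pos hR]
  refine ⟨fun x => (∏ i, ∏ _k ∈ Finset.range m, ((sinc (π * pr (e i) x) : ℝ) : ℂ)) *
    ∏ _k ∈ Finset.range m, ((sinc (π * pr e0 x) : ℝ) : ℂ), ?_, ?_, ?_⟩
  · have h1 : FS (SB d ((Finset.univ : Finset (Fin d)).card * ((Finset.range m).card * (1 / R))))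
        (fun x => ∏ i, ∏ _k ∈ Finset.range m, ((sinc (π * pr (e i) x) : ℝ) : ℂ)) := by
      refine FS_prod _ _ fun i _ => FS_prod _ _ fun k _ => (FS_sinc (e i)).mono ?_
      intro ξ hξ
      simp only [Set.mem_ofPred_eq] at *
      exact hξ.trans (hne i)
    have h2 : FS (SB d ((Finset.range m).card * (1 / R)))
        (fun x => ∏ _k ∈ Finset.range m, ((sinc (π * pr e0 x) : ℝ) : ℂ)) := by
      refine FS_prod _ _ fun k _ => (FS_sinc e0).mono ?_
      intro ξ hξ
      simp only [Set.mem_ofPred_eq] at *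
      exact hξ.trans hne0
    refine h1.mul h2 ?_
    intro ξ hξ ζ hζ
    simp only [Set.mem_ofPred_eq, Finset.card_univ, Fintype.card_fin, Finset.card_range] at *
    refine (norm_add_le _ _).trans ((add_le_add hξ hζ).trans ?_)
    push_cast
    rw [← mul_assoc, ← add_mul, mul_one_div]
    refine div_le_div_of_nonneg_right ?_ hR.le
    linarith
  · intro x
    simp only [Finset.prod_const, Finset.card_range, norm_mul, norm_prod, norm_pow, Complex.norm_real,
      Real.norm_eq_abs]
    have hle : ∀ u, |sinc u| ^ m ≤ 1 := fun u => pow_le_one₀ (abs_nonneg _) (abs_sinc_le_one _)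
    have hd : ∀ s : ℝ, |sinc (π * s)| ^ m ≤ 2 ^ m * ((1 + |s|) ^ m)⁻¹ := by
      intro s
      rw [← inv_pow, ← mul_pow]
      exact pow_le_pow_left₀ (abs_nonneg _) (abs_sinc_pi_le s) m
    have hx : ‖x‖ = |x.2| ∨ ∃ i, ‖x‖ = |x.1 i| := by
      rcases le_total ‖x.1‖ ‖x.2‖ with h | h
      · left; rw [Prod.norm_def, max_eq_right h]; rfl
      · rw [Prod.norm_def, max_eq_left h]
        rcases Nat.eq_zero_or_pos d with h0 | h0
        · subst h0
          left
          have : ‖x.1‖ = 0 := by simp [Subsingleton.elim x.1 0]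
          rw [this] at h ⊢
          exact (le_antisymm h (norm_nonneg _)).symm
        · right
          have : Nonempty (Fin d) := ⟨⟨0, h0⟩⟩
          obtain ⟨i, hi⟩ := (Finset.univ.exists_mem_eq_sup' Finset.univ_nonempty (fun i => ‖x.1 i‖₊))
          refine ⟨i, ?_⟩
          rw [← Real.norm_eq_abs, ← coe_nnnorm, ← coe_nnnorm, ← hi.2, Finset.sup'_eq_sup]
          rfl
    rcases hx with hx | ⟨i, hx⟩
    · calc _ ≤ 1 * (2 ^ m * ((1 + |x.2 / R|) ^ m)⁻¹) := by
            gcongr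
            · exact Finset.prod_le_one (fun _ _ => by positivity) fun i _ => hle _
            · rw [hpe0]; exact hd _
        _ = _ := by rw [hx, abs_div, abs_of_pos hR, one_mul]
    · calc _ ≤ (2 ^ m * ((1 + |x.1 i / R|) ^ m)⁻¹) * 1 := by
            gcongr
            · rw [← Finset.mul_prod_erase _ _ (Finset.mem_univ i)]
              calc _ ≤ (2 ^ m * ((1 + |x.1 i / R|) ^ m)⁻¹) * 1 := by
                    gcongr
                    · rw [hpe]; exact hd _
                    · exact Finset.prod_le_one (fun _ _ => by positivity) fun i _ => hle _
                _ = _ := mul_one _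
            · exact hle _
        _ = _ := by rw [hx, abs_div, abs_of_pos hR, mul_one]
  · intro x hx
    simp only [Finset.prod_const, Finset.card_range, norm_mul, norm_prod, norm_pow, Complex.norm_real,
      Real.norm_eq_abs]
    have hl : ∀ s : ℝ, |s| ≤ R / 2 → 1 / 2 ≤ |sinc (π * (s / R))| := by
      intro s hs
      refine le_trans (sinc_pi_ge ?_) (le_abs_self _)
      rw [abs_div, abs_of_pos hR, div_le_iff₀ hR]; linarith
    calc (1 / 2 : ℝ) ^ (m * (d + 1)) = (∏ _i : Fin d, (1 / 2 : ℝ) ^ m) * (1 / 2) ^ m := by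
          simp only [Finset.prod_const, Finset.card_univ, Fintype.card_fin]
          rw [← pow_succ, pow_mul]
      _ ≤ _ := by
          gcongr with i
          · rw [hpe]; exact hl _ ((abs_fst_le x i).trans hx)
          · rw [hpe0]; exact hl _ ((abs_snd_le x).trans hx)

end DR

namespace DR
open Filter Topology
open scoped ENNReal NNReal

/-! ### Loomis and Whitney and the multilinear Kakeya step -/

variable {d : ℕ}

/-- the unit interval measure -/
def μI : Measure ℝ := volume.restrict (Set.Icc (-(1 / 2)) (1 / 2))

instance : IsProbabilityMeasure μI := ⟨by
  unfold μI; rw [Measure.restrict_apply_univ, Real.volume_Icc]; norm_num⟩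

/-- the unit cube measure -/
def μQ (m : ℕ) : Measure (Fin m → ℝ) := Measure.pi (fun _ => μI)

instance (m : ℕ) : IsProbabilityMeasure (μQ m) := by unfold μQ; infer_instance

lemma μQ_eq (m : ℕ) : μQ m = volume.restrict (Set.univ.pi fun _ => Set.Icc (-(1 / 2) : ℝ) (1 / 2)) := by
  unfold μQ μI
  rw [volume_pi, Measure.restrict_pi_pi]

lemma μQ_ae (m : ℕ) : ∀ᵐ s ∂(μQ m), ∀ i, s i ∈ Set.Icc (-(1 / 2) : ℝ) (1 / 2) := by
  rw [μQ_eq]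
  filter_upwards [ae_restrict_mem (MeasurableSet.univ_pi fun _ => measurableSet_Icc)] with s hs i
  exact hs i (Set.mem_univ i)

lemma LW_aux (hd : 1 ≤ d) (f : Fin (d + 1) → (Fin (d + 1) → ℝ) → ℝ≥0∞) (hf : ∀ i, Measurable (f i)) :
    ∫⁻ s, ∏ i, (∫⁻ u, f i (Function.update s i u) ∂μI) ^ (1 / (d : ℝ)) ∂(μQ (d + 1))
      ≤ ((d + 1 : ℕ) : ℝ≥0∞) ^ (((d + 1 : ℕ) : ℝ) / d) *
        ∏ i, (∫⁻ s, f i s ∂(μQ (d + 1))) ^ (1 / (d : ℝ)) := by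
  have hd0 : (0 : ℝ) < d := by exact_mod_cast hd
  have h1d : (0 : ℝ) < 1 / d := by positivity
  set n : Fin (d + 1) → ℝ≥0∞ := fun i => ∫⁻ s, f i s ∂(μQ (d + 1)) with hn
  have hupd : ∀ i, Measurable (fun p : (Fin (d + 1) → ℝ) × ℝ => Function.update p.1 i p.2) := by
    intro i
    refine measurable_pi_lambda _ fun j => ?_
    by_cases h : j = i
    · subst h; simpa using measurable_snd
    · simp only [Function.update_of_ne h]; fun_prop
  by_cases h0 : ∃ i, n i = 0
  · obtain ⟨i, hi⟩ := h0
    have hLHS : ∫⁻ s, ∏ i, (∫⁻ u, f i (Function.update s i u) ∂μI) ^ (1 / (d : ℝ)) ∂(μQ (d + 1)) = 0 := by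
      have h1 : ∫⁻ s, ∫⁻ u, f i (Function.update s i u) ∂μI ∂(μQ (d + 1)) = 0 := by
        rw [← hi, hn]
        refine lintegral_eq_of_lmarginal_eq {i}
          (Measurable.lintegral_prod_right ((hf i).comp (hupd i))) (hf i) ?_
        rw [lmarginal_singleton, lmarginal_singleton]
        ext s
        simp
      rw [lintegral_eq_zero_iff] at h1 ⊢
      · filter_upwards [h1] with s hs
        simp only [Pi.zero_apply] at hs ⊢
        exact Finset.prod_eq_zero (Finset.mem_univ i) (by rw [hs, ENNReal.zero_rpow_of_pos h1d])
      · refine Finset.measurable_prod _ fun j _ => Measurable.pow_const ?_ _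
        exact Measurable.lintegral_prod_right ((hf j).comp (hupd j))
      · exact Measurable.lintegral_prod_right ((hf i).comp (hupd i))
    rw [hLHS]; exact zero_le
  push Not at h0
  by_cases htop : ∃ i, n i = ∞
  · obtain ⟨i, hi⟩ := htop
    have : ∏ i, n i ^ (1 / (d : ℝ)) = ∞ := by
      rw [← Finset.mul_prod_erase _ _ (Finset.mem_univ i), hi, ENNReal.top_rpow_of_pos h1d,
        ENNReal.top_mul]
      exact Finset.prod_ne_zero_iff.2 fun j _ => by
        simp only [ne_eq, ENNReal.rpow_eq_zero_iff, not_or, not_and_or]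
        exact ⟨Or.inl (h0 j), Or.inr (by linarith)⟩
    rw [this, ENNReal.mul_top]
    · exact le_top
    · simp only [ne_eq, ENNReal.rpow_eq_zero_iff, not_or, not_and_or]
      refine ⟨Or.inl (by simp), Or.inl (by simp)⟩
  push Not at htop
  set F : (Fin (d + 1) → ℝ) → ℝ≥0∞ := fun s => ∑ i, (n i)⁻¹ * f i s with hF
  have hFm : Measurable F := by rw [hF]; fun_prop
  have hHC : Real.HolderConjugate (Fintype.card (Fin (d + 1)) : ℝ) (((d + 1 : ℕ) : ℝ) / d) := by
    rw [Real.holderConjugate_iff]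
    simp only [Fintype.card_fin]
    push_cast
    constructor
    · linarith
    · field_simp; ring
  have key := lintegral_prod_lintegral_pow_le (fun _ : Fin (d + 1) => μI) hHC hFm
  have hFint : ∫⁻ s, F s ∂(μQ (d + 1)) = ((d + 1 : ℕ) : ℝ≥0∞) := by
    rw [hF, lintegral_finsetSum _ (by fun_prop)]
    simp_rw [fun i => lintegral_const_mul ((n i)⁻¹) (hf i) (μ := μQ (d + 1))]
    have : ∀ i, (n i)⁻¹ * ∫⁻ s, f i s ∂(μQ (d + 1)) = 1 := fun i =>
      ENNReal.inv_mul_cancel (h0 i) (htop i)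
    simp [this]
  have hcard : ((Fintype.card (Fin (d + 1)) : ℝ) - 1) = d := by simp
  rw [hcard] at key
  change ∫⁻ s, ∏ i, (∫⁻ u, F (Function.update s i u) ∂μI) ^ (1 / (d : ℝ)) ∂(μQ (d + 1)) ≤
    (∫⁻ s, F s ∂(μQ (d + 1))) ^ (((d + 1 : ℕ) : ℝ) / d) at key
  rw [hFint] at key
  calc ∫⁻ s, ∏ i, (∫⁻ u, f i (Function.update s i u) ∂μI) ^ (1 / (d : ℝ)) ∂(μQ (d + 1))
      ≤ ∫⁻ s, (∏ i, n i ^ (1 / (d : ℝ))) *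
          ∏ i, (∫⁻ u, F (Function.update s i u) ∂μI) ^ (1 / (d : ℝ)) ∂(μQ (d + 1)) := by
        refine lintegral_mono fun s => ?_
        dsimp only
        rw [← Finset.prod_mul_distrib]
        gcongr with i
        rw [← ENNReal.mul_rpow_of_nonneg _ _ h1d.le]
        gcongr
        rw [← lintegral_const_mul' _ _ (htop i)]
        refine lintegral_mono fun u => ?_
        dsimp only
        calc f i (Function.update s i u)
            = n i * ((n i)⁻¹ * f i (Function.update s i u)) := by
              rw [← mul_assoc, ENNReal.mul_inv_cancel (h0 i) (htop i), one_mul]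
          _ ≤ _ := by
              gcongr
              exact Finset.single_le_sum (f := fun i' => (n i')⁻¹ * f i' (Function.update s i u))
                (fun _ _ => zero_le) (Finset.mem_univ i)
    _ = (∏ i, n i ^ (1 / (d : ℝ))) *
          ∫⁻ s, ∏ i, (∫⁻ u, F (Function.update s i u) ∂μI) ^ (1 / (d : ℝ)) ∂(μQ (d + 1)) := by
        refine lintegral_const_mul _ ?_
        refine Finset.measurable_prod _ fun j _ => Measurable.pow_const ?_ _
        exact Measurable.lintegral_prod_right (hFm.comp (hupd j))
    _ ≤ _ := by rw [mul_comm]; gcongr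

lemma LW (hd : 1 ≤ d) (h : Fin (d + 1) → (Fin (d + 1) → ℝ) → ℝ≥0∞) (hh : ∀ i, Measurable (h i))
    {σ : ℝ} (hσ : 0 < σ) (hσd : σ * d ≤ 1) (C0 : ℝ≥0)
    (hC : ∀ i s u, s i ∈ Set.Icc (-(1 / 2) : ℝ) (1 / 2) → u ∈ Set.Icc (-(1 / 2) : ℝ) (1 / 2) →
      h i s ≤ C0 * h i (Function.update s i u)) :
    ∫⁻ s, ∏ i, h i s ^ σ ∂(μQ (d + 1)) ≤
      (((C0 : ℝ≥0∞) ^ σ) ^ (d + 1) * ((d + 1 : ℕ) : ℝ≥0∞) ^ (((d + 1 : ℕ) : ℝ) / d)) *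
        ∏ i, (∫⁻ s, h i s ∂(μQ (d + 1))) ^ σ := by
  have hd0 : (0 : ℝ) < d := by exact_mod_cast hd
  have hσd0 : 0 < σ * d := by positivity
  have h1 : ∀ᵐ s ∂(μQ (d + 1)), ∏ i, h i s ^ σ ≤ ((C0 : ℝ≥0∞) ^ σ) ^ (d + 1) *
      ∏ i, (∫⁻ u, h i (Function.update s i u) ^ (σ * d) ∂μI) ^ (1 / (d : ℝ)) := by
    filter_upwards [μQ_ae (d + 1)] with s hs
    calc ∏ i, h i s ^ σ ≤ ∏ i, ((C0 : ℝ≥0∞) ^ σ *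
          (∫⁻ u, h i (Function.update s i u) ^ (σ * d) ∂μI) ^ (1 / (d : ℝ))) := by
          gcongr with i
          have : h i s ^ (σ * d) ≤ (C0 : ℝ≥0∞) ^ (σ * d) *
              ∫⁻ u, h i (Function.update s i u) ^ (σ * d) ∂μI := by
            rw [← lintegral_const_mul' _ _ (by simp [hσd0.le])]
            calc h i s ^ (σ * d) = ∫⁻ _u, h i s ^ (σ * d) ∂μI := by simp
              _ ≤ _ := by
                apply lintegral_mono_ae
                unfold μI
                filter_upwards [ae_restrict_mem measurableSet_Icc] with u hu
                rw [← ENNReal.mul_rpow_of_nonneg _ _ hσd0.le]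
                gcongr
                exact hC i s u (hs i) hu
          calc h i s ^ σ = (h i s ^ (σ * d)) ^ (1 / (d : ℝ)) := by
                rw [← ENNReal.rpow_mul]; congr 1; field_simp
            _ ≤ ((C0 : ℝ≥0∞) ^ (σ * d) *
              ∫⁻ u, h i (Function.update s i u) ^ (σ * d) ∂μI) ^ (1 / (d : ℝ)) := by gcongr
            _ = _ := by
                rw [ENNReal.mul_rpow_of_nonneg _ _ (by positivity), ← ENNReal.rpow_mul]
                congr 2; field_simp
      _ = _ := by
          rw [Finset.prod_mul_distrib]; simp
  have h2 := LW_aux hd (fun i s => h i s ^ (σ * d)) (fun i => (hh i).pow_const _)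
  calc ∫⁻ s, ∏ i, h i s ^ σ ∂(μQ (d + 1)) ≤ ∫⁻ s, ((C0 : ℝ≥0∞) ^ σ) ^ (d + 1) *
      ∏ i, (∫⁻ u, h i (Function.update s i u) ^ (σ * d) ∂μI) ^ (1 / (d : ℝ)) ∂(μQ (d + 1)) :=
        lintegral_mono_ae h1
    _ = ((C0 : ℝ≥0∞) ^ σ) ^ (d + 1) * ∫⁻ s,
      ∏ i, (∫⁻ u, h i (Function.update s i u) ^ (σ * d) ∂μI) ^ (1 / (d : ℝ)) ∂(μQ (d + 1)) :=
        lintegral_const_mul' _ _ (by simp [hσ.le])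
    _ ≤ ((C0 : ℝ≥0∞) ^ σ) ^ (d + 1) * (((d + 1 : ℕ) : ℝ≥0∞) ^ (((d + 1 : ℕ) : ℝ) / d) *
        ∏ i, (∫⁻ s, h i s ^ (σ * d) ∂(μQ (d + 1))) ^ (1 / (d : ℝ))) := by gcongr
    _ ≤ ((C0 : ℝ≥0∞) ^ σ) ^ (d + 1) * (((d + 1 : ℕ) : ℝ≥0∞) ^ (((d + 1 : ℕ) : ℝ) / d) *
        ∏ i, (∫⁻ s, h i s ∂(μQ (d + 1))) ^ σ) := by
        gcongr with i
        have := lintegral_rpow_le_mass (μ := μQ (d + 1)) hσd0 hσd (hh i)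
        rw [measure_univ, ENNReal.one_rpow, mul_one] at this
        calc _ ≤ ((∫⁻ s, h i s ∂(μQ (d + 1))) ^ (σ * d)) ^ (1 / (d : ℝ)) := by gcongr
          _ = _ := by rw [← ENNReal.rpow_mul]; congr 1; field_simp
    _ = _ := by ring

/-- The linear map with columns `r • e i`. -/
def Ph (e : Fin (d + 1) → V d) (r : ℝ) (s : Fin (d + 1) → ℝ) : V d := ∑ i, (r * s i) • e i

@[fun_prop] lemma Ph_cont (e : Fin (d + 1) → V d) (r : ℝ) : Continuous (Ph e r) := by
  unfold Ph; fun_prop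

@[fun_prop] lemma Ph_meas (e : Fin (d + 1) → V d) (r : ℝ) : Measurable (Ph e r) :=
  (Ph_cont e r).measurable

lemma Ph_update (e : Fin (d + 1) → V d) (r : ℝ) (s : Fin (d + 1) → ℝ) (i) (u : ℝ) :
    Ph e r s = Ph e r (Function.update s i u) + (r * (s i - u)) • e i := by
  unfold Ph
  rw [← Finset.add_sum_erase _ _ (Finset.mem_univ i),
    ← Finset.add_sum_erase (a := i) _ (fun j => (r * Function.update s i u j) • e j) (Finset.mem_univ i)]
  have : ∑ x ∈ Finset.univ.erase i, (r * Function.update s i u x) • e x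
      = ∑ x ∈ Finset.univ.erase i, (r * s x) • e x := by
    refine Finset.sum_congr rfl fun j hj => ?_
    rw [Function.update_of_ne (Finset.ne_of_mem_erase hj)]
  rw [this, Function.update_self, mul_sub, sub_smul]
  abel

/-- One step of multilinear Kakeya, abstract form. -/
lemma kak1 (hd : 1 ≤ d) (e : Fin (d + 1) → V d) {r : ℝ} (hr : 0 < r)
    (H : Fin (d + 1) → V d → ℝ≥0∞) (hH : ∀ i, Measurable (H i))
    {σ : ℝ} (hσ : 0 < σ) (hσd : σ * d ≤ 1) (C0 : ℝ≥0)
    (hC : ∀ i x s, |s| ≤ r → H i (x + s • e i) ≤ C0 * H i x) :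
    ∫⁻ x, ∏ i, H i x ^ σ ≤
      (((C0 : ℝ≥0∞) ^ σ) ^ (d + 1) * ((d + 1 : ℕ) : ℝ≥0∞) ^ (((d + 1 : ℕ) : ℝ) / d)) *
        ∫⁻ x, ∏ i, (∫⁻ s, H i (x + Ph e r s) ∂(μQ (d + 1))) ^ σ := by
  have hm : ∀ i, Measurable (fun p : V d × (Fin (d + 1) → ℝ) => H i (p.1 + Ph e r p.2)) := by
    intro i
    exact (hH i).comp (by fun_prop)
  calc ∫⁻ x, ∏ i, H i x ^ σ
      = ∫⁻ s, (∫⁻ x, ∏ i, H i (x + Ph e r s) ^ σ) ∂(μQ (d + 1)) := by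
        have : ∀ s, ∫⁻ x, ∏ i, H i (x + Ph e r s) ^ σ = ∫⁻ x, ∏ i, H i x ^ σ := fun s =>
          lintegral_add_right_eq_self (fun x => ∏ i, H i x ^ σ) (Ph e r s)
        simp [this]
    _ = ∫⁻ x, (∫⁻ s, ∏ i, H i (x + Ph e r s) ^ σ ∂(μQ (d + 1))) := by
        rw [lintegral_lintegral_swap]
        refine Measurable.aemeasurable ?_
        exact Finset.measurable_prod _ fun i _ => ((hm i).comp measurable_swap).pow_const _
    _ ≤ ∫⁻ x, (((C0 : ℝ≥0∞) ^ σ) ^ (d + 1) * ((d + 1 : ℕ) : ℝ≥0∞) ^ (((d + 1 : ℕ) : ℝ) / d)) *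
        ∏ i, (∫⁻ s, H i (x + Ph e r s) ∂(μQ (d + 1))) ^ σ := by
        refine lintegral_mono fun x => ?_
        refine LW hd (fun i s => H i (x + Ph e r s)) (fun i => (hH i).comp (by fun_prop)) hσ hσd C0 ?_
        intro i s u hs hu
        rw [Ph_update e r s i u, ← add_assoc]
        refine hC i _ _ ?_
        rw [abs_mul, abs_of_pos hr]
        have : |s i - u| ≤ 1 := by
          rw [abs_le]; constructor <;> linarith [hs.1, hs.2, hu.1, hu.2]
        nlinarith
    _ = _ := by
        refine lintegral_const_mul _ ?_
        exact Finset.measurable_prod _ fun i _ => (Measurable.lintegral_prod_right (hm i)).pow_const _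

/-- coordinates -/
def cc (x : V d) : Fin (d + 1) → ℝ := Fin.cons x.2 x.1

lemma lintegral_tail {f : V d → ℝ≥0∞} :
    ∫⁻ u : Fin (d + 1) → ℝ, f (Fin.tail u, u 0) = ∫⁻ x, f x := by
  have h1 := (volume_preserving_piFinSuccAbove (fun _ : Fin (d + 1) => ℝ) 0)
  have h2 : MeasurePreserving (MeasurableEquiv.prodComm : ℝ × (Fin d → ℝ) ≃ᵐ V d) :=
    Measure.measurePreserving_swap
  have h3 := (h2.comp h1)
  rw [← h3.lintegral_comp_emb]
  · rfl
  · exact (MeasurableEquiv.measurableEmbedding _).comp (MeasurableEquiv.measurableEmbedding _)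

lemma lintegral_Ph (e : Fin (d + 1) → V d) (hdet : Matrix.det (Matrix.of fun i => cc (e i)) ≠ 0)
    {f : V d → ℝ≥0∞} (hf : Measurable f) :
    ∫⁻ s, f (Ph e 1 s) = ENNReal.ofReal |(Matrix.det (Matrix.of fun i => cc (e i)))⁻¹| * ∫⁻ x, f x := by
  rw [← lintegral_tail]
  have hf' : Measurable (fun u : Fin (d + 1) → ℝ => f (Fin.tail u, u 0)) := by
    refine hf.comp (Measurable.prodMk ?_ (measurable_pi_apply 0))
    exact measurable_pi_lambda _ fun j => measurable_pi_apply _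
  have hdet' : LinearMap.det (Matrix.toLin' (Matrix.of fun i => cc (e i)).transpose) ≠ 0 := by
    rw [LinearMap.det_toLin', Matrix.det_transpose]; exact hdet
  have := lintegral_comp_lin (Matrix.toLin' (Matrix.of fun i => cc (e i)).transpose) hdet' hf'
  rw [LinearMap.det_toLin', Matrix.det_transpose] at this
  rw [← this]
  congr 1; ext s
  congr 1
  unfold Ph
  ext
  · simp [Matrix.toLin'_apply, Matrix.mulVec, dotProduct, cc, Fin.tail, Prod.fst_sum, mul_comm]
  · simp [Matrix.toLin'_apply, Matrix.mulVec, dotProduct, cc, Prod.snd_sum, mul_comm]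

end DR

namespace DR

open Filter Topology
open scoped ENNReal NNReal

variable {d : ℕ}

lemma vol_Icc_sym (B : ℝ) : volume (Set.Icc (-B) B) = ENNReal.ofReal (2 * B) := by
  rw [Real.volume_Icc]; congr 1; ring

lemma v_avg {F : ℕ} (hF : 2 ≤ F) {B : ℝ} (hB : 1 ≤ B) {ρ ρ' : ℝ} (hρ : 0 < ρ) (h : ρ ≤ ρ') (s : ℝ) :
    ∫⁻ b in Set.Icc (-(B * ρ')) (B * ρ'), v F ρ (s + b) ≤
      (Cv * ENNReal.ofReal ((1 + 2 * B) ^ F) + ENNReal.ofReal (2 * B * 4 ^ F)) *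
        (ENNReal.ofReal ρ' * v F ρ' s) := by
  have hρ' : 0 < ρ' := hρ.trans_le h
  have hbr := one_le_br s hρ'
  have e1 : ENNReal.ofReal ρ' * v F ρ' s = ENNReal.ofReal (((1 + |s| / ρ') ^ F)⁻¹) := by
    unfold v vr
    rw [← ENNReal.ofReal_mul hρ'.le]; congr 1; field_simp
  rw [e1, add_mul]
  by_cases hs : |s| ≤ 2 * B * ρ'
  · refine le_trans ?_ le_self_add
    have : 1 ≤ ENNReal.ofReal ((1 + 2 * B) ^ F) * ENNReal.ofReal (((1 + |s| / ρ') ^ F)⁻¹) := by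
      rw [← ENNReal.ofReal_mul (by positivity), ENNReal.one_le_ofReal,
        ← div_eq_mul_inv, one_le_div (by positivity)]
      gcongr
      rw [div_le_iff₀ hρ']; exact hs
    rw [mul_assoc]
    calc _ ≤ ∫⁻ b, v F ρ (s + b) := setLIntegral_le_lintegral _ _
      _ = ∫⁻ b, v F ρ b := lintegral_add_left_eq_self (fun b => v F ρ b) s
      _ ≤ Cv * 1 := by rw [mul_one]; exact lintegral_v hF hρ
      _ ≤ _ := by gcongr
  · push Not at hs
    refine le_trans ?_ le_add_self
    have key : ∀ b ∈ Set.Icc (-(B * ρ')) (B * ρ'),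
        v F ρ (s + b) ≤ ENNReal.ofReal (ρ'⁻¹ * 4 ^ F * ((1 + |s| / ρ') ^ F)⁻¹) := by
      intro b hb
      have hb' : |b| ≤ B * ρ' := abs_le.2 hb
      have h1 : |s| / 2 ≤ |s + b| := by
        have := abs_sub_abs_le_abs_sub s (-b)
        rw [abs_neg, sub_neg_eq_add] at this
        linarith
      unfold v vr
      apply ENNReal.ofReal_le_ofReal
      rw [← mul_inv, ← div_eq_mul_inv, ← one_div, div_le_div_iff₀ (by have := one_le_br (s+b) hρ; positivity) (by positivity), ]
      obtain ⟨m, rfl⟩ : ∃ m, F = m + 1 := ⟨F - 1, by omega⟩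
      have h2 : (1 + |s| / ρ') ≤ 4 * (1 + |s + b| / ρ) := by
        have : |s| / ρ' ≤ |s| / ρ := by gcongr
        have : |s| / ρ ≤ 2 * (|s + b| / ρ) := by rw [mul_div_assoc']; gcongr; linarith
        have := one_le_br (s + b) hρ
        linarith
      have h3 : ρ' * (1 + |s| / ρ') ≤ 4 * (ρ * (1 + |s + b| / ρ)) := by
        have a1 : ρ' * (1 + |s| / ρ') = ρ' + |s| := by field_simp
        have a2 : ρ * (1 + |s + b| / ρ) = ρ + |s + b| := by field_simp
        rw [a1, a2]
        nlinarith
      calc 1 * (1 + |s| / ρ') ^ (m + 1) = ρ'⁻¹ * ((1 + |s| / ρ') ^ m * (ρ' * (1 + |s| / ρ'))) := by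
            generalize 1 + |s| / ρ' = X
            field_simp
            ring
        _ ≤ ρ'⁻¹ * ((4 * (1 + |s + b| / ρ)) ^ m * (4 * (ρ * (1 + |s + b| / ρ)))) := by
            gcongr
        _ = _ := by rw [mul_pow]; ring
    calc _ ≤ ∫⁻ b in Set.Icc (-(B * ρ')) (B * ρ'),
          ENNReal.ofReal (ρ'⁻¹ * 4 ^ F * ((1 + |s| / ρ') ^ F)⁻¹) :=
          setLIntegral_mono (by fun_prop) key
      _ = ENNReal.ofReal (ρ'⁻¹ * 4 ^ F * ((1 + |s| / ρ') ^ F)⁻¹) * ENNReal.ofReal (2 * (B * ρ')) := by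
          rw [setLIntegral_const, vol_Icc_sym]
      _ ≤ _ := by
          rw [← ENNReal.ofReal_mul (by positivity), ← ENNReal.ofReal_mul (by positivity)]
          apply ENNReal.ofReal_le_ofReal
          apply le_of_eq; field_simp

lemma v_avg2 (F : ℕ) {B : ℝ} (hB : 1 ≤ B) {ρ' L : ℝ} (hρ : 0 < ρ') (h : ρ' ≤ L) (s : ℝ) :
    ∫⁻ b in Set.Icc (-(B * ρ')) (B * ρ'), v F L (s + b) ≤
      ENNReal.ofReal (2 * B * (1 + B) ^ F) * (ENNReal.ofReal ρ' * v F L s) := by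
  have hL : 0 < L := hρ.trans_le h
  calc _ ≤ ∫⁻ b in Set.Icc (-(B * ρ')) (B * ρ'), ENNReal.ofReal ((1 + B) ^ F) * v F L s := by
        refine setLIntegral_mono (by fun_prop) fun b hb => (v_shift F hL s b).trans ?_
        gcongr
        rw [div_le_iff₀ hL]
        exact (abs_le.2 hb).trans (by gcongr)
    _ = _ := by
        rw [setLIntegral_const, vol_Icc_sym, mul_right_comm, ← mul_assoc (ENNReal.ofReal (2 * B * (1 + B) ^ F))]
        congr 1
        rw [← ENNReal.ofReal_mul (by positivity), ← ENNReal.ofReal_mul (by positivity)]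
        congr 1; ring

lemma Ph_smul (e : Fin (d + 1) → V d) (r : ℝ) (s : Fin (d + 1) → ℝ) : Ph e r s = r • Ph e 1 s := by
  unfold Ph
  rw [Finset.smul_sum]
  refine Finset.sum_congr rfl fun i _ => ?_
  rw [smul_smul, one_mul]

lemma norm_Ph_le (e : Fin (d + 1) → V d) {G : ℝ} (he : ∀ i, ‖e i‖ ≤ G) {s : Fin (d + 1) → ℝ}
    (hs : ∀ i, s i ∈ Set.Icc (-(1 / 2) : ℝ) (1 / 2)) : ‖Ph e 1 s‖ ≤ (d + 1) * G := by
  unfold Ph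
  refine (norm_sum_le _ _).trans ?_
  calc _ ≤ ∑ i : Fin (d + 1), G := by
        refine Finset.sum_le_sum fun i _ => ?_
        rw [norm_smul, one_mul]
        have h1 : ‖s i‖ ≤ 1 := by
          rw [Real.norm_eq_abs, abs_le]; constructor <;> linarith [(hs i).1, (hs i).2]
        nlinarith [norm_nonneg (e i), he i, norm_nonneg (s i)]
    _ = _ := by simp

/-- averaging a function over a parallelepiped, by the integral over a sup-ball -/
lemma Ph_avg (e : Fin (d + 1) → V d) {G c : ℝ} (he : ∀ i, ‖e i‖ ≤ G) (hc : 0 < c)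
    (hdet : c ≤ |Matrix.det (Matrix.of fun i => cc (e i))|) {f : V d → ℝ≥0∞} (hf : Measurable f)
    {r : ℝ} (hr : 0 < r) :
    ∫⁻ s, f (Ph e r s) ∂μQ (d + 1) ≤
      ENNReal.ofReal (c⁻¹) * (ENNReal.ofReal (r⁻¹ ^ (d + 1)) *
        ∫⁻ a, ({a : V d | ‖a‖ ≤ (d + 1) * G * r}).indicator f a) := by
  have hS : MeasurableSet {a : V d | ‖a‖ ≤ (d + 1) * G * r} :=
    measurableSet_le measurable_norm measurable_const
  set h : V d → ℝ≥0∞ := ({a : V d | ‖a‖ ≤ (d + 1) * G * r}).indicator f with hh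
  have hhm : Measurable h := hf.indicator hS
  have hd0 : Matrix.det (Matrix.of fun i => cc (e i)) ≠ 0 := by
    intro h0; rw [h0, abs_zero] at hdet; linarith
  calc _ ≤ ∫⁻ s, h (r • Ph e 1 s) ∂μQ (d + 1) := by
        apply lintegral_mono_ae
        filter_upwards [μQ_ae (d + 1)] with s hs
        rw [← Ph_smul, hh, Set.indicator_of_mem]
        change ‖_‖ ≤ _
        rw [Ph_smul, norm_smul, Real.norm_eq_abs, abs_of_pos hr, mul_comm]
        gcongr
        exact norm_Ph_le e he hs
    _ ≤ ∫⁻ s, h (r • Ph e 1 s) := by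
        rw [μQ_eq]; exact setLIntegral_le_lintegral _ _
    _ = ENNReal.ofReal |(Matrix.det (Matrix.of fun i => cc (e i)))⁻¹| * ∫⁻ x, h (r • x) :=
        lintegral_Ph e hd0 (f := fun x => h (r • x)) (by fun_prop)
    _ = ENNReal.ofReal |(Matrix.det (Matrix.of fun i => cc (e i)))⁻¹| *
          (ENNReal.ofReal (r⁻¹ ^ (d + 1)) * ∫⁻ x, h x) := by
        rw [← lintegral_dil hhm (inv_pos.2 hr), inv_inv]
    _ ≤ _ := by
        gcongr
        rw [abs_inv]
        gcongr

lemma I4 (F : ℕ) (hF : 2 ≤ F) {G G' c : ℝ} (hG : 0 ≤ G) (hG' : 1 ≤ G') (hc : 0 < c) :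
    ∃ C : ℝ≥0, ∀ (g : Fin d → ℝ) (e : Fin (d + 1) → V d) (ρ ρ' L : ℝ), (∀ i, |g i| ≤ G) →
      (∀ i, ‖e i‖ ≤ G') → c ≤ |Matrix.det (Matrix.of fun i => cc (e i))| → 0 < ρ → ρ ≤ ρ' →
      ρ' ≤ L → ∀ x, ∫⁻ s, W F g ρ L (x + Ph e ρ' s) ∂μQ (d + 1) ≤ C * W F g ρ' L x := by
  set B : ℝ := (1 + G) * ((d + 1) * G') with hBdef
  have hB : 1 ≤ B := by
    have : (1:ℝ) ≤ (d + 1) * G' := by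
      have : (0:ℝ) ≤ d := by positivity
      nlinarith
    nlinarith
  have hB2 : (d + 1) * G' ≤ B := by
    have : (0:ℝ) ≤ (d + 1) * G' := by positivity
    nlinarith
  set K : ℝ≥0∞ := (Cv * ENNReal.ofReal ((1 + 2 * B) ^ F) + ENNReal.ofReal (2 * B * 4 ^ F)) with hK
  have hKt : K ≠ ∞ := by
    rw [hK]
    exact ENNReal.add_ne_top.2 ⟨ENNReal.mul_ne_top Cv_lt_top.ne ENNReal.ofReal_ne_top, ENNReal.ofReal_ne_top⟩
  set K2 : ℝ≥0∞ := ENNReal.ofReal (2 * B * (1 + B) ^ F) with hK2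
  have hC : ENNReal.ofReal c⁻¹ * (K ^ d * K2) ≠ ∞ :=
    ENNReal.mul_ne_top ENNReal.ofReal_ne_top
      (ENNReal.mul_ne_top (ENNReal.pow_ne_top hKt) ENNReal.ofReal_ne_top)
  refine ⟨(ENNReal.ofReal c⁻¹ * (K ^ d * K2)).toNNReal, ?_⟩
  intro g e ρ ρ' L hg he hdet hρ h1 h2 x
  have hρ' : 0 < ρ' := hρ.trans_le h1
  rw [ENNReal.coe_toNNReal hC]
  refine (Ph_avg e he hc hdet (f := fun a => W F g ρ L (x + a)) (by fun_prop) hρ').trans ?_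
  have step : ∫⁻ a, ({a : V d | ‖a‖ ≤ (d + 1) * G' * ρ'}).indicator (fun a => W F g ρ L (x + a)) a
      ≤ K ^ d * K2 * (ENNReal.ofReal (ρ' ^ (d + 1)) * W F g ρ' L x) := by
    set I : Set ℝ := Set.Icc (-(B * ρ')) (B * ρ') with hI
    calc _ ≤ ∫⁻ a : V d, (∏ i, I.indicator (fun b => v F ρ ((x.1 i + g i * x.2) + b)) (a.1 i + g i * a.2)) *
          I.indicator (fun b => v F L (x.2 + b)) a.2 := by
          refine lintegral_mono fun a => ?_
          dsimp only
          by_cases ha : ‖a‖ ≤ (d + 1) * G' * ρ'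
          swap
          · rw [Set.indicator_of_notMem (by exact ha)]; exact bot_le
          rw [Set.indicator_of_mem (by exact ha)]
          have m1 : ∀ i, a.1 i + g i * a.2 ∈ I := fun i => by
            rw [hI, Set.mem_Icc, ← abs_le]
            refine (abs_shear_le hg a i).trans ?_
            rw [hBdef, mul_assoc]
            gcongr
          have m2 : a.2 ∈ I := by
            rw [hI, Set.mem_Icc, ← abs_le]
            exact (abs_snd_le a).trans (ha.trans (by gcongr))
          rw [Set.indicator_of_mem m2]
          rw [Finset.prod_congr rfl fun i _ => Set.indicator_of_mem (m1 i) _]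
          unfold W
          apply le_of_eq
          congr 1
          refine Finset.prod_congr rfl fun i _ => ?_
          congr 1
          simp only [Prod.fst_add, Prod.snd_add, Pi.add_apply]; ring
      _ = (∏ i, ∫⁻ s, I.indicator (fun b => v F ρ ((x.1 i + g i * x.2) + b)) s) *
            ∫⁻ s, I.indicator (fun b => v F L (x.2 + b)) s := by
          apply lintegral_shear
          · intro i; exact Measurable.indicator (by fun_prop) measurableSet_Icc
          · exact Measurable.indicator (by fun_prop) measurableSet_Icc
      _ ≤ (∏ i, K * (ENNReal.ofReal ρ' * v F ρ' (x.1 i + g i * x.2))) *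
            (K2 * (ENNReal.ofReal ρ' * v F L x.2)) := by
          simp only [lintegral_indicator measurableSet_Icc, hI]
          gcongr with i
          · exact v_avg hF hB hρ h1 _
          · exact v_avg2 F hB hρ' h2 _
      _ = _ := by
          unfold W
          rw [Finset.prod_mul_distrib, Finset.prod_mul_distrib, Finset.prod_const, Finset.prod_const,
            Finset.card_univ, Fintype.card_fin, ENNReal.ofReal_pow hρ'.le]
          ring
  calc _ ≤ ENNReal.ofReal c⁻¹ * (ENNReal.ofReal (ρ'⁻¹ ^ (d + 1)) *
        (K ^ d * K2 * (ENNReal.ofReal (ρ' ^ (d + 1)) * W F g ρ' L x))) := by gcongr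
    _ = (ENNReal.ofReal (ρ'⁻¹ ^ (d + 1)) * ENNReal.ofReal (ρ' ^ (d + 1))) *
          (ENNReal.ofReal c⁻¹ * (K ^ d * K2) * W F g ρ' L x) := by ring
    _ = _ := by
        rw [← ENNReal.ofReal_mul (by positivity), ← mul_pow, inv_mul_cancel₀ hρ'.ne', one_pow,
          ENNReal.ofReal_one, one_mul]

/-- the building block of the multilinear Kakeya iteration -/
def Hk {ι : Type*} (F : ℕ) (r : ℝ) (T : Finset ι) (gv : ι → Fin d → ℝ) (g : ι → V d → ℝ≥0∞)
    (ρ L : ℝ) (x : V d) : ℝ≥0∞ := (∑ J ∈ T, cv (g J) (W F (gv J) ρ L) x ^ (1 / r)) ^ r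

lemma Hk_meas {ι : Type*} (F : ℕ) (r : ℝ) (T : Finset ι) (gv : ι → Fin d → ℝ)
    {g : ι → V d → ℝ≥0∞} (hg : ∀ J, Measurable (g J)) (ρ L : ℝ) :
    Measurable (Hk F r T gv g ρ L) := by
  unfold Hk
  refine Measurable.pow_const (Finset.measurable_sum _ fun J _ => Measurable.pow_const ?_ _) _
  have := hg J
  fun_prop

lemma sum_rpow_const {ι : Type*} {r : ℝ} (hr : 0 < r) (T : Finset ι) (c : ℝ≥0∞) (a : ι → ℝ≥0∞) :
    (∑ J ∈ T, (c * a J) ^ (1 / r)) ^ r = c * (∑ J ∈ T, (a J) ^ (1 / r)) ^ r := by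
  have : ∀ J, (c * a J) ^ (1 / r) = c ^ (1 / r) * (a J) ^ (1 / r) := fun J =>
    ENNReal.mul_rpow_of_nonneg _ _ (by positivity)
  simp only [this, ← Finset.mul_sum]
  rw [ENNReal.mul_rpow_of_nonneg _ _ hr.le, rpow_inv_rpow' _ hr.ne']

/-- One step of the Kakeya iteration. -/
lemma K1 (hd : 1 ≤ d) (F : ℕ) (hF : 2 ≤ F) {G G' c K : ℝ} (hG : 0 ≤ G) (hG' : 1 ≤ G') (hc : 0 < c)
    (hK : 1 ≤ K) {σ r : ℝ} (hσ : 0 < σ) (hσd : σ * d ≤ 1) (hr : 1 ≤ r) :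
    ∃ C : ℝ≥0, 1 ≤ C ∧ ∀ {ι : Type} (e : Fin (d + 1) → V d) (T : Fin (d + 1) → Finset ι)
      (gv : ι → Fin d → ℝ) (g : ι → V d → ℝ≥0∞) (Lam l ρ L : ℝ),
      (∀ i, ‖e i‖ ≤ G') → (∀ i, (e i).2 = 1) →
      c ≤ |Matrix.det (Matrix.of fun i => cc (e i))| →
      (∀ i, ∀ J ∈ T i, ∀ k, |gv J k| ≤ G) →
      (∀ i, ∀ J ∈ T i, ∀ k, |(e i).1 k + gv J k| * Lam ≤ K) →
      (∀ J, Measurable (g J)) → 0 < ρ → 1 ≤ l → l ≤ Lam → l * ρ ≤ L →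
      ∫⁻ x, ∏ i, Hk F r (T i) gv g ρ L x ^ σ ≤
        C * ∫⁻ x, ∏ i, Hk F r (T i) gv g (l * ρ) L x ^ σ := by
  obtain ⟨C1, hC1⟩ := I4 (d := d) F hF hG hG' hc
  have h0 : 0 < r := by linarith
  set C0 : ℝ≥0 := Real.toNNReal ((1 + K) ^ (F * (d + 1))) with hC0
  set CC : ℝ≥0∞ := (((C0 : ℝ≥0∞) ^ σ) ^ (d + 1) * ((d + 1 : ℕ) : ℝ≥0∞) ^ (((d + 1 : ℕ) : ℝ) / d)) *
    ((C1 : ℝ≥0∞) ^ σ) ^ (d + 1) with hCC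
  have hCCt : CC ≠ ∞ := by
    refine ENNReal.mul_ne_top (ENNReal.mul_ne_top (ENNReal.pow_ne_top ?_) ?_) (ENNReal.pow_ne_top ?_)
    · exact ENNReal.rpow_ne_top_of_nonneg hσ.le ENNReal.coe_ne_top
    · exact ENNReal.rpow_ne_top_of_nonneg (by positivity) (ENNReal.natCast_ne_top _)
    · exact ENNReal.rpow_ne_top_of_nonneg hσ.le ENNReal.coe_ne_top
  refine ⟨max 1 CC.toNNReal, le_max_left _ _, ?_⟩
  intro ι e T gv g Lam l ρ L he he2 hdet hgv hK' hg hρ hl hlL hL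
  have hlρ : 0 < l * ρ := by positivity
  have hL0 : 0 < L := hlρ.trans_le hL
  have step1 := kak1 hd e hlρ (fun i => Hk F r (T i) gv g ρ L) (fun i => Hk_meas F r (T i) gv hg ρ L)
    hσ hσd C0 (by
      intro i x s hs
      unfold Hk
      rw [← sum_rpow_const h0]
      gcongr with J hJ
      rw [cv_comm, cv_comm (g J)]
      unfold cv
      rw [← lintegral_const_mul _ (by fun_prop)]
      refine lintegral_mono fun y => ?_
      dsimp only
      rw [← mul_assoc]
      gcongr
      rw [show x + s • e i - y = (x - y) + s • e i by abel]
      refine (W_shift F (gv J) hρ hL0 _ _).trans ?_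
      gcongr
      have f1 : ∀ k, (1 + |(s • e i).1 k + gv J k * (s • e i).2| / ρ) ^ F ≤ (1 + K) ^ F := by
        intro k
        gcongr
        rw [div_le_iff₀ hρ]
        have : (s • e i).1 k + gv J k * (s • e i).2 = s * ((e i).1 k + gv J k) := by
          simp [he2]; ring
        rw [this, abs_mul]
        have h1 := hK' i J hJ k
        have h2 : |(e i).1 k + gv J k| * l ≤ K := le_trans (by gcongr) h1
        calc _ ≤ (l * ρ) * |(e i).1 k + gv J k| := by gcongr
          _ = (|(e i).1 k + gv J k| * l) * ρ := by ring
          _ ≤ _ := by gcongr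
      have f2 : (1 + |(s • e i).2| / L) ^ F ≤ (1 + K) ^ F := by
        gcongr
        rw [div_le_iff₀ hL0]
        simp only [Prod.smul_snd, he2, smul_eq_mul, mul_one]
        calc _ ≤ l * ρ := hs
          _ ≤ 1 * L := by linarith
          _ ≤ _ := by gcongr
      calc _ ≤ (∏ k : Fin d, ENNReal.ofReal ((1 + K) ^ F)) * ENNReal.ofReal ((1 + K) ^ F) := by
            refine mul_le_mul' (Finset.prod_le_prod' fun k _ => ENNReal.ofReal_le_ofReal (f1 k))
              (ENNReal.ofReal_le_ofReal f2)
        _ = _ := by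
            rw [Finset.prod_const, Finset.card_univ, Fintype.card_fin, ← pow_succ,
              ← ENNReal.ofReal_pow (by positivity), ← pow_mul]
            rfl)
  refine step1.trans ?_
  have step2 : ∀ x i, (∫⁻ s, Hk F r (T i) gv g ρ L (x + Ph e (l * ρ) s) ∂(μQ (d + 1))) ≤
      C1 * Hk F r (T i) gv g (l * ρ) L x := by
    intro x i
    have hm : ∀ J, Measurable fun s => cv (g J) (W F (gv J) ρ L) (x + Ph e (l * ρ) s) := by
      intro J
      have h1 : Measurable (cv (g J) (W F (gv J) ρ L)) := by have := hg J; fun_prop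
      exact h1.comp (by fun_prop)
    have := N_sum_le (μ := μQ (d + 1)) hr (T i)
      (F := fun J s => cv (g J) (W F (gv J) ρ L) (x + Ph e (l * ρ) s) ^ (1 / r))
      (fun J => (hm J).pow_const _)
    have h2 := ENNReal.rpow_le_rpow this h0.le
    rw [N_rpow_self h0] at h2
    refine h2.trans ?_
    unfold Hk
    rw [← sum_rpow_const h0]
    gcongr with J hJ
    unfold N
    gcongr
    simp only [rpow_inv_rpow' _ h0.ne']
    have e1 : ∀ z, cv (g J) (W F (gv J) ρ L) z = ∫⁻ y, W F (gv J) ρ L (z - y) * g J y := fun z => by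
      rw [cv_comm]; rfl
    have hgJ := hg J
    simp only [e1]
    rw [lintegral_lintegral_swap (by fun_prop), cv_comm]
    unfold cv
    rw [← lintegral_const_mul _ (by fun_prop)]
    refine lintegral_mono fun y => ?_
    dsimp only
    rw [lintegral_mul_const _ (by fun_prop), ← mul_assoc]
    gcongr
    have := hC1 (gv J) e ρ (l * ρ) L (hgv i J hJ) he hdet hρ (by nlinarith) hL (x - y)
    refine le_trans (le_of_eq ?_) this
    congr 1; ext s; congr 1; abel
  calc _ ≤ (((C0 : ℝ≥0∞) ^ σ) ^ (d + 1) * ((d + 1 : ℕ) : ℝ≥0∞) ^ (((d + 1 : ℕ) : ℝ) / d)) *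
        ∫⁻ x, ((C1 : ℝ≥0∞) ^ σ) ^ (d + 1) * ∏ i, (Hk F r (T i) gv g (l * ρ) L x) ^ σ := by
        gcongr with x
        calc _ ≤ ∏ i, (C1 * Hk F r (T i) gv g (l * ρ) L x) ^ σ := by
              gcongr with i
              exact step2 x i
          _ = _ := by
              simp only [ENNReal.mul_rpow_of_nonneg _ _ hσ.le]
              rw [Finset.prod_mul_distrib, Finset.prod_const, Finset.card_univ, Fintype.card_fin]
    _ = CC * ∫⁻ x, ∏ i, (Hk F r (T i) gv g (l * ρ) L x) ^ σ := by
        rw [lintegral_const_mul, hCC, ← mul_assoc]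
        exact Finset.measurable_prod _ fun i _ => (Hk_meas F r (T i) gv hg _ L).pow_const _
    _ ≤ _ := by
        gcongr
        rw [← ENNReal.coe_toNNReal hCCt]
        exact_mod_cast le_max_right _ _

/-- Iterated Kakeya. -/
lemma Kit (hd : 1 ≤ d) (F : ℕ) (hF : 2 ≤ F) {G G' c K : ℝ} (hG : 0 ≤ G) (hG' : 1 ≤ G') (hc : 0 < c)
    (hK : 1 ≤ K) {σ r : ℝ} (hσ : 0 < σ) (hσd : σ * d ≤ 1) (hr : 1 ≤ r) :
    ∃ C : ℝ≥0, 1 ≤ C ∧ ∀ {ι : Type} (e : Fin (d + 1) → V d) (T : Fin (d + 1) → Finset ι)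
      (gv : ι → Fin d → ℝ) (g : ι → V d → ℝ≥0∞) (Lam L : ℝ),
      (∀ i, ‖e i‖ ≤ G') → (∀ i, (e i).2 = 1) →
      c ≤ |Matrix.det (Matrix.of fun i => cc (e i))| →
      (∀ i, ∀ J ∈ T i, ∀ k, |gv J k| ≤ G) →
      (∀ i, ∀ J ∈ T i, ∀ k, |(e i).1 k + gv J k| * Lam ≤ K) →
      (∀ J, Measurable (g J)) → 1 ≤ Lam → ∀ (n : ℕ) (ρ ρ' : ℝ), 0 < ρ → ρ ≤ ρ' →
      ρ' ≤ Lam ^ n * ρ → ρ' ≤ L →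
      ∫⁻ x, ∏ i, Hk F r (T i) gv g ρ L x ^ σ ≤
        (C : ℝ≥0∞) ^ n * ∫⁻ x, ∏ i, Hk F r (T i) gv g ρ' L x ^ σ := by
  obtain ⟨C, hC1, hC⟩ := K1 hd F hF hG hG' hc hK hσ hσd hr
  refine ⟨C, hC1, ?_⟩
  intro ι e T gv g Lam L he he2 hdet hgv hK' hg hLam n
  induction n with
  | zero =>
    intro ρ ρ' _ h1 h2 _
    rw [pow_zero, one_mul] at h2
    rw [le_antisymm h2 h1, pow_zero, one_mul]
  | succ n ih =>
    intro ρ ρ' hρ h1 h2 h3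
    set l := min Lam (ρ' / ρ) with hl
    have e1 : l * ρ = min (Lam * ρ) ρ' := by
      rw [hl, min_mul_of_nonneg _ _ hρ.le, div_mul_cancel₀ _ hρ.ne']
    have hl1 : 1 ≤ l := le_min hLam (by rw [le_div_iff₀ hρ]; linarith)
    have s1 := hC e T gv g Lam l ρ L he he2 hdet hgv hK' hg hρ hl1 (min_le_left _ _)
      (by rw [e1]; exact (min_le_right _ _).trans h3)
    have s2 := ih (l * ρ) ρ' (by positivity) (by rw [e1]; exact min_le_right _ _) (by
      rw [e1]
      rcases le_total (Lam * ρ) ρ' with h | h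
      · rw [min_eq_left h]; rw [pow_succ, mul_assoc] at h2; exact h2
      · rw [min_eq_right h]
        have : 1 ≤ Lam ^ n := one_le_pow₀ hLam
        nlinarith) h3
    refine s1.trans ?_
    rw [pow_succ', mul_assoc]
    gcongr

end DR

namespace DR

open Filter Topology
open scoped ENNReal NNReal

variable {d : ℕ}

/-- L^p norm -/
def nrm (p : ℝ) (f : V d → ℂ) : ℝ≥0∞ := N p volume (fun x => ‖f x‖ₑ)

def bil (M : Fin d → Fin d → ℝ) (x y : Fin d → ℝ) : ℝ := ∑ i, ∑ j, M i j * x i * y j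

def Mv (M : Fin d → Fin d → ℝ) (x : Fin d → ℝ) (i : Fin d) : ℝ := ∑ j, M i j * x j

structure QM (Lam : ℝ) (M : Fin d → Fin d → ℝ) : Prop where
  symm : ∀ i j, M i j = M j i
  coer : ∀ x : Fin d → ℝ, ∑ i, x i ^ 2 ≤ bil M x x
  bd : ∀ i j, |M i j| ≤ Lam

lemma bil_add_left (M : Fin d → Fin d → ℝ) (x x' y : Fin d → ℝ) :
    bil M (x + x') y = bil M x y + bil M x' y := by
  unfold bil
  simp only [← Finset.sum_add_distrib, Pi.add_apply]
  refine Finset.sum_congr rfl fun i _ => Finset.sum_congr rfl fun j _ => by ring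

lemma bil_add_right (M : Fin d → Fin d → ℝ) (x y y' : Fin d → ℝ) :
    bil M x (y + y') = bil M x y + bil M x y' := by
  unfold bil
  simp only [← Finset.sum_add_distrib, Pi.add_apply]
  refine Finset.sum_congr rfl fun i _ => Finset.sum_congr rfl fun j _ => by ring

lemma bil_smul (M : Fin d → Fin d → ℝ) (c : ℝ) (x y : Fin d → ℝ) :
    bil M (c • x) (c • y) = c ^ 2 * bil M x y := by
  unfold bil
  simp only [Finset.mul_sum, Pi.smul_apply, smul_eq_mul]
  refine Finset.sum_congr rfl fun i _ => Finset.sum_congr rfl fun j _ => by ring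

lemma bil_eq_Mv (M : Fin d → Fin d → ℝ) (x y : Fin d → ℝ) :
    bil M x y = ∑ i, x i * Mv M y i := by
  unfold bil Mv
  refine Finset.sum_congr rfl fun i _ => ?_
  rw [Finset.mul_sum]
  exact Finset.sum_congr rfl fun j _ => by ring

lemma bil_symm {Lam : ℝ} {M : Fin d → Fin d → ℝ} (hM : QM Lam M) (x y : Fin d → ℝ) :
    bil M x y = bil M y x := by
  unfold bil
  rw [Finset.sum_comm]
  refine Finset.sum_congr rfl fun i _ => Finset.sum_congr rfl fun j _ => by
    rw [hM.symm j i]; ring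

/-- expansion around a point -/
lemma bil_expand {Lam : ℝ} {M : Fin d → Fin d → ℝ} (hM : QM Lam M) (x c : Fin d → ℝ) :
    bil M (x + c) (x + c) = bil M x x + 2 * ∑ i, x i * Mv M c i + bil M c c := by
  rw [bil_add_left, bil_add_right, bil_add_right, bil_symm hM c x, ← bil_eq_Mv]
  ring

lemma abs_Mv_le {Lam : ℝ} {M : Fin d → Fin d → ℝ} (hM : QM Lam M) {x : Fin d → ℝ} {A : ℝ}
    (hx : ∀ i, |x i| ≤ A) (i : Fin d) : |Mv M x i| ≤ d * (Lam * A) := by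
  unfold Mv
  refine (Finset.abs_sum_le_sum_abs _ _).trans ?_
  calc _ ≤ ∑ j : Fin d, Lam * A := by
        refine Finset.sum_le_sum fun j _ => ?_
        rw [abs_mul]
        have := hM.bd i j
        have := hx j
        have := abs_nonneg (M i j)
        gcongr
        linarith
    _ = _ := by simp

lemma abs_bil_le {Lam : ℝ} {M : Fin d → Fin d → ℝ} (hM : QM Lam M) {x : Fin d → ℝ} {A : ℝ}
    (hx : ∀ i, |x i| ≤ A) : |bil M x x| ≤ d * (A * (d * (Lam * A))) := by
  rw [bil_eq_Mv]
  refine (Finset.abs_sum_le_sum_abs _ _).trans ?_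
  calc _ ≤ ∑ j : Fin d, A * (d * (Lam * A)) := by
        refine Finset.sum_le_sum fun j _ => ?_
        rw [abs_mul]
        have := abs_Mv_le hM hx j
        have := hx j
        have := abs_nonneg (x j)
        gcongr
        linarith
    _ = _ := by simp

def box (M : Fin d → Fin d → ℝ) (l : Fin d → ℝ) (κ : ℝ) (k : ℕ) (z : Fin d → ℤ) : Set (V d) :=
  {v | (∀ i, |v.1 i - z i / 2 ^ k| ≤ 2 / 2 ^ k) ∧
    |v.2 - (bil M v.1 v.1 + ∑ i, l i * v.1 i + κ)| ≤ 1 / 4 ^ k}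

def Dec (d : ℕ) (Lam p : ℝ) (k : ℕ) (D : ℝ≥0∞) : Prop :=
  ∀ M : Fin d → Fin d → ℝ, QM Lam M → ∀ (l : Fin d → ℝ) (κ : ℝ) (P : Fin d → ℤ)
    (T : Finset (Fin d → ℤ)), (∀ z ∈ T, ∀ i, z i / 2 ^ k = P i) →
    ∀ f : (Fin d → ℤ) → V d → ℂ, (∀ z ∈ T, FS (box M l κ k z) (f z)) →
    nrm p (fun x => ∑ z ∈ T, f z x) ≤ D * l2 T (fun z => nrm p (f z))

def DecN (d : ℕ) (Lam p : ℝ) (k : ℕ) (D : ℝ≥0∞) : Prop :=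
  ∀ M : Fin d → Fin d → ℝ, QM Lam M →
    ∀ (T : Finset (Fin d → ℤ)), (∀ z ∈ T, ∀ i, z i / 2 ^ k = 0) →
    ∀ f : (Fin d → ℤ) → V d → ℂ, (∀ z ∈ T, FS (box M 0 0 k z) (f z)) →
    nrm p (fun x => ∑ z ∈ T, f z x) ≤ D * l2 T (fun z => nrm p (f z))

lemma nrm_congr {p : ℝ} {f g : V d → ℂ} (h : ∀ x, ‖f x‖ₑ = ‖g x‖ₑ) : nrm p f = nrm p g := by
  unfold nrm; congr 1; ext x; exact h x

lemma nrm_comp {p : ℝ} (hp : 0 < p) (A : V d ≃ₗ[ℝ] V d) :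
    ∃ c : ℝ≥0∞, c ≠ 0 ∧ c ≠ ∞ ∧ ∀ f : V d → ℂ, Measurable f → nrm p (fun x => f (A x)) = c * nrm p f := by
  have hdet : LinearMap.det (A : V d →ₗ[ℝ] V d) ≠ 0 := (LinearEquiv.isUnit_det' A).ne_zero
  refine ⟨ENNReal.ofReal |(LinearMap.det (A : V d →ₗ[ℝ] V d))⁻¹| ^ (1 / p), ?_, ?_, ?_⟩
  · have : 0 < |(LinearMap.det (A : V d →ₗ[ℝ] V d))⁻¹| := abs_pos.2 (inv_ne_zero hdet)
    have h2 : 0 < ENNReal.ofReal |(LinearMap.det (A : V d →ₗ[ℝ] V d))⁻¹| := ENNReal.ofReal_pos.2 this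
    exact (ENNReal.rpow_pos h2 ENNReal.ofReal_ne_top).ne'
  · exact ENNReal.rpow_ne_top_of_nonneg (by positivity) ENNReal.ofReal_ne_top
  · intro f hf
    unfold nrm N
    rw [← ENNReal.mul_rpow_of_nonneg _ _ (by positivity)]
    congr 1
    exact lintegral_comp_lin (A : V d →ₗ[ℝ] V d) hdet (f := fun x => ‖f x‖ₑ ^ p) (by fun_prop)

/-- transfer of a decoupling inequality through a linear change of variables and modulation -/
lemma transfer {ι : Type*} {p : ℝ} (hp : 0 < p) (A : V d ≃ₗ[ℝ] V d) (b : V d) (T : Finset ι)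
    (f : ι → V d → ℂ) (hf : ∀ z ∈ T, Measurable (f z)) (D : ℝ≥0∞)
    (h : nrm p (fun x => ∑ z ∈ T, ee (pr b x) * f z (A x)) ≤
      D * l2 T (fun z => nrm p (fun x => ee (pr b x) * f z (A x)))) :
    nrm p (fun x => ∑ z ∈ T, f z x) ≤ D * l2 T (fun z => nrm p (f z)) := by
  obtain ⟨c, hc0, hct, hc⟩ := nrm_comp (d := d) hp A
  have e1 : nrm p (fun x => ∑ z ∈ T, ee (pr b x) * f z (A x)) = c * nrm p (fun x => ∑ z ∈ T, f z x) := by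
    rw [← hc _ (Finset.measurable_sum _ hf)]
    refine nrm_congr fun x => ?_
    rw [← Finset.mul_sum, enorm_mul]
    have : ‖ee (pr b x)‖ₑ = 1 := by rw [← ofReal_norm, norm_ee]; simp
    rw [this, one_mul]
  have e2 : l2 T (fun z => nrm p (fun x => ee (pr b x) * f z (A x))) = c * l2 T (fun z => nrm p (f z)) := by
    rw [← l2_const_mul]
    unfold l2
    congr 1
    refine Finset.sum_congr rfl fun z hz => ?_
    congr 1
    dsimp only
    rw [← hc _ (hf z hz)]
    refine nrm_congr fun x => ?_
    rw [enorm_mul]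
    have : ‖ee (pr b x)‖ₑ = 1 := by rw [← ofReal_norm, norm_ee]; simp
    rw [this, one_mul]
  rw [e1, e2, mul_left_comm] at h
  exact (ENNReal.mul_le_mul_iff_right hc0 hct).1 h

/-- Galilean shear -/
def shr (γ : Fin d → ℝ) : V d ≃ₗ[ℝ] V d where
  toFun x := (x.1 - x.2 • γ, x.2)
  invFun x := (x.1 + x.2 • γ, x.2)
  map_add' x y := by ext <;> simp <;> ring
  map_smul' c x := by ext <;> simp; ring
  left_inv x := by ext <;> simp
  right_inv x := by ext <;> simp

/-- parabolic dilation -/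
def dil (r : ℝ) (hr : r ≠ 0) : V d ≃ₗ[ℝ] V d where
  toFun x := (r • x.1, r ^ 2 * x.2)
  invFun x := (r⁻¹ • x.1, (r ^ 2)⁻¹ * x.2)
  map_add' x y := by ext <;> simp <;> ring
  map_smul' c x := by ext <;> simp <;> ring
  left_inv x := by ext <;> simp [hr]
  right_inv x := by ext <;> simp [hr]

lemma l2_image {ι κ : Type*} [DecidableEq κ] (T : Finset ι) (φ : ι → κ) (hφ : Set.InjOn φ T) (F : κ → ℝ≥0∞) :
    l2 (T.image φ) F = l2 T (fun z => F (φ z)) := by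
  unfold l2
  rw [Finset.sum_image hφ]

lemma DecN_Dec {Lam p : ℝ} (hp : 0 < p) {k : ℕ} {D : ℝ≥0∞} (h : DecN d Lam p k D) :
    Dec d Lam p k D := by
  classical
  intro M hM l κ P T hT f hf
  set c : Fin d → ℝ := fun i => (P i : ℝ) with hc
  set γ : Fin d → ℝ := fun i => 2 * Mv M c i + l i with hγ
  set b : V d := (-c, bil M c c - κ) with hb
  refine transfer hp (shr γ) b T f (fun z hz => (hf z hz).meas) D ?_
  set φ : (Fin d → ℤ) → (Fin d → ℤ) := fun z i => z i - 2 ^ k * P i with hφ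
  have hinj : Function.Injective φ := by
    intro z z' hzz
    ext i
    have := congrFun hzz i
    simp only [hφ] at this
    linarith
  set ψ : (Fin d → ℤ) → (Fin d → ℤ) := fun z i => z i + 2 ^ k * P i with hψ
  have hψφ : ∀ z, ψ (φ z) = z := fun z => by ext i; simp [hφ, hψ]
  have := h M hM (T.image φ) (by
    intro z' hz' i
    obtain ⟨z, hz, rfl⟩ := Finset.mem_image.1 hz'
    have h1 := hT z hz i
    have : φ z i = z i + 2 ^ k * (-P i) := by simp only [hφ]; ring
    rw [this, Int.add_mul_ediv_left _ _ (by positivity), h1]; ring)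
    (fun z' x => ee (pr b x) * f (ψ z') (shr γ x)) (by
      intro z' hz'
      obtain ⟨z, hz, rfl⟩ := Finset.mem_image.1 hz'
      rw [hψφ]
      have h2 : FS {v : V d | b + v ∈ box M 0 0 k (φ z)} (fun x => f z (shr γ x)) := by
        refine (hf z hz).comp _ fun ξ hξ => ?_
        have e1 : ∀ x, pr ξ (shr γ x) = pr ((ξ.1, ξ.2 - ∑ i, ξ.1 i * γ i) : V d) x := by
          intro x
          simp only [pr, shr, LinearEquiv.coe_mk, LinearMap.coe_mk, AddHom.coe_mk, Pi.sub_apply,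
            Pi.smul_apply, smul_eq_mul, mul_sub, Finset.sum_sub_distrib, sub_mul, Finset.sum_mul]
          have : ∑ i, ξ.1 i * (x.2 * γ i) = ∑ i, ξ.1 i * γ i * x.2 :=
            Finset.sum_congr rfl fun i _ => by ring
          rw [this]; ring
        simp only [e1]
        refine FS.exp _ ?_
        have hξ' := hξ
        refine ⟨fun i => ?_, ?_⟩
        · have := hξ.1 i
          simp only [hb, hc, hφ, Prod.fst_add, Pi.add_apply, Pi.neg_apply]
          push_cast
          rw [show -(P i : ℝ) + ξ.1 i - (z i - 2 ^ k * P i) / 2 ^ k = ξ.1 i - z i / 2 ^ k by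
            field_simp; ring]
          exact this
        · have h3 := hξ.2
          have h4 := bil_expand hM (ξ.1 + -c) c
          rw [neg_add_cancel_right] at h4
          simp only [hb, Prod.fst_add, Prod.snd_add, Pi.zero_apply, zero_mul, Finset.sum_const_zero,
            add_zero]
          rw [add_comm (-c)]
          have h5 : ∑ i, (ξ.1 + -c) i * Mv M c i = ∑ i, ξ.1 i * Mv M c i - bil M c c := by
            rw [bil_eq_Mv, ← Finset.sum_sub_distrib]
            refine Finset.sum_congr rfl fun i _ => ?_
            simp; ring
          have h6 : ∑ i, ξ.1 i * γ i = 2 * ∑ i, ξ.1 i * Mv M c i + ∑ i, l i * ξ.1 i := by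
            rw [Finset.mul_sum, ← Finset.sum_add_distrib]
            refine Finset.sum_congr rfl fun i _ => ?_
            simp only [hγ]; ring
          rw [show bil M c c - κ + (ξ.2 - ∑ i, ξ.1 i * γ i) - bil M (ξ.1 + -c) (ξ.1 + -c) =
            ξ.2 - (bil M ξ.1 ξ.1 + ∑ i, l i * ξ.1 i + κ) by rw [h4, h5, h6]; ring]
          exact h3
      exact h2.exp_mul b (fun v hv => hv))
  rw [l2_image _ _ hinj.injOn] at this
  simp only [Finset.sum_image hinj.injOn, hψφ] at this
  exact this

lemma Dec_mono {Lam p : ℝ} {k : ℕ} {D D' : ℝ≥0∞} (h : Dec d Lam p k D) (hD : D ≤ D') :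
    Dec d Lam p k D' := by
  intro M hM l κ P T hT f hf
  exact (h M hM l κ P T hT f hf).trans (by gcongr)

/-- parabolic rescaling -/
lemma Dec_rescale {Lam p : ℝ} (hp : 0 < p) {k j : ℕ} (hj : j ≤ k) {D : ℝ≥0∞} (h : Dec d Lam p (k - j) D)
    {M : Fin d → Fin d → ℝ} (hM : QM Lam M) (l : Fin d → ℝ) (κ : ℝ) (J : Fin d → ℤ)
    (T : Finset (Fin d → ℤ)) (hT : ∀ z ∈ T, ∀ i, z i / 2 ^ (k - j) = J i)
    (f : (Fin d → ℤ) → V d → ℂ) (hf : ∀ z ∈ T, FS (box M l κ k z) (f z)) :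
    nrm p (fun x => ∑ z ∈ T, f z x) ≤ D * l2 T (fun z => nrm p (f z)) := by
  have h2 : (2 : ℝ) ^ j ≠ 0 := by positivity
  refine transfer hp (dil (2 ^ j) h2) 0 T f (fun z hz => (hf z hz).meas) D ?_
  refine h M hM (fun i => 2 ^ j * l i) (4 ^ j * κ) J T hT _ fun z hz => ?_
  refine FS.exp_mul (S := box M (fun i => 2 ^ j * l i) (4 ^ j * κ) (k - j) z) ?_ 0 (by simp)
  refine (hf z hz).comp _ fun ξ hξ => ?_
  have e1 : ∀ x, pr ξ (dil (2 ^ j) h2 x) = pr ((2 ^ j : ℝ) • ξ.1, 4 ^ j * ξ.2) x := by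
    intro x
    simp only [pr, dil, LinearEquiv.coe_mk, LinearMap.coe_mk, AddHom.coe_mk,
            Pi.smul_apply, smul_eq_mul]
    congr 1
    · exact Finset.sum_congr rfl fun i _ => by ring
    · rw [← pow_mul, mul_comm j 2, pow_mul]; norm_num; ring
  simp only [e1]
  refine FS.exp _ ?_
  have hk : (2 : ℝ) ^ k = 2 ^ j * 2 ^ (k - j) := by rw [← pow_add]; congr 1; omega
  have hk4 : (4 : ℝ) ^ k = 4 ^ j * 4 ^ (k - j) := by rw [← pow_add]; congr 1; omega
  refine ⟨fun i => ?_, ?_⟩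
  · have := hξ.1 i
    simp only [Pi.smul_apply, smul_eq_mul]
    have e2 : (2 : ℝ) ^ j * ξ.1 i - z i / 2 ^ (k - j) = 2 ^ j * (ξ.1 i - z i / 2 ^ k) := by
      rw [hk]; field_simp
    rw [e2, abs_mul, abs_of_pos (by positivity : (0:ℝ) < 2 ^ j)]
    calc _ ≤ (2 : ℝ) ^ j * (2 / 2 ^ k) := by gcongr
      _ = _ := by rw [hk]; field_simp
  · have := hξ.2
    simp only []
    rw [bil_smul]
    have e3 : ∑ i, 2 ^ j * l i * ((2 ^ j : ℝ) • ξ.1) i = 4 ^ j * ∑ i, l i * ξ.1 i := by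
      rw [Finset.mul_sum]
      refine Finset.sum_congr rfl fun i _ => ?_
      simp only [Pi.smul_apply, smul_eq_mul]
      rw [show (4 : ℝ) = 2 * 2 by norm_num, mul_pow]; ring
    rw [e3, show ((2 : ℝ) ^ j) ^ 2 = 4 ^ j by rw [← pow_mul, mul_comm, pow_mul]; norm_num]
    rw [show (4 : ℝ) ^ j * ξ.2 - (4 ^ j * bil M ξ.1 ξ.1 + 4 ^ j * ∑ i, l i * ξ.1 i + 4 ^ j * κ) =
      4 ^ j * (ξ.2 - (bil M ξ.1 ξ.1 + ∑ i, l i * ξ.1 i + κ)) by ring, abs_mul,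
      abs_of_pos (by positivity : (0:ℝ) < 4 ^ j)]
    calc _ ≤ (4 : ℝ) ^ j * (1 / 4 ^ k) := by gcongr
      _ = _ := by rw [hk4]; field_simp

/-- ancestor -/
def par (r : ℕ) (z : Fin d → ℤ) : Fin d → ℤ := fun i => z i / 2 ^ r

lemma par_par (r s : ℕ) (z : Fin d → ℤ) : par r (par s z) = par (r + s) z := by
  ext i
  simp only [par]
  rw [Int.ediv_ediv_of_nonneg (by positivity), ← pow_add, add_comm]

lemma par_zero (z : Fin d → ℤ) : par 0 z = z := by ext i; simp [par]

lemma par_le (r : ℕ) (z : Fin d → ℤ) (i : Fin d) :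
    (par r z i : ℝ) * 2 ^ r ≤ z i ∧ (z i : ℝ) + 1 ≤ (par r z i + 1) * 2 ^ r := by
  have h1 := Int.ediv_mul_le (z i) (show (2 : ℤ) ^ r ≠ 0 by positivity)
  have h2 := Int.lt_ediv_add_one_mul_self (z i) (show (0 : ℤ) < (2 : ℤ) ^ r by positivity)
  have h3 : z i + 1 ≤ (z i / 2 ^ r + 1) * 2 ^ r := h2
  exact ⟨by unfold par; exact_mod_cast h1, by unfold par; exact_mod_cast h3⟩

/-- cubes are contained in the (enlarged) ancestors -/
lemma box_par (M : Fin d → Fin d → ℝ) (l : Fin d → ℝ) (κ : ℝ) {k j : ℕ} (hj : j ≤ k) (z : Fin d → ℤ) :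
    box M l κ k z ⊆ box M l κ j (par (k - j) z) := by
  have hk : (2 : ℝ) ^ k = 2 ^ j * 2 ^ (k - j) := by rw [← pow_add]; congr 1; omega
  rintro v ⟨h1, h2⟩
  refine ⟨fun i => ?_, h2.trans ?_⟩
  · have h3 := par_le (k - j) z i
    have h4 := abs_le.1 (h1 i)
    have hp : (0:ℝ) < 2 ^ j := by positivity
    have hq : (0:ℝ) < 2 ^ (k - j) := by positivity
    have hq1 : (1:ℝ) ≤ 2 ^ (k - j) := one_le_pow₀ (by norm_num)
    have a1 : (par (k - j) z i : ℝ) / 2 ^ j ≤ z i / 2 ^ k := by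
      rw [hk, div_le_div_iff₀ hp (by positivity)]; nlinarith
    have a2 : (z i : ℝ) / 2 ^ k + 1 / 2 ^ k ≤ par (k - j) z i / 2 ^ j + 1 / 2 ^ j := by
      rw [← add_div, ← add_div, hk, div_le_div_iff₀ (by positivity) hp]; nlinarith
    have a3 : (1:ℝ) / 2 ^ k ≤ 1 / 2 ^ j := by
      gcongr; norm_num
    have a4 : (2:ℝ) / 2 ^ k = 1 / 2 ^ k + 1 / 2 ^ k := by ring
    have a5 : (2:ℝ) / 2 ^ j = 1 / 2 ^ j + 1 / 2 ^ j := by ring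
    rw [abs_le]
    constructor <;> linarith
  · gcongr; norm_num

/-- the piece of `f` associated with an ancestor -/
def fJ (T : Finset (Fin d → ℤ)) (f : (Fin d → ℤ) → V d → ℂ) (r : ℕ) (J : Fin d → ℤ) (x : V d) : ℂ :=
  ∑ z ∈ T.filter (fun z => par r z = J), f z x

lemma fJ_sum (T : Finset (Fin d → ℤ)) (f : (Fin d → ℤ) → V d → ℂ) (r : ℕ)
    (S : Finset (Fin d → ℤ)) (hS : ∀ z ∈ T, par r z ∈ S) (x : V d) :
    ∑ J ∈ S, fJ T f r J x = ∑ z ∈ T, f z x := by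
  unfold fJ
  exact Finset.sum_fiberwise_of_maps_to hS _

lemma fJ_fJ (T : Finset (Fin d → ℤ)) (f : (Fin d → ℤ) → V d → ℂ) (r s : ℕ)
    (S : Finset (Fin d → ℤ)) (J : Fin d → ℤ) (hS : ∀ z ∈ T, par (r + s) z = J → par s z ∈ S)
    (hS' : ∀ I ∈ S, par r I = J) (x : V d) :
    ∑ I ∈ S, fJ T f s I x = fJ T f (r + s) J x := by
  unfold fJ
  rw [← Finset.sum_fiberwise_of_maps_to (t := S) (g := par s)
    (s := T.filter (fun z => par (r + s) z = J))
    (fun z hz => hS z (Finset.mem_filter.1 hz).1 (Finset.mem_filter.1 hz).2)]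
  refine Finset.sum_congr rfl fun I hI => Finset.sum_congr ?_ fun _ _ => rfl
  ext z
  simp only [Finset.mem_filter]
  constructor
  · rintro ⟨h1, h2⟩
    refine ⟨⟨h1, ?_⟩, h2⟩
    rw [← par_par, h2]; exact hS' I hI
  · rintro ⟨⟨h1, _⟩, h2⟩
    exact ⟨h1, h2⟩

lemma fJ_FS {T : Finset (Fin d → ℤ)} {f : (Fin d → ℤ) → V d → ℂ} {M : Fin d → Fin d → ℝ}
    {l : Fin d → ℝ} {κ : ℝ} {k j : ℕ} (hj : j ≤ k) (hf : ∀ z ∈ T, FS (box M l κ k z) (f z))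
    (J : Fin d → ℤ) : FS (box M l κ j J) (fJ T f (k - j) J) := by
  refine FS.sum fun z hz => ?_
  obtain ⟨h1, h2⟩ := Finset.mem_filter.1 hz
  have := box_par M l κ hj z
  rw [h2] at this
  exact (hf z h1).mono this

lemma l2_fiber (T : Finset (Fin d → ℤ)) (r : ℕ) (S : Finset (Fin d → ℤ)) (hS : ∀ z ∈ T, par r z ∈ S)
    (F : (Fin d → ℤ) → ℝ≥0∞) :
    l2 S (fun J => l2 (T.filter (fun z => par r z = J)) F) = l2 T F := by
  unfold l2
  congr 1
  rw [← Finset.sum_fiberwise_of_maps_to hS]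
  refine Finset.sum_congr rfl fun J _ => ?_
  rw [← ENNReal.rpow_mul]; norm_num

/-- rescaled decoupling of the piece at level `j` -/
lemma fJ_dec {Lam p : ℝ} (hp : 0 < p) {k j : ℕ} (hj : j ≤ k) {D : ℝ≥0∞} (h : Dec d Lam p (k - j) D)
    {M : Fin d → Fin d → ℝ} (hM : QM Lam M) (l : Fin d → ℝ) (κ : ℝ)
    (T : Finset (Fin d → ℤ)) (f : (Fin d → ℤ) → V d → ℂ) (hf : ∀ z ∈ T, FS (box M l κ k z) (f z))
    (J : Fin d → ℤ) :
    nrm p (fJ T f (k - j) J) ≤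
      D * l2 (T.filter (fun z => par (k - j) z = J)) (fun z => nrm p (f z)) := by
  refine Dec_rescale hp hj h hM l κ J _ (fun z hz i => ?_) f fun z hz => hf z (Finset.mem_filter.1 hz).1
  exact congrFun (Finset.mem_filter.1 hz).2 i

/-- triangle inequality and Cauchy-Schwarz -/
lemma sum_le_l2 {ι : Type*} (T : Finset ι) (F : ι → ℝ≥0∞) :
    ∑ z ∈ T, F z ≤ (T.card : ℝ≥0∞) ^ (1 / 2 : ℝ) * l2 T F := by
  unfold l2
  have := ENNReal.inner_le_Lp_mul_Lq T (fun _ => 1) F (p := 2) (q := 2)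
    (Real.HolderConjugate.two_two)
  simpa using this

lemma nrm_sum_le {ι : Type*} {p : ℝ} (hp : 1 ≤ p) (T : Finset ι) (f : ι → V d → ℂ)
    (hf : ∀ z ∈ T, Measurable (f z)) :
    nrm p (fun x => ∑ z ∈ T, f z x) ≤ ∑ z ∈ T, nrm p (f z) := by
  classical
  unfold nrm
  have := N_sum_le (μ := volume) hp T (F := fun z x => if z ∈ T then ‖f z x‖ₑ else 0) (by
    intro z
    by_cases hz : z ∈ T
    · simp only [hz, if_true]; exact (hf z hz).enorm
    · simp only [hz, if_false]; exact measurable_const)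
  refine (N_mono (by linarith) fun x => ?_).trans (this.trans (le_of_eq ?_))
  · refine (enorm_sum_le _ _).trans (le_of_eq ?_)
    refine Finset.sum_congr rfl fun z hz => ?_
    simp [hz]
  · refine Finset.sum_congr rfl fun z hz => ?_
    simp [hz]

/-- cubes with a given ancestor -/
def chl (r : ℕ) (J : Fin d → ℤ) : Finset (Fin d → ℤ) :=
  Fintype.piFinset (fun i => Finset.Ico (J i * 2 ^ r) (J i * 2 ^ r + 2 ^ r))

lemma mem_chl {r : ℕ} {J z : Fin d → ℤ} : z ∈ chl r J ↔ par r z = J := by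
  unfold chl par
  simp only [Fintype.mem_piFinset, Finset.mem_Ico, funext_iff]
  refine forall_congr' fun i => ?_
  have h0 : (0 : ℤ) < 2 ^ r := by positivity
  rw [Int.ediv_eq_iff_of_pos h0]

lemma card_chl (r : ℕ) (J : Fin d → ℤ) : (chl r J).card = (2 ^ r) ^ d := by
  unfold chl
  rw [Fintype.card_piFinset]
  have : ((2 : ℤ) ^ r).toNat = 2 ^ r := by
    rw [show (2 : ℤ) ^ r = ((2 ^ r : ℕ) : ℤ) by push_cast; rfl, Int.toNat_natCast]
  simp [this]

lemma nrm_sum_le_l2 {ι : Type*} {p : ℝ} (hp : 1 ≤ p) (T : Finset ι) (f : ι → V d → ℂ)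
    (hf : ∀ z ∈ T, Measurable (f z)) :
    nrm p (fun x => ∑ z ∈ T, f z x) ≤ (T.card : ℝ≥0∞) ^ (1 / 2 : ℝ) * l2 T (fun z => nrm p (f z)) :=
  (nrm_sum_le hp T f hf).trans (sum_le_l2 _ _)

lemma Dec_trivial {Lam p : ℝ} (hp : 1 ≤ p) (k : ℕ) :
    Dec d Lam p k (((2 ^ k) ^ d : ℕ) : ℝ≥0∞) := by
  intro M hM l κ P T hT f hf
  refine (nrm_sum_le_l2 hp T f fun z hz => (hf z hz).meas).trans ?_
  gcongr
  have h1 : T.card ≤ (2 ^ k) ^ d := by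
    rw [← card_chl k P]
    exact Finset.card_le_card fun z hz => mem_chl.2 (funext fun i => hT z hz i)
  have h2 : (1 : ℝ≥0∞) ≤ (((2 ^ k) ^ d : ℕ) : ℝ≥0∞) := by
    exact_mod_cast Nat.one_le_two_pow.trans (Nat.le_of_eq (pow_mul 2 k d))
  calc (T.card : ℝ≥0∞) ^ (1 / 2 : ℝ) ≤ (((2 ^ k) ^ d : ℕ) : ℝ≥0∞) ^ (1 / 2 : ℝ) := by gcongr
    _ ≤ (((2 ^ k) ^ d : ℕ) : ℝ≥0∞) ^ (1 : ℝ) :=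
        ENNReal.rpow_le_rpow_of_exponent_le h2 (by norm_num)
    _ = _ := by simp

end DR

namespace DR

open Filter Topology
open scoped ENNReal NNReal

variable {d : ℕ}

/-- pointwise power of the modulus -/
def pw (q : ℝ) (f : V d → ℂ) (y : V d) : ℝ≥0∞ := ‖f y‖ₑ ^ q

lemma pw_meas {q : ℝ} {f : V d → ℂ} (hf : Measurable f) : Measurable (pw q f) := by
  unfold pw; fun_prop

lemma pw_rpow (q r : ℝ) (f : V d → ℂ) (y : V d) : pw q f y ^ r = pw (q * r) f y := by
  unfold pw; rw [ENNReal.rpow_mul]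

lemma cv_jens {q : ℝ} (hq : 2 ≤ q) {f : V d → ℂ} (hf : Measurable f) {E : ℕ} (hE : d + 2 ≤ E) {R : ℝ}
    (hR : 0 < R) (x : V d) :
    cv (pw 2 f) (w E R) x ≤ Cw d ^ (1 - 2 / q) * cv (pw q f) (w E R) x ^ (2 / q) := by
  have h0 : 0 < q := by linarith
  have := cv_jensen (r := q / 2) (by linarith) (pw_meas (q := 2) hf) (meas_w E R) x
  simp only [pw_rpow, show (2:ℝ) * (q / 2) = q by ring, one_div_div] at this
  refine this.trans ?_
  rw [mul_comm]
  gcongr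
  · rw [sub_nonneg, div_le_one h0]; exact hq
  · exact lintegral_w hE hR

lemma cv_hold {p : ℝ} (hp : 2 ≤ p) {f : V d → ℂ} (hf : Measurable f) (E : ℕ) (R : ℝ) (x : V d) :
    cv (pw (4 * p / (p + 2)) f) (w E R) x ≤
      cv (pw 2 f) (w E R) x ^ (p / (p + 2)) * cv (pw p f) (w E R) x ^ (2 / (p + 2)) := by
  have hp2 : 0 < p + 2 := by linarith
  rw [cv_withDensity (pw_meas hf) (meas_w E R), cv_withDensity (pw_meas hf) (meas_w E R),
    cv_withDensity (pw_meas hf) (meas_w E R)]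
  have h2 := pw_meas (q := 2) hf
  have hpm := pw_meas (q := p) hf
  have := ENNReal.lintegral_mul_norm_pow_le (μ := volume.withDensity (w E R))
    (f := fun y => pw 2 f (x - y)) (g := fun y => pw p f (x - y)) (p := p / (p + 2)) (q := 2 / (p + 2))
    (by fun_prop) (by fun_prop) (by positivity) (by positivity) (by field_simp)
  refine le_trans (le_of_eq ?_) this
  congr 1; ext y
  rw [pw_rpow, pw_rpow]
  unfold pw
  rw [← ENNReal.rpow_add_of_nonneg _ _ (by positivity) (by positivity)]
  congr 1; ring

/-- centre of a cube -/
def ctr (j : ℕ) (J : Fin d → ℤ) (i : Fin d) : ℝ := J i / 2 ^ j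

/-- slope -/
def slp (M : Fin d → Fin d → ℝ) (j : ℕ) (J : Fin d → ℤ) (i : Fin d) : ℝ := 2 * Mv M (ctr j J) i

lemma box_tube {Lam : ℝ} (hLam : 0 ≤ Lam) {M : Fin d → Fin d → ℝ} (hM : QM Lam M) (j : ℕ) (J : Fin d → ℤ) :
    ∀ ξ ∈ box M 0 0 j J, (∀ i, |ξ.1 i - ctr j J i| ≤ (2 + d * (d * Lam) * 4) / 2 ^ j) ∧
      |ξ.2 - bil M (ctr j J) (ctr j J) - ∑ i, slp M j J i * (ξ.1 i - ctr j J i)| ≤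
        (2 + d * (d * Lam) * 4) / 4 ^ j := by
  rintro ξ ⟨h1, h2⟩
  have hpos : 0 ≤ (d : ℝ) * (d * Lam) * 4 := by positivity
  refine ⟨fun i => (h1 i).trans (by gcongr; linarith), ?_⟩
  have e1 := bil_expand hM (ξ.1 - ctr j J) (ctr j J)
  rw [sub_add_cancel] at e1
  have e2 : ∑ i, slp M j J i * (ξ.1 i - ctr j J i) = 2 * ∑ i, (ξ.1 - ctr j J) i * Mv M (ctr j J) i := by
    rw [Finset.mul_sum]
    refine Finset.sum_congr rfl fun i _ => ?_
    simp only [slp, Pi.sub_apply]; ring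
  have e3 := abs_bil_le hM (x := ξ.1 - ctr j J) (A := 2 / 2 ^ j) h1
  simp only [Pi.zero_apply, zero_mul, Finset.sum_const_zero, add_zero] at h2
  rw [e2, show ξ.2 - bil M (ctr j J) (ctr j J) - 2 * ∑ i, (ξ.1 - ctr j J) i * Mv M (ctr j J) i =
    (ξ.2 - bil M ξ.1 ξ.1) + bil M (ξ.1 - ctr j J) (ξ.1 - ctr j J) by rw [e1]; ring]
  refine (abs_add_le _ _).trans ((add_le_add h2 e3).trans ?_)
  have h4 : (2:ℝ) ^ j * 2 ^ j = 4 ^ j := by rw [← mul_pow]; norm_num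
  have h5 : (d:ℝ) * (2 / 2 ^ j * (d * (Lam * (2 / 2 ^ j)))) = (d * (d * Lam) * 4) / 4 ^ j := by
    rw [← h4]; field_simp; ring
  rw [h5, ← add_div]
  gcongr; norm_num

lemma slp_le {Lam : ℝ} {M : Fin d → Fin d → ℝ} (hM : QM Lam M) (j : ℕ) (J : Fin d → ℤ)
    (hc : ∀ i, |ctr j J i| ≤ 1) (i : Fin d) : |slp M j J i| ≤ 2 * (d * Lam) := by
  unfold slp
  rw [abs_mul, abs_two]
  have := abs_Mv_le hM hc i
  rw [mul_one] at this
  linarith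

lemma tube {Lam : ℝ} (hLam : 0 ≤ Lam) {q : ℝ} (hq : 2 ≤ q) (F E : ℕ) (hF : 2 ≤ F)
    (hE : F * (d + 1) + d + 2 ≤ E) :
    ∃ C : ℝ≥0, ∀ M : Fin d → Fin d → ℝ, QM Lam M → ∀ (j : ℕ) (J : Fin d → ℤ),
      (∀ i, |ctr j J i| ≤ 1) → ∀ f, FS (box M 0 0 j J) f → ∀ x,
      cv (pw 2 f) (w E (2 ^ j)) x ≤
        C * cv (pw q f) (W F (slp M j J) (2 ^ j) (4 ^ j)) x ^ (2 / q) := by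
  obtain ⟨C1, hC1⟩ := L1 d F hF (2 + d * (d * Lam) * 4) (by positivity) q (by linarith)
  set G : ℝ := 2 * (d * Lam) with hG
  have hG0 : 0 ≤ G := by positivity
  set K : ℝ≥0∞ := ENNReal.ofReal ((1 + G) ^ (F * (d + 1))) * Cw d with hK
  have hKt : K ≠ ∞ := ENNReal.mul_ne_top ENNReal.ofReal_ne_top Cw_lt_top.ne
  have h2q : 0 ≤ 2 / q := by positivity
  have h2q' : 0 ≤ 1 - 2 / q := by rw [sub_nonneg, div_le_one (by linarith)]; exact hq
  have hCt : Cw d ^ (1 - 2 / q) * ((C1 : ℝ≥0∞) * K) ^ (2 / q) ≠ ∞ := by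
    refine ENNReal.mul_ne_top (ENNReal.rpow_ne_top_of_nonneg h2q' Cw_lt_top.ne)
      (ENNReal.rpow_ne_top_of_nonneg h2q (ENNReal.mul_ne_top ENNReal.coe_ne_top hKt))
  refine ⟨(Cw d ^ (1 - 2 / q) * ((C1 : ℝ≥0∞) * K) ^ (2 / q)).toNNReal, ?_⟩
  intro M hM j J hc f hf x
  rw [ENNReal.coe_toNNReal hCt]
  have hR : (0:ℝ) < 2 ^ j := by positivity
  have hL : (2:ℝ) ^ j ≤ 4 ^ j := by gcongr; norm_num
  have hfm := hf.meas
  have hpm := pw_meas (q := q) hfm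
  have hd2 : d + 2 ≤ E := by
    have : 0 ≤ F * (d + 1) := Nat.zero_le _
    omega
  refine (cv_jens hq hfm hd2 hR x).trans ?_
  rw [mul_assoc, ← ENNReal.mul_rpow_of_nonneg _ _ h2q]
  gcongr
  calc cv (pw q f) (w E (2 ^ j)) x
      ≤ cv (fun y => C1 * cv (pw q f) (W F (slp M j J) (2 ^ j) (4 ^ j)) y) (w E (2 ^ j)) x :=
        cv_mono (fun y => hC1 _ f hf (ctr j J) (bil M (ctr j J) (ctr j J)) (slp M j J) (2 ^ j) (4 ^ j)
          hR (by positivity) (box_tube hLam hM j J) y) (fun _ => le_rfl) x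
    _ = C1 * cv (pw q f) (cv (W F (slp M j J) (2 ^ j) (4 ^ j)) (w E (2 ^ j))) x := by
        rw [cv_const_mul_left (by fun_prop) (by fun_prop), cv_assoc hpm (by fun_prop) (by fun_prop)]
    _ ≤ C1 * cv (pw q f) (fun y => K * W F (slp M j J) (2 ^ j) (4 ^ j) y) x := by
        gcongr
        exact cv_mono (fun _ => le_rfl) (fun y => W_cv_w hE hG0 (slp_le hM j J hc) hR hL y) x
    _ = _ := by
        rw [cv_const_mul_right hpm (by fun_prop), ← mul_assoc]

/-- the level-`j` cubes below `α` -/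
def Sj (T : Finset (Fin d → ℤ)) (k a j : ℕ) (α : Fin d → ℤ) : Finset (Fin d → ℤ) :=
  (T.image (par (k - j))).filter (fun J => par (j - a) J = α)

def Xj (T : Finset (Fin d → ℤ)) (f : (Fin d → ℤ) → V d → ℂ) (k a j E : ℕ) (R : ℝ) (α : Fin d → ℤ) (x : V d) :
    ℝ≥0∞ :=
  ∑ J ∈ Sj T k a j α, cv (pw 2 (fJ T f (k - j) J)) (w E R) x

def Yj (p : ℝ) (T : Finset (Fin d → ℤ)) (f : (Fin d → ℤ) → V d → ℂ) (k a j E : ℕ) (R : ℝ) (α : Fin d → ℤ)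
    (x : V d) : ℝ≥0∞ :=
  ∑ J ∈ Sj T k a j α, cv (pw p (fJ T f (k - j) J)) (w E R) x ^ (2 / p)

def Aj (p : ℝ) (T : Finset (Fin d → ℤ)) (f : (Fin d → ℤ) → V d → ℂ) (k a j E : ℕ)
    (α : Fin (d + 1) → Fin d → ℤ) : ℝ≥0∞ :=
  ∫⁻ x, ∏ i, Xj T f k a j E (2 ^ j) (α i) x ^ (p / (2 * ((d + 1 : ℕ) : ℝ)))

def Bp (p : ℝ) (T : Finset (Fin d → ℤ)) (f : (Fin d → ℤ) → V d → ℂ) (k a : ℕ)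
    (α : Fin (d + 1) → Fin d → ℤ) : ℝ≥0∞ :=
  ∏ i, (∑ z ∈ T.filter (fun z => par (k - a) z = α i), nrm p (f z) ^ (2:ℝ)) ^
    (p / (2 * ((d + 1 : ℕ) : ℝ)))

lemma fJ_meas {T : Finset (Fin d → ℤ)} {f : (Fin d → ℤ) → V d → ℂ} (hf : ∀ z ∈ T, Measurable (f z))
    (r : ℕ) (J : Fin d → ℤ) : Measurable (fJ T f r J) := by
  unfold fJ
  exact Finset.measurable_sum _ fun z hz => hf z (Finset.mem_filter.1 hz).1

lemma Xj_meas {T : Finset (Fin d → ℤ)} {f : (Fin d → ℤ) → V d → ℂ} (hf : ∀ z ∈ T, Measurable (f z))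
    (k a j E : ℕ) (R : ℝ) (α : Fin d → ℤ) : Measurable (Xj T f k a j E R α) := by
  unfold Xj
  refine Finset.measurable_sum _ fun J _ => ?_
  have := pw_meas (q := 2) (fJ_meas hf (k - j) J)
  fun_prop

lemma Yj_meas {p : ℝ} {T : Finset (Fin d → ℤ)} {f : (Fin d → ℤ) → V d → ℂ} (hf : ∀ z ∈ T, Measurable (f z))
    (k a j E : ℕ) (R : ℝ) (α : Fin d → ℤ) : Measurable (Yj p T f k a j E R α) := by
  unfold Yj
  refine Finset.measurable_sum _ fun J _ => ?_
  have := pw_meas (q := p) (fJ_meas hf (k - j) J)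
  fun_prop

lemma sum_filter_Sj (T : Finset (Fin d → ℤ)) {k a j : ℕ} (ha : a ≤ j) (hj : j ≤ k) (α : Fin d → ℤ)
    (F : (Fin d → ℤ) → ℝ≥0∞) :
    ∑ J ∈ Sj T k a j α, ∑ z ∈ T.filter (fun z => par (k - j) z = J), F z =
      ∑ z ∈ T.filter (fun z => par (k - a) z = α), F z := by
  have hpar : ∀ z : Fin d → ℤ, par (j - a) (par (k - j) z) = par (k - a) z := fun z => by
    rw [par_par]; congr 1; omega
  rw [← Finset.sum_fiberwise_of_maps_to (t := Sj T k a j α) (g := par (k - j))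
    (s := T.filter (fun z => par (k - a) z = α)) (by
      intro z hz
      obtain ⟨h1, h2⟩ := Finset.mem_filter.1 hz
      exact Finset.mem_filter.2 ⟨Finset.mem_image_of_mem _ h1, by rw [hpar, h2]⟩)]
  refine Finset.sum_congr rfl fun J hJ => Finset.sum_congr ?_ fun _ _ => rfl
  ext z
  simp only [Finset.mem_filter]
  constructor
  · rintro ⟨h1, h2⟩
    refine ⟨⟨h1, ?_⟩, h2⟩
    rw [← hpar, h2]; exact (Finset.mem_filter.1 hJ).2
  · rintro ⟨⟨h1, _⟩, h2⟩; exact ⟨h1, h2⟩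

lemma Yj_bound {Lam p : ℝ} (hp : 2 ≤ p) {k a j : ℕ} (ha : a ≤ j) (hj : j ≤ k) {D : ℝ≥0∞}
    (h : Dec d Lam p (k - j) D) {M : Fin d → Fin d → ℝ} (hM : QM Lam M)
    (T : Finset (Fin d → ℤ)) (f : (Fin d → ℤ) → V d → ℂ) (hf : ∀ z ∈ T, FS (box M 0 0 k z) (f z))
    {E : ℕ} (hE : d + 2 ≤ E) {R : ℝ} (hR : 0 < R) (α : Fin (d + 1) → Fin d → ℤ) :
    ∫⁻ x, ∏ i, Yj p T f k a j E R (α i) x ^ (p / (2 * ((d + 1 : ℕ) : ℝ))) ≤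
      Cw d * (D ^ p * Bp p T f k a α) := by
  have hp0 : 0 < p := by linarith
  have hm : (0:ℝ) < ((d + 1 : ℕ) : ℝ) := by positivity
  have hfm : ∀ z ∈ T, Measurable (f z) := fun z hz => (hf z hz).meas
  have hY := fun i => Yj_meas (p := p) hfm k a j E R (α i)
  have key : ∀ i, ∫⁻ x, Yj p T f k a j E R (α i) x ^ (p / 2) ≤
      Cw d * (D ^ p * (∑ z ∈ T.filter (fun z => par (k - a) z = α i), nrm p (f z) ^ (2:ℝ)) ^ (p / 2)) := by
    intro i
    have hpj := fun J => pw_meas (q := p) (fJ_meas hfm (k - j) J)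
    have := N_sum_le (μ := volume) (p := p / 2) (by linarith) (Sj T k a j (α i))
      (F := fun J x => cv (pw p (fJ T f (k - j) J)) (w E R) x ^ (2 / p)) (fun J => by
        have := hpj J
        fun_prop)
    have h2 := ENNReal.rpow_le_rpow this (show 0 ≤ p / 2 by positivity)
    rw [N_rpow_self (by positivity)] at h2
    refine h2.trans ?_
    have h3 : ∀ J, N (p / 2) volume (fun x => cv (pw p (fJ T f (k - j) J)) (w E R) x ^ (2 / p)) ≤
        Cw d ^ (2 / p) * nrm p (fJ T f (k - j) J) ^ (2:ℝ) := by
      intro J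
      unfold N
      simp only [← ENNReal.rpow_mul]
      rw [show 2 / p * (p / 2) = 1 by field_simp, show 1 / (p / 2) = 2 / p by field_simp]
      simp only [ENNReal.rpow_one]
      rw [lintegral_cv (hpj J) (by fun_prop), ENNReal.mul_rpow_of_nonneg _ _ (by positivity), mul_comm]
      gcongr
      · exact lintegral_w hE hR
      · apply le_of_eq
        unfold nrm N pw
        rw [← ENNReal.rpow_mul]
        congr 1; ring
    calc _ ≤ (∑ J ∈ Sj T k a j (α i), Cw d ^ (2 / p) * (D ^ (2:ℝ) *
          ∑ z ∈ T.filter (fun z => par (k - j) z = J), nrm p (f z) ^ (2:ℝ))) ^ (p / 2) := by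
          gcongr with J hJ
          refine (h3 J).trans ?_
          gcongr
          have := ENNReal.rpow_le_rpow (fJ_dec hp0 hj h hM 0 0 T f hf J) (show (0:ℝ) ≤ 2 by norm_num)
          rw [ENNReal.mul_rpow_of_nonneg _ _ (by norm_num), l2_sq] at this
          exact this
      _ = _ := by
          rw [← Finset.mul_sum, ← Finset.mul_sum, sum_filter_Sj T ha hj,
            ENNReal.mul_rpow_of_nonneg _ _ (by positivity), ENNReal.mul_rpow_of_nonneg _ _ (by positivity),
            ← ENNReal.rpow_mul, ← ENNReal.rpow_mul, show 2 / p * (p / 2) = 1 by field_simp,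
            show 2 * (p / 2) = p by ring, ENNReal.rpow_one]
  have hold := ENNReal.lintegral_prod_norm_pow_le (μ := volume) Finset.univ
    (f := fun i x => Yj p T f k a j E R (α i) x ^ (p / 2)) (p := fun _ => 1 / ((d + 1 : ℕ) : ℝ))
    (fun i _ => ((hY i).pow_const _).aemeasurable) (by simp; field_simp) (fun i _ => by positivity)
  simp only [← ENNReal.rpow_mul] at hold
  rw [show p / 2 * (1 / ((d + 1 : ℕ) : ℝ)) = p / (2 * ((d + 1 : ℕ) : ℝ)) by field_simp] at hold
  refine hold.trans ?_
  calc _ ≤ ∏ i, (Cw d * (D ^ p * (∑ z ∈ T.filter (fun z => par (k - a) z = α i),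
        nrm p (f z) ^ (2:ℝ)) ^ (p / 2))) ^ (1 / ((d + 1 : ℕ) : ℝ)) := by
        gcongr with i; exact key i
    _ = _ := by
        have e1 : ∀ a : ℝ≥0∞, ∏ i : Fin (d + 1), a ^ (1 / ((d + 1 : ℕ) : ℝ)) = a := by
          intro a
          rw [Finset.prod_const, Finset.card_univ, Fintype.card_fin, ← ENNReal.rpow_natCast,
            ← ENNReal.rpow_mul, one_div_mul_cancel hm.ne', ENNReal.rpow_one]
        simp only [ENNReal.mul_rpow_of_nonneg _ _ (show 0 ≤ 1 / ((d + 1 : ℕ) : ℝ) by positivity)]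
        rw [Finset.prod_mul_distrib, Finset.prod_mul_distrib, e1, e1]
        unfold Bp
        simp only [← ENNReal.rpow_mul]
        rw [show p / 2 * (1 / ((d + 1 : ℕ) : ℝ)) = p / (2 * ((d + 1 : ℕ) : ℝ)) by field_simp]

/-- end of the iteration -/
lemma Aj_end {Lam p : ℝ} (hp : 2 ≤ p) {E : ℕ} (hE : d + 2 ≤ E) :
    ∃ C : ℝ≥0, ∀ {k a j : ℕ} (_ : a ≤ j) (_ : j ≤ k) {D : ℝ≥0∞}
    (_ : Dec d Lam p (k - j) D) {M : Fin d → Fin d → ℝ} (_ : QM Lam M)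
    (T : Finset (Fin d → ℤ)) (f : (Fin d → ℤ) → V d → ℂ) (_ : ∀ z ∈ T, FS (box M 0 0 k z) (f z))
    (α : Fin (d + 1) → Fin d → ℤ), Aj p T f k a j E α ≤ C * (D ^ p * Bp p T f k a α) := by
  have hp0 : 0 < p := by linarith
  have hm : (0:ℝ) < ((d + 1 : ℕ) : ℝ) := by positivity
  set σ : ℝ := p / (2 * ((d + 1 : ℕ) : ℝ)) with hσ
  have hσ0 : 0 < σ := by positivity
  set K : ℝ≥0∞ := ((Cw d ^ (1 - 2 / p)) ^ σ) ^ (d + 1) * Cw d with hK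
  have hKt : K ≠ ∞ := by
    refine ENNReal.mul_ne_top (ENNReal.pow_ne_top (ENNReal.rpow_ne_top_of_nonneg hσ0.le
      (ENNReal.rpow_ne_top_of_nonneg ?_ Cw_lt_top.ne))) Cw_lt_top.ne
    rw [sub_nonneg, div_le_one hp0]; exact hp
  refine ⟨K.toNNReal, ?_⟩
  intro k a j ha hj D h M hM T f hf α
  rw [ENNReal.coe_toNNReal hKt]
  have hfm : ∀ z ∈ T, Measurable (f z) := fun z hz => (hf z hz).meas
  calc Aj p T f k a j E α ≤ ∫⁻ x, ((Cw d ^ (1 - 2 / p)) ^ σ) ^ (d + 1) *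
        ∏ i, Yj p T f k a j E (2 ^ j) (α i) x ^ σ := by
        unfold Aj
        refine lintegral_mono fun x => ?_
        dsimp only
        calc _ ≤ ∏ i, (Cw d ^ (1 - 2 / p) * Yj p T f k a j E (2 ^ j) (α i) x) ^ σ := by
              gcongr with i
              unfold Xj Yj
              rw [Finset.mul_sum]
              gcongr with J hJ
              exact cv_jens hp (fJ_meas hfm _ _) hE (by positivity) x
          _ = _ := by
              simp only [ENNReal.mul_rpow_of_nonneg _ _ hσ0.le]
              rw [Finset.prod_mul_distrib, Finset.prod_const, Finset.card_univ, Fintype.card_fin]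
    _ = ((Cw d ^ (1 - 2 / p)) ^ σ) ^ (d + 1) * ∫⁻ x, ∏ i, Yj p T f k a j E (2 ^ j) (α i) x ^ σ := by
        rw [lintegral_const_mul]
        exact Finset.measurable_prod _ fun i _ => (Yj_meas hfm _ _ _ _ _ _).pow_const _
    _ ≤ ((Cw d ^ (1 - 2 / p)) ^ σ) ^ (d + 1) * (Cw d * (D ^ p * Bp p T f k a α)) := by
        gcongr
        exact Yj_bound hp ha hj h hM T f hf hE (by positivity) α
    _ = _ := by rw [hK, mul_assoc]

end DR

namespace DR

open Filter Topology
open scoped ENNReal NNReal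

variable {d : ℕ}

lemma cs_sum {ι : Type*} (T : Finset ι) (a b : ι → ℝ≥0∞) :
    ∑ J ∈ T, a J ^ (1 / 2 : ℝ) * b J ^ (1 / 2 : ℝ) ≤
      (∑ J ∈ T, a J) ^ (1 / 2 : ℝ) * (∑ J ∈ T, b J) ^ (1 / 2 : ℝ) := by
  have := ENNReal.inner_le_Lp_mul_Lq T (fun J => a J ^ (1 / 2 : ℝ)) (fun J => b J ^ (1 / 2 : ℝ))
    Real.HolderConjugate.two_two
  simpa only [← ENNReal.rpow_mul, show (1 / 2 : ℝ) * 2 = 1 by norm_num, ENNReal.rpow_one] using this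

/-- normal direction -/
def evec (M : Fin d → Fin d → ℝ) (a : ℕ) (α : Fin d → ℤ) : V d := (fun i => -slp M a α i, 1)

lemma Mv_sub (M : Fin d → Fin d → ℝ) (x y : Fin d → ℝ) (i : Fin d) :
    Mv M (x - y) i = Mv M x i - Mv M y i := by
  simp [Mv, mul_sub, Finset.sum_sub_distrib]

lemma mem_Sj {T : Finset (Fin d → ℤ)} {k a j : ℕ} {α J : Fin d → ℤ} (hJ : J ∈ Sj T k a j α) :
    (∃ z ∈ T, par (k - j) z = J) ∧ par (j - a) J = α := by
  obtain ⟨h1, h2⟩ := Finset.mem_filter.1 hJ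
  obtain ⟨z, hz, rfl⟩ := Finset.mem_image.1 h1
  exact ⟨⟨z, hz, rfl⟩, h2⟩

lemma ctr_le_one {k j : ℕ} (hj : j ≤ k) {z : Fin d → ℤ} (hz : ∀ i, z i / 2 ^ k = 0) (i : Fin d) :
    |ctr j (par (k - j) z) i| ≤ 1 := by
  have h0 : par j (par (k - j) z) = 0 := by
    rw [par_par, show j + (k - j) = k by omega]
    ext i; exact hz i
  obtain ⟨h1, h2⟩ := par_le j (par (k - j) z) i
  rw [h0] at h1 h2
  simp only [Pi.zero_apply, Int.cast_zero, zero_mul, zero_add, one_mul] at h1 h2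
  unfold ctr
  rw [abs_of_nonneg (by positivity), div_le_one (by positivity)]
  linarith

lemma ctr_sub_le {a j : ℕ} (ha : a ≤ j) (J : Fin d → ℤ) (i : Fin d) :
    |(ctr j J - ctr a (par (j - a) J)) i| ≤ 1 / 2 ^ a := by
  obtain ⟨h1, h2⟩ := par_le (j - a) J i
  have e : (2:ℝ) ^ j = 2 ^ a * 2 ^ (j - a) := by rw [← pow_add]; congr 1; omega
  simp only [Pi.sub_apply, ctr]
  have : (J i : ℝ) / 2 ^ j - (par (j - a) J i : ℝ) / 2 ^ a =
      ((J i : ℝ) - par (j - a) J i * 2 ^ (j - a)) / 2 ^ j := by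
    rw [e]; field_simp
  rw [this, abs_of_nonneg (by apply div_nonneg <;> [linarith; positivity]), div_le_div_iff₀ (by positivity)
    (by positivity), e]
  have h3 : (J i : ℝ) - par (j - a) J i * 2 ^ (j - a) ≤ 2 ^ (j - a) := by linarith
  have h4 : (0:ℝ) < 2 ^ a := by positivity
  nlinarith

lemma X_child (d E : ℕ) : ∃ C : ℝ≥0, ∀ {k a j : ℕ} (_ : a ≤ j) (_ : 2 * j ≤ k) {M : Fin d → Fin d → ℝ}
    (T : Finset (Fin d → ℤ)) (f : (Fin d → ℤ) → V d → ℂ) (_ : ∀ z ∈ T, FS (box M 0 0 k z) (f z))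
    (α : Fin d → ℤ) (x : V d), Xj T f k a j E (4 ^ j) α x ≤ C * Xj T f k a (2 * j) E (2 ^ (2 * j)) α x := by
  obtain ⟨C, hC⟩ := L2 d E
  refine ⟨C, ?_⟩
  intro k a j ha hj M T f hf α x
  have h4 : (2:ℝ) ^ (2 * j) = 4 ^ j := by rw [pow_mul]; norm_num
  have hrs : j + (k - 2 * j) = k - j := by omega
  unfold Xj
  rw [h4]
  set S : (Fin d → ℤ) → Finset (Fin d → ℤ) := fun J => (T.image (par (k - 2 * j))).filter (fun I => par j I = J)
  have key : ∀ J, cv (pw 2 (fJ T f (k - j) J)) (w E (4 ^ j)) x ≤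
      C * ∑ I ∈ S J, cv (pw 2 (fJ T f (k - 2 * j) I)) (w E (4 ^ j)) x := by
    intro J
    have := hC (4 ^ j) (1 / 4 ^ j) (by positivity) (by field_simp; rfl) (S J) (fun I => fJ T f (k - 2 * j) I)
      (by
        intro I _
        refine (fJ_FS hj hf I).mono ?_
        rintro ξ ⟨h1, _⟩ i
        have := h1 i
        rw [h4] at this
        rw [mul_one_div, mul_one_div]; exact this) x
    have e : (fun y => ‖∑ I ∈ S J, fJ T f (k - 2 * j) I y‖ₑ ^ (2:ℝ)) = pw 2 (fJ T f (k - j) J) := by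
      ext y
      unfold pw
      rw [fJ_fJ T f j (k - 2 * j) (S J) J ?_ ?_ y, hrs]
      · intro z hz h
        exact Finset.mem_filter.2 ⟨Finset.mem_image_of_mem _ hz, by rw [par_par, h]⟩
      · intro I hI; exact (Finset.mem_filter.1 hI).2
    rw [e] at this
    exact this
  calc _ ≤ ∑ J ∈ Sj T k a j α, C * ∑ I ∈ S J, cv (pw 2 (fJ T f (k - 2 * j) I)) (w E (4 ^ j)) x :=
        Finset.sum_le_sum fun J _ => key J
    _ = _ := by
        rw [← Finset.mul_sum]
        congr 1
        rw [← Finset.sum_fiberwise_of_maps_to (s := Sj T k a (2 * j) α) (t := Sj T k a j α) (g := par j)]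
        · refine Finset.sum_congr rfl fun J hJ => Finset.sum_congr ?_ fun _ _ => rfl
          ext I
          simp only [S, Sj, Finset.mem_filter]
          constructor
          · rintro ⟨h1, h2⟩
            refine ⟨⟨h1, ?_⟩, h2⟩
            rw [← (mem_Sj hJ).2, ← h2, par_par]; congr 1; omega
          · rintro ⟨⟨h1, _⟩, h2⟩; exact ⟨h1, h2⟩
        · intro I hI
          obtain ⟨⟨z, hz, rfl⟩, h2⟩ := mem_Sj hI
          refine Finset.mem_filter.2 ⟨?_, ?_⟩
          · rw [par_par, hrs]; exact Finset.mem_image_of_mem _ hz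
          · rw [← h2, par_par]; congr 1; omega

lemma step (hd : 1 ≤ d) {Lam p c : ℝ} (hLam : 0 ≤ Lam) (hp : 2 ≤ p) (hpd : p * d ≤ 2 * (d + 2)) (hc : 0 < c)
    (F E : ℕ) (hF : d + 2 ≤ F) (hE : F * (d + 1) + d + 2 ≤ E) :
    ∃ C CK : ℝ≥0, 1 ≤ CK ∧ ∀ {k a j : ℕ} (_ : 1 ≤ a) (_ : a ≤ j) (_ : 2 * j ≤ k) {D : ℝ≥0∞}
    (_ : Dec d Lam p (k - j) D) {M : Fin d → Fin d → ℝ} (_ : QM Lam M)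
    (T : Finset (Fin d → ℤ)) (_ : ∀ z ∈ T, ∀ i, z i / 2 ^ k = 0)
    (f : (Fin d → ℤ) → V d → ℂ) (_ : ∀ z ∈ T, FS (box M 0 0 k z) (f z))
    (α : Fin (d + 1) → Fin d → ℤ) (_ : ∀ i l, |ctr a (α i) l| ≤ 1)
    (_ : c ≤ |(Matrix.of fun i => cc (evec M a (α i))).det|),
    Aj p T f k a j E α ≤ C * (CK ^ (j / a + 1) * ((Aj p T f k a (2 * j) F α) ^ (1 / 2 : ℝ) *
      (D ^ p * Bp p T f k a α) ^ (1 / 2 : ℝ))) := by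
  have hp0 : 0 < p := by linarith
  have hm : (0:ℝ) < ((d + 1 : ℕ) : ℝ) := by positivity
  have hdpos : (0:ℝ) < d := by exact_mod_cast hd
  set m : ℝ := ((d + 1 : ℕ) : ℝ) with hmdef
  set q : ℝ := 4 * p / (p + 2) with hq
  have hq2 : 2 ≤ q := by rw [hq, le_div_iff₀ (by linarith)]; linarith
  have hq0 : 0 < q := by linarith
  set τ : ℝ := p / (2 * m) with hτ
  have hτ0 : 0 < τ := by positivity
  set σ : ℝ := p / (m * q) with hσ
  have hσ0 : 0 < σ := by positivity
  have hσd : σ * d ≤ 1 := by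
    have : σ = (p + 2) / (4 * m) := by rw [hσ, hq]; field_simp
    rw [this, div_mul_eq_mul_div, div_le_one (by positivity), hmdef]
    push_cast
    linarith
  have hqσ : q / 2 * σ = τ := by rw [hσ, hτ]; field_simp
  set G : ℝ := 2 * (d * Lam) with hG
  have hG0 : 0 ≤ G := by positivity
  have hF2 : 2 ≤ F := by omega
  obtain ⟨C1, hC1⟩ := tube (d := d) hLam hq2 F E hF2 hE
  obtain ⟨CK, hCK1, hCK⟩ := Kit hd F hF2 (G := G) (G' := 1 + G) (c := c) (K := 1 + G) hG0 (by linarith) hc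
    (by linarith) (r := q / 2) hσ0 hσd (by linarith)
  obtain ⟨C2, hC2⟩ := X_child d F
  set Gw : ℝ≥0∞ := ENNReal.ofReal ((1 + G) ^ F) with hGw
  set K : ℝ≥0∞ := ((C1 : ℝ≥0∞) ^ τ) ^ (d + 1) * (((Gw ^ (2 / q) * (C2 : ℝ≥0∞) ^ (1 / 2 : ℝ)) ^ τ) ^ (d + 1) *
    Cw d ^ (1 / 2 : ℝ)) with hK
  have h2q : 0 ≤ 2 / q := by positivity
  have hKt : K ≠ ∞ := by
    refine ENNReal.mul_ne_top ?_ (ENNReal.mul_ne_top ?_ ?_)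
    · exact ENNReal.pow_ne_top (ENNReal.rpow_ne_top_of_nonneg hτ0.le ENNReal.coe_ne_top)
    · exact ENNReal.pow_ne_top (ENNReal.rpow_ne_top_of_nonneg hτ0.le (ENNReal.mul_ne_top
        (ENNReal.rpow_ne_top_of_nonneg h2q ENNReal.ofReal_ne_top)
        (ENNReal.rpow_ne_top_of_nonneg (by norm_num) ENNReal.coe_ne_top)))
    · exact ENNReal.rpow_ne_top_of_nonneg (by norm_num) Cw_lt_top.ne
  refine ⟨K.toNNReal, CK, hCK1, ?_⟩
  intro k a j ha haj hjk D hD M hM T hT f hf α hα hdet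
  rw [ENNReal.coe_toNNReal hKt]
  have hjk' : j ≤ k := by omega
  have hfm : ∀ z ∈ T, Measurable (f z) := fun z hz => (hf z hz).meas
  have hgm : ∀ J, Measurable (pw q (fJ T f (k - j) J)) := fun J => pw_meas (fJ_meas hfm _ _)
  have hJc : ∀ i, ∀ J ∈ Sj T k a j (α i), ∀ l, |ctr j J l| ≤ 1 := by
    intro i J hJ l
    obtain ⟨⟨z, hz, rfl⟩, _⟩ := mem_Sj hJ
    exact ctr_le_one hjk' (hT z hz) l
  have hprodc : ∀ (c' : ℝ≥0∞) (g : Fin (d + 1) → ℝ≥0∞), ∏ i, (c' * g i) ^ τ = (c' ^ τ) ^ (d + 1) * ∏ i, g i ^ τ := by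
    intro c' g
    simp only [ENNReal.mul_rpow_of_nonneg _ _ hτ0.le]
    rw [Finset.prod_mul_distrib, Finset.prod_const, Finset.card_univ, Fintype.card_fin]
  set H : ℝ → V d → ℝ≥0∞ := fun ρ x => ∏ i, Hk F (q / 2) (Sj T k a j (α i)) (slp M j)
    (fun J => pw q (fJ T f (k - j) J)) ρ (4 ^ j) x ^ σ with hH
  have hHm : ∀ ρ, Measurable (H ρ) := fun ρ =>
    Finset.measurable_prod _ fun i _ => (Hk_meas F _ _ _ hgm _ _).pow_const _
  have hHeq : ∀ ρ x, H ρ x = ∏ i, (∑ J ∈ Sj T k a j (α i), cv (pw q (fJ T f (k - j) J))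
      (W F (slp M j J) ρ (4 ^ j)) x ^ (2 / q)) ^ τ := by
    intro ρ x
    simp only [hH, Hk, ← ENNReal.rpow_mul, hqσ, one_div_div]
  have s1 : Aj p T f k a j E α ≤ ((C1 : ℝ≥0∞) ^ τ) ^ (d + 1) * ∫⁻ x, H (2 ^ j) x := by
    rw [← lintegral_const_mul _ (hHm _)]
    unfold Aj
    refine lintegral_mono fun x => ?_
    dsimp only
    rw [hHeq, ← hprodc]
    refine Finset.prod_le_prod' fun i _ => ENNReal.rpow_le_rpow ?_ hτ0.le
    unfold Xj
    rw [Finset.mul_sum]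
    refine Finset.sum_le_sum fun J hJ => ?_
    exact hC1 M hM j J (hJc i J hJ) _ (fJ_FS hjk' hf J) x
  have s2 : ∫⁻ x, H (2 ^ j) x ≤ (CK : ℝ≥0∞) ^ (j / a + 1) * ∫⁻ x, H (4 ^ j) x := by
    refine hCK (fun i => evec M a (α i)) (fun i => Sj T k a j (α i)) (slp M j) _ (2 ^ a) (4 ^ j) ?_ ?_ hdet ?_ ?_ hgm
      (one_le_pow₀ (by norm_num)) (j / a + 1) _ _ (by positivity) (by gcongr; norm_num) ?_ le_rfl
    · intro i
      have : ‖evec M a (α i)‖ ≤ max G 1 := by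
        rw [Prod.norm_def]
        refine max_le_max ?_ (by simp [evec])
        refine (pi_norm_le_iff_of_nonneg hG0).2 fun l => ?_
        simp only [evec, norm_neg, Real.norm_eq_abs]
        exact slp_le hM a (α i) (hα i) l
      exact this.trans (max_le (by linarith) (by linarith))
    · intro i; rfl
    · intro i J hJ l
      exact slp_le hM j J (hJc i J hJ) l
    · intro i J hJ l
      have e : (evec M a (α i)).1 l + slp M j J l = 2 * Mv M (ctr j J - ctr a (α i)) l := by
        simp only [evec, slp, Mv_sub]; ring
      have hb := abs_Mv_le hM (x := ctr j J - ctr a (α i)) (A := 1 / 2 ^ a) (by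
        rw [← (mem_Sj hJ).2]; exact ctr_sub_le haj J) l
      rw [e, abs_mul, abs_two]
      have h2a : (0:ℝ) < 2 ^ a := by positivity
      calc 2 * |Mv M (ctr j J - ctr a (α i)) l| * 2 ^ a ≤ 2 * (d * (Lam * (1 / 2 ^ a))) * 2 ^ a := by gcongr
        _ = G := by rw [hG]; field_simp
        _ ≤ 1 + G := by linarith
    · rw [← pow_mul, ← pow_add, show (4:ℝ) ^ j = 2 ^ (2 * j) by rw [pow_mul]; norm_num]
      refine pow_le_pow_right₀ (by norm_num) ?_
      have := Nat.lt_mul_div_succ j ha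
      nlinarith
  have s3 : ∀ x, H (4 ^ j) x ≤ ((Gw ^ (2 / q) * (C2 : ℝ≥0∞) ^ (1 / 2 : ℝ)) ^ τ) ^ (d + 1) *
      ((∏ i, Xj T f k a (2 * j) F (2 ^ (2 * j)) (α i) x ^ τ) ^ (1 / 2 : ℝ) *
        (∏ i, Yj p T f k a j F (4 ^ j) (α i) x ^ τ) ^ (1 / 2 : ℝ)) := by
    intro x
    rw [hHeq]
    have e : ∀ i, ∑ J ∈ Sj T k a j (α i), cv (pw q (fJ T f (k - j) J)) (W F (slp M j J) (4 ^ j) (4 ^ j)) x ^ (2 / q) ≤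
        (Gw ^ (2 / q) * (C2 : ℝ≥0∞) ^ (1 / 2 : ℝ)) * (Xj T f k a (2 * j) F (2 ^ (2 * j)) (α i) x ^ (1 / 2 : ℝ) *
          Yj p T f k a j F (4 ^ j) (α i) x ^ (1 / 2 : ℝ)) := by
      intro i
      calc _ ≤ ∑ J ∈ Sj T k a j (α i), Gw ^ (2 / q) *
            (cv (pw 2 (fJ T f (k - j) J)) (w F (4 ^ j)) x ^ (1 / 2 : ℝ) *
            (cv (pw p (fJ T f (k - j) J)) (w F (4 ^ j)) x ^ (2 / p)) ^ (1 / 2 : ℝ)) := by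
            refine Finset.sum_le_sum fun J hJ => ?_
            have h1 : cv (pw q (fJ T f (k - j) J)) (W F (slp M j J) (4 ^ j) (4 ^ j)) x ≤
                Gw * cv (pw q (fJ T f (k - j) J)) (w F (4 ^ j)) x := by
              rw [← cv_const_mul_right (hgm J) (by fun_prop)]
              exact cv_mono (fun _ => le_rfl) (fun y => W_le_w F hG0 (slp_le hM j J (hJc i J hJ)) (by positivity) y) x
            have h2 := h1.trans (mul_le_mul_right (cv_hold hp (fJ_meas hfm (k - j) J) F (4 ^ j) x) Gw)
            have h3 := ENNReal.rpow_le_rpow h2 h2q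
            rw [ENNReal.mul_rpow_of_nonneg _ _ h2q, ENNReal.mul_rpow_of_nonneg _ _ h2q, ← ENNReal.rpow_mul,
              ← ENNReal.rpow_mul, show p / (p + 2) * (2 / q) = 1 / 2 by rw [hq]; field_simp; norm_num,
              show 2 / (p + 2) * (2 / q) = 2 / p * (1 / 2) by rw [hq]; field_simp; norm_num] at h3
            rw [← ENNReal.rpow_mul]
            exact h3
        _ ≤ Gw ^ (2 / q) * (Xj T f k a j F (4 ^ j) (α i) x ^ (1 / 2 : ℝ) *
              Yj p T f k a j F (4 ^ j) (α i) x ^ (1 / 2 : ℝ)) := by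
            rw [← Finset.mul_sum]
            gcongr
            exact cs_sum _ _ _
        _ ≤ Gw ^ (2 / q) * ((C2 * Xj T f k a (2 * j) F (2 ^ (2 * j)) (α i) x) ^ (1 / 2 : ℝ) *
              Yj p T f k a j F (4 ^ j) (α i) x ^ (1 / 2 : ℝ)) := by
            gcongr
            exact hC2 haj hjk T f hf (α i) x
        _ = _ := by
            rw [ENNReal.mul_rpow_of_nonneg _ _ (by norm_num)]; ring
    refine (Finset.prod_le_prod' fun i _ => ENNReal.rpow_le_rpow (e i) hτ0.le).trans (le_of_eq ?_)
    rw [hprodc]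
    congr 1
    rw [← ENNReal.prod_rpow_of_nonneg (by norm_num), ← ENNReal.prod_rpow_of_nonneg (by norm_num),
      ← Finset.prod_mul_distrib]
    refine Finset.prod_congr rfl fun i _ => ?_
    rw [ENNReal.mul_rpow_of_nonneg _ _ hτ0.le, ← ENNReal.rpow_mul, ← ENNReal.rpow_mul, ← ENNReal.rpow_mul,
      ← ENNReal.rpow_mul, mul_comm τ]
  have mX : Measurable fun x => ∏ i, Xj T f k a (2 * j) F (2 ^ (2 * j)) (α i) x ^ τ :=
    Finset.measurable_prod _ fun i _ => (Xj_meas hfm _ _ _ _ _ _).pow_const _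
  have mY : Measurable fun x => ∏ i, Yj p T f k a j F (4 ^ j) (α i) x ^ τ :=
    Finset.measurable_prod _ fun i _ => (Yj_meas hfm _ _ _ _ _ _).pow_const _
  have s4 : ∫⁻ x, H (4 ^ j) x ≤ ((Gw ^ (2 / q) * (C2 : ℝ≥0∞) ^ (1 / 2 : ℝ)) ^ τ) ^ (d + 1) *
      (Aj p T f k a (2 * j) F α ^ (1 / 2 : ℝ) * (Cw d * (D ^ p * Bp p T f k a α)) ^ (1 / 2 : ℝ)) := by
    refine (lintegral_mono s3).trans ?_
    rw [lintegral_const_mul _ (by fun_prop)]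
    gcongr
    refine (ENNReal.lintegral_mul_norm_pow_le mX.aemeasurable mY.aemeasurable (by norm_num) (by norm_num)
      (by norm_num)).trans ?_
    gcongr
    · rfl
    · exact Yj_bound hp haj hjk' hD hM T f hf hF (by positivity) α
  calc _ ≤ _ := s1
    _ ≤ _ := mul_le_mul_right s2 _
    _ ≤ _ := mul_le_mul_right (mul_le_mul_right s4 _) _
    _ = _ := by
      rw [ENNReal.mul_rpow_of_nonneg _ _ (by norm_num : (0:ℝ) ≤ 1 / 2), hK]; ring

/-- decay exponents -/
def Es (d : ℕ) : ℕ → ℕ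
  | 0 => d + 2
  | s + 1 => Es d s * (d + 1) + d + 2

lemma le_Es (d s : ℕ) : d + 2 ≤ Es d s := by
  cases s with
  | zero => exact le_rfl
  | succ s =>
    rw [Es]
    have : 0 ≤ Es d s * (d + 1) := Nat.zero_le _
    omega

lemma iter (hd : 1 ≤ d) {Lam p c : ℝ} (hLam : 0 ≤ Lam) (hp : 2 ≤ p) (hpd : p * d ≤ 2 * (d + 2)) (hc : 0 < c)
    (s : ℕ) : ∃ (C CK : ℝ≥0), 1 ≤ CK ∧ ∀ {k a j : ℕ} (_ : 1 ≤ a) (_ : a ≤ j) (_ : 2 ^ s * j ≤ k)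
    {D : ℝ≥0∞} {η : ℝ} (_ : ∀ k' : ℕ, Dec d Lam p k' (D * 2 ^ (η * k'))) {M : Fin d → Fin d → ℝ} (_ : QM Lam M)
    (T : Finset (Fin d → ℤ)) (_ : ∀ z ∈ T, ∀ i, z i / 2 ^ k = 0)
    (f : (Fin d → ℤ) → V d → ℂ) (_ : ∀ z ∈ T, FS (box M 0 0 k z) (f z))
    (α : Fin (d + 1) → Fin d → ℤ) (_ : ∀ i l, |ctr a (α i) l| ≤ 1)
    (_ : c ≤ |(Matrix.of fun i => cc (evec M a (α i))).det|),
    Aj p T f k a j (Es d s) α ≤ C * ((CK ^ (k / a + 1)) ^ 2 *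
      ((D * 2 ^ (η * (k - j * (1 + s / 2)))) ^ p * Bp p T f k a α)) := by
  have hp0 : 0 < p := by linarith
  induction s with
  | zero =>
    obtain ⟨C, hC⟩ := Aj_end (d := d) (Lam := Lam) hp (le_refl (d + 2))
    refine ⟨C, 1, le_rfl, ?_⟩
    intro k a j ha haj hjk D η hD M hM T hT f hf α hα hdet
    have hj : j ≤ k := by simpa using hjk
    have := hC haj hj (hD (k - j)) hM T f hf α
    rw [Nat.cast_sub hj] at this
    simpa [Es] using this
  | succ s ih =>
    obtain ⟨C1, CK1, hCK1, h1⟩ := ih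
    obtain ⟨C2, CK2, hCK2, h2⟩ := step hd hLam hp hpd hc (Es d s) (Es d (s + 1)) (le_Es d s) le_rfl
    refine ⟨C2 * C1 ^ (1 / 2 : ℝ), max CK1 CK2, hCK1.trans (le_max_left _ _), ?_⟩
    intro k a j ha haj hjk D η hD M hM T hT f hf α hα hdet
    have hjs : 2 ^ s * (2 * j) ≤ k := by rw [pow_succ] at hjk; linarith
    have h2s : 1 ≤ 2 ^ s := Nat.one_le_two_pow
    have h2j : 2 * j ≤ k := by nlinarith
    have hj : j ≤ k := by omega
    have a1 := h1 (j := 2 * j) ha (by omega) hjs hD hM T hT f hf α hα hdet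
    have a2 := h2 ha haj h2j (hD (k - j)) hM T hT f hf α hα hdet
    rw [Nat.cast_sub hj] at a2
    set X : ℝ≥0∞ := ((max CK1 CK2 : ℝ≥0) : ℝ≥0∞) ^ (k / a + 1) with hX
    have hX1 : (CK1 : ℝ≥0∞) ^ (k / a + 1) ≤ X := by
      rw [hX]; gcongr; exact le_max_left _ _
    have hX2 : (CK2 : ℝ≥0∞) ^ (j / a + 1) ≤ X := by
      rw [hX]
      calc (CK2 : ℝ≥0∞) ^ (j / a + 1) ≤ (CK2 : ℝ≥0∞) ^ (k / a + 1) := by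
            refine pow_le_pow_right₀ (by exact_mod_cast hCK2) ?_
            gcongr
        _ ≤ _ := by gcongr; exact le_max_right _ _
    have hh : (0:ℝ) ≤ 1 / 2 := by norm_num
    have hdb : ∀ a : ℝ≥0∞, a ^ (1 / 2 : ℝ) * a ^ (1 / 2 : ℝ) = a := by
      intro a
      rw [← ENNReal.rpow_add_of_nonneg _ _ hh hh, show (1 / 2 : ℝ) + 1 / 2 = 1 by norm_num, ENNReal.rpow_one]
    calc _ ≤ _ := a2
      _ ≤ C2 * (X * ((C1 * (X ^ 2 * ((D * 2 ^ (η * (k - (2 * j : ℕ) * (1 + s / 2)))) ^ p * Bp p T f k a α)))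
            ^ (1 / 2 : ℝ) * ((D * 2 ^ (η * (k - j))) ^ p * Bp p T f k a α) ^ (1 / 2 : ℝ))) := by
          refine mul_le_mul_right (mul_le_mul' hX2 (mul_le_mul_left (ENNReal.rpow_le_rpow (a1.trans ?_) hh) _)) _
          exact mul_le_mul_right (mul_le_mul_left (pow_le_pow_left' hX1 2) _) _
      _ = _ := by
          simp only [ENNReal.mul_rpow_of_nonneg _ _ hh, ENNReal.mul_rpow_of_nonneg _ _ hp0.le]
          have e1 : (X ^ 2) ^ (1 / 2 : ℝ) = X := by
            rw [← ENNReal.rpow_natCast, ← ENNReal.rpow_mul]; norm_num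
          have e2 : ((2:ℝ≥0∞) ^ (η * (k - (2 * j : ℕ) * (1 + (s:ℝ) / 2)))) ^ p = ((2:ℝ≥0∞) ^ (p * (η * (k - (2 * j : ℕ) * (1 + (s:ℝ) / 2))))) := by
            rw [← ENNReal.rpow_mul, mul_comm p]
          have e3 : (((2:ℝ≥0∞) ^ (η * (k - (2 * j : ℕ) * (1 + (s:ℝ) / 2)))) ^ p) ^ (1 / 2 : ℝ) *
              (((2:ℝ≥0∞) ^ (η * ((k:ℝ) - j))) ^ p) ^ (1 / 2 : ℝ) =
              ((2:ℝ≥0∞) ^ (η * (k - j * (1 + ((s + 1 : ℕ) : ℝ) / 2)))) ^ p := by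
            simp only [← ENNReal.rpow_mul]
            rw [← ENNReal.rpow_add _ _ (by norm_num) (by norm_num)]
            congr 1; push_cast; ring
          rw [e1, ← e3, ENNReal.coe_mul, ENNReal.coe_rpow_of_nonneg _ hh]
          conv_rhs => rw [← hdb (D ^ p), ← hdb (Bp p T f k a α)]
          ring

lemma Bp_le {p : ℝ} (hp : 2 ≤ p) (T : Finset (Fin d → ℤ)) (f : (Fin d → ℤ) → V d → ℂ) (k a : ℕ)
    (α : Fin (d + 1) → Fin d → ℤ) : Bp p T f k a α ≤ l2 T (fun z => nrm p (f z)) ^ p := by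
  have hm : (0:ℝ) < ((d + 1 : ℕ) : ℝ) := by positivity
  have hp0 : 0 < p := by linarith
  calc Bp p T f k a α ≤ ∏ i : Fin (d + 1), (∑ z ∈ T, nrm p (f z) ^ (2:ℝ)) ^ (p / (2 * ((d + 1 : ℕ) : ℝ))) := by
        unfold Bp
        refine Finset.prod_le_prod' fun i _ => ENNReal.rpow_le_rpow ?_ (by positivity)
        exact Finset.sum_le_sum_of_subset (Finset.filter_subset _ _)
    _ = _ := by
        rw [Finset.prod_const, Finset.card_univ, Fintype.card_fin, ← ENNReal.rpow_natCast, ← ENNReal.rpow_mul,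
          ← l2_sq, ← ENNReal.rpow_mul]
        congr 1
        field_simp

lemma w_scale (E : ℕ) {R R' : ℝ} (hR : 1 ≤ R) (hRR : R ≤ R') (x : V d) :
    w E R x ≤ ENNReal.ofReal (R' ^ (d + 1)) * w E R' x := by
  unfold w
  have h0 : 0 < R := by linarith
  have h1 : 0 < R' := by linarith
  rw [← ENNReal.ofReal_mul (by positivity)]
  refine ENNReal.ofReal_le_ofReal ?_
  rw [← mul_assoc, mul_inv_cancel₀ (by positivity), one_mul]
  calc _ ≤ 1 * ((1 + ‖x‖ / R) ^ E)⁻¹ := by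
        gcongr
        exact inv_le_one_of_one_le₀ (one_le_pow₀ hR)
    _ ≤ _ := by
        rw [one_mul]
        gcongr

lemma start (T : Finset (Fin d → ℤ)) {k a j : ℕ} (ha : a ≤ j) (hj : j ≤ k) (f : (Fin d → ℤ) → V d → ℂ)
    (hf : ∀ z ∈ T, Measurable (f z)) (E : ℕ) (α : Fin d → ℤ) (x : V d) :
    cv (pw 2 (fJ T f (k - a) α)) (w E (2 ^ a)) x ≤
      (2 ^ j) ^ (2 * d + 1) * Xj T f k a j E (2 ^ j) α x := by
  have hrs : (j - a) + (k - j) = k - a := by omega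
  have e : ∀ y, fJ T f (k - a) α y = ∑ J ∈ Sj T k a j α, fJ T f (k - j) J y := by
    intro y
    rw [fJ_fJ T f (j - a) (k - j) _ α ?_ ?_ y, hrs]
    · intro z hz h
      exact Finset.mem_filter.2 ⟨Finset.mem_image_of_mem _ hz, by rw [par_par, h]⟩
    · intro I hI; exact (Finset.mem_filter.1 hI).2
  have hcard : ((Sj T k a j α).card : ℝ≥0∞) ≤ (2 ^ j) ^ d := by
    have : (Sj T k a j α).card ≤ (2 ^ (j - a)) ^ d := by
      rw [← card_chl (j - a) α]
      exact Finset.card_le_card fun I hI => mem_chl.2 (mem_Sj hI).2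
    have h2 : (2 ^ (j - a)) ^ d ≤ (2 ^ j) ^ d :=
      Nat.pow_le_pow_left (Nat.pow_le_pow_right (by norm_num) (by omega)) d
    exact_mod_cast this.trans h2
  have hmj := fun J => pw_meas (q := 2) (fJ_meas hf (k - j) J)
  have h1 : ∀ y, pw 2 (fJ T f (k - a) α) y ≤ (2 ^ j) ^ d * ∑ J ∈ Sj T k a j α, pw 2 (fJ T f (k - j) J) y := by
    intro y
    unfold pw
    rw [e]
    have := (enorm_sum_le (Sj T k a j α) (fun J => fJ T f (k - j) J y)).trans (sum_le_l2 _ _)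
    have h2 := ENNReal.rpow_le_rpow this (show (0:ℝ) ≤ 2 by norm_num)
    rw [ENNReal.mul_rpow_of_nonneg _ _ (by norm_num), l2_sq, ← ENNReal.rpow_mul,
      show (1 / 2 : ℝ) * 2 = 1 by norm_num, ENNReal.rpow_one] at h2
    exact h2.trans (mul_le_mul_left hcard _)
  calc _ ≤ cv (fun y => (2 ^ j) ^ d * ∑ J ∈ Sj T k a j α, pw 2 (fJ T f (k - j) J) y)
        (fun y => ENNReal.ofReal ((2 ^ j) ^ (d + 1)) * w E (2 ^ j) y) x :=
        cv_mono h1 (fun y => w_scale E (one_le_pow₀ (by norm_num)) (pow_le_pow_right₀ (by norm_num) ha) y) x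
    _ = _ := by
        rw [cv_const_mul_left (by fun_prop) (by fun_prop), cv_const_mul_right (by fun_prop) (by fun_prop),
          cv_sum_left (fun J => hmj J) (by fun_prop), ← mul_assoc]
        congr 1
        rw [ENNReal.ofReal_pow (by positivity), ENNReal.ofReal_pow (by positivity), ENNReal.ofReal_ofNat, ← pow_add]
        congr 1; ring

/-- multilinear estimate -/
lemma ML (hd : 1 ≤ d) {Lam p c : ℝ} (hLam : 0 ≤ Lam) (hp : 2 ≤ p) (hpd : p * d ≤ 2 * (d + 2)) (hc : 0 < c)
    (s : ℕ) : ∃ (C CK : ℝ≥0), 1 ≤ CK ∧ ∀ {k a j : ℕ} (_ : 1 ≤ a) (_ : a ≤ j) (_ : 2 ^ s * j ≤ k)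
    {D : ℝ≥0∞} {η : ℝ} (_ : ∀ k' : ℕ, Dec d Lam p k' (D * 2 ^ (η * k'))) {M : Fin d → Fin d → ℝ} (_ : QM Lam M)
    (T : Finset (Fin d → ℤ)) (_ : ∀ z ∈ T, ∀ i, z i / 2 ^ k = 0)
    (f : (Fin d → ℤ) → V d → ℂ) (_ : ∀ z ∈ T, FS (box M 0 0 k z) (f z))
    (α : Fin (d + 1) → Fin d → ℤ) (_ : ∀ i l, |ctr a (α i) l| ≤ 1)
    (_ : c ≤ |(Matrix.of fun i => cc (evec M a (α i))).det|),
    ∫⁻ x, ∏ i, cv (pw 2 (fJ T f (k - a) (α i))) (w (Es d s) (2 ^ a)) x ^ (p / (2 * ((d + 1 : ℕ) : ℝ))) ≤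
      C * ((CK ^ (k / a + 1)) ^ 2 *
      (2 ^ ((2 * d + 1) * (j:ℝ) / 2 + η * (k - j * (1 + s / 2))) * D * l2 T (fun z => nrm p (f z))) ^ p) := by
  have hp0 : 0 < p := by linarith
  have hm : (0:ℝ) < ((d + 1 : ℕ) : ℝ) := by positivity
  obtain ⟨C, CK, hCK, h⟩ := iter hd hLam hp hpd hc s
  refine ⟨C, CK, hCK, ?_⟩
  intro k a j ha haj hjk D η hD M hM T hT f hf α hα hdet
  have h2s : 1 ≤ 2 ^ s := Nat.one_le_two_pow
  have hj : j ≤ k := by nlinarith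
  have hfm : ∀ z ∈ T, Measurable (f z) := fun z hz => (hf z hz).meas
  set τ : ℝ := p / (2 * ((d + 1 : ℕ) : ℝ)) with hτ
  have hτ0 : 0 < τ := by positivity
  have h1 := h ha haj hjk hD hM T hT f hf α hα hdet
  calc _ ≤ ∫⁻ x, ((2:ℝ≥0∞) ^ ((2 * d + 1) * (j:ℝ) / 2)) ^ p * ∏ i, Xj T f k a j (Es d s) (2 ^ j) (α i) x ^ τ := by
        refine lintegral_mono fun x => ?_
        dsimp only
        refine (Finset.prod_le_prod' fun i _ => ENNReal.rpow_le_rpow (start T haj hj f hfm (Es d s) (α i) x) hτ0.le).trans ?_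
        simp only [ENNReal.mul_rpow_of_nonneg _ _ hτ0.le]
        rw [Finset.prod_mul_distrib, Finset.prod_const, Finset.card_univ, Fintype.card_fin]
        refine mul_le_mul_left (le_of_eq ?_) _
        simp only [← ENNReal.rpow_natCast, ← ENNReal.rpow_mul]
        congr 1
        rw [hτ]; push_cast; field_simp
    _ = ((2:ℝ≥0∞) ^ ((2 * d + 1) * (j:ℝ) / 2)) ^ p * Aj p T f k a j (Es d s) α := by
        rw [lintegral_const_mul]
        · rfl
        · exact Finset.measurable_prod _ fun i _ => (Xj_meas hfm _ _ _ _ _ _).pow_const _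
    _ ≤ ((2:ℝ≥0∞) ^ ((2 * d + 1) * (j:ℝ) / 2)) ^ p * (C * ((CK ^ (k / a + 1)) ^ 2 *
          ((D * 2 ^ (η * (k - j * (1 + s / 2)))) ^ p * l2 T (fun z => nrm p (f z)) ^ p))) :=
        mul_le_mul_right (h1.trans (mul_le_mul_right (mul_le_mul_right (mul_le_mul_right (Bp_le hp T f k a α) _) _) _)) _
    _ = _ := by
        rw [ENNReal.rpow_add _ _ (by norm_num) (by norm_num)]
        simp only [ENNReal.mul_rpow_of_nonneg _ _ hp0.le]
        ring

end DR

namespace DR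

open Filter Topology
open scoped ENNReal NNReal

variable {d : ℕ}

/-- transversality dichotomy -/
lemma dicho (m : ℕ) (S : Set (Fin m → ℝ)) {r : ℝ} (hr : 0 < r) :
    (∃ n : Fin m → ℝ, (∃ i, 1 ≤ |n i|) ∧ ∀ v ∈ S, |∑ i, n i * v i| ≤ r) ∨
    (∃ t : Fin m → Fin m → ℝ, (∀ i, t i ∈ S) ∧ r ^ m ≤ |(Matrix.of t).det|) := by
  induction m with
  | zero => right; exact ⟨fun i => i.elim0, fun i => i.elim0, by simp⟩
  | succ m ih =>
    by_cases h : ∀ v ∈ S, |v 0| ≤ r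
    · left
      refine ⟨Pi.single 0 1, ⟨0, by simp⟩, fun v hv => ?_⟩
      simpa [Pi.single_apply] using h v hv
    · push Not at h
      obtain ⟨u, hu, hur⟩ := h
      have hu0 : u 0 ≠ 0 := by
        intro h0; rw [h0, abs_zero] at hur; linarith
      rcases ih ((fun v : Fin (m + 1) → ℝ => fun i : Fin m => v i.succ - v 0 / u 0 * u i.succ) '' S) with
        ⟨n, ⟨i, hi⟩, hn⟩ | ⟨t, ht, hdet⟩
      · left
        refine ⟨Fin.cons (-(∑ i, n i * u i.succ) / u 0) n, ⟨i.succ, by simpa using hi⟩, fun v hv => ?_⟩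
        have := hn _ ⟨v, hv, rfl⟩
        rw [Fin.sum_univ_succ]
        simp only [Fin.cons_zero, Fin.cons_succ]
        have e : -(∑ i, n i * u i.succ) / u 0 * v 0 + ∑ i : Fin m, n i * v i.succ =
            ∑ i, n i * (v i.succ - v 0 / u 0 * u i.succ) := by
          have : ∑ i, n i * (v i.succ - v 0 / u 0 * u i.succ) =
              ∑ i : Fin m, n i * v i.succ - v 0 / u 0 * ∑ i, n i * u i.succ := by
            rw [Finset.mul_sum, ← Finset.sum_sub_distrib]
            refine Finset.sum_congr rfl fun i _ => by ring
          rw [this]; field_simp; ring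
        rw [e]; exact this
      · right
        choose v hv hvt using ht
        refine ⟨Fin.cons u v, ?_, ?_⟩
        · intro i
          refine Fin.cases ?_ (fun j => ?_) i
          · simpa using hu
          · simpa using hv j
        · set B : Matrix (Fin (m + 1)) (Fin (m + 1)) ℝ := Matrix.of (Fin.cons u v) with hB
          set c : Fin (m + 1) → ℝ := Fin.cons 0 (fun j => -(v j 0 / u 0)) with hc
          set A : Matrix (Fin (m + 1)) (Fin (m + 1)) ℝ := Matrix.of fun i j => B i j + c i * B 0 j with hA
          have hAB : A.det = B.det := Matrix.det_eq_of_forall_row_eq_smul_add_const c 0 (by simp [hc]) (fun i j => rfl)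
          rw [← hAB, Matrix.det_succ_column_zero, Fin.sum_univ_succ]
          have z : ∀ j : Fin m, A j.succ 0 = 0 := by
            intro j
            simp only [hA, hB, hc, Matrix.of_apply, Fin.cons_succ, Fin.cons_zero]
            field_simp; ring
          have sub : A.submatrix (Fin.succAbove 0) Fin.succ = Matrix.of t := by
            ext i j
            simp only [hA, hB, hc, Matrix.submatrix_apply, Matrix.of_apply, Fin.zero_succAbove, Fin.cons_succ,
              Fin.cons_zero, ← hvt]
            ring
          have a00 : A 0 0 = u 0 := by simp [hA, hB, hc]
          rw [sub, a00]
          simp only [z, mul_zero, zero_mul, Finset.sum_const_zero, add_zero, Fin.val_zero, pow_zero, one_mul]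
          rw [abs_mul, pow_succ, mul_comm]
          gcongr

/-- near-degenerate families of normals lie near a hyperplane -/
lemma hyper {Lam : ℝ} {M : Fin (d + 1) → Fin (d + 1) → ℝ} (hM : QM Lam M) (A : ℕ) (S : Finset (Fin (d + 1) → ℤ))
    (hS : ∀ α ∈ S, ∀ l, |ctr A α l| ≤ 1) {r : ℝ} (hr : 0 < r) (hr4 : r ≤ 1 / 4)
    (h : ∀ τ : Fin (d + 2) → Fin (d + 1) → ℤ, (∀ i, τ i ∈ S) →
      ¬ r ^ (d + 2) ≤ |(Matrix.of fun i => cc (evec M A (τ i))).det|) :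
    ∃ (i : Fin (d + 1)) (t0 : ℝ) (t : Fin d → ℝ), (∀ l, |t l| ≤ 1) ∧ ∀ α ∈ S,
      |ctr A α i - (t0 + ∑ l, t l * ctr A α (i.succAbove l))| ≤ 2 * (d + 1) * r := by
  rcases S.eq_empty_or_nonempty with rfl | ⟨α0, hα0⟩
  · exact ⟨0, 0, 0, by simp, by simp⟩
  rcases dicho (d + 2) ((fun α => cc (evec M A α)) '' (S : Set (Fin (d + 1) → ℤ))) hr with ⟨n, ⟨i0, hi0⟩, hn⟩ | ⟨t, ht, hdet⟩
  swap
  · exfalso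
    choose τ hτ hτt using ht
    refine h τ (fun i => by simpa using hτ i) ?_
    convert hdet using 5
    rename_i i
    exact hτt i
  set n' : Fin (d + 1) → ℝ := fun j => n j.succ with hn'
  set u : Fin (d + 1) → ℝ := fun j => 2 * Mv M n' j with hu
  have hkey : ∀ α ∈ S, |n 0 - ∑ j, u j * ctr A α j| ≤ r := by
    intro α hα
    have := hn _ ⟨α, hα, rfl⟩
    have e : ∑ i, n i * cc (evec M A α) i = n 0 - ∑ j, u j * ctr A α j := by
      rw [Fin.sum_univ_succ]
      simp only [cc, evec, Fin.cons_zero, Fin.cons_succ, mul_one]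
      rw [sub_eq_add_neg]
      congr 1
      have e1 : ∑ j, u j * ctr A α j = 2 * bil M (ctr A α) n' := by
        rw [bil_eq_Mv, Finset.mul_sum]
        refine Finset.sum_congr rfl fun j _ => by simp only [hu]; ring
      have e2 : ∑ j : Fin (d + 1), n j.succ * -slp M A α j = -(2 * bil M n' (ctr A α)) := by
        rw [bil_eq_Mv, Finset.mul_sum, ← Finset.sum_neg_distrib]
        refine Finset.sum_congr rfl fun j _ => by simp only [hn', slp]; ring
      rw [e1, e2, bil_symm hM]
    rw [← e]; exact this
  have hd1 : (0:ℝ) < (d:ℝ) + 1 := by positivity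
  obtain ⟨i, -, hi⟩ := Finset.exists_max_image Finset.univ (fun j => |u j|) ⟨0, Finset.mem_univ _⟩
  have hi' : ∀ j, |u j| ≤ |u i| := fun j => hi j (Finset.mem_univ _)
  have hlow : 1 / (2 * ((d:ℝ) + 1)) ≤ |u i| := by
    by_contra hcon
    push Not at hcon
    have h1 : |∑ j, u j * ctr A α0 j| ≤ 1 / 2 := by
      refine (Finset.abs_sum_le_sum_abs _ _).trans ?_
      calc ∑ j, |u j * ctr A α0 j| ≤ ∑ _j : Fin (d + 1), 1 / (2 * ((d:ℝ) + 1)) := by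
            refine Finset.sum_le_sum fun j _ => ?_
            rw [abs_mul]
            calc |u j| * |ctr A α0 j| ≤ |u j| * 1 := by gcongr; exact hS α0 hα0 j
              _ ≤ _ := by rw [mul_one]; exact (hi' j).trans hcon.le
        _ = 1 / 2 := by
            rw [Finset.sum_const, Finset.card_univ, Fintype.card_fin, nsmul_eq_mul]; push_cast; field_simp
    have h2 : |n 0| < 1 := by
      have := hkey α0 hα0
      have h3 := abs_add_le (n 0 - ∑ j, u j * ctr A α0 j) (∑ j, u j * ctr A α0 j)
      rw [sub_add_cancel] at h3
      linarith
    obtain ⟨i1, -, hi1⟩ := Finset.exists_max_image Finset.univ (fun j => |n' j|) ⟨0, Finset.mem_univ _⟩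
    have hi1' : ∀ j, |n' j| ≤ |n' i1| := fun j => hi1 j (Finset.mem_univ _)
    have h4 : 1 ≤ |n' i1| := by
      rcases Fin.eq_zero_or_eq_succ i0 with rfl | ⟨j, rfl⟩
      · exact absurd hi0 (not_le.2 h2)
      · exact hi0.trans (hi1' j)
    have h5 : |n' i1| ^ 2 ≤ (d + 1) * (|n' i1| * (|u i| / 2)) := by
      calc |n' i1| ^ 2 = n' i1 ^ 2 := sq_abs _
        _ ≤ ∑ j, n' j ^ 2 := Finset.single_le_sum (f := fun j => n' j ^ 2) (fun j _ => sq_nonneg _) (Finset.mem_univ _)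
        _ ≤ bil M n' n' := hM.coer n'
        _ = ∑ j, n' j * (u j / 2) := by
            rw [bil_eq_Mv]
            refine Finset.sum_congr rfl fun j _ => by simp only [hu]; ring
        _ ≤ ∑ _j : Fin (d + 1), |n' i1| * (|u i| / 2) := by
            refine Finset.sum_le_sum fun j _ => ?_
            refine (le_abs_self _).trans ?_
            rw [abs_mul, abs_div, abs_two]
            exact mul_le_mul (hi1' j) (div_le_div_of_nonneg_right (hi' j) (by norm_num)) (by positivity) (abs_nonneg _)
        _ = _ := by
            rw [Finset.sum_const, Finset.card_univ, Fintype.card_fin, nsmul_eq_mul]; push_cast; ring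
    have h6 : |n' i1| ≤ (d + 1) * (|u i| / 2) := by
      have : 0 < |n' i1| := by linarith
      nlinarith
    rw [lt_div_iff₀ (by positivity)] at hcon
    nlinarith [abs_nonneg (u i)]
  have hui : 0 < |u i| := lt_of_lt_of_le (by positivity) hlow
  have hui0 : u i ≠ 0 := abs_pos.1 hui
  refine ⟨i, n 0 / u i, fun l => -(u (i.succAbove l) / u i), ?_, ?_⟩
  · intro l
    rw [abs_neg, abs_div, div_le_one hui]
    exact hi' _
  · intro α hα
    have h1 := hkey α hα
    rw [Fin.sum_univ_succAbove _ i] at h1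
    have e : ctr A α i - (n 0 / u i + ∑ l, -(u (i.succAbove l) / u i) * ctr A α (i.succAbove l)) =
        -(n 0 - (u i * ctr A α i + ∑ l, u (i.succAbove l) * ctr A α (i.succAbove l))) / u i := by
      have : ∑ l, -(u (i.succAbove l) / u i) * ctr A α (i.succAbove l) =
          -(∑ l, u (i.succAbove l) * ctr A α (i.succAbove l)) / u i := by
        rw [neg_div, Finset.sum_div, ← Finset.sum_neg_distrib]
        refine Finset.sum_congr rfl fun l _ => by ring
      rw [this]; field_simp; ring
    rw [e, abs_div, abs_neg, div_le_iff₀ hui]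
    refine h1.trans ?_
    have : 1 ≤ 2 * ((d:ℝ) + 1) * |u i| := by
      rw [div_le_iff₀ (by positivity)] at hlow; linarith
    nlinarith

end DR

namespace DR

open Filter Topology
open scoped ENNReal NNReal

variable {d : ℕ}

/-- insert a coordinate -/
def ins (i : Fin (d + 1)) (s : ℝ) (v : V d) : V (d + 1) := (i.insertNth s v.1, v.2)

lemma mp_ins (i : Fin (d + 1)) : MeasurePreserving (fun x : ℝ × V d => ins i x.1 x.2) volume volume := by
  have h1 := (volume_preserving_piFinSuccAbove (fun _ : Fin (d + 1) => ℝ) i).symm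
  have h2 := h1.prod (MeasurePreserving.id (volume : Measure ℝ))
  have h3 := (volume_preserving_prodAssoc (α₁ := ℝ) (β₁ := Fin d → ℝ) (γ₁ := ℝ)).symm
  exact h2.comp h3

lemma lintegral_ins (i : Fin (d + 1)) {F : V (d + 1) → ℝ≥0∞} (hF : Measurable F) :
    ∫⁻ y, F y = ∫⁻ s : ℝ, ∫⁻ v : V d, F (ins i s v) := by
  rw [← (mp_ins i).lintegral_comp hF]
  exact lintegral_prod _ (hF.comp (mp_ins i).measurable).aemeasurable

lemma nrm_ins {p : ℝ} (hp : 0 < p) (i : Fin (d + 1)) {g : V (d + 1) → ℂ} (hg : Measurable g) :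
    nrm p g = N p volume (fun s => nrm p (fun v => g (ins i s v))) := by
  unfold nrm N
  rw [lintegral_ins i (by fun_prop)]
  congr 2
  ext s
  exact (rpow_inv_rpow' _ hp.ne').symm

lemma meas_nrm_ins {p : ℝ} (i : Fin (d + 1)) {g : V (d + 1) → ℂ} (hg : Measurable g) :
    Measurable (fun s => nrm p (fun v => g (ins i s v))) := by
  unfold nrm N
  refine Measurable.pow_const ?_ _
  have h : Measurable (fun x : ℝ × V d => ‖g (ins i x.1 x.2)‖ₑ ^ p) :=
    ((hg.comp (mp_ins i).measurable).enorm).pow_const _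
  exact h.lintegral_prod_right'

lemma FS_ins (i : Fin (d + 1)) (s : ℝ) {S : Set (V (d + 1))} {U : Set (V d)} {g : V (d + 1) → ℂ} (hg : FS S g)
    (hU : ∀ ξ ∈ S, ((fun l => ξ.1 (i.succAbove l), ξ.2) : V d) ∈ U) : FS U (fun v => g (ins i s v)) := by
  refine hg.comp (ins i s) fun ξ hξ => ?_
  have e : (fun v : V d => ee (pr ξ (ins i s v))) =
      fun v => ee (ξ.1 i * s) * ee (pr (fun l => ξ.1 (i.succAbove l), ξ.2) v) := by
    ext v
    rw [← ee_add]
    congr 1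
    simp only [pr, ins]
    rw [Fin.sum_univ_succAbove _ i]
    simp only [Fin.insertNth_apply_same, Fin.insertNth_apply_succAbove]
    ring
  rw [e]
  exact FS.smul _ _ (FS.exp _ (hU ξ hξ))

/-- graph embedding of the hyperplane -/
def insg (i : Fin (d + 1)) (t : Fin d → ℝ) (x : Fin d → ℝ) : Fin (d + 1) → ℝ := i.insertNth (∑ l, t l * x l) x

/-- induced quadratic form -/
def Mt (M : Fin (d + 1) → Fin (d + 1) → ℝ) (i : Fin (d + 1)) (t : Fin d → ℝ) (l l' : Fin d) : ℝ :=
  M (i.succAbove l) (i.succAbove l') + t l * M i (i.succAbove l') + M (i.succAbove l) i * t l' + t l * M i i * t l'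

lemma bil_insg (M : Fin (d + 1) → Fin (d + 1) → ℝ) (i : Fin (d + 1)) (t x : Fin d → ℝ) :
    bil M (insg i t x) (insg i t x) = bil (Mt M i t) x x := by
  unfold bil Mt
  simp only [Fin.sum_univ_succAbove _ i, insg, Fin.insertNth_apply_same, Fin.insertNth_apply_succAbove]
  simp only [add_mul, Finset.sum_add_distrib]
  have e1 : ∑ l, ∑ l', t l * M i (i.succAbove l') * x l * x l' =
      ∑ l', M i (i.succAbove l') * (∑ l, t l * x l) * x l' := by
    rw [Finset.sum_comm]
    refine Finset.sum_congr rfl fun l' _ => ?_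
    rw [Finset.mul_sum, Finset.sum_mul]
    refine Finset.sum_congr rfl fun l _ => by ring
  have e2 : ∑ l, ∑ l', M (i.succAbove l) i * t l' * x l * x l' =
      ∑ l, M (i.succAbove l) i * x l * (∑ l', t l' * x l') := by
    refine Finset.sum_congr rfl fun l _ => ?_
    rw [Finset.mul_sum]
    refine Finset.sum_congr rfl fun l' _ => by ring
  have e3 : ∑ l, ∑ l', t l * M i i * t l' * x l * x l' = M i i * (∑ l, t l * x l) * (∑ l', t l' * x l') := by
    rw [mul_assoc, Finset.sum_mul_sum, Finset.mul_sum]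
    refine Finset.sum_congr rfl fun l _ => ?_
    rw [Finset.mul_sum]
    refine Finset.sum_congr rfl fun l' _ => by ring
  rw [e1, e2, e3]; ring

lemma QM_Mt {Lam : ℝ} {M : Fin (d + 1) → Fin (d + 1) → ℝ} (hM : QM Lam M) (i : Fin (d + 1)) {t : Fin d → ℝ}
    (ht : ∀ l, |t l| ≤ 1) : QM (4 * Lam) (Mt M i t) where
  symm l l' := by
    unfold Mt
    rw [hM.symm (i.succAbove l), hM.symm i, hM.symm (i.succAbove l) i]; ring
  coer x := by
    rw [← bil_insg]
    refine le_trans ?_ (hM.coer _)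
    rw [Fin.sum_univ_succAbove _ i]
    simp only [insg, Fin.insertNth_apply_succAbove]
    nlinarith [sq_nonneg ((i.insertNth (∑ l, t l * x l) x : Fin (d + 1) → ℝ) i)]
  bd l l' := by
    unfold Mt
    have hL : 0 ≤ Lam := (abs_nonneg _).trans (hM.bd i i)
    have h1 := hM.bd (i.succAbove l) (i.succAbove l')
    have h2 : |t l * M i (i.succAbove l')| ≤ Lam := by
      rw [abs_mul]
      calc _ ≤ 1 * Lam := mul_le_mul (ht l) (hM.bd _ _) (abs_nonneg _) (by norm_num)
        _ = Lam := one_mul _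
    have h3 : |M (i.succAbove l) i * t l'| ≤ Lam := by
      rw [abs_mul]
      calc _ ≤ Lam * 1 := mul_le_mul (hM.bd _ _) (ht l') (abs_nonneg _) hL
        _ = Lam := mul_one _
    have h4 : |t l * M i i * t l'| ≤ Lam := by
      rw [abs_mul, abs_mul]
      calc _ ≤ 1 * Lam * 1 := mul_le_mul (mul_le_mul (ht l) (hM.bd _ _) (abs_nonneg _) (by norm_num)) (ht l')
            (abs_nonneg _) (by positivity)
        _ = Lam := by ring
    calc _ ≤ |M (i.succAbove l) (i.succAbove l')| + |t l * M i (i.succAbove l')| + |M (i.succAbove l) i * t l'| +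
          |t l * M i i * t l'| := by
          refine (abs_add_le _ _).trans ?_
          gcongr
          refine (abs_add_le _ _).trans ?_
          gcongr
          exact abs_add_le _ _
      _ ≤ 4 * Lam := by linarith

lemma bil_aff {Lam : ℝ} {M : Fin (d + 1) → Fin (d + 1) → ℝ} (hM : QM Lam M) (i : Fin (d + 1)) (t : Fin d → ℝ)
    (t0 : ℝ) : ∃ (l' : Fin d → ℝ) (κ : ℝ), ∀ x : Fin d → ℝ, bil M (insg i t x + Pi.single i t0) (insg i t x + Pi.single i t0) =
      bil (Mt M i t) x x + ∑ l, l' l * x l + κ := by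
  set c : Fin (d + 1) → ℝ := Mv M (Pi.single i t0) with hc
  refine ⟨fun l => 2 * (c (i.succAbove l) + t l * c i), bil M (Pi.single i t0) (Pi.single i t0), fun x => ?_⟩
  rw [bil_expand hM, bil_insg]
  congr 2
  rw [Fin.sum_univ_succAbove _ i]
  simp only [insg, Fin.insertNth_apply_same, Fin.insertNth_apply_succAbove, ← hc]
  rw [Finset.sum_mul, ← Finset.sum_add_distrib, Finset.mul_sum]
  refine Finset.sum_congr rfl fun l _ => by ring

lemma l2_fib {ι κ : Type*} [DecidableEq κ] (S : Finset ι) (g : ι → κ) (F : ι → ℝ≥0∞) :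
    l2 (S.image g) (fun J => l2 (S.filter (fun z => g z = J)) F) = l2 S F := by
  have h : ∀ J, l2 (S.filter (fun z => g z = J)) F ^ (2:ℝ) = ∑ z ∈ S.filter (fun z => g z = J), F z ^ (2:ℝ) :=
    fun J => l2_sq _ _
  conv_lhs => unfold l2
  unfold l2 at h
  simp only [h]
  rw [Finset.sum_fiberwise_of_maps_to (fun z hz => Finset.mem_image_of_mem _ hz)]
  rfl

lemma slice {Lam p : ℝ} (hLam : 0 ≤ Lam) (hp : 2 ≤ p) {b : ℕ} {D' : ℝ≥0∞} (hD : Dec d (4 * Lam) p b D')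
    {M : Fin (d + 1) → Fin (d + 1) → ℝ} (hM : QM Lam M) (i : Fin (d + 1)) (t0 : ℝ) (t : Fin d → ℝ)
    (ht : ∀ l, |t l| ≤ 1) {δ : ℝ} (hδ0 : 0 ≤ δ) (hδ1 : δ ≤ 1) (hδ : (1 + 9 * ((d:ℝ) + 1) ^ 2 * Lam) * δ ≤ 1 / 4 ^ b)
    (S : Finset (Fin (d + 1) → ℤ)) (hS : ∀ β ∈ S, ∀ l, β l / 2 ^ b = 0)
    (hS' : ∀ β ∈ S, |(β i : ℝ) - (t0 * 2 ^ b + ∑ l, t l * β (i.succAbove l))| ≤ d + 4)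
    (G : (Fin (d + 1) → ℤ) → V (d + 1) → ℂ)
    (hG : ∀ β ∈ S, FS {ξ : V (d + 1) | (∀ l, |ξ.1 l - β l / 2 ^ b| ≤ 2 / 2 ^ b) ∧
      |ξ.1 i - (t0 + ∑ l, t l * ξ.1 (i.succAbove l))| ≤ δ ∧ |ξ.2 - bil M ξ.1 ξ.1| ≤ δ} (G β)) :
    nrm p (fun x => ∑ β ∈ S, G β x) ≤
      D' * (((2 * d + 10 : ℕ) : ℝ≥0∞) ^ (1 / 2 : ℝ) * l2 S (fun β => nrm p (G β))) := by
  have hp0 : 0 < p := by linarith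
  have hGm : ∀ β ∈ S, Measurable (G β) := fun β hβ => (hG β hβ).meas
  set rm : (Fin (d + 1) → ℤ) → Fin d → ℤ := fun β l => β (i.succAbove l) with hrm
  set G' : (Fin d → ℤ) → V (d + 1) → ℂ := fun β' x => ∑ β ∈ S.filter (fun β => rm β = β'), G β x with hG'
  have hG'm : ∀ β', Measurable (G' β') := fun β' =>
    Finset.measurable_sum _ fun β hβ => hGm β (Finset.mem_filter.1 hβ).1
  have hsum : ∀ x, ∑ β ∈ S, G β x = ∑ β' ∈ S.image rm, G' β' x := fun x =>
    (Finset.sum_fiberwise_of_maps_to (fun z hz => Finset.mem_image_of_mem _ hz) _).symm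
  obtain ⟨l', κ, hlκ⟩ := bil_aff hM i t t0
  have hFS : ∀ s, ∀ β' ∈ S.image rm, FS (box (Mt M i t) l' κ b β') (fun v => G' β' (ins i s v)) := by
    intro s β' _
    refine FS.sum fun β hβ => ?_
    obtain ⟨hβS, rfl⟩ := Finset.mem_filter.1 hβ
    refine FS_ins i s (hG β hβS) ?_
    rintro ξ ⟨h1, h2, h3⟩
    refine ⟨fun l => h1 (i.succAbove l), ?_⟩
    set x' : Fin d → ℝ := fun l => ξ.1 (i.succAbove l) with hx'
    set x0 : Fin (d + 1) → ℝ := insg i t x' + Pi.single i t0 with hx0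
    rw [← hlκ x', ← hx0]
    have hdiff : ∀ j, |(ξ.1 - x0) j| ≤ δ := by
      intro j
      rcases Fin.eq_self_or_eq_succAbove i j with rfl | ⟨l, rfl⟩
      · simp only [hx0, Pi.sub_apply, Pi.add_apply, insg, Fin.insertNth_apply_same, Pi.single_eq_same]
        rw [add_comm (∑ l, t l * x' l) t0]; exact h2
      · simp only [hx0, Pi.sub_apply, Pi.add_apply, insg, Fin.insertNth_apply_succAbove,
          Pi.single_eq_of_ne (Fin.succAbove_ne i l), hx', add_zero, sub_self, abs_zero]
        exact hδ0
    have hx0b : ∀ j, |x0 j| ≤ 4 := by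
      intro j
      have hβ1 : |(β j : ℝ) / 2 ^ b| ≤ 1 := by
        have := ctr_le_one (le_refl b) (hS β hβS) j
        simpa [ctr, par_zero] using this
      have hξ := h1 j
      have h22 : (2:ℝ) / 2 ^ b ≤ 2 := by
        rw [div_le_iff₀ (by positivity)]
        have : (1:ℝ) ≤ 2 ^ b := one_le_pow₀ (by norm_num)
        linarith
      have hd := hdiff j
      simp only [Pi.sub_apply] at hd
      rw [abs_le] at *
      constructor <;> linarith
    have hexp := bil_expand hM (ξ.1 - x0) x0
    rw [sub_add_cancel] at hexp
    have b1 := abs_bil_le hM hdiff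
    have b2 : |∑ j, (ξ.1 - x0) j * Mv M x0 j| ≤ (d + 1) * (δ * ((d + 1) * (Lam * 4))) := by
      refine (Finset.abs_sum_le_sum_abs _ _).trans ?_
      calc _ ≤ ∑ _j : Fin (d + 1), δ * ((d + 1) * (Lam * 4)) := by
            refine Finset.sum_le_sum fun j _ => ?_
            rw [abs_mul]
            have := abs_Mv_le hM hx0b j
            push_cast at this
            exact mul_le_mul (hdiff j) this (abs_nonneg _) hδ0
        _ = _ := by
            rw [Finset.sum_const, Finset.card_univ, Fintype.card_fin, nsmul_eq_mul]; push_cast; ring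
    push_cast at b1
    rw [show ξ.2 - bil M x0 x0 = (ξ.2 - bil M ξ.1 ξ.1) + (bil M (ξ.1 - x0) (ξ.1 - x0) +
      2 * ∑ j, (ξ.1 - x0) j * Mv M x0 j) by rw [hexp]; ring]
    refine le_trans ?_ hδ
    have b3 : |2 * ∑ j, (ξ.1 - x0) j * Mv M x0 j| ≤ 2 * ((d + 1) * (δ * ((d + 1) * (Lam * 4)))) := by
      rw [abs_mul, abs_two]; linarith
    have b4 : ((d:ℝ) + 1) * (δ * (((d:ℝ) + 1) * (Lam * δ))) ≤ ((d:ℝ) + 1) * (δ * (((d:ℝ) + 1) * (Lam * 1))) := by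
      gcongr
    have c1 := abs_add_le (ξ.2 - bil M ξ.1 ξ.1) (bil M (ξ.1 - x0) (ξ.1 - x0) + 2 * ∑ j, (ξ.1 - x0) j * Mv M x0 j)
    have c2 := abs_add_le (bil M (ξ.1 - x0) (ξ.1 - x0)) (2 * ∑ j, (ξ.1 - x0) j * Mv M x0 j)
    nlinarith
  have hcard : ∀ β', ((S.filter (fun β => rm β = β')).card : ℝ≥0∞) ≤ ((2 * d + 10 : ℕ) : ℝ≥0∞) := by
    intro β'
    set c : ℝ := t0 * 2 ^ b + ∑ l, t l * β' l with hc
    have : (S.filter (fun β => rm β = β')).card ≤ (Finset.Icc ⌈c - (d + 4)⌉ ⌊c + (d + 4)⌋).card := by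
      refine Finset.card_le_card_of_injOn (fun β => β i) ?_ ?_
      · intro β hβ
        obtain ⟨h1, rfl⟩ := Finset.mem_filter.1 hβ
        have := abs_le.1 (hS' β h1)
        simp only [Finset.coe_Icc, Set.mem_Icc]
        rw [Int.ceil_le, Int.le_floor]
        simp only [hc, hrm]
        constructor <;> linarith
      · intro β hβ β2 hβ2 h
        have e1 := (Finset.mem_filter.1 hβ).2
        have e2 := (Finset.mem_filter.1 hβ2).2
        ext j
        rcases Fin.eq_self_or_eq_succAbove i j with rfl | ⟨l, rfl⟩
        · exact h
        · exact congrFun (e1.trans e2.symm) l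
    have h2 : (Finset.Icc ⌈c - (d + 4)⌉ ⌊c + (d + 4)⌋).card ≤ 2 * d + 10 := by
      rw [Int.card_Icc, Int.toNat_le]
      have h3 : ((⌊c + (d + 4)⌋ + 1 - ⌈c - (d + 4)⌉ : ℤ) : ℝ) ≤ ((2 * d + 10 : ℕ) : ℝ) := by
        push_cast
        have := Int.floor_le (c + (d + 4))
        have := Int.le_ceil (c - ((d:ℝ) + 4))
        linarith
      exact_mod_cast h3
    exact_mod_cast this.trans h2
  have hGsum : Measurable fun x => ∑ β ∈ S, G β x := Finset.measurable_sum _ fun β hβ => hGm β hβ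
  calc nrm p (fun x => ∑ β ∈ S, G β x)
      = N p volume (fun s => nrm p (fun v => ∑ β' ∈ S.image rm, G' β' (ins i s v))) := by
        rw [nrm_ins hp0 i hGsum]
        simp only [hsum]
    _ ≤ N p volume (fun s => D' * l2 (S.image rm) (fun β' => nrm p (fun v => G' β' (ins i s v)))) := by
        refine N_mono hp0.le fun s => ?_
        refine hD (Mt M i t) (QM_Mt hM i ht) l' κ 0 (S.image rm) ?_ (fun β' v => G' β' (ins i s v)) (hFS s)
        intro β' hβ' l
        obtain ⟨β, hβ, rfl⟩ := Finset.mem_image.1 hβ'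
        exact hS β hβ _
    _ ≤ D' * l2 (S.image rm) (fun β' => nrm p (G' β')) := by
        have hm := fun β' => meas_nrm_ins (p := p) i (hG'm β')
        rw [N_const_mul hp0 _ (by unfold l2; fun_prop)]
        gcongr
        refine (N_l2_le hp _ hm).trans (le_of_eq ?_)
        congr 1; ext β'
        rw [nrm_ins hp0 i (hG'm β')]
    _ ≤ D' * l2 (S.image rm) (fun β' => ((2 * d + 10 : ℕ) : ℝ≥0∞) ^ (1 / 2 : ℝ) *
          l2 (S.filter (fun β => rm β = β')) (fun β => nrm p (G β))) := by
        gcongr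
        refine l2_mono fun β' _ => ?_
        refine (nrm_sum_le_l2 (by linarith) _ _ fun β hβ => hGm β (Finset.mem_filter.1 hβ).1).trans ?_
        gcongr
        exact_mod_cast hcard β'
    _ = _ := by
        rw [l2_const_mul, l2_fib]

end DR

namespace DR

open Filter Topology
open scoped ENNReal NNReal

variable {d : ℕ}

lemma l2_add_le {ι : Type*} (T : Finset ι) (F G : ι → ℝ≥0∞) :
    l2 T (fun i => F i + G i) ≤ l2 T F + l2 T G := by
  unfold l2
  exact ENNReal.Lp_add_le T F G (by norm_num)

lemma l2_le_sum {ι : Type*} (T : Finset ι) (F : ι → ℝ≥0∞) : l2 T F ≤ ∑ i ∈ T, F i := by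
  unfold l2
  have h : ∑ i ∈ T, F i ^ (2:ℝ) ≤ (∑ i ∈ T, F i) ^ (2:ℝ) := by
    rw [ENNReal.rpow_two, sq, Finset.sum_mul]
    refine Finset.sum_le_sum fun i hi => ?_
    rw [ENNReal.rpow_two, sq]
    gcongr
    exact Finset.single_le_sum (f := F) (fun _ _ => bot_le) hi
  calc _ ≤ ((∑ i ∈ T, F i) ^ (2:ℝ)) ^ (1 / 2 : ℝ) := by gcongr
    _ = _ := rpow_rpow_inv' _ (by norm_num)

/-- local constancy at scale `2^A` -/
lemma loc_pt (d : ℕ) {Lam : ℝ} (hLam : 0 ≤ Lam) {E : ℕ} (hE : d + 2 ≤ E) :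
    ∃ C : ℝ≥0, ∀ {M : Fin d → Fin d → ℝ}, QM Lam M → ∀ (A : ℕ) (α : Fin d → ℤ), (∀ i, |ctr A α i| ≤ 1) →
      ∀ g, FS (box M 0 0 A α) g → ∀ x y,
        ‖g (x + y)‖ₑ ≤ C * ENNReal.ofReal ((1 + ‖y‖ / 2 ^ A) ^ E) * cv (pw 2 g) (w E (2 ^ A)) x ^ (1 / 2 : ℝ) := by
  obtain ⟨C, hC⟩ := L1 d E (by omega) (2 + d * (d * Lam) * 4) (by positivity) 2 (by norm_num)
  set K : ℝ≥0∞ := C * ENNReal.ofReal ((1 + 2 * (d * Lam)) ^ E) with hK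
  have hKt : K ^ (1/2:ℝ) ≠ ⊤ := by
    refine ENNReal.rpow_ne_top_of_nonneg (by norm_num) ?_
    rw [hK]; exact ENNReal.mul_ne_top ENNReal.coe_ne_top ENNReal.ofReal_ne_top
  refine ⟨(K ^ (1/2:ℝ)).toNNReal, fun {M} hM A α hα g hg x y => ?_⟩
  rw [ENNReal.coe_toNNReal hKt]
  have hR : (0:ℝ) < 2 ^ A := by positivity
  have h1 := hC _ g hg (ctr A α) (bil M (ctr A α) (ctr A α)) (slp M A α) (2 ^ A) (2 ^ A) hR hR (by
    intro ξ hξ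
    obtain ⟨a, b⟩ := box_tube hLam hM A α ξ hξ
    refine ⟨a, b.trans ?_⟩
    gcongr
    norm_num) (x + y)
  have h2 : cv (fun y => ‖g y‖ₑ ^ (2:ℝ)) (W E (slp M A α) (2 ^ A) (2 ^ A)) (x + y) ≤
      ENNReal.ofReal ((1 + 2 * (d * Lam)) ^ E) * (ENNReal.ofReal ((1 + ‖y‖ / 2 ^ A) ^ E) *
        cv (pw 2 g) (w E (2 ^ A)) x) := by
    unfold cv
    rw [← lintegral_const_mul' _ _ ENNReal.ofReal_ne_top, ← lintegral_const_mul' _ _ ENNReal.ofReal_ne_top,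
      ← lintegral_add_right_eq_self _ y]
    refine lintegral_mono fun z => ?_
    dsimp only
    rw [show x + y - (z + y) = x - z by abel]
    have a1 := W_le_w E (by positivity : 0 ≤ 2 * ((d:ℝ) * Lam)) (slp_le hM A α hα) hR (z + y)
    have a2 := w_shift E hR z y
    calc _ ≤ ‖g (x - z)‖ₑ ^ (2:ℝ) * (ENNReal.ofReal ((1 + 2 * (d * Lam)) ^ E) *
          (ENNReal.ofReal ((1 + ‖y‖ / 2 ^ A) ^ E) * w E (2 ^ A) z)) := by
          gcongr
          exact a1.trans (by gcongr)
      _ = _ := by unfold pw; ring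
  have h3 : ‖g (x + y)‖ₑ ^ (2:ℝ) ≤ K * ENNReal.ofReal ((1 + ‖y‖ / 2 ^ A) ^ E) * cv (pw 2 g) (w E (2 ^ A)) x := by
    refine (h1.trans (mul_le_mul_right h2 _)).trans (le_of_eq ?_)
    rw [hK]; ring
  calc ‖g (x + y)‖ₑ = (‖g (x + y)‖ₑ ^ (2:ℝ)) ^ (1/2:ℝ) := (rpow_rpow_inv' _ (by norm_num)).symm
    _ ≤ (K * ENNReal.ofReal ((1 + ‖y‖ / 2 ^ A) ^ E) * cv (pw 2 g) (w E (2 ^ A)) x) ^ (1/2:ℝ) := by gcongr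
    _ ≤ _ := by
      rw [ENNReal.mul_rpow_of_nonneg _ _ (by norm_num), ENNReal.mul_rpow_of_nonneg _ _ (by norm_num)]
      gcongr
      have h1 : 1 ≤ ENNReal.ofReal ((1 + ‖y‖ / 2 ^ A) ^ E) := by
        rw [ENNReal.one_le_ofReal]
        exact one_le_pow₀ (by have : 0 ≤ ‖y‖ / 2 ^ A := by positivity
                              linarith)
      calc _ ≤ ENNReal.ofReal ((1 + ‖y‖ / 2 ^ A) ^ E) ^ (1:ℝ) :=
            ENNReal.rpow_le_rpow_of_exponent_le h1 (by norm_num)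
        _ = _ := ENNReal.rpow_one _

/-- normalising factor -/
def Hn (d : ℕ) (p R : ℝ) : ℝ≥0∞ := ENNReal.ofReal (R ^ (d + 1)) ^ (1 / p)

lemma Hn_ne_zero {p R : ℝ} (hR : 0 < R) : Hn d p R ≠ 0 := by
  unfold Hn
  have : 0 < ENNReal.ofReal (R ^ (d + 1)) := ENNReal.ofReal_pos.2 (by positivity)
  exact (ENNReal.rpow_pos this ENNReal.ofReal_ne_top).ne'

lemma Hn_ne_top {p R : ℝ} (hp : 0 < p) : Hn d p R ≠ ⊤ :=
  ENNReal.rpow_ne_top_of_nonneg (by positivity) ENNReal.ofReal_ne_top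

lemma chi_up {p : ℝ} (hp : 1 ≤ p) {C : ℝ} (hC : 0 < C) {E m : ℕ} (hm : E + d + 2 ≤ m) {R : ℝ} (hR : 0 < R)
    {χ : V d → ℂ} (hχ : ∀ x, ‖χ x‖ ≤ C * ((1 + ‖x‖ / R) ^ m)⁻¹) :
    N p volume (fun y => ENNReal.ofReal ((1 + ‖y‖ / R) ^ E) * ‖χ y‖ₑ) ≤
      ENNReal.ofReal C * Cw d ^ (1 / p) * Hn d p R := by
  have hp0 : 0 < p := by linarith
  have h1 : ∀ y : V d, ENNReal.ofReal ((1 + ‖y‖ / R) ^ E) * ‖χ y‖ₑ ≤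
      ENNReal.ofReal C * ENNReal.ofReal (((1 + ‖y‖ / R) ^ (d + 2))⁻¹) := by
    intro y
    have hb : 1 ≤ 1 + ‖y‖ / R := by
      have : 0 ≤ ‖y‖ / R := by positivity
      linarith
    have hb0 : 0 < 1 + ‖y‖ / R := by linarith
    rw [← ofReal_norm, ← ENNReal.ofReal_mul (by positivity), ← ENNReal.ofReal_mul hC.le]
    refine ENNReal.ofReal_le_ofReal ?_
    calc _ ≤ (1 + ‖y‖ / R) ^ E * (C * ((1 + ‖y‖ / R) ^ m)⁻¹) := by gcongr; exact hχ y
      _ ≤ (1 + ‖y‖ / R) ^ E * (C * ((1 + ‖y‖ / R) ^ (E + (d + 2)))⁻¹) := by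
          gcongr
          omega
      _ = _ := by rw [pow_add]; field_simp
  have h2 : ∀ y : V d, (ENNReal.ofReal C * ENNReal.ofReal (((1 + ‖y‖ / R) ^ (d + 2))⁻¹)) ^ p ≤
      ENNReal.ofReal C ^ p * (ENNReal.ofReal (R ^ (d + 1)) * w (d + 2) R y) := by
    intro y
    have hb : 1 ≤ 1 + ‖y‖ / R := by
      have : 0 ≤ ‖y‖ / R := by positivity
      linarith
    have hb0 : 0 < 1 + ‖y‖ / R := by linarith
    rw [ENNReal.mul_rpow_of_nonneg _ _ hp0.le]
    gcongr
    unfold w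
    rw [← ENNReal.ofReal_mul (by positivity), ← mul_assoc, mul_inv_cancel₀ (by positivity), one_mul]
    have : ENNReal.ofReal (((1 + ‖y‖ / R) ^ (d + 2))⁻¹) ≤ 1 := by
      rw [ENNReal.ofReal_le_one]
      exact inv_le_one_of_one_le₀ (one_le_pow₀ hb)
    calc _ ≤ ENNReal.ofReal (((1 + ‖y‖ / R) ^ (d + 2))⁻¹) ^ (1:ℝ) :=
          ENNReal.rpow_le_rpow_of_exponent_ge this hp
      _ = _ := ENNReal.rpow_one _
  unfold N Hn
  calc _ ≤ (ENNReal.ofReal C ^ p * (ENNReal.ofReal (R ^ (d + 1)) * Cw d)) ^ (1 / p) := by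
        gcongr
        calc _ ≤ ∫⁻ y : V d, ENNReal.ofReal C ^ p * (ENNReal.ofReal (R ^ (d + 1)) * w (d + 2) R y) := by
              refine lintegral_mono fun y => ?_
              exact (ENNReal.rpow_le_rpow (h1 y) hp0.le).trans (h2 y)
          _ ≤ _ := by
              rw [lintegral_const_mul' _ _ (ENNReal.rpow_ne_top_of_nonneg hp0.le ENNReal.ofReal_ne_top),
                lintegral_const_mul' _ _ ENNReal.ofReal_ne_top]
              gcongr
              exact lintegral_w le_rfl hR
    _ = _ := by
        rw [ENNReal.mul_rpow_of_nonneg _ _ (by positivity), ENNReal.mul_rpow_of_nonneg _ _ (by positivity),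
          rpow_rpow_inv' _ hp0.ne']
        ring

lemma chi_low (d : ℕ) {p : ℝ} (hp : 1 ≤ p) {c : ℝ} (hc : 0 < c) : ∃ c' : ℝ≥0, c' ≠ 0 ∧ ∀ R : ℝ, 0 < R →
    ∀ χ : V d → ℂ, (∀ x, ‖x‖ ≤ R / 2 → c ≤ ‖χ x‖) → c' * Hn d p R ≤ nrm p χ := by
  have hp0 : 0 < p := by linarith
  set v : ℝ≥0∞ := volume (Metric.closedBall (0 : V d) (1 / 2)) with hv
  have hv0 : v ≠ 0 := (Metric.measure_closedBall_pos _ _ (by norm_num)).ne'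
  have hvt : v ≠ ⊤ := measure_closedBall_lt_top.ne
  have hct : ENNReal.ofReal c * v ^ (1/p) ≠ ⊤ := ENNReal.mul_ne_top ENNReal.ofReal_ne_top
    (ENNReal.rpow_ne_top_of_nonneg (by positivity) hvt)
  refine ⟨(ENNReal.ofReal c * v ^ (1/p)).toNNReal, ?_, fun R hR χ hχ => ?_⟩
  · rw [← ENNReal.coe_ne_coe, ENNReal.coe_toNNReal hct]
    refine mul_ne_zero (ENNReal.ofReal_pos.2 hc).ne' ?_
    exact (ENNReal.rpow_pos (pos_iff_ne_zero.2 hv0) hvt).ne'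
  rw [ENNReal.coe_toNNReal hct]
  have hvol : volume (Metric.closedBall (0 : V d) (R / 2)) = ENNReal.ofReal (R ^ (d + 1)) * v := by
    have := Measure.addHaar_closedBall_mul (volume : Measure (V d)) 0 hR.le (by norm_num : (0:ℝ) ≤ 1 / 2)
    rw [show R / 2 = R * (1 / 2) by ring, this]
    congr 3
    simp [V]
  unfold nrm N Hn
  calc _ = (ENNReal.ofReal c ^ p * volume (Metric.closedBall (0 : V d) (R / 2))) ^ (1 / p) := by
        rw [hvol, ENNReal.mul_rpow_of_nonneg _ _ (by positivity), ENNReal.mul_rpow_of_nonneg _ _ (by positivity),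
          rpow_rpow_inv' _ hp0.ne']
        ring
    _ ≤ _ := by
        gcongr
        calc _ = ∫⁻ _x in Metric.closedBall (0 : V d) (R / 2), ENNReal.ofReal c ^ p := by
              rw [setLIntegral_const]
          _ ≤ ∫⁻ x in Metric.closedBall (0 : V d) (R / 2), ‖χ x‖ₑ ^ p := by
              refine setLIntegral_mono' Metric.isClosed_closedBall.measurableSet fun x hx => ?_
              gcongr
              rw [← ofReal_norm]
              exact ENNReal.ofReal_le_ofReal (hχ x (by simpa using hx))
          _ ≤ _ := setLIntegral_le_lintegral _ _

/-- localised norm -/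
def LN (p : ℝ) (χ : V d → ℂ) (g : V d → ℂ) (x : V d) : ℝ≥0∞ := nrm p (fun y => g (x + y) * χ y)

lemma LN_meas {p : ℝ} {χ g : V d → ℂ} (hχ : Measurable χ) (hg : Measurable g) : Measurable (LN p χ g) := by
  unfold LN nrm N
  refine Measurable.pow_const ?_ _
  have h : Measurable (fun x : V d × V d => ‖g (x.1 + x.2) * χ x.2‖ₑ ^ p) := by fun_prop
  exact h.lintegral_prod_right'

lemma LN_int {p : ℝ} (hp : 0 < p) {χ g : V d → ℂ} (hχ : Measurable χ) (hg : Measurable g) :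
    N p volume (LN p χ g) = nrm p g * nrm p χ := by
  unfold LN nrm N
  simp only [rpow_inv_rpow' _ hp.ne']
  rw [lintegral_lintegral_swap (by fun_prop), ← ENNReal.mul_rpow_of_nonneg _ _ (by positivity)]
  congr 1
  rw [← lintegral_const_mul _ (by fun_prop)]
  refine lintegral_congr fun y => ?_
  simp only [enorm_mul, ENNReal.mul_rpow_of_nonneg _ _ hp.le]
  rw [lintegral_mul_const _ (by fun_prop)]
  congr 1
  exact lintegral_add_right_eq_self (fun x => ‖g x‖ₑ ^ p) y

lemma LN_loc (d : ℕ) {Lam p : ℝ} (hLam : 0 ≤ Lam) (hp : 1 ≤ p) {E m : ℕ} (hE : d + 2 ≤ E) (hm : E + d + 2 ≤ m)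
    {C : ℝ} (hC : 0 < C) : ∃ C' : ℝ≥0, ∀ {M : Fin d → Fin d → ℝ}, QM Lam M → ∀ (A : ℕ) (α : Fin d → ℤ),
      (∀ i, |ctr A α i| ≤ 1) → ∀ g, FS (box M 0 0 A α) g → ∀ χ : V d → ℂ, Measurable χ →
      (∀ x, ‖χ x‖ ≤ C * ((1 + ‖x‖ / 2 ^ A) ^ m)⁻¹) → ∀ x,
      LN p χ g x ≤ C' * Hn d p (2 ^ A) * cv (pw 2 g) (w E (2 ^ A)) x ^ (1 / 2 : ℝ) := by
  have hp0 : 0 < p := by linarith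
  obtain ⟨C0, hC0⟩ := loc_pt d hLam hE
  have hct : (C0:ℝ≥0∞) * (ENNReal.ofReal C * Cw d ^ (1/p)) ≠ ⊤ := ENNReal.mul_ne_top ENNReal.coe_ne_top
    (ENNReal.mul_ne_top ENNReal.ofReal_ne_top (ENNReal.rpow_ne_top_of_nonneg (by positivity) Cw_lt_top.ne))
  refine ⟨((C0:ℝ≥0∞) * (ENNReal.ofReal C * Cw d ^ (1/p))).toNNReal, fun {M} hM A α hα g hg χ hχm hχ x => ?_⟩
  rw [ENNReal.coe_toNNReal hct]
  have hu := chi_up hp hC hm (by positivity : (0:ℝ) < 2 ^ A) hχ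
  set X := cv (pw 2 g) (w E (2 ^ A)) x ^ (1 / 2 : ℝ) with hX
  unfold LN nrm
  calc _ ≤ N p volume (fun y => (C0 * X) * (ENNReal.ofReal ((1 + ‖y‖ / 2 ^ A) ^ E) * ‖χ y‖ₑ)) := by
        refine N_mono hp0.le fun y => ?_
        rw [enorm_mul]
        calc _ ≤ C0 * ENNReal.ofReal ((1 + ‖y‖ / 2 ^ A) ^ E) * X * ‖χ y‖ₑ := by
              gcongr
              exact hC0 hM A α hα g hg x y
          _ = _ := by ring
    _ = (C0 * X) * N p volume (fun y => ENNReal.ofReal ((1 + ‖y‖ / 2 ^ A) ^ E) * ‖χ y‖ₑ) :=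
        N_const_mul hp0 _ (by fun_prop)
    _ ≤ (C0 * X) * (ENNReal.ofReal C * Cw d ^ (1 / p) * Hn d p (2 ^ A)) := by gcongr
    _ = _ := by ring

lemma F_int {p : ℝ} (hp : 2 ≤ p) {E : ℕ} (hE : d + 2 ≤ E) {R : ℝ} (hR : 0 < R) {g : V d → ℂ} (hg : Measurable g) :
    N p volume (fun x => cv (pw 2 g) (w E R) x ^ (1 / 2 : ℝ)) ≤ Cw d ^ (1/2 : ℝ) * nrm p g := by
  have hp0 : 0 < p := by linarith
  have hpw : Measurable (pw p g) := pw_meas hg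
  have h2p : 2 / p ≤ 1 := (div_le_one hp0).2 hp
  unfold nrm N
  have h1 : ∀ x, (cv (pw 2 g) (w E R) x ^ (1 / 2 : ℝ)) ^ p ≤ Cw d ^ (p / 2 - 1) * cv (pw p g) (w E R) x := by
    intro x
    rw [← ENNReal.rpow_mul]
    calc _ ≤ (Cw d ^ (1 - 2 / p) * cv (pw p g) (w E R) x ^ (2 / p)) ^ (1 / 2 * p) := by
          gcongr
          exact cv_jens hp hg hE hR x
      _ = _ := by
          rw [ENNReal.mul_rpow_of_nonneg _ _ (by positivity), ← ENNReal.rpow_mul, ← ENNReal.rpow_mul]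
          rw [show (1 - 2 / p) * (1 / 2 * p) = p / 2 - 1 by field_simp,
            show 2 / p * (1 / 2 * p) = 1 by field_simp, ENNReal.rpow_one]
  calc _ ≤ (∫⁻ x, Cw d ^ (p / 2 - 1) * cv (pw p g) (w E R) x) ^ (1 / p) := by
        gcongr with x
        exact h1 x
    _ = (Cw d ^ (p / 2 - 1) * ((∫⁻ x, pw p g x) * ∫⁻ x, w E R x)) ^ (1 / p) := by
        rw [lintegral_const_mul' _ _ (ENNReal.rpow_ne_top_of_nonneg (by linarith) Cw_lt_top.ne),
          lintegral_cv hpw (by fun_prop)]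
    _ ≤ (Cw d ^ (p / 2 - 1) * ((∫⁻ x, pw p g x) * Cw d)) ^ (1 / p) := by
        gcongr
        exact lintegral_w hE hR
    _ = (Cw d ^ (p / 2) * ∫⁻ x, pw p g x) ^ (1 / p) := by
        congr 1
        have : Cw d ^ (p / 2) = Cw d ^ (p / 2 - 1) * Cw d := by
          conv_rhs => rw [← ENNReal.rpow_one (Cw d), ← ENNReal.rpow_mul, one_mul,
            ← ENNReal.rpow_add_of_nonneg _ _ (by linarith) (by norm_num)]
          congr 1; ring
        rw [this]; ring
    _ = _ := by
        rw [ENNReal.mul_rpow_of_nonneg _ _ (by positivity), ← ENNReal.rpow_mul]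
        congr 2
        field_simp

end DR

namespace DR

open Filter Topology
open scoped ENNReal NNReal

variable {d : ℕ}

/-- threshold constant -/
def Qc (d : ℕ) (Lam Γ : ℝ) : ℝ := ((d:ℝ) + 1) * (2 + Γ) + 1 + Γ + 7 * ((d:ℝ) + 1) ^ 2 * Lam * Γ

lemma aff_diff (i : Fin (d + 1)) (t0 : ℝ) {t : Fin d → ℝ} (ht : ∀ l, |t l| ≤ 1) {u v : Fin (d + 1) → ℝ} {e q : ℝ}
    (huv : ∀ l, |u l - v l| ≤ e) (hv : |v i - (t0 + ∑ l, t l * v (i.succAbove l))| ≤ q) :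
    |u i - (t0 + ∑ l, t l * u (i.succAbove l))| ≤ q + (d + 1) * e := by
  have h1 : |∑ l, t l * (u (i.succAbove l) - v (i.succAbove l))| ≤ d * e := by
    refine (Finset.abs_sum_le_sum_abs _ _).trans ?_
    calc _ ≤ ∑ _l : Fin d, e := by
          refine Finset.sum_le_sum fun l _ => ?_
          rw [abs_mul]
          calc _ ≤ 1 * e := mul_le_mul (ht l) (huv _) (abs_nonneg _) (by norm_num)
            _ = e := one_mul _
      _ = _ := by simp
  have h2 : u i - (t0 + ∑ l, t l * u (i.succAbove l)) = (v i - (t0 + ∑ l, t l * v (i.succAbove l))) +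
      (u i - v i) - ∑ l, t l * (u (i.succAbove l) - v (i.succAbove l)) := by
    simp only [mul_sub, Finset.sum_sub_distrib]; ring
  have h3 := huv i
  rw [h2]
  rw [abs_le] at *
  constructor <;> linarith

lemma slice_mem {Lam : ℝ} (hLam : 0 ≤ Lam) {M : Fin (d + 1) → Fin (d + 1) → ℝ} (hM : QM Lam M) (i : Fin (d + 1))
    (t0 : ℝ) {t : Fin d → ℝ} (ht : ∀ l, |t l| ≤ 1) {δ r Γ : ℝ} (hΓ : 0 < Γ) {A b : ℕ} (hbA : b ≤ A)
    (hδb : δ ≤ 1 / 2 ^ b) (hr : 4 * ((d:ℝ) + 1) * r ≤ δ) (hA : 2 * Qc d Lam Γ ≤ δ * 2 ^ A)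
    {α : Fin (d + 1) → ℤ} (hα : ∀ l, |ctr A α l| ≤ 1)
    (hα2 : |ctr A α i - (t0 + ∑ l, t l * ctr A α (i.succAbove l))| ≤ 2 * ((d:ℝ) + 1) * r)
    {ξ η : V (d + 1)} (hξ : ξ ∈ box M 0 0 A α) (hη : ‖η‖ ≤ Γ / 2 ^ A) :
    (∀ l, |(ξ + η).1 l - (par (A - b) α l : ℤ) / 2 ^ b| ≤ 2 / 2 ^ b) ∧
      |(ξ + η).1 i - (t0 + ∑ l, t l * (ξ + η).1 (i.succAbove l))| ≤ δ ∧
      |(ξ + η).2 - bil M (ξ + η).1 (ξ + η).1| ≤ δ := by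
  have hR : (0:ℝ) < 2 ^ A := by positivity
  have hQ : Qc d Lam Γ / 2 ^ A ≤ δ / 2 := by
    rw [div_le_iff₀ hR]; linarith
  obtain ⟨h1, h2⟩ := hξ
  have hη1 : ∀ l, |η.1 l| ≤ Γ / 2 ^ A := fun l => (abs_fst_le η l).trans hη
  have hη2 : |η.2| ≤ Γ / 2 ^ A := (abs_snd_le η).trans hη
  have hu : ∀ l, |(ξ + η).1 l - ctr A α l| ≤ (2 + Γ) / 2 ^ A := by
    intro l
    have a := h1 l
    have b := hη1 l
    simp only [Prod.fst_add, Pi.add_apply, ctr]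
    rw [add_div]
    rw [abs_le] at *
    constructor <;> linarith
  have hd0 : (0:ℝ) ≤ d := Nat.cast_nonneg d
  have q0 : 0 ≤ 7 * ((d:ℝ) + 1) ^ 2 * Lam * Γ := by positivity
  have q1 : (2 + Γ) / 2 ^ A ≤ δ / 2 := by
    refine le_trans ?_ hQ
    gcongr
    unfold Qc
    nlinarith
  refine ⟨fun l => ?_, ?_, ?_⟩
  · have a := hu l
    have c := ctr_sub_le hbA α l
    simp only [Pi.sub_apply] at c
    have e : ((par (A - b) α l : ℤ) : ℝ) / 2 ^ b = ctr b (par (A - b) α) l := rfl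
    have e2 : (2:ℝ) / 2 ^ b = 1 / 2 ^ b + 1 / 2 ^ b := by ring
    have : 0 < (1:ℝ) / 2 ^ b := by positivity
    rw [e, e2]
    rw [abs_le] at *
    constructor <;> linarith
  · refine (aff_diff i t0 ht hu hα2).trans ?_
    have : ((d:ℝ) + 1) * ((2 + Γ) / 2 ^ A) ≤ δ / 2 := by
      refine le_trans ?_ hQ
      rw [← mul_div_assoc]
      gcongr
      unfold Qc
      linarith
    linarith
  · have hexp := bil_expand hM η.1 ξ.1
    rw [add_comm η.1] at hexp
    have hΓA : Γ / 2 ^ A ≤ 1 := by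
      have : Γ / 2 ^ A ≤ (2 + Γ) / 2 ^ A := by gcongr; linarith
      have hb1 : (1:ℝ) / 2 ^ b ≤ 1 := by
        rw [div_le_one (by positivity)]
        exact one_le_pow₀ (by norm_num)
      have h0 : 0 < (2 + Γ) / 2 ^ A := by positivity
      linarith
    have b1 := abs_bil_le hM hη1
    have hx : ∀ l, |ξ.1 l| ≤ 3 := by
      intro l
      have a := h1 l
      have c := hα l
      have h22 : (2:ℝ) / 2 ^ A ≤ 2 := by
        rw [div_le_iff₀ hR]
        have : (1:ℝ) ≤ 2 ^ A := one_le_pow₀ (by norm_num)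
        linarith
      simp only [ctr] at c
      rw [abs_le] at *
      constructor <;> linarith
    set e : ℝ := Γ / 2 ^ A with he
    have he0 : 0 ≤ e := by positivity
    have b2 : |∑ j, η.1 j * Mv M ξ.1 j| ≤ (d + 1) * (e * ((d + 1) * (Lam * 3))) := by
      refine (Finset.abs_sum_le_sum_abs _ _).trans ?_
      calc _ ≤ ∑ _j : Fin (d + 1), e * ((d + 1) * (Lam * 3)) := by
            refine Finset.sum_le_sum fun j _ => ?_
            rw [abs_mul]
            have := abs_Mv_le hM hx j
            push_cast at this
            exact mul_le_mul (hη1 j) this (abs_nonneg _) he0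
        _ = _ := by
            rw [Finset.sum_const, Finset.card_univ, Fintype.card_fin, nsmul_eq_mul]; push_cast; ring
    push_cast at b1
    have b4 : ((d:ℝ) + 1) * (e * (((d:ℝ) + 1) * (Lam * e))) ≤ ((d:ℝ) + 1) * (e * (((d:ℝ) + 1) * (Lam * 1))) := by
      gcongr
    have h2' : |ξ.2 - bil M ξ.1 ξ.1| ≤ 1 / 2 ^ A := by
      have : |ξ.2 - bil M ξ.1 ξ.1| ≤ 1 / 4 ^ A := by simpa using h2
      refine this.trans ?_
      gcongr
      norm_num
    have hQ' : Qc d Lam Γ / 2 ^ A = ((d:ℝ) + 1) * ((2 + Γ) / 2 ^ A) + 1 / 2 ^ A + e + 7 * ((d:ℝ) + 1) ^ 2 * Lam * e := by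
      rw [he]; unfold Qc; ring
    have hδ0 : 0 ≤ δ := by
      have : 0 < (2 + Γ) / 2 ^ A := by positivity
      linarith
    have hpos : 0 ≤ ((d:ℝ) + 1) * ((2 + Γ) / 2 ^ A) := by positivity
    simp only [Prod.fst_add, Prod.snd_add]
    rw [hexp]
    rw [abs_le] at *
    constructor <;> nlinarith

lemma fJ_eq_sum (T : Finset (Fin d → ℤ)) (f : (Fin d → ℤ) → V d → ℂ) {k A b : ℕ} (hb : b ≤ A) (hA : A ≤ k)
    (β : Fin d → ℤ) (y : V d) : fJ T f (k - b) β y =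
      ∑ α ∈ (T.image (par (k - A))).filter (fun α => par (A - b) α = β), fJ T f (k - A) α y := by
  have hrs : (A - b) + (k - A) = k - b := by omega
  rw [fJ_fJ T f (A - b) (k - A) _ β ?_ ?_ y, hrs]
  · intro z hz h
    exact Finset.mem_filter.2 ⟨Finset.mem_image_of_mem _ hz, by rw [par_par, h]⟩
  · intro I hI; exact (Finset.mem_filter.1 hI).2

lemma nrm_add_le {p : ℝ} (hp : 1 ≤ p) {f g : V d → ℂ} (hf : Measurable f) (hg : Measurable g) :
    nrm p (fun x => f x + g x) ≤ nrm p f + nrm p g := by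
  unfold nrm
  refine (N_mono (by linarith) fun x => enorm_add_le _ _).trans ?_
  exact N_add_le hp hf.enorm hg.enorm

lemma par_ediv {k j : ℕ} (hj : j ≤ k) {z : Fin d → ℤ} (hz : ∀ i, z i / 2 ^ k = 0) (i : Fin d) :
    par (k - j) z i / 2 ^ j = 0 := by
  unfold par
  rw [Int.ediv_ediv_of_nonneg (by positivity), ← pow_add, show k - j + j = k by omega]
  exact hz i

end DR

namespace DR

open Filter Topology
open scoped ENNReal NNReal

variable {d : ℕ}

/-- transversal tuples -/
def good (M : Fin (d + 1) → Fin (d + 1) → ℝ) (A : ℕ) (r : ℝ) (SA : Finset (Fin (d + 1) → ℤ)) :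
    Finset (Fin (d + 2) → Fin (d + 1) → ℤ) :=
  (Fintype.piFinset fun _ => SA).filter fun τ => r ^ (d + 2) ≤ |(Matrix.of fun i => cc (evec M A (τ i))).det|

lemma bn_pt {Lam p : ℝ} (hLam : 0 ≤ Lam) (hp : 2 ≤ p) {b A k : ℕ} (hbA : b ≤ A) (hAk : A ≤ k) {D' : ℝ≥0∞}
    (hD : Dec d (4 * Lam) p b D') {M : Fin (d + 1) → Fin (d + 1) → ℝ} (hM : QM Lam M)
    {δ r Γ : ℝ} (hΓ : 0 < Γ) (hδ : (1 + 9 * ((d:ℝ) + 1) ^ 2 * Lam) * δ ≤ 1 / 4 ^ b) (hr0 : 0 < r)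
    (hr : 4 * ((d:ℝ) + 1) * r ≤ δ) (hA : 2 * Qc d Lam Γ ≤ δ * 2 ^ A)
    (T : Finset (Fin (d + 1) → ℤ)) (hT : ∀ z ∈ T, ∀ i, z i / 2 ^ k = 0)
    (f : (Fin (d + 1) → ℤ) → V (d + 1) → ℂ) (hf : ∀ z ∈ T, FS (box M 0 0 k z) (f z))
    {χ : V (d + 1) → ℂ} (hχ : FS (SB (d + 1) (Γ / 2 ^ A)) χ) (x : V (d + 1)) (K : ℝ≥0∞)
    (a : (Fin (d + 1) → ℤ) → ℝ≥0∞) (ha : ∀ α ∈ T.image (par (k - A)), LN p χ (fJ T f (k - A) α) x ≤ K * a α) :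
    LN p χ (fun y => ∑ z ∈ T, f z y) x ≤
      D' * (((2 * d + 10 : ℕ) : ℝ≥0∞) ^ (1 / 2 : ℝ) *
        (l2 (T.image (par (k - b))) (fun β => LN p χ (fJ T f (k - b) β) x) + K * l2 (T.image (par (k - A))) a)) +
      K * l2 (T.image (par (k - A))) a +
      ((T.image (par (k - A))).card : ℝ≥0∞) ^ 2 * K *
        ∑ τ ∈ good M A r (T.image (par (k - A))), ∏ i, a (τ i) ^ (1 / ((d + 2 : ℕ) : ℝ)) := by
  classical
  have hp1 : 1 ≤ p := by linarith
  have hp0 : 0 < p := by linarith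
  have hd0 : (0:ℝ) ≤ d := Nat.cast_nonneg d
  have hfm : ∀ z ∈ T, Measurable (f z) := fun z hz => (hf z hz).meas
  have hχm : Measurable χ := hχ.meas
  rcases T.eq_empty_or_nonempty with rfl | hTne
  · have : LN p χ (fun y => ∑ z ∈ (∅ : Finset (Fin (d + 1) → ℤ)), f z y) x = 0 := by
      unfold LN nrm N
      simp [hp0]
    rw [this]; exact bot_le
  set SA := T.image (par (k - A)) with hSA
  have hSAne : SA.Nonempty := hTne.image _
  set n : ℝ≥0∞ := (SA.card : ℝ≥0∞) with hn
  have hn0 : n ≠ 0 := by rw [hn]; exact_mod_cast hSAne.card_pos.ne'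
  have hnt : n ≠ ⊤ := ENNReal.natCast_ne_top _
  obtain ⟨αs, hαs, hmax⟩ := SA.exists_max_image a hSAne
  set Fs := a αs with hFs
  have hFl2 : Fs ≤ l2 SA a := le_l2 hαs
  set S := SA.filter (fun α => n⁻¹ * Fs ≤ a α) with hS
  have hfJm : ∀ r α, Measurable (fJ T f r α) := fun r α => fJ_meas hfm r α
  have hLm : ∀ r α, Measurable (fun y => fJ T f r α (x + y) * χ y) := fun r α => by
    have := hfJm r α
    fun_prop
  have hsmall : ∑ α ∈ SA.filter (fun α => ¬ n⁻¹ * Fs ≤ a α), K * a α ≤ K * Fs := by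
    calc _ ≤ ∑ α ∈ SA.filter (fun α => ¬ n⁻¹ * Fs ≤ a α), K * (n⁻¹ * Fs) := by
          refine Finset.sum_le_sum fun α hα => ?_
          gcongr
          exact (not_le.1 (Finset.mem_filter.1 hα).2).le
      _ ≤ n * (K * (n⁻¹ * Fs)) := by
          rw [Finset.sum_const, nsmul_eq_mul]
          gcongr
          rw [hn]
          exact_mod_cast Finset.card_filter_le _ _
      _ = (n * n⁻¹) * (K * Fs) := by ring
      _ = K * Fs := by rw [ENNReal.mul_inv_cancel hn0 hnt, one_mul]
  have hsumA : ∀ y, ∑ z ∈ T, f z y = ∑ α ∈ SA, fJ T f (k - A) α y := fun y =>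
    (fJ_sum T f (k - A) SA (fun z hz => Finset.mem_image_of_mem _ hz) y).symm
  by_cases hbr : ∃ τ ∈ good M A r SA, ∀ i, τ i ∈ S
  · -- broad
    obtain ⟨τ, hτ, hτS⟩ := hbr
    have h1 : LN p χ (fun y => ∑ z ∈ T, f z y) x ≤ n * (K * Fs) := by
      unfold LN
      simp only [hsumA, Finset.sum_mul]
      refine (nrm_sum_le hp1 SA _ fun α _ => hLm _ α).trans ?_
      calc _ ≤ ∑ α ∈ SA, K * Fs := by
            refine Finset.sum_le_sum fun α hα => (ha α hα).trans ?_
            gcongr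
            exact hmax α hα
        _ = _ := by rw [Finset.sum_const, nsmul_eq_mul]
    have h2 : Fs ≤ n * ∏ i, a (τ i) ^ (1 / ((d + 2 : ℕ) : ℝ)) := by
      have h3 : n⁻¹ * Fs ≤ ∏ i, a (τ i) ^ (1 / ((d + 2 : ℕ) : ℝ)) := by
        calc n⁻¹ * Fs = ∏ _i : Fin (d + 2), (n⁻¹ * Fs) ^ (1 / ((d + 2 : ℕ) : ℝ)) := by
              rw [Finset.prod_const, Finset.card_univ, Fintype.card_fin, ← ENNReal.rpow_natCast, ← ENNReal.rpow_mul]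
              rw [one_div, inv_mul_cancel₀ (by positivity), ENNReal.rpow_one]
          _ ≤ _ := by
              gcongr with i
              exact (Finset.mem_filter.1 (hτS i)).2
      calc Fs = n * n⁻¹ * Fs := by rw [ENNReal.mul_inv_cancel hn0 hnt, one_mul]
        _ = n * (n⁻¹ * Fs) := by ring
        _ ≤ _ := by gcongr
    refine h1.trans (le_trans ?_ le_add_self)
    calc n * (K * Fs) ≤ n * (K * (n * ∏ i, a (τ i) ^ (1 / ((d + 2 : ℕ) : ℝ)))) := by gcongr
      _ = n ^ 2 * K * ∏ i, a (τ i) ^ (1 / ((d + 2 : ℕ) : ℝ)) := by ring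
      _ ≤ _ := by
          gcongr
          exact Finset.single_le_sum (f := fun τ : Fin (d + 2) → Fin (d + 1) → ℤ =>
            ∏ i, a (τ i) ^ (1 / ((d + 2 : ℕ) : ℝ))) (fun _ _ => bot_le) hτ
  · -- narrow
    have h4b : (1:ℝ) / 4 ^ b ≤ 1 / 2 ^ b := by gcongr; norm_num
    have h2b : (1:ℝ) / 2 ^ b ≤ 1 := by
      rw [div_le_one (by positivity)]
      exact one_le_pow₀ (by norm_num)
    have hδ0 : 0 < δ := lt_of_lt_of_le (by positivity) hr
    have hδb : δ ≤ 1 / 2 ^ b := by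
      refine le_trans ?_ (hδ.trans h4b)
      have : 0 ≤ 9 * ((d:ℝ) + 1) ^ 2 * Lam * δ := by positivity
      linarith
    have hrq : r ≤ 1 / 4 := by
      have : 4 * r ≤ 4 * ((d:ℝ) + 1) * r := by nlinarith
      linarith
    have hctr : ∀ α ∈ SA, ∀ l, |ctr A α l| ≤ 1 := by
      intro α hα
      obtain ⟨z, hz, rfl⟩ := Finset.mem_image.1 hα
      exact ctr_le_one hAk (hT z hz)
    obtain ⟨i, t0, t, ht, hpl⟩ := hyper hM A S (fun α hα => hctr α (Finset.mem_filter.1 hα).1) hr0 hrq (by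
      intro τ hτ hdet
      refine hbr ⟨τ, Finset.mem_filter.2 ⟨?_, hdet⟩, hτ⟩
      rw [Fintype.mem_piFinset]
      exact fun i => (Finset.mem_filter.1 (hτ i)).1)
    set SB' := S.image (par (A - b)) with hSB'
    have hSBsub : SB' ⊆ T.image (par (k - b)) := by
      intro β hβ
      obtain ⟨α, hα, rfl⟩ := Finset.mem_image.1 hβ
      obtain ⟨z, hz, rfl⟩ := Finset.mem_image.1 (Finset.mem_filter.1 hα).1
      rw [par_par, show A - b + (k - A) = k - b by omega]
      exact Finset.mem_image_of_mem _ hz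
    set G : (Fin (d + 1) → ℤ) → V (d + 1) → ℂ := fun β y =>
      ∑ α ∈ S.filter (fun α => par (A - b) α = β), fJ T f (k - A) α (x + y) * χ y with hG
    have hGm : ∀ β, Measurable (G β) := fun β => Finset.measurable_sum _ fun α _ => hLm _ α
    have hslice := slice hLam hp hD hM i t0 t ht hδ0.le (hδb.trans h2b) hδ SB' (by
      intro β hβ l
      obtain ⟨z, hz, rfl⟩ := Finset.mem_image.1 (hSBsub hβ)
      exact par_ediv (hbA.trans hAk) (hT z hz) l) (by
      intro β hβ
      obtain ⟨α, hα, rfl⟩ := Finset.mem_image.1 hβ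
      have h1 := aff_diff i t0 ht (u := ctr b (par (A - b) α)) (v := ctr A α) (e := 1 / 2 ^ b)
        (fun l => by rw [abs_sub_comm]; exact ctr_sub_le hbA α l) (hpl α hα)
      have h2 : ((par (A - b) α i : ℤ) : ℝ) - (t0 * 2 ^ b + ∑ l, t l * (par (A - b) α (i.succAbove l) : ℤ)) =
          2 ^ b * (ctr b (par (A - b) α) i - (t0 + ∑ l, t l * ctr b (par (A - b) α) (i.succAbove l))) := by
        unfold ctr
        rw [mul_sub, mul_add, Finset.mul_sum, mul_div_cancel₀ _ (by positivity)]
        congr 1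
        congr 1
        · ring
        · refine Finset.sum_congr rfl fun l _ => ?_
          field_simp
      rw [h2, abs_mul, abs_of_pos (by positivity)]
      calc _ ≤ 2 ^ b * (2 * ((d:ℝ) + 1) * r + (d + 1) * (1 / 2 ^ b)) := by gcongr
        _ = 2 ^ b * (2 * ((d:ℝ) + 1) * r) + (d + 1) := by field_simp
        _ ≤ 2 ^ b * (1 / 2 ^ b) + (d + 1) := by
            gcongr
            linarith
        _ = 1 + (d + 1) := by rw [mul_one_div_cancel (by positivity)]
        _ ≤ _ := by linarith) G (by
      intro β hβ
      refine FS.sum fun α hα => ?_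
      obtain ⟨hαS, rfl⟩ := Finset.mem_filter.1 hα
      have e : (fun y => fJ T f (k - A) α (x + y)) = fun y => fJ T f (k - A) α (y + x) := by
        ext y; rw [add_comm x y]
      have h1 : FS (box M 0 0 A α) (fun y => fJ T f (k - A) α (x + y)) := by
        rw [e]; exact (fJ_FS hAk hf α).shift x
      refine h1.mul hχ ?_
      intro ξ hξ η hη
      exact slice_mem hLam hM i t0 ht hΓ hbA hδb hr hA (hctr α (Finset.mem_filter.1 hαS).1) (hpl α hαS) hξ hη)
    -- main estimate on each piece
    have hpiece : ∀ β, nrm p (G β) ≤ LN p χ (fJ T f (k - b) β) x +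
        ∑ α ∈ (SA.filter (fun α => ¬ n⁻¹ * Fs ≤ a α)).filter (fun α => par (A - b) α = β), K * a α := by
      intro β
      have e : G β = fun y => fJ T f (k - b) β (x + y) * χ y +
          ∑ α ∈ (SA.filter (fun α => ¬ n⁻¹ * Fs ≤ a α)).filter (fun α => par (A - b) α = β),
            -(fJ T f (k - A) α (x + y) * χ y) := by
        ext y
        rw [fJ_eq_sum T f hbA hAk β (x + y), Finset.sum_mul, Finset.sum_neg_distrib, ← sub_eq_add_neg, eq_sub_iff_add_eq]
        simp only [hG, hS]
        rw [Finset.filter_filter, Finset.filter_filter]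
        have := Finset.sum_filter_add_sum_filter_not (SA.filter (fun α => par (A - b) α = β))
          (fun α => n⁻¹ * Fs ≤ a α) (fun α => fJ T f (k - A) α (x + y) * χ y)
        rw [Finset.filter_filter, Finset.filter_filter] at this
        rw [← this]
        simp only [and_comm]
      rw [e]
      refine (nrm_add_le hp1 (hLm _ β) (Finset.measurable_sum _ fun α _ => (hLm _ α).neg)).trans ?_
      refine add_le_add le_rfl ?_
      refine (nrm_sum_le hp1 _ _ fun α _ => (hLm _ α).neg).trans ?_
      refine Finset.sum_le_sum fun α hα => ?_
      refine le_trans (le_of_eq ?_) (ha α (Finset.mem_filter.1 (Finset.mem_filter.1 hα).1).1)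
      unfold LN nrm
      simp only [Pi.neg_apply, enorm_neg]
    have hl2 : l2 SB' (fun β => nrm p (G β)) ≤
        l2 (T.image (par (k - b))) (fun β => LN p χ (fJ T f (k - b) β) x) + K * l2 SA a := by
      refine (l2_mono fun β _ => hpiece β).trans ((l2_add_le _ _ _).trans ?_)
      refine add_le_add (l2_subset hSBsub) ((l2_le_sum _ _).trans ?_)
      calc _ ≤ ∑ α ∈ SA.filter (fun α => ¬ n⁻¹ * Fs ≤ a α), K * a α := by
            refine Finset.sum_fiberwise_le_sum_of_sum_fiber_nonneg ?_
            intro _ _; exact bot_le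
        _ ≤ K * Fs := hsmall
        _ ≤ _ := by gcongr
    have hdecomp : (fun y => (∑ z ∈ T, f z (x + y)) * χ y) = fun y => ∑ β ∈ SB', G β y +
        ∑ α ∈ SA.filter (fun α => ¬ n⁻¹ * Fs ≤ a α), fJ T f (k - A) α (x + y) * χ y := by
      ext y
      rw [hsumA, Finset.sum_mul]
      rw [show ∑ β ∈ SB', G β y = ∑ α ∈ S, fJ T f (k - A) α (x + y) * χ y from
        Finset.sum_fiberwise_of_maps_to (fun z hz => Finset.mem_image_of_mem _ hz) _]
      rw [hS, Finset.sum_filter_add_sum_filter_not]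
    refine le_trans ?_ le_self_add
    unfold LN at *
    rw [hdecomp]
    refine (nrm_add_le hp1 (Finset.measurable_sum _ fun β _ => hGm β)
      (Finset.measurable_sum _ fun α _ => hLm _ α)).trans ?_
    refine add_le_add (hslice.trans (by gcongr)) ?_
    refine (nrm_sum_le hp1 _ _ fun α _ => hLm _ α).trans ?_
    refine (Finset.sum_le_sum fun α hα => ha α (Finset.mem_filter.1 hα).1).trans ?_
    exact hsmall.trans (by gcongr)

end DR

namespace DR

open Filter Topology
open scoped ENNReal NNReal

variable {d : ℕ}

lemma bn (d : ℕ) {Lam p : ℝ} (hLam : 0 ≤ Lam) (hp : 2 ≤ p) {E : ℕ} (hE : d + 1 + 2 ≤ E) :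
    ∃ (Γ : ℝ) (C : ℝ≥0), 0 < Γ ∧ ∀ {b A k : ℕ}, b ≤ A → A ≤ k → ∀ {D' : ℝ≥0∞}, Dec d (4 * Lam) p b D' →
    ∀ {M : Fin (d + 1) → Fin (d + 1) → ℝ}, QM Lam M →
    ∀ {δ r : ℝ}, (1 + 9 * ((d:ℝ) + 1) ^ 2 * Lam) * δ ≤ 1 / 4 ^ b → 0 < r →
    4 * ((d:ℝ) + 1) * r ≤ δ → 2 * Qc d Lam Γ ≤ δ * 2 ^ A →
    ∀ (T : Finset (Fin (d + 1) → ℤ)), (∀ z ∈ T, ∀ i, z i / 2 ^ k = 0) →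
    ∀ (f : (Fin (d + 1) → ℤ) → V (d + 1) → ℂ), (∀ z ∈ T, FS (box M 0 0 k z) (f z)) →
    nrm p (fun x => ∑ z ∈ T, f z x) ≤ C * ((1 + D') *
      (l2 (T.image (par (k - b))) (fun β => nrm p (fJ T f (k - b) β)) +
        l2 (T.image (par (k - A))) (fun α => nrm p (fJ T f (k - A) α))) +
      ((T.image (par (k - A))).card : ℝ≥0∞) ^ 2 * ∑ τ ∈ good M A r (T.image (par (k - A))),
        (∫⁻ x, ∏ i, cv (pw 2 (fJ T f (k - A) (τ i))) (w E (2 ^ A)) x ^ (p / (2 * ((d + 2 : ℕ) : ℝ)))) ^ (1 / p)) := by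
  have hp1 : 1 ≤ p := by linarith
  have hp0 : 0 < p := by linarith
  obtain ⟨Γ, c, Cχ, hΓ, hc, hCχ, hchi⟩ := exists_chi (d + 1) (E + (d + 1) + 2)
  obtain ⟨C', hC'⟩ := LN_loc (d + 1) hLam hp1 hE le_rfl hCχ
  obtain ⟨c', hcp0, hc'⟩ := chi_low (d + 1) hp1 hc
  set C1 : ℝ≥0∞ := ((2 * d + 10 : ℕ) : ℝ≥0∞) ^ (1 / 2 : ℝ) with hC1
  set C2 : ℝ≥0∞ := ENNReal.ofReal Cχ * Cw (d + 1) ^ (1 / p) with hC2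
  set Cx : ℝ≥0∞ := Cw (d + 1) ^ (1 / 2 : ℝ) with hCx
  have hC1t : C1 ≠ ⊤ := ENNReal.rpow_ne_top_of_nonneg (by norm_num) (ENNReal.natCast_ne_top _)
  have hC2t : C2 ≠ ⊤ := ENNReal.mul_ne_top ENNReal.ofReal_ne_top
    (ENNReal.rpow_ne_top_of_nonneg (by positivity) Cw_lt_top.ne)
  have hCxt : Cx ≠ ⊤ := ENNReal.rpow_ne_top_of_nonneg (by norm_num) Cw_lt_top.ne
  set Q : ℝ≥0∞ := C1 * C2 + C1 * C' * Cx + C' * Cx + C' with hQ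
  have hQt : Q ≠ ⊤ := by
    rw [hQ]
    refine ENNReal.add_ne_top.2 ⟨ENNReal.add_ne_top.2 ⟨ENNReal.add_ne_top.2 ⟨ENNReal.mul_ne_top hC1t hC2t,
      ENNReal.mul_ne_top (ENNReal.mul_ne_top hC1t ENNReal.coe_ne_top) hCxt⟩,
      ENNReal.mul_ne_top ENNReal.coe_ne_top hCxt⟩, ENNReal.coe_ne_top⟩
  have hcp0e : (c' : ℝ≥0∞) ≠ 0 := by exact_mod_cast hcp0
  have hfin : (c' : ℝ≥0∞)⁻¹ * Q ≠ ⊤ := ENNReal.mul_ne_top (ENNReal.inv_ne_top.2 hcp0e) hQt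
  refine ⟨Γ, ((c' : ℝ≥0∞)⁻¹ * Q).toNNReal, hΓ, ?_⟩
  intro b A k hbA hAk D' hD M hM δ r hδ hr0 hr hA T hT f hf
  rw [ENNReal.coe_toNNReal hfin]
  have hR : (0:ℝ) < 2 ^ A := by positivity
  obtain ⟨χ, hχ, hχu, hχl⟩ := hchi (2 ^ A) hR
  have hχm : Measurable χ := hχ.meas
  have hfm : ∀ z ∈ T, Measurable (f z) := fun z hz => (hf z hz).meas
  have hfJm : ∀ r α, Measurable (fJ T f r α) := fun r α => fJ_meas hfm r α
  set H := Hn (d + 1) p (2 ^ A) with hH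
  have hH0 : H ≠ 0 := Hn_ne_zero hR
  have hHt : H ≠ ⊤ := Hn_ne_top hp0
  have hlow := hc' _ hR χ hχl
  have hup : nrm p χ ≤ C2 * H := by
    have := chi_up hp1 hCχ (show 0 + (d + 1) + 2 ≤ E + (d + 1) + 2 by omega) hR hχu
    simp only [pow_zero, ENNReal.ofReal_one, one_mul] at this
    exact this
  set a : V (d + 1) → (Fin (d + 1) → ℤ) → ℝ≥0∞ := fun x α =>
    cv (pw 2 (fJ T f (k - A) α)) (w E (2 ^ A)) x ^ (1 / 2 : ℝ) with ha
  have ham : ∀ α, Measurable (fun x => a x α) := fun α => by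
    have : Measurable (cv (pw 2 (fJ T f (k - A) α)) (w E (2 ^ A))) := cv_meas (pw_meas (hfJm _ α)) (by fun_prop)
    exact this.pow_const _
  have hctr : ∀ α ∈ T.image (par (k - A)), ∀ l, |ctr A α l| ≤ 1 := by
    intro α hα
    obtain ⟨z, hz, rfl⟩ := Finset.mem_image.1 hα
    exact ctr_le_one hAk (hT z hz)
  set SA := T.image (par (k - A)) with hSA
  set Sb := T.image (par (k - b)) with hSb
  set n : ℝ≥0∞ := (SA.card : ℝ≥0∞) with hn
  set K : ℝ≥0∞ := C' * H with hK
  have hpt : ∀ x, LN p χ (fun y => ∑ z ∈ T, f z y) x ≤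
      (D' * (C1 * (l2 Sb (fun β => LN p χ (fJ T f (k - b) β) x) + K * l2 SA (a x))) + K * l2 SA (a x)) +
      n ^ 2 * K * ∑ τ ∈ good M A r SA, ∏ i, a x (τ i) ^ (1 / ((d + 2 : ℕ) : ℝ)) := by
    intro x
    exact bn_pt hLam hp hbA hAk hD hM hΓ hδ hr0 hr hA T hT f hf hχ x K (a x) (fun α hα =>
      hC' hM A α (hctr α hα) _ (fJ_FS hAk hf α) χ hχm hχu x)
  have hl2m : Measurable (fun x => l2 SA (a x)) := by
    unfold l2; fun_prop
  have hLNm : ∀ β, Measurable (LN p χ (fJ T f (k - b) β)) := fun β => LN_meas hχm (hfJm _ β)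
  have hl2m' : Measurable (fun x => l2 Sb (fun β => LN p χ (fJ T f (k - b) β) x)) := by
    unfold l2; fun_prop
  have hpm : ∀ τ : Fin (d + 2) → Fin (d + 1) → ℤ, Measurable (fun x => ∏ i, a x (τ i) ^ (1 / ((d + 2 : ℕ) : ℝ))) := by
    intro τ
    refine Finset.measurable_fun_prod _ fun i _ => (ham _).pow_const _
  have hsm : Measurable (fun x => ∑ τ ∈ good M A r SA, ∏ i, a x (τ i) ^ (1 / ((d + 2 : ℕ) : ℝ))) :=
    Finset.measurable_sum _ fun τ _ => hpm τ
  set X := nrm p (fun x => ∑ z ∈ T, f z x) with hX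
  set T1 := l2 Sb (fun β => nrm p (fJ T f (k - b) β)) with hT1
  set T2 := l2 SA (fun α => nrm p (fJ T f (k - A) α)) with hT2
  set Z := ∑ τ ∈ good M A r SA,
        (∫⁻ x, ∏ i, cv (pw 2 (fJ T f (k - A) (τ i))) (w E (2 ^ A)) x ^ (p / (2 * ((d + 2 : ℕ) : ℝ)))) ^ (1 / p) with hZ
  have n1 : N p volume (fun x => l2 Sb (fun β => LN p χ (fJ T f (k - b) β) x)) ≤ C2 * H * T1 := by
    refine (N_l2_le hp _ hLNm).trans ?_
    rw [hT1, ← l2_const_mul]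
    refine l2_mono fun β _ => ?_
    rw [LN_int hp0 hχm (hfJm _ β), mul_comm]
    gcongr
  have n2 : N p volume (fun x => l2 SA (a x)) ≤ Cx * T2 := by
    refine (N_l2_le hp _ ham).trans ?_
    rw [hT2, ← l2_const_mul]
    exact l2_mono fun α _ => F_int hp hE hR (hfJm _ α)
  have n3 : N p volume (fun x => ∑ τ ∈ good M A r SA, ∏ i, a x (τ i) ^ (1 / ((d + 2 : ℕ) : ℝ))) ≤ Z := by
    refine (N_sum_le hp1 _ hpm).trans (le_of_eq ?_)
    refine Finset.sum_congr rfl fun τ _ => ?_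
    unfold N
    congr 1
    refine lintegral_congr fun x => ?_
    rw [← ENNReal.prod_rpow_of_nonneg hp0.le]
    refine Finset.prod_congr rfl fun i _ => ?_
    simp only [ha]
    rw [← ENNReal.rpow_mul, ← ENNReal.rpow_mul]
    congr 1
    field_simp
  have hmain : c' * H * X ≤ (D' * (C1 * (C2 * H * T1 + K * (Cx * T2))) + K * (Cx * T2)) + n ^ 2 * K * Z := by
    calc c' * H * X ≤ X * nrm p χ := by rw [mul_comm]; gcongr
      _ = N p volume (LN p χ (fun y => ∑ z ∈ T, f z y)) :=
          (LN_int hp0 hχm (Finset.measurable_sum _ hfm)).symm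
      _ ≤ _ := N_mono hp0.le hpt
      _ ≤ _ := N_add_le hp1 (by fun_prop) (by fun_prop)
      _ ≤ _ := by
          gcongr
          · refine (N_add_le hp1 (by fun_prop) (by fun_prop)).trans ?_
            gcongr
            · rw [N_const_mul hp0 _ (by fun_prop), N_const_mul hp0 _ (by fun_prop)]
              gcongr
              refine (N_add_le hp1 (by fun_prop) (by fun_prop)).trans ?_
              gcongr
              rw [N_const_mul hp0 _ (by fun_prop)]
              gcongr
            · rw [N_const_mul hp0 _ (by fun_prop)]
              gcongr
          · rw [N_const_mul hp0 _ (by fun_prop)]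
            gcongr
  have hmain2 : c' * H * X ≤ c' * H * ((c' : ℝ≥0∞)⁻¹ * Q * ((1 + D') * (T1 + T2) + n ^ 2 * Z)) := by
    refine hmain.trans ?_
    have e : c' * H * ((c' : ℝ≥0∞)⁻¹ * Q * ((1 + D') * (T1 + T2) + n ^ 2 * Z)) =
        (c' * (c' : ℝ≥0∞)⁻¹) * (H * Q * ((1 + D') * (T1 + T2) + n ^ 2 * Z)) := by ring
    rw [e, ENNReal.mul_inv_cancel hcp0e ENNReal.coe_ne_top, one_mul]
    have e1 : D' * (C1 * (C2 * H * T1 + K * (Cx * T2))) + K * (Cx * T2) + n ^ 2 * K * Z =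
        H * (C1 * C2 * (D' * T1) + C1 * C' * Cx * (D' * T2) + C' * Cx * T2 + C' * (n ^ 2 * Z)) := by
      rw [hK]; ring
    have e2 : H * Q * ((1 + D') * (T1 + T2) + n ^ 2 * Z) = H * (Q * (D' * (T1 + T2)) + Q * (T1 + T2) + Q * (n ^ 2 * Z)) := by
      ring
    rw [e1, e2]
    have q1 : C1 * C2 + C1 * C' * Cx ≤ Q := by
      rw [hQ, add_assoc _ (C' * Cx)]; exact le_self_add
    have q2 : C' * Cx ≤ Q := by
      rw [hQ]; exact le_add_self.trans le_self_add
    have q3 : (C' : ℝ≥0∞) ≤ Q := le_add_self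
    have r1 : C1 * C2 * (D' * T1) + C1 * C' * Cx * (D' * T2) ≤ Q * (D' * (T1 + T2)) := by
      calc _ ≤ C1 * C2 * (D' * (T1 + T2)) + C1 * C' * Cx * (D' * (T1 + T2)) := by
            gcongr
            · exact le_self_add
            · exact le_add_self
        _ = (C1 * C2 + C1 * C' * Cx) * (D' * (T1 + T2)) := by ring
        _ ≤ _ := by gcongr
    gcongr
    exact le_add_self
  exact (ENNReal.mul_le_mul_iff_right (mul_ne_zero hcp0e hH0) (ENNReal.mul_ne_top ENNReal.coe_ne_top hHt)).1 hmain2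

end DR

namespace DR

open Filter Topology
open scoped ENNReal NNReal

variable {d : ℕ}

lemma l2_fJ_dec {Lam p : ℝ} (hp0 : 0 < p) {k j : ℕ} (hj : j ≤ k) {X : ℝ≥0∞} (hX : Dec d Lam p (k - j) X)
    {M : Fin d → Fin d → ℝ} (hM : QM Lam M) (T : Finset (Fin d → ℤ)) (f : (Fin d → ℤ) → V d → ℂ)
    (hf : ∀ z ∈ T, FS (box M 0 0 k z) (f z)) :
    l2 (T.image (par (k - j))) (fun β => nrm p (fJ T f (k - j) β)) ≤ X * l2 T (fun z => nrm p (f z)) := by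
  refine (l2_mono fun β _ => fJ_dec hp0 hj hX hM 0 0 T f hf β).trans ?_
  rw [l2_const_mul, l2_fiber T (k - j) _ (fun z hz => Finset.mem_image_of_mem _ hz)]

lemma card_image_par {k A : ℕ} (hA : A ≤ k) (T : Finset (Fin d → ℤ)) (hT : ∀ z ∈ T, ∀ i, z i / 2 ^ k = 0) :
    (T.image (par (k - A))).card ≤ (2 ^ A) ^ d := by
  rw [← card_chl A (0 : Fin d → ℤ)]
  refine Finset.card_le_card fun α hα => ?_
  obtain ⟨z, hz, rfl⟩ := Finset.mem_image.1 hα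
  rw [mem_chl]
  ext i
  exact par_ediv hA (hT z hz) i

lemma recur (d : ℕ) {Lam p : ℝ} (hLam : 0 ≤ Lam) (hp : 2 ≤ p) (hpd : p * ((d + 1 : ℕ) : ℝ) ≤ 2 * (((d + 1 : ℕ) : ℝ) + 2))
    (s : ℕ) : ∃ C : ℝ≥0, ∀ (b : ℕ) (D' : ℝ≥0∞), Dec d (4 * Lam) p b D' → ∃ (CK : ℝ≥0) (A0 : ℕ), 1 ≤ CK ∧ b ≤ A0 ∧ 1 ≤ A0 ∧
      ∀ A ≥ A0, ∃ CA : ℝ≥0, ∀ (k j : ℕ), A ≤ j → 2 ^ s * j ≤ k → ∀ (D : ℝ≥0∞) (η : ℝ),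
        (∀ k' : ℕ, Dec (d + 1) Lam p k' (D * 2 ^ (η * k'))) → ∀ X Y, Dec (d + 1) Lam p (k - b) X →
        Dec (d + 1) Lam p (k - A) Y → Dec (d + 1) Lam p k (C * (1 + D') * (X + Y) + CA * (CK : ℝ≥0∞) ^ (k / A + 1) *
          (2 ^ ((2 * ((d + 1 : ℕ) : ℝ) + 1) * (j:ℝ) / 2 + η * (k - j * (1 + s / 2))) * D)) := by
  have hp0 : 0 < p := by linarith
  have hd0 : (0:ℝ) ≤ d := Nat.cast_nonneg d
  obtain ⟨Γ, C, hΓ, hbn⟩ := bn d hLam hp (le_Es (d + 1) s)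
  refine ⟨C, fun b D' hD => ?_⟩
  set δ : ℝ := ((1 + 9 * ((d:ℝ) + 1) ^ 2 * Lam) * 4 ^ b)⁻¹ with hδ
  have hden : 0 < 1 + 9 * ((d:ℝ) + 1) ^ 2 * Lam := by positivity
  have hδ0 : 0 < δ := by positivity
  have hδ1 : (1 + 9 * ((d:ℝ) + 1) ^ 2 * Lam) * δ ≤ 1 / 4 ^ b := by
    rw [hδ, mul_inv, ← mul_assoc, mul_inv_cancel₀ hden.ne', one_mul, one_div]
  set r : ℝ := δ / (4 * ((d:ℝ) + 1)) with hr
  have hr0 : 0 < r := by positivity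
  have hr1 : 4 * ((d:ℝ) + 1) * r ≤ δ := by
    rw [hr, mul_div_cancel₀ _ (by positivity)]
  obtain ⟨CM, CK, hCK, hML⟩ := ML (d := d + 1) (by omega) hLam hp (by exact_mod_cast hpd) (c := r ^ (d + 2)) (by positivity) s
  obtain ⟨A1, hA1⟩ := pow_unbounded_of_one_lt (2 * Qc d Lam Γ / δ) (by norm_num : (1:ℝ) < 2)
  refine ⟨CK, A1 + b + 1, hCK, by omega, by omega, fun A hA => ?_⟩
  have hA2 : 2 * Qc d Lam Γ ≤ δ * 2 ^ A := by
    rw [div_lt_iff₀ hδ0] at hA1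
    have : (2:ℝ) ^ A1 ≤ 2 ^ A := pow_le_pow_right₀ (by norm_num) (by omega)
    nlinarith
  set n : ℕ := (2 ^ A) ^ (d + 1) with hn
  set CA : ℝ≥0∞ := C * ((n:ℝ≥0∞) ^ 2 * ((n:ℝ≥0∞) ^ (d + 2) * (CM : ℝ≥0∞) ^ (1 / p))) with hCA
  have hCAt : CA ≠ ⊤ := by
    have : (CM:ℝ≥0∞) ^ (1/p) ≠ ⊤ := ENNReal.rpow_ne_top_of_nonneg (by positivity) ENNReal.coe_ne_top
    have hnt : (n:ℝ≥0∞) ≠ ⊤ := ENNReal.natCast_ne_top n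
    exact ENNReal.mul_ne_top ENNReal.coe_ne_top (ENNReal.mul_ne_top (ENNReal.pow_ne_top hnt)
      (ENNReal.mul_ne_top (ENNReal.pow_ne_top hnt) this))
  refine ⟨CA.toNNReal, fun k j hAj hjk D η hDk X Y hX hY => DecN_Dec hp0 ?_⟩
  rw [ENNReal.coe_toNNReal hCAt]
  intro M hM T hT f hf
  have hjk' : j ≤ k := le_trans (Nat.le_mul_of_pos_left j (by positivity)) hjk
  have hAk : A ≤ k := hAj.trans hjk'
  have hbA : b ≤ A := by omega
  refine (hbn hbA hAk hD hM hδ1 hr0 hr1 hA2 T hT f hf).trans ?_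
  have t1 := l2_fJ_dec hp0 (hbA.trans hAk) hX hM T f hf
  have t2 := l2_fJ_dec hp0 hAk hY hM T f hf
  set L := l2 T (fun z => nrm p (f z)) with hL
  have hcard : ((T.image (par (k - A))).card : ℝ≥0∞) ≤ n := by exact_mod_cast card_image_par hAk T hT
  set U : ℝ≥0∞ := 2 ^ ((2 * ((d + 1 : ℕ) : ℝ) + 1) * (j:ℝ) / 2 + η * (k - j * (1 + s / 2))) with hU
  have t3 : ∀ τ ∈ good M A r (T.image (par (k - A))),
      (∫⁻ x, ∏ i, cv (pw 2 (fJ T f (k - A) (τ i))) (w (Es (d + 1) s) (2 ^ A)) x ^ (p / (2 * ((d + 2 : ℕ) : ℝ)))) ^ (1 / p) ≤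
      (CM : ℝ≥0∞) ^ (1 / p) * ((CK : ℝ≥0∞) ^ (k / A + 1) * (U * D * L)) := by
    intro τ hτ
    obtain ⟨h1, h2⟩ := Finset.mem_filter.1 hτ
    rw [Fintype.mem_piFinset] at h1
    have := hML (k := k) (a := A) (j := j) (by omega) hAj hjk (D := D) (η := η) hDk hM T hT f hf τ (by
      intro i
      obtain ⟨z, hz, hz2⟩ := Finset.mem_image.1 (h1 i)
      rw [← hz2]
      exact ctr_le_one hAk (hT z hz)) h2
    refine (ENNReal.rpow_le_rpow this (by positivity : 0 ≤ 1 / p)).trans ?_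
    rw [ENNReal.mul_rpow_of_nonneg _ _ (by positivity), ENNReal.mul_rpow_of_nonneg _ _ (by positivity),
      rpow_rpow_inv' _ hp0.ne']
    have hck1 : 1 ≤ (CK : ℝ≥0∞) ^ (k / A + 1) := one_le_pow₀ (by exact_mod_cast hCK)
    have : (((CK : ℝ≥0∞) ^ (k / A + 1)) ^ 2) ^ (1 / p) ≤ (CK : ℝ≥0∞) ^ (k / A + 1) := by
      rw [← ENNReal.rpow_two, ← ENNReal.rpow_mul]
      calc _ ≤ ((CK : ℝ≥0∞) ^ (k / A + 1)) ^ (1:ℝ) := by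
            refine ENNReal.rpow_le_rpow_of_exponent_le hck1 ?_
            rw [mul_one_div, div_le_one hp0]; exact hp
        _ = _ := ENNReal.rpow_one _
    exact mul_le_mul_right (mul_le_mul_left this _) _
  have hgc : ((good M A r (T.image (par (k - A)))).card : ℝ≥0∞) ≤ (n:ℝ≥0∞) ^ (d + 2) := by
    have h1 : (good M A r (T.image (par (k - A)))).card ≤ (T.image (par (k - A))).card ^ (d + 2) := by
      refine (Finset.card_filter_le _ _).trans ?_
      rw [Fintype.card_piFinset]
      simp
    have h2 := h1.trans (Nat.pow_le_pow_left (card_image_par hAk T hT) (d + 2))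
    exact_mod_cast h2
  have t4 : ∑ τ ∈ good M A r (T.image (par (k - A))),
      (∫⁻ x, ∏ i, cv (pw 2 (fJ T f (k - A) (τ i))) (w (Es (d + 1) s) (2 ^ A)) x ^ (p / (2 * ((d + 2 : ℕ) : ℝ)))) ^ (1 / p) ≤
      (n:ℝ≥0∞) ^ (d + 2) * ((CM : ℝ≥0∞) ^ (1 / p) * ((CK : ℝ≥0∞) ^ (k / A + 1) * (U * D * L))) := by
    refine (Finset.sum_le_sum t3).trans ?_
    rw [Finset.sum_const, nsmul_eq_mul]
    exact mul_le_mul_left hgc _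
  calc _ ≤ (C:ℝ≥0∞) * ((1 + D') * (X * L + Y * L) + (n:ℝ≥0∞) ^ 2 *
        ((n:ℝ≥0∞) ^ (d + 2) * ((CM : ℝ≥0∞) ^ (1 / p) * ((CK : ℝ≥0∞) ^ (k / A + 1) * (U * D * L))))) := by
        refine mul_le_mul_right (add_le_add (mul_le_mul_right (add_le_add t1 t2) _) ?_) _
        exact mul_le_mul' (pow_le_pow_left' hcard 2) t4
    _ = _ := by rw [hCA]; ring

end DR

namespace DR

open Filter Topology
open scoped ENNReal NNReal

variable {d : ℕ}

/-- decoupling with power loss `η` -/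
def Pow (d : ℕ) (Lam p η : ℝ) : Prop := ∃ C : ℝ≥0, ∀ k : ℕ, Dec d Lam p k (C * 2 ^ (η * k))

/-- full decoupling in dimension `d` -/
def TT (d : ℕ) : Prop := ∀ Lam : ℝ, 0 ≤ Lam → ∀ p : ℝ, 2 ≤ p → p * d ≤ 2 * (d + 2) → ∀ ε > 0, Pow d Lam p ε

lemma two_rpow_le {x y : ℝ} (h : x ≤ y) : (2:ℝ≥0∞) ^ x ≤ 2 ^ y :=
  ENNReal.rpow_le_rpow_of_exponent_le (by norm_num) h

lemma two_rpow_add (x y : ℝ) : (2:ℝ≥0∞) ^ (x + y) = 2 ^ x * 2 ^ y :=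
  ENNReal.rpow_add _ _ (by norm_num) (by norm_num)

lemma one_le_two_rpow {x : ℝ} (h : 0 ≤ x) : (1:ℝ≥0∞) ≤ 2 ^ x := by
  have := two_rpow_le h
  simpa using this

lemma two_rpow_ne_top (x : ℝ) : (2:ℝ≥0∞) ^ x ≠ ⊤ :=
  ENNReal.rpow_ne_top_of_ne_zero (by norm_num) (by norm_num)

lemma Pow_mono {Lam p η η' : ℝ} (h : η ≤ η') (hP : Pow d Lam p η) : Pow d Lam p η' := by
  obtain ⟨C, hC⟩ := hP
  refine ⟨C, fun k => Dec_mono (hC k) ?_⟩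
  exact mul_le_mul_right (two_rpow_le (by gcongr)) _

lemma triv_eq (k : ℕ) : (((2 ^ k) ^ d : ℕ) : ℝ≥0∞) = 2 ^ ((d:ℝ) * k) := by
  push_cast
  rw [← pow_mul, ← ENNReal.rpow_natCast]
  congr 1; push_cast; ring

lemma Pow_triv {Lam p : ℝ} (hp : 1 ≤ p) : Pow d Lam p d := by
  refine ⟨1, fun k => ?_⟩
  have := Dec_trivial (d := d) (Lam := Lam) hp k
  rw [triv_eq] at this
  simpa using this

lemma TT_zero : TT 0 := by
  intro Lam _ p hp _ ε hε
  refine Pow_mono ?_ (Pow_triv (by linarith))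
  simpa using hε.le

lemma exists_b (C C' : ℝ≥0) {ε : ℝ} (hε : 0 < ε) : ∃ b : ℕ, 1 ≤ b ∧
    (C:ℝ≥0∞) * (1 + C' * 2 ^ (ε / 2 * b)) * (2 * 2 ^ (-(ε * b))) ≤ 1 / 2 := by
  have h1 : (1:ℝ) < 2 ^ (ε / 2) := Real.one_lt_rpow (by norm_num) (by positivity)
  obtain ⟨n, hn⟩ := pow_unbounded_of_one_lt (4 * (C:ℝ) * (1 + C')) h1
  refine ⟨n + 1, by omega, ?_⟩
  set b := n + 1 with hb
  have h2 : ENNReal.ofReal (4 * (C:ℝ) * (1 + C')) ≤ 2 ^ (ε / 2 * b) := by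
    have h3 : 4 * (C:ℝ) * (1 + C') ≤ 2 ^ (ε / 2 * b) := by
      rw [Real.rpow_mul (by norm_num), Real.rpow_natCast]
      exact hn.le.trans (pow_le_pow_right₀ h1.le (by omega))
    refine (ENNReal.ofReal_le_ofReal h3).trans (le_of_eq ?_)
    rw [← ENNReal.ofReal_rpow_of_pos (by norm_num)]
    simp
  have h4 : ENNReal.ofReal (4 * (C:ℝ) * (1 + C')) = 4 * C * (1 + C') := by
    rw [ENNReal.ofReal_mul (by positivity), ENNReal.ofReal_mul (by norm_num), ENNReal.ofReal_add (by norm_num) (by positivity)]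
    simp
  rw [h4] at h2
  set t : ℝ≥0∞ := 2 ^ (ε / 2 * b) with ht
  have ht1 : 1 ≤ t := one_le_two_rpow (by positivity)
  have htt : t ≠ ⊤ := two_rpow_ne_top _
  have e : (2:ℝ≥0∞) ^ (-(ε * b)) = t⁻¹ * t⁻¹ := by
    rw [ht, ← ENNReal.rpow_neg, ← two_rpow_add]
    congr 1; ring
  rw [e]
  have ht0 : t ≠ 0 := (lt_of_lt_of_le one_pos ht1).ne'
  calc (C:ℝ≥0∞) * (1 + C' * t) * (2 * (t⁻¹ * t⁻¹)) ≤ (C:ℝ≥0∞) * (t + C' * t) * (2 * (t⁻¹ * t⁻¹)) := by gcongr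
    _ = (C * (1 + C')) * (t * t⁻¹) * (2 * t⁻¹) := by ring
    _ = (C * (1 + C')) * 2 * t⁻¹ := by rw [ENNReal.mul_inv_cancel ht0 htt]; ring
    _ = (1 / 2) * ((4 * C * (1 + C')) * t⁻¹) := by
        have : (1 / 2 : ℝ≥0∞) * 4 = 2 := by
          rw [show (4:ℝ≥0∞) = 2 * 2 by norm_num, ← mul_assoc, one_div, ENNReal.inv_mul_cancel (by norm_num) (by norm_num),
            one_mul]
        calc _ = (2:ℝ≥0∞) * (C * (1 + C') * t⁻¹) := by ring
          _ = ((1 / 2 : ℝ≥0∞) * 4) * (C * (1 + C') * t⁻¹) := by rw [this]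
          _ = _ := by ring
    _ ≤ (1 / 2) * (t * t⁻¹) := by gcongr
    _ = 1 / 2 := by rw [ENNReal.mul_inv_cancel ht0 htt, mul_one]

lemma exists_A (CK : ℝ≥0) {σ : ℝ} (hσ : 0 < σ) : ∃ A : ℕ, ∀ A' ≥ A, (CK:ℝ≥0∞) ≤ 2 ^ (σ * A') := by
  have h1 : (1:ℝ) < 2 ^ σ := Real.one_lt_rpow (by norm_num) hσ
  obtain ⟨n, hn⟩ := pow_unbounded_of_one_lt (CK:ℝ) h1
  refine ⟨n, fun A' hA' => ?_⟩
  have h3 : (CK:ℝ) ≤ 2 ^ (σ * A') := by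
    rw [Real.rpow_mul (by norm_num), Real.rpow_natCast]
    exact hn.le.trans (pow_le_pow_right₀ h1.le hA')
  have := ENNReal.ofReal_le_ofReal h3
  rw [← ENNReal.ofReal_rpow_of_pos (by norm_num)] at this
  simpa using this

lemma boot {Lam p : ℝ} (hLam : 0 ≤ Lam) (hp : 2 ≤ p)
    (hpd : p * ((d + 1 : ℕ) : ℝ) ≤ 2 * (((d + 1 : ℕ) : ℝ) + 2)) {ε : ℝ} (hε : 0 < ε)
    (hlow : Pow d (4 * Lam) p (ε / 2)) {s : ℕ} (hs : (2 * ((d + 1 : ℕ) : ℝ) + 1) / 2 + 1 ≤ ε * (1 + s / 2))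
    {η : ℝ} (hη : ε ≤ η) (hP : Pow (d + 1) Lam p η) : Pow (d + 1) Lam p (max ε (η - 1 / 2 ^ s / 2)) := by
  obtain ⟨C, hC⟩ := recur d hLam hp hpd s
  obtain ⟨C', hC'⟩ := hlow
  obtain ⟨D, hD⟩ := hP
  obtain ⟨b, hb1, hb⟩ := exists_b C C' hε
  obtain ⟨CK, A0, hCK, hbA0, hA01, hA⟩ := hC b _ (hC' b)
  set σ : ℝ := 1 / 2 ^ s / 2 with hσ
  have hσ0 : 0 < σ := by positivity
  obtain ⟨A1, hA1⟩ := exists_A CK hσ0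
  set A := A0 + A1 with hAdef
  obtain ⟨CA, hCA⟩ := hA A (by omega)
  have hCKA := hA1 A (by omega)
  set η' := max ε (η - σ) with hη'
  have hη'ε : ε ≤ η' := le_max_left _ _
  set k0 := 2 ^ s * A with hk0
  set B : ℝ≥0∞ := 2 * (CA * CK * 2 * D) + 2 ^ (((d + 1 : ℕ) : ℝ) * k0) with hB
  have hBt : B ≠ ⊤ := by
    refine ENNReal.add_ne_top.2 ⟨?_, two_rpow_ne_top _⟩
    have : (CA * CK * 2 * D : ℝ≥0∞) ≠ ⊤ := by
      refine ENNReal.mul_ne_top (ENNReal.mul_ne_top (ENNReal.mul_ne_top ?_ ?_) ?_) ?_ <;> simp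
    exact ENNReal.mul_ne_top (by norm_num) this
  refine ⟨B.toNNReal, fun k => ?_⟩
  rw [ENNReal.coe_toNNReal hBt]
  induction k using Nat.strong_induction_on with
  | _ k ih =>
  by_cases hk : k < k0
  · have := Dec_trivial (d := d + 1) (Lam := Lam) (show 1 ≤ p by linarith) k
    rw [triv_eq] at this
    refine Dec_mono this ?_
    calc (2:ℝ≥0∞) ^ (((d + 1 : ℕ) : ℝ) * k) ≤ 2 ^ (((d + 1 : ℕ) : ℝ) * k0) := two_rpow_le (by gcongr)
      _ ≤ B := le_add_self
      _ = B * 1 := (mul_one _).symm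
      _ ≤ _ := by
          gcongr
          exact one_le_two_rpow (by positivity)
  · push Not at hk
    set j := k / 2 ^ s with hj
    have hAj : A ≤ j := by
      rw [hj, Nat.le_div_iff_mul_le (by positivity), mul_comm]; exact hk
    have hjk : 2 ^ s * j ≤ k := Nat.mul_div_le k (2 ^ s)
    have hjk' : j ≤ k := le_trans (Nat.le_mul_of_pos_left j (by positivity)) hjk
    have hAk : A ≤ k := hAj.trans hjk'
    have hbA : b ≤ A := by omega
    have hA1' : 1 ≤ A := by omega
    have := hCA k j hAj hjk D η hD _ _ (ih (k - b) (by omega)) (ih (k - A) (by omega))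
    refine Dec_mono this ?_
    -- first part
    have p1 : (B * 2 ^ (η' * ((k - b : ℕ) : ℝ)) + B * 2 ^ (η' * ((k - A : ℕ) : ℝ))) ≤
        B * 2 ^ (η' * k) * (2 * 2 ^ (-(ε * b))) := by
      have q : ∀ m : ℕ, b ≤ m → m ≤ k → (2:ℝ≥0∞) ^ (η' * ((k - m : ℕ) : ℝ)) ≤ 2 ^ (η' * k) * 2 ^ (-(ε * b)) := by
        intro m hbm hmk
        rw [← two_rpow_add]
        refine two_rpow_le ?_
        rw [Nat.cast_sub hmk]
        have h1 : ε * b ≤ η' * m := by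
          have : (b:ℝ) ≤ m := by exact_mod_cast hbm
          gcongr
        linarith
      calc _ ≤ B * (2 ^ (η' * k) * 2 ^ (-(ε * b))) + B * (2 ^ (η' * k) * 2 ^ (-(ε * b))) := by
            gcongr
            · exact q b le_rfl (hbA.trans hAk)
            · exact q A hbA hAk
        _ = _ := by ring
    have p2 : (CK:ℝ≥0∞) ^ (k / A + 1) ≤ CK * 2 ^ (σ * k) := by
      rw [pow_succ, mul_comm]
      gcongr
      calc (CK:ℝ≥0∞) ^ (k / A) ≤ (2 ^ (σ * A)) ^ (k / A) := by gcongr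
        _ = 2 ^ (σ * A * ((k / A : ℕ) : ℝ)) := by rw [← ENNReal.rpow_natCast, ← ENNReal.rpow_mul]
        _ ≤ _ := by
            refine two_rpow_le ?_
            rw [mul_assoc]
            gcongr
            exact_mod_cast Nat.mul_div_le k A
    have p3 : (2:ℝ≥0∞) ^ ((2 * ((d + 1 : ℕ) : ℝ) + 1) * (j:ℝ) / 2 + η * (k - j * (1 + s / 2))) ≤
        2 * 2 ^ ((η - 2 * σ) * k) := by
      have hjlow : (k:ℝ) * (2 * σ) - 1 ≤ j := by
        have h1 : k < 2 ^ s * (j + 1) := by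
          have := Nat.lt_mul_div_succ k (show 0 < 2 ^ s by positivity)
          rw [← hj] at this
          exact this
        have h2 : (k:ℝ) < 2 ^ s * (j + 1) := by exact_mod_cast h1
        have h3 : (k:ℝ) * (2 * σ) = k / 2 ^ s := by rw [hσ]; ring
        rw [h3]
        have h4 : (k:ℝ) / 2 ^ s < j + 1 := by
          rw [div_lt_iff₀ (by positivity)]; linarith
        linarith
      calc _ ≤ (2:ℝ≥0∞) ^ (1 + (η - 2 * σ) * k) := by
            refine two_rpow_le ?_
            have h1 : (2 * ((d + 1 : ℕ) : ℝ) + 1) / 2 * j + j ≤ η * (1 + s / 2) * j := by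
              have : (2 * ((d + 1 : ℕ) : ℝ) + 1) / 2 + 1 ≤ η * (1 + s / 2) := by
                refine hs.trans ?_
                gcongr
              have hj0 : (0:ℝ) ≤ j := Nat.cast_nonneg j
              nlinarith
            linarith
        _ = _ := by rw [two_rpow_add, ENNReal.rpow_one]
    have p4 : (2:ℝ≥0∞) ^ (σ * k) * 2 ^ ((η - 2 * σ) * k) ≤ 2 ^ (η' * k) := by
      rw [← two_rpow_add]
      refine two_rpow_le ?_
      have : η - σ ≤ η' := le_max_right _ _
      calc _ = (η - σ) * k := by ring
        _ ≤ _ := by gcongr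
    set Z : ℝ≥0∞ := 2 ^ (η' * k) with hZ
    have p5 : (CA:ℝ≥0∞) * CK * 2 * D ≤ (1 / 2) * B := by
      rw [hB, mul_add]
      refine le_trans (le_of_eq ?_) le_self_add
      rw [← mul_assoc (1/2), one_div, ENNReal.inv_mul_cancel (by norm_num) (by norm_num), one_mul]
    calc _ ≤ (C:ℝ≥0∞) * (1 + C' * 2 ^ (ε / 2 * b)) * (B * Z * (2 * 2 ^ (-(ε * b)))) +
          CA * (CK * 2 ^ (σ * k)) * (2 * 2 ^ ((η - 2 * σ) * k) * D) := by
          refine add_le_add (mul_le_mul_right p1 _) ?_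
          exact mul_le_mul' (mul_le_mul_right p2 _) (mul_le_mul_left p3 _)
      _ = ((C:ℝ≥0∞) * (1 + C' * 2 ^ (ε / 2 * b)) * (2 * 2 ^ (-(ε * b)))) * (B * Z) +
          (CA * CK * 2 * D) * (2 ^ (σ * k) * 2 ^ ((η - 2 * σ) * k)) := by ring
      _ ≤ (1 / 2) * (B * Z) + ((1 / 2) * B) * Z := by gcongr
      _ = (1 / 2 + 1 / 2) * (B * Z) := by ring
      _ = B * Z := by rw [ENNReal.add_halves, one_mul]

lemma TT_succ (h : TT d) : TT (d + 1) := by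
  intro Lam hLam p hp hpd ε hε
  have hd0 : (0:ℝ) ≤ d := Nat.cast_nonneg d
  have hpd' : p * (d:ℝ) ≤ 2 * (d + 2) := by
    push_cast at hpd
    nlinarith
  have hlow := h (4 * Lam) (by positivity) p hp hpd' (ε / 2) (by positivity)
  obtain ⟨s, hs'⟩ := exists_nat_ge (2 * ((2 * ((d + 1 : ℕ) : ℝ) + 1) / 2 + 1) / ε)
  have hs : (2 * ((d + 1 : ℕ) : ℝ) + 1) / 2 + 1 ≤ ε * (1 + s / 2) := by
    rw [div_le_iff₀ hε] at hs'
    nlinarith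
  have hit : ∀ m : ℕ, Pow (d + 1) Lam p (max ε (((d + 1 : ℕ) : ℝ) - m * (1 / 2 ^ s / 2))) := by
    intro m
    induction m with
    | zero => exact Pow_mono (le_trans (by simp) (le_max_right _ _)) (Pow_triv (by linarith))
    | succ m ih =>
      refine Pow_mono ?_ (boot hLam hp hpd hε hlow hs (le_max_left _ _) ih)
      have : (0:ℝ) < 1 / 2 ^ s / 2 := by positivity
      refine max_le (le_max_left _ _) ?_
      rw [sub_le_iff_le_add]
      refine max_le ?_ ?_
      · have := le_max_left ε (((d + 1 : ℕ) : ℝ) - (m + 1 : ℕ) * (1 / 2 ^ s / 2))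
        linarith
      · have := le_max_right ε (((d + 1 : ℕ) : ℝ) - (m + 1 : ℕ) * (1 / 2 ^ s / 2))
        push_cast at *
        linarith
  obtain ⟨m, hm⟩ := exists_nat_ge (((d + 1 : ℕ) : ℝ) / (1 / 2 ^ s / 2))
  refine Pow_mono ?_ (hit m)
  refine max_le le_rfl ?_
  rw [div_le_iff₀ (by positivity)] at hm
  linarith

theorem TT_all (d : ℕ) : TT d := by
  induction d with
  | zero => exact TT_zero
  | succ d ih => exact TT_succ ih

end DR

namespace DR
open Filter Topology
open scoped ENNReal NNReal

variable {d : ℕ}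

/-! ### Deduction of the discrete restriction estimate -/

def IM (d : ℕ) (i j : Fin d) : ℝ := if i = j then 1 else 0

lemma bil_IM (x : Fin d → ℝ) : bil (IM d) x x = ∑ i, x i ^ 2 := by
  unfold bil IM
  refine Finset.sum_congr rfl fun i _ => ?_
  simp [sq]

lemma QM_IM : QM 1 (IM d) where
  symm i j := by unfold IM; simp [eq_comm]
  coer x := (bil_IM x).ge
  bd i j := by unfold IM; split_ifs <;> simp

def lft (u : Fin d → ℝ) : V d := (u, ∑ i, u i ^ 2)

lemma box_lft {k : ℕ} {z : Fin d → ℤ} {u : Fin d → ℝ} (hu : ∀ i, |u i| ≤ 1 / 2)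
    (hz : ∀ i, |u i - z i / 2 ^ k| ≤ 1 / 2 ^ k) {s : ℝ} (hs : (1 + 2 * d) * s ≤ 1 / 4 ^ k)
    {η : V d} (hη : ‖η‖ ≤ s) : lft u + η ∈ box (IM d) 0 0 k z := by
  have hs0 : 0 ≤ s := (norm_nonneg _).trans hη
  have h4 : (1:ℝ) / 4 ^ k ≤ 1 / 2 ^ k := by gcongr; norm_num
  have h2 : (1:ℝ) / 2 ^ k ≤ 1 := by
    rw [div_le_one (by positivity)]; exact one_le_pow₀ (by norm_num)
  have hds : 0 ≤ (d:ℝ) * s := by positivity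
  have hs2 : s ≤ 1 / 2 ^ k := by linarith
  have hi : ∀ i, |η.1 i| ≤ s := fun i =>
    ((norm_le_pi_norm η.1 i).trans (norm_fst_le η)).trans hη
  refine ⟨fun i => ?_, ?_⟩
  · have := abs_add_le (u i - z i / 2 ^ k) (η.1 i)
    have e : (lft u + η).1 i - z i / 2 ^ k = (u i - z i / 2 ^ k) + η.1 i := by simp [lft]; ring
    rw [e]
    have := hz i; have := hi i
    rw [show (2:ℝ) / 2 ^ k = 1 / 2 ^ k + 1 / 2 ^ k by ring]
    linarith
  · rw [bil_IM]
    have e : (lft u + η).2 - (∑ i, (lft u + η).1 i ^ 2 + ∑ i, (0 : Fin d → ℝ) i * (lft u + η).1 i + 0)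
        = η.2 - ∑ i, (2 * u i * η.1 i + η.1 i ^ 2) := by
      simp only [lft, Prod.snd_add, Prod.fst_add, Pi.add_apply, Pi.zero_apply, zero_mul,
        Finset.sum_const_zero, add_zero]
      have : ∑ i, (u i + η.1 i) ^ 2 = ∑ i, u i ^ 2 + ∑ i, (2 * u i * η.1 i + η.1 i ^ 2) := by
        rw [← Finset.sum_add_distrib]
        exact Finset.sum_congr rfl fun i _ => by ring
      rw [this]; ring
    rw [e]
    have h5 : |∑ i, (2 * u i * η.1 i + η.1 i ^ 2)| ≤ ∑ _i : Fin d, 2 * s := by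
      refine (Finset.abs_sum_le_sum_abs _ _).trans (Finset.sum_le_sum fun i _ => ?_)
      have h6 := hi i
      have h7 := hu i
      have e2 : 2 * u i * η.1 i + η.1 i ^ 2 = (2 * u i + η.1 i) * η.1 i := by ring
      rw [e2, abs_mul]
      have : |2 * u i + η.1 i| ≤ 2 := by
        rw [abs_le] at *
        constructor <;> linarith
      gcongr
    have h6 : |η.2| ≤ s := (norm_snd_le η).trans hη
    have := abs_sub (η.2) (∑ i, (2 * u i * η.1 i + η.1 i ^ 2))
    simp only [Finset.sum_const, Finset.card_univ, Fintype.card_fin, nsmul_eq_mul] at h5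
    linarith

def PPs (d : ℕ) : Finset (Fin d → ℤ) := Fintype.piFinset (fun _ => ({-1, 0} : Finset ℤ))

lemma PPs_card : (PPs d).card = 2 ^ d := by
  unfold PPs
  rw [Fintype.card_piFinset]; simp

lemma mem_PPs {z : Fin d → ℤ} (h : ∀ i, z i = -1 ∨ z i = 0) : z ∈ PPs d := by
  unfold PPs
  rw [Fintype.mem_piFinset]
  intro i
  simpa using h i

lemma nrm_fiber {ι κ : Type*} [DecidableEq κ] {p : ℝ} (hp : 1 ≤ p) (T : Finset ι) (g : ι → V d → ℂ)
    (hg : ∀ z ∈ T, Measurable (g z)) (φ : ι → κ) (PP : Finset κ) (hφ : ∀ z ∈ T, φ z ∈ PP) :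
    nrm p (fun x => ∑ z ∈ T, g z x) ≤ ∑ P ∈ PP, nrm p (fun x => ∑ z ∈ T.filter (fun z => φ z = P), g z x) := by
  have h : (fun x => ∑ z ∈ T, g z x) = fun x => ∑ P ∈ PP, ∑ z ∈ T.filter (fun z => φ z = P), g z x :=
    funext fun x => (Finset.sum_fiberwise_of_maps_to hφ _).symm
  rw [h]
  refine nrm_sum_le hp PP (fun P x => ∑ z ∈ T.filter (fun z => φ z = P), g z x) ?_
  intro P _
  refine Finset.measurable_fun_sum _ ?_
  intro z hz
  exact hg z (Finset.mem_filter.1 hz).1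

lemma main_V {q : ℝ} (hq2 : 2 ≤ q) (hq : q * d ≤ 2 * (d + 2)) {ε : ℝ} (hε : 0 < ε) {K : ℝ} (hK : 0 < K) :
    ∃ C : ℝ≥0, ∀ (k : ℕ) (T : Finset (Fin d → ℤ)) (u : (Fin d → ℤ) → Fin d → ℝ),
      (∀ z ∈ T, ∀ i, |u z i| ≤ 1 / 2) → (∀ z ∈ T, ∀ i, |u z i - z i / 2 ^ k| ≤ 1 / 2 ^ k) →
      (∀ z ∈ T, ∀ i, z i / 2 ^ k = -1 ∨ z i / 2 ^ k = 0) → ∀ (a : (Fin d → ℤ) → ℂ) (R : ℝ),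
      0 < R → 4 ^ k ≤ K * R → ∀ c : V d,
      N q (volume.restrict {x : V d | ‖x - c‖ ≤ R}) (fun x => ‖∑ z ∈ T, a z * ee (pr (lft (u z)) x)‖ₑ) ≤
        C * 2 ^ (ε * k) * Hn d q R * l2 T (fun z => ‖a z‖ₑ) := by
  classical
  obtain ⟨CD, hCD⟩ := TT_all d 1 zero_le_one q hq2 hq ε hε
  obtain ⟨Γ, c0, C0, hΓ, hc0, hC0, hχ⟩ := exists_chi d (d + 2)
  set L : ℝ := 2 + Γ * K * (1 + 2 * d) with hL
  have hL0 : 0 < L := by positivity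
  have hL2 : 2 ≤ L := by rw [hL]; have : 0 ≤ Γ * K * (1 + 2 * d) := by positivity
                         linarith
  have hq0 : 0 < q := by linarith
  set CC : ℝ≥0∞ := ENNReal.ofReal c0⁻¹ * (2 ^ d * CD * (ENNReal.ofReal C0 * Cw d ^ (1 / q) *
    ENNReal.ofReal (L ^ (d + 1)) ^ (1 / q))) with hCC
  have hCCt : CC ≠ ⊤ := by
    have h1 : Cw d ^ (1 / q) ≠ ⊤ := ENNReal.rpow_ne_top_of_nonneg (by positivity) Cw_lt_top.ne
    have h2 : ENNReal.ofReal (L ^ (d + 1)) ^ (1 / q) ≠ ⊤ :=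
      ENNReal.rpow_ne_top_of_nonneg (by positivity) ENNReal.ofReal_ne_top
    rw [hCC]
    refine ENNReal.mul_ne_top ENNReal.ofReal_ne_top (ENNReal.mul_ne_top (ENNReal.mul_ne_top
      (ENNReal.pow_ne_top (by norm_num)) ENNReal.coe_ne_top)
      (ENNReal.mul_ne_top (ENNReal.mul_ne_top ENNReal.ofReal_ne_top h1) h2))
  refine ⟨CC.toNNReal, ?_⟩
  intro k T u hu huz hpar a R hR hkR c
  rw [ENNReal.coe_toNNReal hCCt]
  obtain ⟨χ, hχF, hχu, hχl⟩ := hχ (L * R) (by positivity)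
  -- the localized pieces
  set g : (Fin d → ℤ) → V d → ℂ := fun z x => a z * (ee (pr (lft (u z)) x) * χ (x + -c)) with hg
  have hgF : ∀ z ∈ T, FS (box (IM d) 0 0 k z) (g z) := by
    intro z hz
    refine FS.smul _ _ (FS.mul (S := {lft (u z)}) (FS.exp _ rfl) (hχF.shift (-c)) ?_)
    intro ξ hξ η hη
    rw [Set.mem_singleton_iff.1 hξ]
    refine box_lft (hu z hz) (huz z hz) ?_ hη
    rw [mul_div_assoc', div_le_div_iff₀ (by positivity) (by positivity)]
    calc (1 + 2 * (d:ℝ)) * Γ * 4 ^ k ≤ (1 + 2 * (d:ℝ)) * Γ * (K * R) := by gcongr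
      _ = (Γ * K * (1 + 2 * d)) * R := by ring
      _ ≤ 1 * (L * R) := by rw [one_mul, hL]; gcongr; linarith
  have hgm : ∀ z ∈ T, Measurable (g z) := fun z hz => (hgF z hz).meas
  have hXn : nrm q χ ≤ ENNReal.ofReal C0 * Cw d ^ (1 / q) * Hn d q (L * R) := by
    have := chi_up (d := d) (E := 0) (p := q) (by linarith) hC0 (le_of_eq (by ring)) (by positivity : 0 < L * R) hχu
    simp only [pow_zero, ENNReal.ofReal_one, one_mul] at this
    exact this
  have hgn : ∀ z, nrm q (g z) = ‖a z‖ₑ * nrm q χ := by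
    intro z
    unfold nrm
    rw [← N_const_mul hq0 _ (hχF.meas.enorm)]
    unfold N
    rw [← lintegral_add_right_eq_self (fun x => (‖a z‖ₑ * ‖χ x‖ₑ) ^ q) (-c)]
    congr 1
    refine lintegral_congr fun x => ?_
    simp only [hg, enorm_mul]
    rw [← ofReal_norm (ee _), norm_ee, ENNReal.ofReal_one, one_mul]
  -- splitting according to parents
  obtain ⟨PP, hPP⟩ : ∃ PP, PP = PPs d := ⟨_, rfl⟩
  obtain ⟨φ, hφ⟩ : ∃ φ : (Fin d → ℤ) → (Fin d → ℤ), ∀ z i, φ z i = z i / 2 ^ k := ⟨fun z i => z i / 2 ^ k, fun _ _ => rfl⟩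
  have hmaps : ∀ z ∈ T, φ z ∈ PP := by
    intro z hz
    rw [hPP]
    simp only [← hφ] at hpar
    exact mem_PPs (hpar z hz)
  have hcard : PP.card = 2 ^ d := by
    rw [hPP, PPs_card]
  have h1 : nrm q (fun x => ∑ z ∈ T, g z x) ≤
      2 ^ d * (CD * 2 ^ (ε * k) * (l2 T (fun z => ‖a z‖ₑ) * nrm q χ)) := by
    refine (nrm_fiber (by linarith) T g hgm φ PP hmaps).trans ?_
    calc _ ≤ ∑ P ∈ PP, (CD * 2 ^ (ε * k) * (l2 T (fun z => ‖a z‖ₑ) * nrm q χ)) := by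
          refine Finset.sum_le_sum fun P hP => ?_
          refine (hCD k (IM d) QM_IM 0 0 P _ (fun z hz i => ?_) g (fun z hz => hgF z (Finset.mem_filter.1 hz).1)).trans ?_
          · rw [← hφ]; exact congrFun (Finset.mem_filter.1 hz).2 i
          · refine mul_le_mul_right ?_ _
            refine (l2_subset (Finset.filter_subset _ _)).trans (le_of_eq ?_)
            simp only [hgn, mul_comm _ (nrm q χ)]
            rw [l2_const_mul]
      _ = _ := by rw [Finset.sum_const, hcard, nsmul_eq_mul]; push_cast; rfl
  -- lower bound on the ball
  have h2 : N q (volume.restrict {x : V d | ‖x - c‖ ≤ R}) (fun x => ‖∑ z ∈ T, a z * ee (pr (lft (u z)) x)‖ₑ) ≤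
      ENNReal.ofReal c0⁻¹ * nrm q (fun x => ∑ z ∈ T, g z x) := by
    unfold nrm
    rw [← N_const_mul hq0 _ (Finset.measurable_fun_sum _ hgm).enorm]
    unfold N
    refine ENNReal.rpow_le_rpow ?_ (by positivity)
    refine le_trans (setLIntegral_mono' ?_ ?_) (setLIntegral_le_lintegral {x : V d | ‖x - c‖ ≤ R} _)
    · exact measurableSet_le (by fun_prop) measurable_const
    · intro x hx
      refine ENNReal.rpow_le_rpow ?_ (by positivity)
      have hx' : ‖x + -c‖ ≤ L * R / 2 := by
        rw [← sub_eq_add_neg]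
        refine le_trans hx ?_
        nlinarith
      have h3 := hχl _ hx'
      have e : ∑ z ∈ T, g z x = (∑ z ∈ T, a z * ee (pr (lft (u z)) x)) * χ (x + -c) := by
        rw [Finset.sum_mul]
        exact Finset.sum_congr rfl fun z _ => by simp only [hg]; ring
      beta_reduce
      rw [e, enorm_mul, ← ofReal_norm (χ _), mul_comm ‖_‖ₑ, ← mul_assoc, ← ENNReal.ofReal_mul (by positivity)]
      refine le_mul_of_one_le_left' ?_
      rw [ENNReal.one_le_ofReal]
      calc (1:ℝ) = c0⁻¹ * c0 := (inv_mul_cancel₀ hc0.ne').symm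
        _ ≤ _ := by gcongr
  have hH : Hn d q (L * R) = ENNReal.ofReal (L ^ (d + 1)) ^ (1 / q) * Hn d q R := by
    unfold Hn
    rw [mul_pow, ENNReal.ofReal_mul (by positivity), ENNReal.mul_rpow_of_nonneg _ _ (by positivity)]
  calc _ ≤ ENNReal.ofReal c0⁻¹ * (2 ^ d * (CD * 2 ^ (ε * k) * (l2 T (fun z => ‖a z‖ₑ) *
        (ENNReal.ofReal C0 * Cw d ^ (1 / q) * Hn d q (L * R))))) := by
        refine h2.trans (mul_le_mul_right (h1.trans ?_) _)
        gcongr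
    _ = _ := by rw [hH, hCC]; ring

end DR

namespace DR
open Filter Topology
open scoped ENNReal NNReal

variable {d : ℕ}

lemma card_par_le {k : ℕ} {T : Finset (Fin d → ℤ)}
    (hpar : ∀ z ∈ T, ∀ i, z i / 2 ^ k = -1 ∨ z i / 2 ^ k = 0) : T.card ≤ (2 * 2 ^ k) ^ d := by
  have h : T ⊆ Fintype.piFinset (fun _ : Fin d => Finset.Ico (-2 ^ k : ℤ) (2 ^ k)) := by
    intro z hz
    rw [Fintype.mem_piFinset]
    intro i
    rw [Finset.mem_Ico]
    have hp : (0:ℤ) < 2 ^ k := by positivity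
    have h1 := Int.mul_ediv_add_emod (z i) (2 ^ k)
    have h2 := Int.emod_nonneg (z i) hp.ne'
    have h3 := Int.emod_lt_of_pos (z i) hp
    rcases hpar z hz i with h | h <;> rw [h] at h1 <;> constructor <;> linarith
  refine (Finset.card_le_card h).trans ?_
  rw [Fintype.card_piFinset]
  simp only [Int.card_Ico, Finset.prod_const, Finset.card_univ, Fintype.card_fin]
  refine Nat.pow_le_pow_left ?_ d
  have : ((2:ℤ) ^ k - -2 ^ k) = ((2 * 2 ^ k : ℕ) : ℤ) := by push_cast; ring
  rw [this, Int.toNat_natCast]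

lemma main_p {q p : ℝ} (hq2 : 2 ≤ q) (hq : q * d ≤ 2 * (d + 2)) (hqp : q ≤ p) {ε : ℝ} (hε : 0 < ε) {K : ℝ}
    (hK : 0 < K) :
    ∃ C : ℝ≥0, ∀ (k : ℕ) (T : Finset (Fin d → ℤ)) (u : (Fin d → ℤ) → Fin d → ℝ),
      (∀ z ∈ T, ∀ i, |u z i| ≤ 1 / 2) → (∀ z ∈ T, ∀ i, |u z i - z i / 2 ^ k| ≤ 1 / 2 ^ k) →
      (∀ z ∈ T, ∀ i, z i / 2 ^ k = -1 ∨ z i / 2 ^ k = 0) → ∀ (a : (Fin d → ℤ) → ℂ) (R : ℝ),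
      0 < R → 4 ^ k ≤ K * R → ∀ c : V d,
      N p (volume.restrict {x : V d | ‖x - c‖ ≤ R}) (fun x => ‖∑ z ∈ T, a z * ee (pr (lft (u z)) x)‖ₑ) ≤
        C * 2 ^ ((d / 2 * (1 - q / p) + ε) * k) * Hn d p R * l2 T (fun z => ‖a z‖ₑ) := by
  obtain ⟨C, hC⟩ := main_V hq2 hq hε hK
  have hq0 : 0 < q := by linarith
  have hp0 : 0 < p := by linarith
  have hs0 : 0 ≤ q / p := by positivity
  have hs1 : q / p ≤ 1 := (div_le_one hp0).2 hqp
  have hr0 : 0 ≤ 1 - q / p := by linarith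
  set CC : ℝ≥0∞ := ((2:ℝ≥0∞) ^ ((d:ℝ) / 2)) ^ (1 - q / p) * (C:ℝ≥0∞) ^ (q / p) with hCC
  have hCCt : CC ≠ ⊤ := by
    rw [hCC]
    exact ENNReal.mul_ne_top (ENNReal.rpow_ne_top_of_nonneg hr0 (two_rpow_ne_top _))
      (ENNReal.rpow_ne_top_of_nonneg hs0 ENNReal.coe_ne_top)
  refine ⟨CC.toNNReal, ?_⟩
  intro k T u hu huz hpar a R hR hkR c
  rw [ENNReal.coe_toNNReal hCCt]
  have hmain := hC k T u hu huz hpar a R hR hkR c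
  obtain ⟨A, hA⟩ : ∃ A, A = l2 T (fun z => ‖a z‖ₑ) := ⟨_, rfl⟩
  obtain ⟨F, hF⟩ : ∃ F : V d → ℝ≥0∞, F = fun x => ‖∑ z ∈ T, a z * ee (pr (lft (u z)) x)‖ₑ := ⟨_, rfl⟩
  rw [← hA, ← hF] at hmain ⊢
  have hFm : Measurable F := by
    rw [hF]
    have : Measurable (fun x : V d => ∑ z ∈ T, a z * ee (pr (lft (u z)) x)) := by fun_prop
    exact this.enorm
  have hsup : ∀ x, F x ≤ (2:ℝ≥0∞) ^ ((d:ℝ) / 2) * 2 ^ ((d:ℝ) / 2 * k) * A := by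
    intro x
    rw [hF]
    calc ‖∑ z ∈ T, a z * ee (pr (lft (u z)) x)‖ₑ ≤ ∑ z ∈ T, ‖a z‖ₑ := by
          refine (enorm_sum_le _ _).trans (le_of_eq (Finset.sum_congr rfl fun z _ => ?_))
          rw [enorm_mul, ← ofReal_norm (ee _), norm_ee, ENNReal.ofReal_one, mul_one]
      _ ≤ (T.card : ℝ≥0∞) ^ (1 / 2 : ℝ) * A := by rw [hA]; exact sum_le_l2 _ _
      _ ≤ (((2 * 2 ^ k) ^ d : ℕ) : ℝ≥0∞) ^ (1 / 2 : ℝ) * A := by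
          gcongr
          exact card_par_le hpar
      _ = _ := by
          congr 1
          rw [← two_rpow_add]
          push_cast
          rw [← pow_succ', ← pow_mul, ← ENNReal.rpow_natCast, ← ENNReal.rpow_mul]
          congr 1; push_cast; ring
  obtain ⟨S, hS⟩ : ∃ S, S = (2:ℝ≥0∞) ^ ((d:ℝ) / 2) * 2 ^ ((d:ℝ) / 2 * k) * A := ⟨_, rfl⟩
  rw [← hS] at hsup
  obtain ⟨μ, hμ⟩ : ∃ μ : Measure (V d), μ = volume.restrict {x : V d | ‖x - c‖ ≤ R} := ⟨_, rfl⟩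
  rw [← hμ] at hmain ⊢
  have h1 : N p μ F ≤ S ^ (1 - q / p) * (N q μ F) ^ (q / p) := by
    have h2 : ∫⁻ x, F x ^ p ∂μ ≤ S ^ (p - q) * ∫⁻ x, F x ^ q ∂μ := by
      rw [← lintegral_const_mul _ (hFm.pow_const q)]
      refine lintegral_mono fun x => ?_
      calc F x ^ p = F x ^ (p - q) * F x ^ q := by
            rw [← ENNReal.rpow_add_of_nonneg _ _ (by linarith) hq0.le]; congr 1; ring
        _ ≤ _ := by
            refine mul_le_mul_left (ENNReal.rpow_le_rpow (hsup x) (by linarith)) _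
    unfold N
    refine (ENNReal.rpow_le_rpow h2 (by positivity)).trans (le_of_eq ?_)
    rw [ENNReal.mul_rpow_of_nonneg _ _ (by positivity), ← ENNReal.rpow_mul, ← ENNReal.rpow_mul]
    congr 2
    · field_simp
    · field_simp
  refine h1.trans ?_
  refine (mul_le_mul_right (ENNReal.rpow_le_rpow hmain hs0) _).trans ?_
  rw [hS]
  have eH : Hn d q R ^ (q / p) = Hn d p R := by
    unfold Hn
    rw [← ENNReal.rpow_mul]; congr 1; field_simp
  have eA : A ^ (1 - q / p) * A ^ (q / p) = A := by
    rw [← ENNReal.rpow_add_of_nonneg _ _ hr0 hs0]; simp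
  simp only [ENNReal.mul_rpow_of_nonneg _ _ hr0, ENNReal.mul_rpow_of_nonneg _ _ hs0]
  rw [eH]
  calc _ = CC * ((2 ^ ((d:ℝ) / 2 * k)) ^ (1 - q / p) * (2 ^ (ε * k)) ^ (q / p)) * Hn d p R *
        (A ^ (1 - q / p) * A ^ (q / p)) := by rw [hCC]; ring
    _ ≤ _ := by
        rw [eA, ← ENNReal.rpow_mul, ← ENNReal.rpow_mul, ← two_rpow_add]
        refine mul_le_mul_left (mul_le_mul_left (mul_le_mul_right (two_rpow_le ?_) _) _) _
        have : ε * k * (q / p) ≤ ε * k := mul_le_of_le_one_right (by positivity) hs1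
        nlinarith

end DR

namespace DR
open Filter Topology
open scoped ENNReal NNReal

variable {d : ℕ}

/-- coordinates -/
def phi (x : Rsp d) : V d := (fun i => x (Sum.inl i), x (Sum.inr ()))

lemma phi_mp : MeasurePreserving (phi (d := d)) volume volume := by
  have h1 := PiLp.volume_preserving_ofLp (Fin d ⊕ Unit)
  have h2 := volume_measurePreserving_sumPiEquivProdPi (fun _ : Fin d ⊕ Unit => ℝ)
  have h3 := (MeasurePreserving.id (volume : Measure (Fin d → ℝ))).prod (volume_preserving_funUnique Unit ℝ)
  exact h3.comp (h2.comp h1)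

lemma phi_inner (ξ x : Rsp d) : ⟪ξ, x⟫ = pr (phi ξ) (phi x) := by
  rw [PiLp.inner_apply, Fintype.sum_sum_type]
  simp [pr, phi, mul_comm]

lemma phi_sub (x y : Rsp d) : phi (x - y) = phi x - phi y := by
  ext <;> simp [phi]

lemma norm_phi_le (x : Rsp d) : ‖phi x‖ ≤ ‖x‖ := by
  refine norm_prod_le_iff.2 ⟨?_, ?_⟩
  · refine (pi_norm_le_iff_of_nonneg (norm_nonneg _)).2 fun i => ?_
    exact PiLp.norm_apply_le x (Sum.inl i)
  · exact PiLp.norm_apply_le x (Sum.inr ())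

lemma sep_floor {k : ℕ} {δ : ℝ} (hk : ((d:ℝ) + d ^ 2) / δ < 4 ^ k) (hδ : 0 < δ) {ξ η : Rsp d}
    (h1 : (∀ i, |ξ (Sum.inl i)| ≤ 1 / 2) ∧ ξ (Sum.inr ()) = ∑ i, (ξ (Sum.inl i)) ^ 2)
    (h2 : (∀ i, |η (Sum.inl i)| ≤ 1 / 2) ∧ η (Sum.inr ()) = ∑ i, (η (Sum.inl i)) ^ 2)
    (h : ∀ i, ⌊ξ (Sum.inl i) * 2 ^ k⌋ = ⌊η (Sum.inl i) * 2 ^ k⌋) : dist ξ η < √δ := by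
  have hi : ∀ i, |ξ (Sum.inl i) - η (Sum.inl i)| ≤ 1 / 2 ^ k := by
    intro i
    have := Int.abs_sub_lt_one_of_floor_eq_floor (h i)
    rw [← sub_mul, abs_mul, abs_of_pos (by positivity : (0:ℝ) < 2 ^ k)] at this
    rw [le_div_iff₀ (by positivity)]
    exact this.le
  have h44 : (1 / 2 ^ k : ℝ) ^ 2 = 1 / 4 ^ k := by
    rw [div_pow, one_pow, ← pow_mul, mul_comm, pow_mul]; norm_num
  have hh : |ξ (Sum.inr ()) - η (Sum.inr ())| ≤ d * (1 / 2 ^ k) := by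
    rw [h1.2, h2.2, ← Finset.sum_sub_distrib]
    refine (Finset.abs_sum_le_sum_abs _ _).trans ?_
    calc _ ≤ ∑ _i : Fin d, (1 / 2 ^ k : ℝ) := by
          refine Finset.sum_le_sum fun i _ => ?_
          have e : ξ (Sum.inl i) ^ 2 - η (Sum.inl i) ^ 2 =
            (ξ (Sum.inl i) + η (Sum.inl i)) * (ξ (Sum.inl i) - η (Sum.inl i)) := by ring
          rw [e, abs_mul]
          have a1 := h1.1 i
          have a2 := h2.1 i
          have a3 := abs_add_le (ξ (Sum.inl i)) (η (Sum.inl i))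
          have : |ξ (Sum.inl i) + η (Sum.inl i)| ≤ 1 := by linarith
          calc _ ≤ 1 * (1 / 2 ^ k : ℝ) := by gcongr; exact hi i
            _ = _ := one_mul _
      _ = _ := by simp
  rw [EuclideanSpace.dist_eq]
  refine Real.sqrt_lt_sqrt (by positivity) ?_
  rw [Fintype.sum_sum_type]
  simp only [Finset.univ_unique, Finset.sum_singleton, Real.dist_eq]
  calc _ ≤ ∑ _i : Fin d, (1 / 2 ^ k : ℝ) ^ 2 + (d * (1 / 2 ^ k)) ^ 2 := by
        gcongr with i
        exact hi i
    _ = (d + d ^ 2) / 4 ^ k := by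
        simp only [Finset.sum_const, Finset.card_univ, Fintype.card_fin, nsmul_eq_mul, mul_pow, h44]; ring
    _ < δ := by
        rw [div_lt_iff₀ (by positivity)]
        rwa [div_lt_iff₀ hδ, mul_comm] at hk

lemma floor_par {k : ℕ} {t : ℝ} (ht : |t| ≤ 1 / 2) : ⌊t * 2 ^ k⌋ / 2 ^ k = -1 ∨ ⌊t * 2 ^ k⌋ / 2 ^ k = 0 := by
  have hp : (0:ℝ) < 2 ^ k := by positivity
  have hpz : (0:ℤ) < 2 ^ k := by positivity
  rw [abs_le] at ht
  have h1 : (-2 ^ k : ℤ) ≤ ⌊t * 2 ^ k⌋ := by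
    rw [Int.le_floor]; push_cast; nlinarith
  have h2 : ⌊t * 2 ^ k⌋ < 2 ^ k := by
    rw [Int.floor_lt]; push_cast; nlinarith
  have h3 : -1 ≤ ⌊t * 2 ^ k⌋ / 2 ^ k := Int.le_ediv_of_mul_le hpz (by linarith)
  have h4 : ⌊t * 2 ^ k⌋ / 2 ^ k < 1 := Int.ediv_lt_of_lt_mul hpz (by linarith)
  omega

lemma floor_near {k : ℕ} {t : ℝ} : |t - (⌊t * 2 ^ k⌋ : ℤ) / 2 ^ k| ≤ 1 / 2 ^ k := by
  have hp : (0:ℝ) < 2 ^ k := by positivity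
  have h1 := Int.floor_le (t * 2 ^ k)
  have h2 := (Int.lt_floor_add_one (t * 2 ^ k)).le
  have e : t - (⌊t * 2 ^ k⌋ : ℤ) / 2 ^ k = (t * 2 ^ k - (⌊t * 2 ^ k⌋ : ℤ)) / 2 ^ k := by field_simp
  rw [e, abs_of_nonneg (div_nonneg (by linarith) hp.le)]
  gcongr
  linarith

/-- the estimate in `ℝ≥0∞` form -/
lemma final_enn {p q : ℝ} (hd : 1 ≤ d) (hq2 : 2 ≤ q) (hq : q * d ≤ 2 * (d + 2)) (hqp : q ≤ p) {ε : ℝ} (hε : 0 < ε) :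
    ∃ C : ℝ≥0, ∀ δ : ℝ, 0 < δ → δ < 1 → ∀ Λ : Finset (Rsp d),
      (∀ ξ ∈ Λ, (∀ i, |ξ (Sum.inl i)| ≤ 1 / 2) ∧ ξ (Sum.inr ()) = ∑ i, (ξ (Sum.inl i)) ^ 2) →
      (∀ ξ ∈ Λ, ∀ η ∈ Λ, ξ ≠ η → √δ ≤ dist ξ η) → ∀ a : Rsp d → ℂ, ∀ R : ℝ, δ⁻¹ ≤ R → ∀ c : Rsp d,
      (∫⁻ x in Metric.ball c R, ‖∑ ξ ∈ Λ, a ξ * ee ⟪ξ, x⟫‖ₑ ^ p) ^ (1 / p) ≤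
        C * ENNReal.ofReal (δ ^ (-((d / 2 * (1 - q / p) + ε) / 2))) * Hn d p R * l2 Λ (fun ξ => ‖a ξ‖ₑ) := by
  classical
  have hd1 : (1:ℝ) ≤ d := by exact_mod_cast hd
  set D : ℝ := (d:ℝ) + d ^ 2 with hD
  have hD1 : 1 ≤ D := by rw [hD]; nlinarith
  obtain ⟨C, hC⟩ := main_p (d := d) hq2 hq hqp hε (K := 4 * D) (by positivity)
  have hq0 : 0 < q := by linarith
  have hp0 : 0 < p := by linarith
  have hs1 : q / p ≤ 1 := (div_le_one hp0).2 hqp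
  obtain ⟨e, he⟩ : ∃ e : ℝ, e = d / 2 * (1 - q / p) + ε := ⟨_, rfl⟩
  have he0 : 0 ≤ e := by
    rw [he]
    have : 0 ≤ (d:ℝ) / 2 * (1 - q / p) := mul_nonneg (by positivity) (by linarith)
    linarith
  rw [← he] at hC ⊢
  refine ⟨C * Real.toNNReal ((4 * D) ^ (e / 2)), ?_⟩
  intro δ hδ hδ1 Λ hΛ hsep a R hR c
  have hR0 : 0 < R := lt_of_lt_of_le (inv_pos.2 hδ) hR
  have hx1 : 1 ≤ D / δ := by rw [le_div_iff₀ hδ]; linarith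
  obtain ⟨k0, hk1, hk2⟩ := exists_nat_pow_near hx1 (by norm_num : (1:ℝ) < 4)
  obtain ⟨k, hk⟩ : ∃ k, k = k0 + 1 := ⟨_, rfl⟩
  rw [← hk] at hk2
  have hk3 : (4:ℝ) ^ k ≤ 4 * D * δ⁻¹ := by
    rw [hk, pow_succ]
    rw [div_eq_mul_inv] at hk1
    linarith
  have hkR : (4:ℝ) ^ k ≤ 4 * D * R := hk3.trans (by gcongr)
  set Z : Rsp d → (Fin d → ℤ) := fun ξ i => ⌊ξ (Sum.inl i) * 2 ^ k⌋ with hZ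
  have hinj : Set.InjOn Z (Λ : Set (Rsp d)) := by
    intro ξ hξ η hη h
    by_contra hne
    have h1 := hsep ξ hξ η hη hne
    have h2 := sep_floor hk2 hδ (hΛ ξ hξ) (hΛ η hη) (fun i => congrFun h i)
    linarith
  set inv : (Fin d → ℤ) → Rsp d := Function.invFunOn Z (Λ : Set (Rsp d)) with hinv
  have hinvZ : ∀ ξ ∈ Λ, inv (Z ξ) = ξ := fun ξ hξ => hinj.leftInvOn_invFunOn hξ
  set T := Λ.image Z with hT
  have hTall : ∀ {Q : (Fin d → ℤ) → Prop}, (∀ ξ ∈ Λ, Q (Z ξ)) → ∀ z ∈ T, Q z := by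
    intro Q hQ z hz
    obtain ⟨ξ, hξ, rfl⟩ := Finset.mem_image.1 hz
    exact hQ ξ hξ
  have hmain := hC k T (fun z i => inv z (Sum.inl i))
    (hTall fun ξ hξ i => by rw [hinvZ ξ hξ]; exact (hΛ ξ hξ).1 i)
    (hTall fun ξ hξ i => by rw [hinvZ ξ hξ]; exact floor_near)
    (hTall fun ξ hξ i => floor_par ((hΛ ξ hξ).1 i))
    (fun z => a (inv z)) R hR0 hkR (phi c)
  have hsum : ∀ x : Rsp d, ∑ z ∈ T, a (inv z) * ee (pr (lft (fun i => inv z (Sum.inl i))) (phi x)) =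
      ∑ ξ ∈ Λ, a ξ * ee ⟪ξ, x⟫ := by
    intro x
    rw [hT, Finset.sum_image hinj]
    refine Finset.sum_congr rfl fun ξ hξ => ?_
    rw [hinvZ ξ hξ, phi_inner]
    congr 3
    unfold lft phi
    rw [(hΛ ξ hξ).2]
  have hl2 : l2 T (fun z => ‖a (inv z)‖ₑ) = l2 Λ (fun ξ => ‖a ξ‖ₑ) := by
    unfold l2
    rw [hT, Finset.sum_image hinj]
    congr 1
    exact Finset.sum_congr rfl fun ξ hξ => by beta_reduce; rw [hinvZ ξ hξ]
  rw [hl2] at hmain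
  have hX : (∫⁻ x in Metric.ball c R, ‖∑ ξ ∈ Λ, a ξ * ee ⟪ξ, x⟫‖ₑ ^ p) ^ (1 / p) ≤
      N p (volume.restrict {x : V d | ‖x - phi c‖ ≤ R})
        (fun x => ‖∑ z ∈ T, a (inv z) * ee (pr (lft (fun i => inv z (Sum.inl i))) x)‖ₑ) := by
    unfold N
    refine ENNReal.rpow_le_rpow ?_ (by positivity)
    have hms : MeasurableSet {x : V d | ‖x - phi c‖ ≤ R} := measurableSet_le (by fun_prop) measurable_const
    have hmf : Measurable (fun x : V d => ‖∑ z ∈ T, a (inv z) * ee (pr (lft (fun i => inv z (Sum.inl i))) x)‖ₑ ^ p) := by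
      have : Measurable (fun x : V d => ∑ z ∈ T, a (inv z) * ee (pr (lft (fun i => inv z (Sum.inl i))) x)) := by
        fun_prop
      exact this.enorm.pow_const p
    rw [← phi_mp.setLIntegral_comp_preimage hms hmf]
    simp only [hsum]
    refine lintegral_mono_set ?_
    intro x hx
    rw [Metric.mem_ball, dist_eq_norm] at hx
    show ‖phi x - phi c‖ ≤ R
    rw [← phi_sub]
    exact (norm_phi_le _).trans hx.le
  refine (hX.trans hmain).trans ?_
  refine mul_le_mul_left (mul_le_mul_left ?_ _) _
  push_cast
  rw [mul_assoc]
  refine mul_le_mul_right ?_ _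
  have e1 : (2:ℝ≥0∞) ^ (e * k) = ENNReal.ofReal (2 ^ (e * k)) := by
    rw [← ENNReal.ofReal_rpow_of_pos (by norm_num)]; norm_num
  have e2 : ((Real.toNNReal ((4 * D) ^ (e / 2)) : ℝ≥0) : ℝ≥0∞) = ENNReal.ofReal ((4 * D) ^ (e / 2)) := rfl
  rw [e1, e2, ← ENNReal.ofReal_mul (by positivity)]
  refine ENNReal.ofReal_le_ofReal ?_
  calc (2:ℝ) ^ (e * k) = ((4:ℝ) ^ k) ^ (e / 2) := by
        rw [show (4:ℝ) = 2 ^ (2:ℝ) by norm_num, ← Real.rpow_natCast, ← Real.rpow_mul (by norm_num), ← Real.rpow_mul (by norm_num)]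
        congr 1; ring
    _ ≤ (4 * D * δ⁻¹) ^ (e / 2) := by gcongr
    _ = _ := by
        rw [Real.mul_rpow (by positivity) (by positivity), Real.rpow_neg hδ.le, Real.inv_rpow hδ.le]

lemma final_d {p : ℝ} (hd : 1 ≤ d) (hp : 2 * ((d:ℝ) + 2) / d ≤ p) :
    ∀ ε > (0 : ℝ), ∃ C > (0 : ℝ), ∀ δ : ℝ, 0 < δ → δ < 1 →
      ∀ Λ : Finset (Rsp d),
      (∀ ξ ∈ Λ, (∀ i, |ξ (Sum.inl i)| ≤ 1 / 2) ∧ ξ (Sum.inr ()) = ∑ i, (ξ (Sum.inl i)) ^ 2) →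
        (∀ ξ ∈ Λ, ∀ η ∈ Λ, ξ ≠ η → Real.sqrt δ ≤ dist ξ η) →
        ∀ a : Rsp d → ℂ, ∀ R : ℝ, δ⁻¹ ≤ R → ∀ c : Rsp d,
          ((volume (Metric.ball c R)).toReal⁻¹ *
              ∫ x in Metric.ball c R, ‖∑ ξ ∈ Λ, a ξ * ee ⟪ξ, x⟫‖ ^ p) ^ (1 / p) ≤
            C * δ ^ (((d : ℝ) + 2) / (2 * p) - (d : ℝ) / 4 - ε) *
              (∑ ξ ∈ Λ, ‖a ξ‖ ^ 2) ^ (1 / 2 : ℝ) := by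
  intro ε hε
  have hd0 : (0:ℝ) < d := by exact_mod_cast hd
  obtain ⟨q, hqd⟩ : ∃ q : ℝ, q = 2 * ((d:ℝ) + 2) / d := ⟨_, rfl⟩
  rw [← hqd] at hp
  have hqd' : q * d = 2 * (d + 2) := by rw [hqd]; field_simp
  have hq2 : 2 ≤ q := by
    rw [hqd, le_div_iff₀ hd0]; linarith
  have hp0 : 0 < p := by linarith
  obtain ⟨C, hC⟩ := final_enn hd hq2 hqd'.le hp (by positivity : 0 < 2 * ε)
  set v1 : ℝ≥0∞ := volume (Metric.ball (0 : Rsp d) 1) with hv1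
  have hv0 : v1 ≠ 0 := (Metric.measure_ball_pos _ _ one_pos).ne'
  have hvt : v1 ≠ ⊤ := measure_ball_lt_top.ne
  have hCt : (v1⁻¹ ^ (1 / p) * C) ≠ ⊤ := ENNReal.mul_ne_top
    (ENNReal.rpow_ne_top_of_nonneg (by positivity) (ENNReal.inv_ne_top.2 hv0)) ENNReal.coe_ne_top
  refine ⟨(v1⁻¹ ^ (1 / p) * C).toReal + 1, by positivity, ?_⟩
  intro δ hδ hδ1 Λ hΛ hsep a R hR c
  have hR0 : 0 < R := lt_of_lt_of_le (inv_pos.2 hδ) hR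
  have hmain := hC δ hδ hδ1 Λ hΛ hsep a R hR c
  have hinteg : ∫ x in Metric.ball c R, ‖∑ ξ ∈ Λ, a ξ * ee ⟪ξ, x⟫‖ ^ p =
      (∫⁻ x in Metric.ball c R, ‖∑ ξ ∈ Λ, a ξ * ee ⟪ξ, x⟫‖ₑ ^ p).toReal := by
    rw [integral_eq_lintegral_of_nonneg_ae]
    · congr 1
      refine lintegral_congr fun x => ?_
      rw [← ENNReal.ofReal_rpow_of_nonneg (norm_nonneg _) hp0.le, ofReal_norm]
    · exact Eventually.of_forall fun x => by positivity
    · have h1 : Continuous (fun x : Rsp d => ∑ ξ ∈ Λ, a ξ * ee ⟪ξ, x⟫) := by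
        refine continuous_finsetSum _ fun ξ _ => ?_
        exact continuous_const.mul (continuous_ee.comp (by fun_prop))
      exact (h1.norm.measurable.pow_const p).aestronglyMeasurable
  rw [hinteg, ← ENNReal.toReal_inv, ← ENNReal.toReal_mul, ENNReal.toReal_rpow]
  refine ENNReal.toReal_le_of_le_ofReal (by positivity) ?_
  have hvol : volume (Metric.ball c R) = ENNReal.ofReal (R ^ (d + 1)) * v1 := by
    rw [Measure.addHaar_ball _ _ hR0.le, hv1]
    simp
  have hA : l2 Λ (fun ξ => ‖a ξ‖ₑ) = ENNReal.ofReal ((∑ ξ ∈ Λ, ‖a ξ‖ ^ 2) ^ (1 / 2 : ℝ)) := by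
    unfold l2
    rw [← ENNReal.ofReal_rpow_of_nonneg (by positivity) (by norm_num), ENNReal.ofReal_sum_of_nonneg (fun _ _ => by positivity)]
    congr 1
    refine Finset.sum_congr rfl fun ξ _ => ?_
    rw [ENNReal.ofReal_pow (norm_nonneg _), ofReal_norm]; norm_num
  have hexp : -(((d:ℝ) / 2 * (1 - q / p) + 2 * ε) / 2) = ((d : ℝ) + 2) / (2 * p) - (d : ℝ) / 4 - ε := by
    have : (d:ℝ) * q = 2 * (d + 2) := by linarith
    field_simp
    linear_combination 4 * this
  rw [hexp, hA] at hmain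
  rw [ENNReal.mul_rpow_of_nonneg _ _ (by positivity), hvol]
  have hRt : ENNReal.ofReal (R ^ (d + 1)) ≠ ⊤ := ENNReal.ofReal_ne_top
  have hR00 : ENNReal.ofReal (R ^ (d + 1)) ≠ 0 := by
    rw [Ne, ENNReal.ofReal_eq_zero, not_le]; positivity
  rw [ENNReal.mul_inv (Or.inl hR00) (Or.inl hRt), ENNReal.mul_rpow_of_nonneg _ _ (by positivity), ENNReal.inv_rpow (ENNReal.ofReal (R ^ (d + 1)))]
  refine (mul_le_mul_right hmain _).trans ?_
  have hHn : (ENNReal.ofReal (R ^ (d + 1)) ^ (1 / p))⁻¹ * Hn d p R = 1 :=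
    ENNReal.inv_mul_cancel (Hn_ne_zero hR0) (Hn_ne_top hp0)
  obtain ⟨A, hA'⟩ : ∃ A : ℝ, A = (∑ ξ ∈ Λ, ‖a ξ‖ ^ 2) ^ (1 / 2 : ℝ) := ⟨_, rfl⟩
  obtain ⟨B, hB⟩ : ∃ B : ℝ, B = δ ^ (((d : ℝ) + 2) / (2 * p) - (d : ℝ) / 4 - ε) := ⟨_, rfl⟩
  have hB0 : 0 ≤ B := by rw [hB]; positivity
  rw [← hA', ← hB]
  calc _ = ((ENNReal.ofReal (R ^ (d + 1)) ^ (1 / p))⁻¹ * Hn d p R) * (v1⁻¹ ^ (1 / p) * C) * ENNReal.ofReal B * ENNReal.ofReal A := by ring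
    _ = (v1⁻¹ ^ (1 / p) * C) * ENNReal.ofReal B * ENNReal.ofReal A := by rw [hHn, one_mul]
    _ ≤ _ := by
        rw [ENNReal.ofReal_mul (by positivity), ENNReal.ofReal_mul (by positivity)]
        refine mul_le_mul_left (mul_le_mul_left ?_ _) _
        rw [ENNReal.ofReal_add (by positivity) (by norm_num), ENNReal.ofReal_toReal hCt]
        exact le_self_add

end DR

theorem discrete_restriction_paraboloid (n : ℕ) (hn : 2 ≤ n) (p : ℝ)
    (hp : 2 * ((n : ℝ) + 1) / ((n : ℝ) - 1) ≤ p) :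
    ∀ ε > (0 : ℝ), ∃ C > (0 : ℝ), ∀ δ : ℝ, 0 < δ → δ < 1 →
      ∀ Λ : Finset (Rsp (n - 1)), ↑Λ ⊆ parabSurf n →
        (∀ ξ ∈ Λ, ∀ η ∈ Λ, ξ ≠ η → Real.sqrt δ ≤ dist ξ η) →
        ∀ a : Rsp (n - 1) → ℂ, ∀ R : ℝ, δ⁻¹ ≤ R → ∀ c : Rsp (n - 1),
          ((volume (Metric.ball c R)).toReal⁻¹ *
              ∫ x in Metric.ball c R, ‖∑ ξ ∈ Λ, a ξ * ee ⟪ξ, x⟫‖ ^ p) ^ (1 / p) ≤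
            C * δ ^ (((n : ℝ) + 1) / (2 * p) - ((n : ℝ) - 1) / 4 - ε) *
              (∑ ξ ∈ Λ, ‖a ξ‖ ^ 2) ^ (1 / 2 : ℝ) := by
  have e : ((n - 1 : ℕ) : ℝ) = (n : ℝ) - 1 := by
    rw [Nat.cast_sub (by omega)]; norm_num
  have e2 : (n : ℝ) - 1 + 2 = n + 1 := by ring
  intro ε hε
  obtain ⟨C, hC0, hC⟩ := DR.final_d (d := n - 1) (p := p) (by omega) (by rw [e, e2]; exact hp) ε hε
  refine ⟨C, hC0, ?_⟩
  intro δ hδ hδ1 Λ hΛ hsep a R hR c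
  have := hC δ hδ hδ1 Λ (fun ξ hξ => hΛ hξ) hsep a R hR c
  rw [e, e2] at this
  exact this

end
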